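/- Let N ≥ 3, m > 1, γ ∈ [0,2), 0 < k ≤ K, and let ρ satisfy the weight condition. Then for every u₀ ∈ X₀ there exists a very weak solution u of ρ u_t = Δ(uᵐ) on ℝᴺ × (0, +∞) with u(·,0) = u₀ such that: (i) t ↦ u(·,t) is continuous from [0,+∞) into X with respect to the norm ‖·‖_{1,1}; and (ii) for every t > 0, ess lim_{|x|→+∞} |x|^{−(2−γ)/(m−1)} u(x,t) = 0, meaning that for every ε > 0 there is R > 0 with |x|^{−(2−γ)/(m−1)} |u(x,t)| ≤ ε for a.e. x with |x| > R. -/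

import Mathlib

open MeasureTheory Metric Filter Set ENNReal

noncomputable section

abbrev Euc (N : ℕ) := EuclideanSpace ℝ (Fin N)

/-- The weight condition: `k (1+|x|)^(-γ) ≤ ρ(x) ≤ K |x|^(-γ)` for a.e. `x`. -/
def WeightCond (N : ℕ) (γ k K : ℝ) (ρ : Euc N → ℝ) : Prop :=
  Measurable ρ ∧
    ∀ᵐ x : Euc N ∂volume, k * (1 + ‖x‖) ^ (-γ) ≤ ρ x ∧ ρ x ≤ K * ‖x‖ ^ (-γ)

/-- Local integrability with respect to the weight `ρ`. -/
def LocInt1 {N : ℕ} (ρ f : Euc N → ℝ) : Prop :=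
  ∀ R : ℝ, 0 < R → IntegrableOn (fun x => |f x| * ρ x) (ball (0 : Euc N) R)

/-- The weighted norm `‖f‖_{1,r}`. -/
def wnorm1 {N : ℕ} (ρ : Euc N → ℝ) (m γ : ℝ) (r : ℝ) (f : Euc N → ℝ) : ℝ :=
  sSup ((fun R : ℝ =>
    R ^ (-((2 - γ) / (m - 1)) - (N : ℝ) + γ) * ∫ x in ball (0 : Euc N) R, |f x| * ρ x) '' Ici r)

/-- Membership in the space `X`. -/
def memX {N : ℕ} (ρ : Euc N → ℝ) (m γ : ℝ) (f : Euc N → ℝ) : Prop :=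
  LocInt1 ρ f ∧
    BddAbove ((fun R : ℝ =>
      R ^ (-((2 - γ) / (m - 1)) - (N : ℝ) + γ) * ∫ x in ball (0 : Euc N) R, |f x| * ρ x) '' Ici 1)

/-- `ℓ(f) = lim_{r→∞} ‖f‖_{1,r}`; since `r ↦ ‖f‖_{1,r}` is nonincreasing and nonnegative,
the limit equals the infimum. -/
def ell {N : ℕ} (ρ : Euc N → ℝ) (m γ : ℝ) (f : Euc N → ℝ) : ℝ :=
  sInf ((fun r : ℝ => wnorm1 ρ m γ r f) '' Ici 1)

/-- The weighted norm `‖f‖_{∞,r}`. -/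
def wnormInf {N : ℕ} (m γ : ℝ) (r : ℝ) (f : Euc N → ℝ) : ℝ :=
  sSup ((fun R : ℝ =>
    R ^ (-((2 - γ) / (m - 1))) *
      (eLpNorm f ⊤ (volume.restrict (ball (0 : Euc N) R))).toReal) '' Ici r)

/-- Membership in the space `X_∞`. -/
def memXinf {N : ℕ} (m γ : ℝ) (f : Euc N → ℝ) : Prop :=
  AEStronglyMeasurable f volume ∧
  (∀ R : ℝ, 0 < R → eLpNorm f ⊤ (volume.restrict (ball (0 : Euc N) R)) < ⊤) ∧
  BddAbove ((fun R : ℝ =>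
    R ^ (-((2 - γ) / (m - 1))) *
      (eLpNorm f ⊤ (volume.restrict (ball (0 : Euc N) R))).toReal) '' Ici 1)

/-- Signed power `u^m := |u|^(m-1) u`. -/
def spow (m s : ℝ) : ℝ := |s| ^ (m - 1) * s

/-- The Laplacian of `φ : ℝᴺ → ℝ`, as a sum of second directional derivatives along the
standard orthonormal basis. -/
def lap {N : ℕ} (φ : Euc N → ℝ) (x : Euc N) : ℝ :=
  ∑ i : Fin N, fderiv ℝ (fun y => fderiv ℝ φ y (EuclideanSpace.single i (1 : ℝ))) x
    (EuclideanSpace.single i (1 : ℝ))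

/-- The open time interval `(0,T)`, for `T ∈ (0,∞]`. -/
def TimeSet (T : ℝ≥0∞) : Set ℝ := {t : ℝ | 0 < t ∧ ENNReal.ofReal t < T}

/-- The time interval `[0,T)`, for `T ∈ (0,∞]`. -/
def TimeSet0 (T : ℝ≥0∞) : Set ℝ := {t : ℝ | 0 ≤ t ∧ ENNReal.ofReal t < T}

/-- Very weak solution of `ρ u_t = Δ(u^m)` on `ℝᴺ × (0,T)` with initial datum `u₀`. -/
def IsVeryWeakSol {N : ℕ} (ρ : Euc N → ℝ) (m : ℝ) (T : ℝ≥0∞)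
    (u : Euc N → ℝ → ℝ) (u₀ : Euc N → ℝ) : Prop :=
  (∀ t ∈ TimeSet0 T, LocInt1 ρ (fun x => u x t)) ∧
  (∀ s ∈ TimeSet0 T, ∀ R : ℝ, 0 < R →
    Tendsto (fun t => ∫ x in ball (0 : Euc N) R, |u x t - u x s| * ρ x)
      (nhdsWithin s (TimeSet0 T)) (nhds 0)) ∧
  (∀ᵐ x : Euc N ∂volume, u x 0 = u₀ x) ∧
  (∀ R : ℝ, 0 < R → ∀ a b : ℝ, 0 < a → a ≤ b → ENNReal.ofReal b < T →
    IntegrableOn (fun p : Euc N × ℝ => spow m (u p.1 p.2)) (ball (0 : Euc N) R ×ˢ Icc a b)) ∧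
  (∀ φ : Euc N × ℝ → ℝ, ContDiff ℝ (⊤ : ℕ∞) φ → HasCompactSupport φ →
    tsupport φ ⊆ {p : Euc N × ℝ | p.2 ∈ TimeSet T} →
    -(∫ p : Euc N × ℝ in (univ : Set (Euc N)) ×ˢ TimeSet T,
        u p.1 p.2 * deriv (fun s => φ (p.1, s)) p.2 * ρ p.1) =
      ∫ p : Euc N × ℝ in (univ : Set (Euc N)) ×ˢ TimeSet T,
        spow m (u p.1 p.2) * lap (fun y => φ (y, p.2)) p.1)

/-- The existence time `T = C / L^(m-1)` if `L > 0`, and `T = ∞` if `L = 0` (here `L = ℓ(u₀)` or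
`L = ‖u₀‖_{1,r}`). -/
def Tof (C m L : ℝ) : ℝ≥0∞ := if 0 < L then ENNReal.ofReal (C / L ^ (m - 1)) else ⊤

end

noncomputable section

/-- The standard exponential law. -/
def expo : Measure ℝ := (volume.restrict (Ioi 0)).withDensity (fun x => ENNReal.ofReal (Real.exp (-x)))

lemma integral_expo {F : Type*} [NormedAddCommGroup F] [NormedSpace ℝ F] (f : ℝ → F) :
    ∫ x, f x ∂expo = ∫ x in Ioi 0, Real.exp (-x) • f x := by
  unfold expo
  rw [integral_withDensity_eq_integral_toReal_smul (by fun_prop) (by simp)]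
  simp [ENNReal.toReal_ofReal (Real.exp_pos _).le]

lemma integrable_expo {f : ℝ → ℝ} :
    Integrable f expo ↔ IntegrableOn (fun x => Real.exp (-x) * f x) (Ioi 0) := by
  unfold expo
  rw [integrable_withDensity_iff_integrable_smul₀' (by fun_prop) (by simp)]
  simp [ENNReal.toReal_ofReal (Real.exp_pos _).le, IntegrableOn]

instance : IsProbabilityMeasure expo := by
  constructor
  unfold expo
  rw [withDensity_apply _ MeasurableSet.univ, Measure.restrict_univ,
    ← ofReal_integral_eq_lintegral_ofReal (integrableOn_exp_neg_Ioi 0) (ae_of_all _ fun x => (Real.exp_pos _).le)]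
  rw [integral_exp_neg_Ioi_zero]; simp

lemma integrable_expo_rpow {s : ℝ} (hs : 0 ≤ s) : Integrable (fun x : ℝ => x ^ s) expo := by
  rw [integrable_expo]
  have := Real.GammaIntegral_convergent (s := s + 1) (by linarith)
  simpa using this

lemma integral_expo_id : ∫ x, x ∂expo = 1 := by
  rw [integral_expo]
  have := Real.Gamma_eq_integral (s := 2) (by norm_num)
  rw [Real.Gamma_two] at this
  rw [this]
  refine setIntegral_congr_fun measurableSet_Ioi fun x hx => ?_
  norm_num

lemma integral_expo_exp {a : ℝ} (ha : 0 ≤ a) :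
    ∫ x, Complex.exp (-(a * x : ℝ)) ∂expo = ((1 / (1 + a) : ℝ) : ℂ) := by
  rw [integral_expo]
  have h : ∀ x : ℝ, Real.exp (-x) • Complex.exp (-(a * x : ℝ)) = ((Real.exp (-(1 + a) * x) : ℝ) : ℂ) := by
    intro x
    rw [Complex.real_smul]
    push_cast
    rw [← Complex.exp_add]
    congr 1
    ring
  simp_rw [h]
  rw [integral_complex_ofReal]
  congr 1
  rw [integral_exp_mul_Ioi (by linarith)]
  have h1 : 1 + a ≠ 0 := by linarith
  simp only [mul_zero, Real.exp_zero]
  rw [neg_div_neg_eq]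

variable {N : ℕ}

def nu1 (N : ℕ) : Measure (Euc N) :=
  (expo.prod (ProbabilityTheory.stdGaussian (Euc N))).map (fun p => Real.sqrt (2 * p.1) • p.2)

lemma meas_nu1map : Measurable (fun p : ℝ × Euc N => Real.sqrt (2 * p.1) • p.2) := by fun_prop

instance : IsProbabilityMeasure (nu1 N) := by
  unfold nu1
  exact Measure.isProbabilityMeasure_map meas_nu1map.aemeasurable

def nu (N : ℕ) (δ : ℝ) : Measure (Euc N) := (nu1 N).map (fun y => Real.sqrt δ • y)

instance (δ : ℝ) : IsProbabilityMeasure (nu N δ) := by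
  unfold nu
  exact Measure.isProbabilityMeasure_map (by fun_prop)

lemma expo_ae_pos : ∀ᵐ x ∂expo, 0 < x := by
  unfold expo
  exact (withDensity_absolutelyContinuous _ _).ae_le (ae_restrict_mem measurableSet_Ioi)

lemma charFun_nu1 (t : Euc N) : charFun (nu1 N) t = ((1 / (1 + ‖t‖ ^ 2) : ℝ) : ℂ) := by
  have hb : Integrable (fun p : ℝ × Euc N => Complex.exp (inner ℝ (Real.sqrt (2 * p.1) • p.2) t * Complex.I))
      (expo.prod (ProbabilityTheory.stdGaussian (Euc N))) := by
    refine Integrable.of_bound (C := 1) ?_ ?_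
    · exact Measurable.aestronglyMeasurable (by fun_prop)
    · refine ae_of_all _ fun p => ?_
      rw [Complex.norm_exp_ofReal_mul_I]
  rw [charFun_apply, nu1, integral_map meas_nu1map.aemeasurable (by exact Measurable.aestronglyMeasurable (by fun_prop)),
    integral_prod _ hb, ← integral_expo_exp (sq_nonneg ‖t‖)]
  refine integral_congr_ae ?_
  filter_upwards [expo_ae_pos] with x hx
  have h1 : ∀ y : Euc N, inner ℝ (Real.sqrt (2 * x) • y) t = inner ℝ y (Real.sqrt (2 * x) • t) := by
    intro y; rw [inner_smul_left, inner_smul_right]; simp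
  simp only [h1]
  rw [← charFun_apply, ProbabilityTheory.charFun_stdGaussian, norm_smul]
  congr 1
  rw [Real.norm_of_nonneg (Real.sqrt_nonneg _)]
  push_cast
  rw [mul_pow, ← Complex.ofReal_pow (√(2*x)), Real.sq_sqrt (by linarith)]
  push_cast
  ring

lemma charFun_nu {δ : ℝ} (hδ : 0 ≤ δ) (t : Euc N) :
    charFun (nu N δ) t = ((1 / (1 + δ * ‖t‖ ^ 2) : ℝ) : ℂ) := by
  rw [nu, charFun_map_smul, charFun_nu1, norm_smul, mul_pow, Real.norm_of_nonneg (Real.sqrt_nonneg _), Real.sq_sqrt hδ]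

lemma integral_nu {F : Type*} [NormedAddCommGroup F] [NormedSpace ℝ F] {δ : ℝ} (hδ : 0 < δ) (f : Euc N → F) :
    ∫ y, f y ∂(nu N δ) = ∫ y, f (Real.sqrt δ • y) ∂(nu1 N) := by
  unfold nu
  have : MeasurableEmbedding (fun y : Euc N => Real.sqrt δ • y) :=
    (MeasurableEquiv.smul₀ (√δ) (by positivity)).measurableEmbedding
  exact this.integral_map _

lemma nu_neg {δ : ℝ} (hδ : 0 ≤ δ) : (nu N δ).map (fun y => -y) = nu N δ := by
  have : IsProbabilityMeasure ((nu N δ).map (fun y => -y)) := Measure.isProbabilityMeasure_map (by fun_prop)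
  refine Measure.ext_of_charFun ?_
  ext t
  have : (fun y : Euc N => -y) = fun y => (-1 : ℝ) • y := by ext1 y; simp
  rw [this, charFun_map_smul, charFun_nu hδ, charFun_nu hδ]
  simp

/-- resolvent identity at the level of measures -/
lemma nu_resolvent {δ η : ℝ} (hη : 0 < η) (hδ : η < δ) :
    ENNReal.ofReal δ • nu N δ = ENNReal.ofReal η • nu N η + ENNReal.ofReal (δ - η) • (nu N δ ∗ nu N η) := by
  have : ∀ c : ℝ, IsFiniteMeasure (ENNReal.ofReal c • nu N δ) := fun c => Measure.smul_finite _ ENNReal.ofReal_ne_top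
  have : ∀ c : ℝ, IsFiniteMeasure (ENNReal.ofReal c • nu N η) := fun c => Measure.smul_finite _ ENNReal.ofReal_ne_top
  have : ∀ c : ℝ, IsFiniteMeasure (ENNReal.ofReal c • (nu N δ ∗ nu N η)) := fun c => Measure.smul_finite _ ENNReal.ofReal_ne_top
  refine Measure.ext_of_charFun ?_
  ext t
  have hi : ∀ (μ : Measure (Euc N)) [IsFiniteMeasure μ], Integrable (fun x => Complex.exp ((inner ℝ x t : ℝ) * Complex.I)) μ := by
    intro μ _
    refine Integrable.of_bound (C := 1) (Measurable.aestronglyMeasurable (by fun_prop)) (ae_of_all _ fun p => ?_)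
    rw [Complex.norm_exp_ofReal_mul_I]
  rw [charFun_apply, charFun_apply, integral_add_measure (hi _) (hi _), integral_smul_measure, integral_smul_measure,
    integral_smul_measure, ← charFun_apply, ← charFun_apply, ← charFun_apply, charFun_conv, charFun_nu (by linarith), charFun_nu hη.le]
  rw [ENNReal.toReal_ofReal (by linarith), ENNReal.toReal_ofReal (by linarith), ENNReal.toReal_ofReal (by linarith)]
  simp only [Complex.real_smul]
  norm_cast
  have h1 : 0 < 1 + δ * ‖t‖ ^ 2 := by have : 0 < δ := by linarith
                                      positivity
  have h2 : 0 < 1 + η * ‖t‖ ^ 2 := by positivity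
  field_simp
  ring

end

noncomputable section
variable {N : ℕ}

def Pop (δ : ℝ) (f : Euc N → ℝ) (x : Euc N) : ℝ := ∫ y, f (x + y) ∂(nu N δ)
def Aop (δ : ℝ) (f : Euc N → ℝ) (x : Euc N) : ℝ := (Pop δ f x - f x) / δ

/-- bounded measurable -/
def BM (C : ℝ) (f : Euc N → ℝ) : Prop := Measurable f ∧ ∀ x, |f x| ≤ C

lemma mp_add (δ : ℝ) : MeasurePreserving (fun p : Euc N × Euc N => p.1 + p.2)
    (volume.prod (nu N δ)) volume := by
  have h1 := measurePreserving_prod_add (nu N δ) (volume : Measure (Euc N))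
  have h2 : MeasurePreserving (Prod.snd : Euc N × Euc N → Euc N) ((nu N δ).prod volume) volume :=
    measurePreserving_snd
  have h3 := (h2.comp h1).comp (Measure.measurePreserving_swap (μ := (volume : Measure (Euc N))) (ν := nu N δ))
  convert h3 using 1
  ext1 p
  simp [add_comm]

lemma int_add {δ : ℝ} {f : Euc N → ℝ} (hf : Integrable f) :
    Integrable (fun p : Euc N × Euc N => f (p.1 + p.2)) (volume.prod (nu N δ)) :=
  (mp_add δ).integrable_comp_of_integrable hf

lemma BM.shift {δ C : ℝ} {f : Euc N → ℝ} (hf : BM C f) (x : Euc N) : Integrable (fun y => f (x + y)) (nu N δ) :=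
  Integrable.of_bound (C := C) (hf.1.comp (by fun_prop)).aestronglyMeasurable (ae_of_all _ fun y => hf.2 _)

lemma meas_Pop {δ : ℝ} {f : Euc N → ℝ} (hf : Measurable f) : Measurable (Pop δ f) := by
  unfold Pop
  refine StronglyMeasurable.measurable ?_
  refine StronglyMeasurable.integral_prod_right (f := fun (x y : Euc N) => f (x + y)) ?_
  exact (hf.comp (by fun_prop)).stronglyMeasurable

lemma Pop_bd {δ C : ℝ} {f : Euc N → ℝ} (hf : ∀ x, |f x| ≤ C) (x : Euc N) : |Pop δ f x| ≤ C := by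
  have := norm_integral_le_of_norm_le_const (μ := nu N δ) (f := fun y => f (x + y)) (C := C) (ae_of_all _ fun y => hf _)
  simpa [Pop] using this

lemma BM.Pop {C δ : ℝ} {f : Euc N → ℝ} (hf : BM C f) : BM C (Pop δ f) := ⟨meas_Pop hf.1, Pop_bd hf.2⟩

lemma BM.mono {C C' : ℝ} {f : Euc N → ℝ} (hf : BM C f) (h : C ≤ C') : BM C' f := ⟨hf.1, fun x => (hf.2 x).trans h⟩

lemma BM.neg {C : ℝ} {f : Euc N → ℝ} (hf : BM C f) : BM C (fun x => - f x) := ⟨hf.1.neg, fun x => by simpa using hf.2 x⟩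

lemma BM.add {C C' : ℝ} {f g : Euc N → ℝ} (hf : BM C f) (hg : BM C' g) : BM (C + C') (fun x => f x + g x) :=
  ⟨hf.1.add hg.1, fun x => (abs_add_le _ _).trans (add_le_add (hf.2 x) (hg.2 x))⟩

lemma BM.sub {C C' : ℝ} {f g : Euc N → ℝ} (hf : BM C f) (hg : BM C' g) : BM (C + C') (fun x => f x - g x) :=
  ⟨hf.1.sub hg.1, fun x => (abs_sub _ _).trans (add_le_add (hf.2 x) (hg.2 x))⟩

lemma BM.abs {C : ℝ} {f : Euc N → ℝ} (hf : BM C f) : BM C (fun x => |f x|) :=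
  ⟨hf.1.abs, fun x => by simpa using hf.2 x⟩

lemma BM.const_mul {C : ℝ} {f : Euc N → ℝ} (hf : BM C f) (c : ℝ) : BM (|c| * C) (fun x => c * f x) :=
  ⟨hf.1.const_mul c, fun x => by rw [abs_mul]; exact mul_le_mul_of_nonneg_left (hf.2 x) (abs_nonneg c)⟩

lemma BM.mul {C C' : ℝ} {f g : Euc N → ℝ} (hf : BM C f) (hg : BM C' g) : BM (C * C') (fun x => f x * g x) :=
  ⟨hf.1.mul hg.1, fun x => by
    rw [abs_mul]; exact mul_le_mul (hf.2 x) (hg.2 x) (abs_nonneg _) ((abs_nonneg _).trans (hf.2 x))⟩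

lemma BM.nonneg {C : ℝ} {f : Euc N → ℝ} (hf : BM C f) : 0 ≤ C := (abs_nonneg _).trans (hf.2 0)

lemma BM.finset_sum {ι : Type*} (s : Finset ι) {C : ℝ} {f : ι → Euc N → ℝ} (hf : ∀ i ∈ s, BM C (f i)) :
    BM (s.card * C) (fun x => ∑ i ∈ s, f i x) :=
  ⟨Finset.measurable_sum s fun i hi => (hf i hi).1, fun x => by
    refine (Finset.abs_sum_le_sum_abs _ _).trans ?_
    rw [← nsmul_eq_mul]
    exact Finset.sum_le_card_nsmul _ _ _ fun i hi => (hf i hi).2 x⟩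

lemma Pop_mono {δ C C' : ℝ} {f g : Euc N → ℝ} (hf : BM C f) (hg : BM C' g) (h : ∀ x, f x ≤ g x) (x : Euc N) :
    Pop δ f x ≤ Pop δ g x :=
  integral_mono (hf.shift x) (hg.shift x) fun _ => h _

lemma Pop_add {δ C C' : ℝ} {f g : Euc N → ℝ} (hf : BM C f) (hg : BM C' g) (x : Euc N) :
    Pop δ (fun x => f x + g x) x = Pop δ f x + Pop δ g x := integral_add (hf.shift x) (hg.shift x)

lemma Pop_sub {δ C C' : ℝ} {f g : Euc N → ℝ} (hf : BM C f) (hg : BM C' g) (x : Euc N) :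
    Pop δ (fun x => f x - g x) x = Pop δ f x - Pop δ g x := integral_sub (hf.shift x) (hg.shift x)

lemma Pop_const_mul {δ c : ℝ} {f : Euc N → ℝ} (x : Euc N) :
    Pop δ (fun x => c * f x) x = c * Pop δ f x := integral_const_mul _ _

lemma Pop_sum {ι : Type*} (s : Finset ι) {δ C : ℝ} {f : ι → Euc N → ℝ} (hf : ∀ i ∈ s, BM C (f i)) (x : Euc N) :
    Pop δ (fun x => ∑ i ∈ s, f i x) x = ∑ i ∈ s, Pop δ (f i) x :=
  integral_finsetSum s fun i hi => (hf i hi).shift x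

lemma Pop_const {δ c : ℝ} (x : Euc N) : Pop δ (fun _ => c) x = c := by simp [Pop]

lemma Pop_abs_le {δ : ℝ} {f : Euc N → ℝ} (x : Euc N) :
    |Pop δ f x| ≤ Pop δ (fun x => |f x|) x := abs_integral_le_integral_abs

lemma Pop_integrable {δ : ℝ} {f : Euc N → ℝ} (hf : Integrable f) : Integrable (Pop δ f) :=
  (int_add hf).integral_prod_left

lemma integral_Pop {δ : ℝ} {f : Euc N → ℝ} (hf : Integrable f) : ∫ x, Pop δ f x = ∫ x, f x := by
  unfold Pop
  rw [← integral_prod _ (int_add hf)]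
  have h := (mp_add (N := N) δ).map_eq
  conv_rhs => rw [← h]
  rw [integral_map (mp_add δ).measurable.aemeasurable (by rw [h]; exact hf.1)]

lemma Pop_l1 {δ : ℝ} {f : Euc N → ℝ} (hf : Integrable f) : ∫ x, |Pop δ f x| ≤ ∫ x, |f x| := by
  rw [← integral_Pop (δ := δ) hf.abs]
  exact integral_mono (Pop_integrable hf).abs (Pop_integrable hf.abs) fun x => Pop_abs_le x

lemma Pop_neg_arg {δ : ℝ} (hδ : 0 ≤ δ) (f : Euc N → ℝ) (x : Euc N) : Pop δ f x = ∫ y, f (x - y) ∂(nu N δ) := by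
  unfold Pop
  conv_lhs => rw [← nu_neg hδ]
  have h := (MeasurableEquiv.neg (Euc N)).measurableEmbedding.integral_map (μ := nu N δ) (fun y => f (x + y))
  simp only [sub_eq_add_neg]
  exact h

lemma Pop_symm {δ C' : ℝ} (hδ : 0 ≤ δ) {f g : Euc N → ℝ} (hf : Integrable f) (hg : BM C' g) :
    ∫ x, Pop δ f x * g x = ∫ x, f x * Pop δ g x := by
  have hi : Integrable (fun p : Euc N × Euc N => f (p.1 + p.2) * g p.1) (volume.prod (nu N δ)) := by
    refine (int_add hf).mul_bdd (c := C') ?_ (ae_of_all _ fun p => hg.2 _)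
    exact (hg.1.comp measurable_fst).aestronglyMeasurable
  have hi2 : Integrable (fun p : Euc N × Euc N => f p.1 * g (p.1 - p.2)) (volume.prod (nu N δ)) := by
    refine Integrable.mul_bdd (c := C') (hf.comp_fst _) ?_ (ae_of_all _ fun p => hg.2 _)
    exact (hg.1.comp (by fun_prop)).aestronglyMeasurable
  have e1 : ∀ x, Pop δ f x * g x = ∫ y, f (x + y) * g x ∂(nu N δ) := fun x => (integral_mul_const _ _).symm
  have e2 : ∀ x, f x * Pop δ g x = ∫ y, f x * g (x - y) ∂(nu N δ) := fun x => by
    rw [Pop_neg_arg hδ]; exact (integral_const_mul _ _).symm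
  simp_rw [e1, e2]
  have s1 := integral_integral_swap (f := fun x y => f (x + y) * g x) hi
  have s2 := integral_integral_swap (f := fun x y => f x * g (x - y)) hi2
  rw [s1, s2]
  congr 1
  ext1 y
  rw [← integral_add_right_eq_self (fun x => f x * g (x - y)) y]
  simp

lemma Pop_resolvent {δ η C : ℝ} (hη : 0 < η) (hδ : η < δ) {f : Euc N → ℝ} (hf : BM C f) (x : Euc N) :
    δ * Pop δ f x = η * Pop η f x + (δ - η) * Pop δ (Pop η f) x := by
  have h : ∫ y, f (x + y) ∂_ = ∫ y, f (x + y) ∂_ := congrArg (fun μ => ∫ y, f (x + y) ∂μ) (nu_resolvent (N := N) hη hδ)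
  have hi : ∀ (μ : Measure (Euc N)) [IsFiniteMeasure μ], Integrable (fun y => f (x + y)) μ := fun μ _ =>
    Integrable.of_bound (C := C) (hf.1.comp (by fun_prop)).aestronglyMeasurable (ae_of_all _ fun y => hf.2 _)
  have : ∀ c : ℝ, IsFiniteMeasure (ENNReal.ofReal c • nu N η) := fun c => Measure.smul_finite _ ENNReal.ofReal_ne_top
  have : ∀ c : ℝ, IsFiniteMeasure (ENNReal.ofReal c • (nu N δ ∗ nu N η)) := fun c => Measure.smul_finite _ ENNReal.ofReal_ne_top
  rw [integral_add_measure (hi _) (hi _), integral_smul_measure, integral_smul_measure, integral_smul_measure,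
    ENNReal.toReal_ofReal (by linarith), ENNReal.toReal_ofReal (by linarith), ENNReal.toReal_ofReal (by linarith)] at h
  simp only [smul_eq_mul] at h
  unfold Pop
  rw [h]
  congr 2
  rw [integral_conv (hi _)]
  simp [add_assoc]

lemma Pop_comm {δ η C : ℝ} {f : Euc N → ℝ} (hf : BM C f) (x : Euc N) :
    Pop δ (Pop η f) x = Pop η (Pop δ f) x := by
  unfold Pop
  have hi : Integrable (fun p : Euc N × Euc N => f (x + p.1 + p.2)) ((nu N δ).prod (nu N η)) :=
    Integrable.of_bound (C := C) (hf.1.comp (by fun_prop)).aestronglyMeasurable (ae_of_all _ fun y => hf.2 _)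
  rw [integral_integral_swap hi]
  congr 1; ext1 y; congr 1; ext1 z; congr 1; abel

/-! ### The generator -/

lemma BM.Aop {C δ : ℝ} (hδ : 0 < δ) {f : Euc N → ℝ} (hf : BM C f) : BM (2 * C / δ) (Aop δ f) := by
  refine ⟨(hf.Pop.1.sub hf.1).div_const δ, fun x => ?_⟩
  unfold _root_.Aop
  rw [abs_div, abs_of_pos hδ]
  gcongr
  exact ((hf.Pop (δ := δ)).sub hf).2 x |>.trans (by linarith)

lemma Aop_integrable {δ : ℝ} {f : Euc N → ℝ} (hf : Integrable f) : Integrable (Aop δ f) :=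
  ((Pop_integrable hf).sub hf).div_const δ

lemma integral_Aop {δ : ℝ} {f : Euc N → ℝ} (hf : Integrable f) : ∫ x, Aop δ f x = 0 := by
  unfold Aop
  rw [integral_div, integral_sub (Pop_integrable hf) hf, integral_Pop hf]
  simp

lemma Aop_symm {δ C' : ℝ} (hδ : 0 ≤ δ) {f g : Euc N → ℝ} (hf : Integrable f) (hg : BM C' g) :
    ∫ x, Aop δ f x * g x = ∫ x, f x * Aop δ g x := by
  have e1 : ∀ x, Aop δ f x * g x = (Pop δ f x * g x - f x * g x) / δ := fun x => by unfold Aop; ring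
  have e2 : ∀ x, f x * Aop δ g x = (f x * Pop δ g x - f x * g x) / δ := fun x => by unfold Aop; ring
  simp_rw [e1, e2]
  rw [integral_div, integral_div, integral_sub, integral_sub, Pop_symm hδ hf hg]
  · exact hf.mul_bdd (c := C') hg.Pop.1.aestronglyMeasurable (ae_of_all _ fun p => hg.Pop.2 _)
  · exact hf.mul_bdd (c := C') hg.1.aestronglyMeasurable (ae_of_all _ fun p => hg.2 _)
  · exact (Pop_integrable hf).mul_bdd (c := C') hg.1.aestronglyMeasurable (ae_of_all _ fun p => hg.2 _)
  · exact hf.mul_bdd (c := C') hg.1.aestronglyMeasurable (ae_of_all _ fun p => hg.2 _)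

lemma Aop_nonpos {δ C : ℝ} (hδ : 0 < δ) {f : Euc N → ℝ} (hf : Integrable f) (hfb : BM C f) :
    ∫ x, Aop δ f x * f x ≤ 0 := by
  have e1 : ∀ x, Aop δ f x * f x ≤ Aop δ (fun x => f x * f x) x / 2 := fun x => by
    have h1 : 2 * (Pop δ f x * f x) ≤ Pop δ (fun x => f x * f x) x + f x * f x := by
      have hi : Integrable (fun y => f (x + y)) (nu N δ) := hfb.shift x
      have hi2 : Integrable (fun y => f (x + y) * f (x + y)) (nu N δ) := (hfb.mul hfb).shift x
      have : 0 ≤ ∫ y, (f (x + y) - f x) * (f (x + y) - f x) ∂(nu N δ) :=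
        integral_nonneg fun y => mul_self_nonneg _
      have e : ∀ y, (f (x + y) - f x) * (f (x + y) - f x) = f (x+y) * f (x+y) - (2 * f x) * f (x + y) + f x * f x := fun y => by ring
      simp_rw [e] at this
      have hs : Integrable (fun y => f (x+y) * f (x+y) - (2 * f x) * f (x + y)) (nu N δ) := hi2.sub (hi.const_mul _)
      rw [integral_add hs (integrable_const _), integral_sub hi2 (hi.const_mul _), integral_const_mul] at this
      simp at this
      unfold Pop
      linarith
    unfold Aop
    rw [div_mul_eq_mul_div, div_div, div_le_div_iff₀ hδ (by positivity)]
    nlinarith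
  have hff : Integrable (fun x => f x * f x) := hf.mul_bdd (c := C) hfb.1.aestronglyMeasurable (ae_of_all _ fun p => hfb.2 _)
  calc ∫ x, Aop δ f x * f x ≤ ∫ x, Aop δ (fun x => f x * f x) x / 2 := by
        refine integral_mono ?_ ((Aop_integrable hff).div_const 2) e1
        exact (Aop_integrable hf).mul_bdd (c := C) hfb.1.aestronglyMeasurable (ae_of_all _ fun p => hfb.2 _)
    _ = 0 := by rw [integral_div, integral_Aop hff]; simp

lemma Aop_sub {δ C C' : ℝ} {f g : Euc N → ℝ} (hf : BM C f) (hg : BM C' g) (x : Euc N) :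
    Aop δ (fun x => f x - g x) x = Aop δ f x - Aop δ g x := by
  unfold Aop; rw [Pop_sub hf hg]; ring

lemma Aop_sum {ι : Type*} (s : Finset ι) {δ C : ℝ} {f : ι → Euc N → ℝ} (hf : ∀ i ∈ s, BM C (f i)) (x : Euc N) :
    Aop δ (fun x => ∑ i ∈ s, f i x) x = ∑ i ∈ s, Aop δ (f i) x := by
  unfold Aop; rw [Pop_sum s hf, ← Finset.sum_sub_distrib, Finset.sum_div]

lemma Aop_const_mul {δ c : ℝ} {f : Euc N → ℝ} (x : Euc N) :
    Aop δ (fun x => c * f x) x = c * Aop δ f x := by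
  unfold Aop; rw [Pop_const_mul]; ring

/-- `A_η f = A_δ f - (δ-η) A_δ (A_η f)`. -/
lemma Aop_resolvent {δ η C : ℝ} (hη : 0 < η) (hδ : η < δ) {f : Euc N → ℝ} (hf : BM C f) (x : Euc N) :
    Aop η f x = Aop δ f x - (δ - η) * Aop δ (Aop η f) x := by
  have h := Pop_resolvent hη hδ hf x
  have h0 : Pop δ (Aop η f) x = (Pop δ (Pop η f) x - Pop δ f x) / η := by
    have e : Aop η f = fun x => (1 / η) * ((fun x => Pop η f x - f x) x) := by ext1 x; unfold Aop; field_simp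
    rw [e, Pop_const_mul, Pop_sub hf.Pop hf]
    field_simp
  have hδ0 : 0 < δ := hη.trans hδ
  have : Aop δ (Aop η f) x = (Pop δ (Aop η f) x - Aop η f x) / δ := rfl
  rw [this, h0]
  unfold Aop
  field_simp
  linear_combination -h

/-- `A_δ f = (η/δ) A_η f + (1-η/δ) P_δ (A_η f)`; `L¹` consequence. -/
lemma Aop_l1_mono {δ η C : ℝ} (hη : 0 < η) (hδ : η < δ) {f : Euc N → ℝ} (hf : BM C f) (hi : Integrable f) :
    ∫ x, |Aop δ f x| ≤ ∫ x, |Aop η f x| := by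
  have hδ0 : 0 < δ := hη.trans hδ
  have e : ∀ x, Aop δ f x = (η / δ) * Aop η f x + (1 - η / δ) * Pop δ (Aop η f) x := fun x => by
    have h := Aop_resolvent hη hδ hf x
    have : Aop δ (Aop η f) x = (Pop δ (Aop η f) x - Aop η f x) / δ := rfl
    rw [this] at h
    field_simp at h ⊢
    linarith
  have hq : 0 ≤ 1 - η / δ := by rw [sub_nonneg, div_le_one hδ0]; exact hδ.le
  have hq' : 0 ≤ η / δ := by positivity
  have hA : Integrable (Aop η f) := Aop_integrable hi
  calc ∫ x, |Aop δ f x| ≤ ∫ x, ((η / δ) * |Aop η f x| + (1 - η / δ) * |Pop δ (Aop η f) x|) := by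
        refine integral_mono (Aop_integrable hi).abs ((hA.abs.const_mul _).add ((Pop_integrable hA).abs.const_mul _)) fun x => ?_
        simp only
        rw [e x]
        refine (abs_add_le _ _).trans ?_
        rw [abs_mul, abs_mul, abs_of_nonneg hq, abs_of_nonneg hq']
    _ = (η / δ) * (∫ x, |Aop η f x|) + (1 - η / δ) * ∫ x, |Pop δ (Aop η f) x| := by
        rw [integral_add (hA.abs.const_mul _) ((Pop_integrable hA).abs.const_mul _), integral_const_mul, integral_const_mul]
    _ ≤ (η / δ) * (∫ x, |Aop η f x|) + (1 - η / δ) * ∫ x, |Aop η f x| := by gcongr (_ + _ * ?_); exact Pop_l1 hA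
    _ = _ := by ring

end

noncomputable section
variable {N : ℕ}

local notation "gs" => ProbabilityTheory.stdGaussian (Euc N)

lemma gs_moment (n : ℕ) : Integrable (fun y : Euc N => ‖y‖ ^ n) gs := by
  have h := ProbabilityTheory.IsGaussian.memLp_id (gs) (n : ℝ≥0∞) (by simp)
  simpa using h.integrable_norm_pow'

lemma nu1_moment (n : ℕ) : Integrable (fun y : Euc N => ‖y‖ ^ n) (nu1 N) := by
  unfold nu1
  rw [integrable_map_measure (by fun_prop) meas_nu1map.aemeasurable]
  have h := (integrable_expo_rpow (s := (n : ℝ) / 2) (by positivity)).const_mul (2 ^ ((n : ℝ) / 2))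
  have h2 := h.mul_prod (gs_moment (N := N) n)
  refine h2.congr ?_
  have : ∀ᵐ p ∂(expo.prod gs), 0 < p.1 := Measure.quasiMeasurePreserving_fst.ae expo_ae_pos
  filter_upwards [this] with p hp
  simp only [Function.comp, norm_smul, mul_pow]
  congr 1
  rw [Real.norm_of_nonneg (Real.sqrt_nonneg _), Real.sqrt_eq_rpow, ← Real.rpow_natCast, ← Real.rpow_mul (by positivity),
    ← Real.mul_rpow (by norm_num) hp.le]
  congr 1
  ring

lemma gs_cov (i j : Fin N) : ∫ y, y i * y j ∂gs = if i = j then 1 else 0 := by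
  have h := ProbabilityTheory.covarianceBilin_apply (μ := gs) ProbabilityTheory.IsGaussian.memLp_two_id
    (EuclideanSpace.single i (1 : ℝ)) (EuclideanSpace.single j (1 : ℝ))
  rw [ProbabilityTheory.covarianceBilin_stdGaussian] at h
  have h0 : ∫ x : Euc N, id x ∂gs = 0 := by simp
  rw [h0] at h
  simp only [sub_zero, EuclideanSpace.inner_single_left] at h
  simp at h
  rw [← h, innerSL_apply_apply, EuclideanSpace.inner_single_left]
  simp [eq_comm]

lemma coord_le (y : Euc N) (i : Fin N) : |y i| ≤ ‖y‖ := by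
  have := PiLp.norm_apply_le y i
  simpa using this

lemma nu1_cov_int (i j : Fin N) : Integrable (fun y : Euc N => y i * y j) (nu1 N) := by
  refine (nu1_moment 2).mono' (by fun_prop) (ae_of_all _ fun y => ?_)
  rw [Real.norm_eq_abs, abs_mul, sq]
  exact mul_le_mul (coord_le y i) (coord_le y j) (abs_nonneg _) (norm_nonneg _)

lemma nu1_cov (i j : Fin N) : ∫ y, y i * y j ∂(nu1 N) = if i = j then 2 else 0 := by
  have hi := nu1_cov_int (N := N) i j
  unfold nu1 at hi ⊢
  rw [integrable_map_measure (by fun_prop) meas_nu1map.aemeasurable] at hi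
  rw [integral_map meas_nu1map.aemeasurable (by fun_prop)]
  have : ∀ᵐ p ∂(expo.prod gs), 0 < p.1 := Measure.quasiMeasurePreserving_fst.ae expo_ae_pos
  have e : ∫ p : ℝ × Euc N, (Real.sqrt (2 * p.1) • p.2) i * (Real.sqrt (2 * p.1) • p.2) j ∂(expo.prod gs)
      = ∫ p : ℝ × Euc N, (2 * p.1) * (p.2 i * p.2 j) ∂(expo.prod gs) := by
    refine integral_congr_ae ?_
    filter_upwards [this] with p hp
    simp only [PiLp.smul_apply, smul_eq_mul]
    have := Real.mul_self_sqrt (show 0 ≤ 2 * p.1 by linarith)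
    linear_combination (p.2 i * p.2 j) * this
  rw [e, integral_prod_mul (fun x : ℝ => 2 * x) (fun y : Euc N => y i * y j), gs_cov, integral_const_mul, integral_expo_id]
  split_ifs <;> simp

lemma nu1_coord (i : Fin N) : ∫ y : Euc N, y i ∂(nu1 N) = 0 := by
  have h := nu_neg (N := N) (δ := 1) zero_le_one
  have h1 : nu N 1 = nu1 N := by unfold nu; simp
  rw [h1] at h
  have h2 := (MeasurableEquiv.neg (Euc N)).measurableEmbedding.integral_map (μ := nu1 N) (fun y => y i)
  have h3 : ∫ y : Euc N, y i ∂(nu1 N) = ∫ y : Euc N, (-y) i ∂(nu1 N) := by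
    conv_lhs => rw [← h]
    exact h2
  simp only [PiLp.neg_apply] at h3
  rw [integral_neg] at h3
  linarith

def M2 (N : ℕ) : ℝ := ∫ y, ‖y‖ ^ 2 ∂(nu1 N)
def M3 (N : ℕ) : ℝ := ∫ y, ‖y‖ ^ 3 ∂(nu1 N)

lemma M2_nonneg : 0 ≤ M2 N := integral_nonneg fun _ => by positivity
lemma M3_nonneg : 0 ≤ M3 N := integral_nonneg fun _ => by positivity

lemma nu_moment {δ : ℝ} (n : ℕ) : Integrable (fun y : Euc N => ‖y‖ ^ n) (nu N δ) := by
  unfold nu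
  rw [integrable_map_measure (by fun_prop) (by fun_prop)]
  refine ((nu1_moment n).const_mul ((√δ) ^ n)).congr (ae_of_all _ fun y => ?_)
  simp [norm_smul, mul_pow, abs_of_nonneg (Real.sqrt_nonneg δ)]

lemma nu_int_pow {δ : ℝ} (hδ : 0 < δ) (n : ℕ) : ∫ y : Euc N, ‖y‖ ^ n ∂(nu N δ) = (√δ) ^ n * ∫ y, ‖y‖ ^ n ∂(nu1 N) := by
  rw [integral_nu hδ, ← integral_const_mul]
  congr 1; ext1 y
  simp [norm_smul, mul_pow, abs_of_nonneg (Real.sqrt_nonneg δ)]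

lemma nu_M2 {δ : ℝ} (hδ : 0 < δ) : ∫ y : Euc N, ‖y‖ ^ 2 ∂(nu N δ) = δ * M2 N := by
  rw [nu_int_pow hδ, Real.sq_sqrt hδ.le, M2]

lemma nu_M3 {δ : ℝ} (hδ : 0 < δ) : ∫ y : Euc N, ‖y‖ ^ 3 ∂(nu N δ) = δ * √δ * M3 N := by
  rw [nu_int_pow hδ, M3, pow_succ, Real.sq_sqrt hδ.le]

lemma nu_cov {δ : ℝ} (hδ : 0 < δ) (i j : Fin N) : ∫ y, y i * y j ∂(nu N δ) = if i = j then 2 * δ else 0 := by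
  rw [integral_nu hδ]
  have : ∀ y : Euc N, (√δ • y) i * (√δ • y) j = δ * (y i * y j) := fun y => by
    simp only [PiLp.smul_apply, smul_eq_mul]
    have := Real.mul_self_sqrt hδ.le
    linear_combination (y i * y j) * this
  simp_rw [this]
  rw [integral_const_mul, nu1_cov]
  split_ifs
  · ring
  · ring

lemma nu_coord {δ : ℝ} (hδ : 0 < δ) (i : Fin N) : ∫ y : Euc N, y i ∂(nu N δ) = 0 := by
  rw [integral_nu hδ]
  simp only [PiLp.smul_apply, smul_eq_mul]
  rw [integral_const_mul, nu1_coord, mul_zero]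

/-- Chebyshev -/
lemma nu_cheb {δ : ℝ} (hδ : 0 < δ) {R : ℝ} (hR : 0 < R) : (nu N δ).real {y | R ≤ ‖y‖} ≤ δ * M2 N / R ^ 2 := by
  rw [le_div_iff₀ (by positivity), ← nu_M2 hδ, mul_comm]
  have := mul_meas_ge_le_integral_of_nonneg (μ := nu N δ) (f := fun y : Euc N => ‖y‖ ^ 2) (ae_of_all _ fun y => by positivity)
    (nu_moment 2) (R ^ 2)
  have e : {y : Euc N | R ≤ ‖y‖} = {y : Euc N | R ^ 2 ≤ ‖y‖ ^ 2} := by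
    ext y
    exact (pow_le_pow_iff_left₀ (n := 2) hR.le (norm_nonneg y) two_ne_zero).symm
  rw [e]; exact this

/-! ### Taylor -/

def Test (φ : Euc N → ℝ) : Prop := ContDiff ℝ (⊤ : ℕ∞) φ ∧ HasCompactSupport φ

/-- partial derivative -/
def pd (i : Fin N) (φ : Euc N → ℝ) (x : Euc N) : ℝ := fderiv ℝ φ x (EuclideanSpace.single i (1 : ℝ))

lemma cd_pd {φ : Euc N → ℝ} (h : ContDiff ℝ (⊤ : ℕ∞) φ) (i : Fin N) : ContDiff ℝ (⊤ : ℕ∞) (pd i φ) :=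
  (h.fderiv_right (m := (⊤ : ℕ∞)) (by simp)).clm_apply contDiff_const

lemma Test.pd {φ : Euc N → ℝ} (h : Test φ) (i : Fin N) : Test (pd i φ) :=
  ⟨cd_pd h.1 i, h.2.fderiv_apply (𝕜 := ℝ) _⟩

lemma lap_eq {φ : Euc N → ℝ} (x : Euc N) : lap φ x = ∑ i : Fin N, pd i (pd i φ) x := rfl

lemma Test.bdd {φ : Euc N → ℝ} (h : Test φ) : ∃ B, 0 ≤ B ∧ ∀ x, |φ x| ≤ B := by
  obtain ⟨B, hB⟩ := h.1.continuous.bounded_above_of_compact_support h.2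
  exact ⟨B, (norm_nonneg _).trans (hB 0), hB⟩

lemma fderiv_expand {φ : Euc N → ℝ} (x y : Euc N) : fderiv ℝ φ x y = ∑ i : Fin N, y i * pd i φ x := by
  have hy : y = ∑ i : Fin N, y i • EuclideanSpace.single i (1 : ℝ) := by
    have := (EuclideanSpace.basisFun (Fin N) ℝ).sum_repr y
    simpa using this.symm
  conv_lhs => rw [hy]
  simp only [map_sum, map_smul, smul_eq_mul]
  rfl

/-- one-dimensional mean-value bound from zero -/
lemma mv0 {g g' : ℝ → ℝ} {B : ℝ} (h : ∀ t ∈ Icc (0:ℝ) 1, HasDerivAt g (g' t) t) (hb : ∀ t ∈ Icc (0:ℝ) 1, |g' t| ≤ B)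
    {t : ℝ} (ht : t ∈ Icc (0:ℝ) 1) : |g t - g 0| ≤ B := by
  have hB : 0 ≤ B := (abs_nonneg _).trans (hb 0 (by simp))
  have := norm_image_sub_le_of_norm_deriv_le_segment' (f := g) (f' := g') (C := B) (a := 0) (b := 1)
    (fun x hx => (h x hx).hasDerivWithinAt) (fun x hx => hb x ⟨hx.1, hx.2.le⟩) t ht
  rw [Real.norm_eq_abs] at this
  refine this.trans ?_
  rw [sub_zero]
  exact mul_le_of_le_one_right hB ht.2

lemma line_deriv {f : Euc N → ℝ} (hf : ContDiff ℝ (⊤ : ℕ∞) f) (x y : Euc N) (t : ℝ) :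
    HasDerivAt (fun t : ℝ => f (x + t • y)) (∑ i, y i * pd i f (x + t • y)) t := by
  have h1 : HasDerivAt (fun t : ℝ => x + t • y) y t := by
    simpa using ((hasDerivAt_id t).smul_const y).const_add x
  rw [← fderiv_expand]
  exact ((hf.differentiable (by simp)) _).hasFDerivAt.comp_hasDerivAt t h1

lemma sum_coord_bd {B : ℝ} (hB : 0 ≤ B) (y : Euc N) {a : Fin N → ℝ} (ha : ∀ i, |a i| ≤ B) : |∑ i, y i * a i| ≤ N * (‖y‖ * B) := by
  refine (Finset.abs_sum_le_sum_abs _ _).trans ?_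
  have : (N : ℝ) * (‖y‖ * B) = ∑ i : Fin N, ‖y‖ * B := by simp
  rw [this]
  refine Finset.sum_le_sum fun i _ => ?_
  rw [abs_mul]
  exact mul_le_mul (coord_le y i) (ha i) (abs_nonneg _) (norm_nonneg _)

lemma taylor2 {φ : Euc N → ℝ} (h : ContDiff ℝ (⊤ : ℕ∞) φ) {B : ℝ} (hB0 : 0 ≤ B) (hB : ∀ i j z, |pd i (pd j φ) z| ≤ B) (x y : Euc N) :
    |φ (x + y) - φ x - ∑ i, y i * pd i φ x| ≤ N ^ 2 * B * ‖y‖ ^ 2 := by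
  have b2 : ∀ z, |∑ i, y i * ∑ j, y j * pd j (pd i φ) z| ≤ N ^ 2 * B * ‖y‖ ^ 2 := fun z => by
    refine (sum_coord_bd (by positivity) y (fun i => sum_coord_bd hB0 y (fun j => hB j i z))).trans (le_of_eq (by ring))
  have s1 : ∀ t ∈ Icc (0:ℝ) 1, |∑ i, y i * pd i φ (x + t • y) - ∑ i, y i * pd i φ x| ≤ N ^ 2 * B * ‖y‖ ^ 2 := by
    intro t ht
    have := mv0 (g := fun t => ∑ i, y i * pd i φ (x + t • y)) (g' := fun t => ∑ i, y i * ∑ j, y j * pd j (pd i φ) (x + t • y))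
      (fun t _ => HasDerivAt.fun_sum fun i _ => (line_deriv (cd_pd h i) x y t).const_mul _) (fun t _ => b2 _) ht
    simpa using this
  have := mv0 (g := fun t => φ (x + t • y) - t * ∑ i, y i * pd i φ x) (g' := fun t => ∑ i, y i * pd i φ (x + t • y) - ∑ i, y i * pd i φ x)
      (fun t _ => (line_deriv h x y t).sub (by simpa using (hasDerivAt_id t).mul_const (∑ i, y i * pd i φ x))) s1 (t := 1) (by simp)
  simp only [one_smul, zero_smul, add_zero, one_mul, zero_mul, sub_zero] at this
  convert this using 2
  ring

lemma taylor3 {φ : Euc N → ℝ} (h : ContDiff ℝ (⊤ : ℕ∞) φ) {B : ℝ} (hB0 : 0 ≤ B) (hB : ∀ i j k z, |pd i (pd j (pd k φ)) z| ≤ B) (x y : Euc N) :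
    |φ (x + y) - φ x - ∑ i, y i * pd i φ x - (∑ i, y i * ∑ j, y j * pd j (pd i φ) x) / 2| ≤ N ^ 3 * B * ‖y‖ ^ 3 := by
  have b3 : ∀ z, |∑ i, y i * ∑ j, y j * ∑ k, y k * pd k (pd j (pd i φ)) z| ≤ N ^ 3 * B * ‖y‖ ^ 3 := fun z => by
    refine (sum_coord_bd (by positivity) y (fun i => sum_coord_bd (by positivity) y
      (fun j => sum_coord_bd hB0 y fun k => hB k j i z))).trans (le_of_eq (by ring))
  set L := ∑ i, y i * pd i φ x with hL
  set Q := ∑ i, y i * ∑ j, y j * pd j (pd i φ) x with hQ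
  have s2 : ∀ t ∈ Icc (0:ℝ) 1, |∑ i, y i * ∑ j, y j * pd j (pd i φ) (x + t • y) - Q| ≤ N ^ 3 * B * ‖y‖ ^ 3 := by
    intro t ht
    have := mv0 (g := fun t => ∑ i, y i * ∑ j, y j * pd j (pd i φ) (x + t • y))
      (g' := fun t => ∑ i, y i * ∑ j, y j * ∑ k, y k * pd k (pd j (pd i φ)) (x + t • y))
      (fun t _ => HasDerivAt.fun_sum fun i _ => (HasDerivAt.fun_sum fun j _ =>
        (line_deriv (cd_pd (cd_pd h i) j) x y t).const_mul _).const_mul _) (fun t _ => b3 _) ht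
    simpa using this
  have s1 : ∀ t ∈ Icc (0:ℝ) 1, |∑ i, y i * pd i φ (x + t • y) - L - t * Q| ≤ N ^ 3 * B * ‖y‖ ^ 3 := by
    intro t ht
    have := mv0 (g := fun t => ∑ i, y i * pd i φ (x + t • y) - t * Q)
      (g' := fun t => ∑ i, y i * ∑ j, y j * pd j (pd i φ) (x + t • y) - Q)
      (fun t _ => (HasDerivAt.fun_sum fun i _ => (line_deriv (cd_pd h i) x y t).const_mul _).sub
        (by simpa using (hasDerivAt_id t).mul_const Q)) s2 ht
    simp only [zero_smul, add_zero, zero_mul, sub_zero] at this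
    convert this using 2
    ring
  have := mv0 (g := fun t => φ (x + t • y) - t * L - t ^ 2 / 2 * Q)
      (g' := fun t => ∑ i, y i * pd i φ (x + t • y) - L - t * Q)
      (fun t _ => ((line_deriv h x y t).sub (by simpa using (hasDerivAt_id t).mul_const L)).sub
        (by
          have := ((hasDerivAt_pow 2 t).div_const 2).mul_const Q
          have e : t * Q = (2 : ℕ) * t ^ (2 - 1) / 2 * Q := by push_cast; ring
          rw [e]; exact this)) s1 (t := 1) (by simp)
  have e : φ (x + y) - φ x - L - Q / 2 = φ (x + (1:ℝ) • y) - 1 * L - 1 ^ 2 / 2 * Q - (φ (x + (0:ℝ) • y) - 0 * L - 0 ^ 2 / 2 * Q) := by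
    rw [one_smul, zero_smul, add_zero]; ring
  rw [e]; exact this

/-! ### Convergence of the generator -/

lemma Test.BM {φ : Euc N → ℝ} (h : Test φ) : ∃ B, 0 ≤ B ∧ BM B φ := by
  obtain ⟨B, h0, hB⟩ := h.bdd
  exact ⟨B, h0, h.1.continuous.measurable, hB⟩

lemma Test.integrable {φ : Euc N → ℝ} (h : Test φ) : Integrable φ := h.1.continuous.integrable_of_hasCompactSupport h.2

lemma nu_lin {δ : ℝ} (hδ : 0 < δ) (a : Fin N → ℝ) :
    Integrable (fun y : Euc N => ∑ i, y i * a i) (nu N δ) ∧ ∫ y : Euc N, ∑ i, y i * a i ∂(nu N δ) = 0 := by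
  have hi : ∀ i, Integrable (fun y : Euc N => y i * a i) (nu N δ) := fun i => by
    refine Integrable.mul_const ?_ _
    refine ((nu_moment (δ := δ) 1).mono' (by fun_prop) (ae_of_all _ fun y => ?_))
    simpa using coord_le y i
  refine ⟨integrable_finsetSum _ fun i _ => hi i, ?_⟩
  rw [integral_finsetSum _ fun i _ => hi i]
  simp_rw [integral_mul_const, nu_coord hδ]
  simp

lemma nu_quad {δ : ℝ} (hδ : 0 < δ) (a : Fin N → Fin N → ℝ) :
    Integrable (fun y : Euc N => ∑ i, y i * ∑ j, y j * a j i) (nu N δ) ∧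
      ∫ y : Euc N, ∑ i, y i * ∑ j, y j * a j i ∂(nu N δ) = 2 * δ * ∑ i, a i i := by
  have hi : ∀ i j, Integrable (fun y : Euc N => y i * y j * a j i) (nu N δ) := fun i j => by
    refine Integrable.mul_const ?_ _
    refine ((nu_moment (δ := δ) 2).mono' (by fun_prop) (ae_of_all _ fun y => ?_))
    rw [Real.norm_eq_abs, abs_mul, sq]
    exact mul_le_mul (coord_le y i) (coord_le y j) (abs_nonneg _) (norm_nonneg _)
  simp_rw [Finset.mul_sum, ← mul_assoc]
  refine ⟨integrable_finsetSum _ fun i _ => integrable_finsetSum _ fun j _ => hi i j, ?_⟩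
  rw [integral_finsetSum _ fun i _ => integrable_finsetSum _ fun j _ => hi i j]
  refine Finset.sum_congr rfl fun i _ => ?_
  rw [integral_finsetSum _ fun j _ => hi i j]
  simp_rw [integral_mul_const, nu_cov hδ]
  simp

lemma Aop_bd2 {φ : Euc N → ℝ} (h : Test φ) {B : ℝ} (hB0 : 0 ≤ B) (hB : ∀ i j z, |pd i (pd j φ) z| ≤ B)
    {δ : ℝ} (hδ : 0 < δ) (x : Euc N) : |Aop δ φ x| ≤ N ^ 2 * B * M2 N := by
  obtain ⟨C, hC0, hC⟩ := h.BM
  obtain ⟨l1, l2⟩ := nu_lin (N := N) hδ (fun i => pd i φ x)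
  have e : Pop δ φ x - φ x = ∫ y, (φ (x + y) - φ x - ∑ i, y i * pd i φ x) ∂(nu N δ) := by
    have i1 : Integrable (fun y => φ (x + y) - φ x) (nu N δ) := (hC.shift x).sub (integrable_const _)
    rw [integral_sub i1 l1, integral_sub (hC.shift x) (integrable_const _), l2]
    simp [Pop]
  unfold Aop
  rw [e, abs_div, abs_of_pos hδ, div_le_iff₀ hδ]
  refine (norm_integral_le_of_norm_le (f := fun y => φ (x + y) - φ x - ∑ i, y i * pd i φ x) ((nu_moment (δ := δ) 2).const_mul (N ^ 2 * B)) (ae_of_all _ fun y => taylor2 h.1 hB0 hB x y)).trans ?_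
  rw [integral_const_mul, nu_M2 hδ]
  apply le_of_eq; ring

lemma Aop_lap {φ : Euc N → ℝ} (h : Test φ) {B : ℝ} (hB0 : 0 ≤ B) (hB : ∀ i j k z, |pd i (pd j (pd k φ)) z| ≤ B)
    {δ : ℝ} (hδ : 0 < δ) (x : Euc N) : |Aop δ φ x - lap φ x| ≤ N ^ 3 * B * M3 N * √δ := by
  obtain ⟨C, hC0, hC⟩ := h.BM
  obtain ⟨l1, l2⟩ := nu_lin (N := N) hδ (fun i => pd i φ x)
  obtain ⟨q1, q2⟩ := nu_quad (N := N) hδ (fun j i => pd j (pd i φ) x)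
  have e : Pop δ φ x - φ x - δ * lap φ x
      = ∫ y, (φ (x + y) - φ x - ∑ i, y i * pd i φ x - (∑ i, y i * ∑ j, y j * pd j (pd i φ) x) / 2) ∂(nu N δ) := by
    have i1 : Integrable (fun y => φ (x + y) - φ x) (nu N δ) := (hC.shift x).sub (integrable_const _)
    have i2 : Integrable (fun y => φ (x + y) - φ x - ∑ i, y i * pd i φ x) (nu N δ) := i1.sub l1
    rw [integral_sub i2 (q1.div_const 2),
      integral_sub i1 l1, integral_sub (hC.shift x) (integrable_const _), l2, integral_div, q2, lap_eq]
    simp [Pop]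
    ring
  have e2 : Aop δ φ x - lap φ x = (Pop δ φ x - φ x - δ * lap φ x) / δ := by unfold Aop; field_simp
  rw [e2, e, abs_div, abs_of_pos hδ, div_le_iff₀ hδ]
  refine (norm_integral_le_of_norm_le (f := fun y => φ (x + y) - φ x - ∑ i, y i * pd i φ x - (∑ i, y i * ∑ j, y j * pd j (pd i φ) x) / 2) ((nu_moment (δ := δ) 3).const_mul (N ^ 3 * B)) (ae_of_all _ fun y => taylor3 h.1 hB0 hB x y)).trans ?_
  rw [integral_const_mul, nu_M3 hδ]
  apply le_of_eq; ring

lemma Test.third_bdd {φ : Euc N → ℝ} (h : Test φ) : ∃ B, 0 ≤ B ∧ ∀ i j k z, |_root_.pd i (_root_.pd j (_root_.pd k φ)) z| ≤ B := by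
  choose B hB0 hB using fun i j k => (((h.pd k).pd j).pd i).bdd
  refine ⟨∑ i, ∑ j, ∑ k, B i j k, Finset.sum_nonneg fun i _ => Finset.sum_nonneg fun j _ => Finset.sum_nonneg fun k _ => hB0 i j k, fun i j k z => ?_⟩
  refine (hB i j k z).trans ?_
  calc B i j k ≤ ∑ k, B i j k := Finset.single_le_sum (f := fun k => B i j k) (fun k _ => hB0 i j k) (Finset.mem_univ k)
    _ ≤ ∑ j, ∑ k, B i j k := Finset.single_le_sum (f := fun j => ∑ k, B i j k) (fun j _ => Finset.sum_nonneg fun k _ => hB0 i j k) (Finset.mem_univ j)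
    _ ≤ _ := Finset.single_le_sum (f := fun i => ∑ j, ∑ k, B i j k) (fun i _ => Finset.sum_nonneg fun j _ => Finset.sum_nonneg fun k _ => hB0 i j k) (Finset.mem_univ i)

lemma Test.second_bdd {φ : Euc N → ℝ} (h : Test φ) : ∃ B, 0 ≤ B ∧ ∀ i j z, |_root_.pd i (_root_.pd j φ) z| ≤ B := by
  choose B hB0 hB using fun i j => ((h.pd j).pd i).bdd
  refine ⟨∑ i, ∑ j, B i j, Finset.sum_nonneg fun i _ => Finset.sum_nonneg fun j _ => hB0 i j, fun i j z => ?_⟩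
  refine (hB i j z).trans ?_
  calc B i j ≤ ∑ j, B i j := Finset.single_le_sum (f := fun j => B i j) (fun j _ => hB0 i j) (Finset.mem_univ j)
    _ ≤ _ := Finset.single_le_sum (f := fun i => ∑ j, B i j) (fun i _ => Finset.sum_nonneg fun j _ => hB0 i j) (Finset.mem_univ i)

lemma Test.lap {φ : Euc N → ℝ} (h : Test φ) : Test (lap φ) := by
  have e : _root_.lap φ = fun x => ∑ i : Fin N, _root_.pd i (_root_.pd i φ) x := rfl
  refine ⟨?_, ?_⟩
  · rw [e]
    exact ContDiff.sum fun i _ => ((h.pd i).pd i).1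
  · refine HasCompactSupport.intro h.2 fun x hx' => ?_
    rw [e]
    refine Finset.sum_eq_zero fun i _ => ?_
    have h1 : tsupport (_root_.pd i (_root_.pd i φ)) ⊆ tsupport φ :=
      (tsupport_fderiv_apply_subset ℝ _).trans (tsupport_fderiv_apply_subset ℝ _)
    exact image_eq_zero_of_notMem_tsupport fun hh => hx' (h1 hh)

/-- `A_δ φ = P_δ (Δ φ)` -/
lemma Aop_eq_Pop_lap {φ : Euc N → ℝ} (h : Test φ) {δ : ℝ} (hδ : 0 < δ) (x : Euc N) : Aop δ φ x = Pop δ (lap φ) x := by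
  obtain ⟨C, hC0, hC⟩ := h.BM
  obtain ⟨B, hB0, hB⟩ := h.third_bdd
  obtain ⟨B2, hB20, hB2⟩ := h.second_bdd
  obtain ⟨L, hL0, hL⟩ := h.lap.BM
  have key : ∀ η, 0 < η → η < δ → |Aop δ φ x - Pop δ (lap φ) x| ≤ N ^ 3 * B * M3 N * √η + η * (2 * (N ^ 2 * B2 * M2 N) / δ) := by
    intro η hη hηδ
    have hr := Aop_resolvent hη hηδ hC x
    have hA : BM (N ^ 2 * B2 * M2 N) (Aop η φ) := ⟨(hC.Aop hη).1, Aop_bd2 h hB20 hB2 hη⟩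
    have hd : |Pop δ (fun x => Aop η φ x - lap φ x) x| ≤ N ^ 3 * B * M3 N * √η :=
      Pop_bd (fun z => Aop_lap h hB0 hB hη z) x
    rw [Pop_sub hA hL] at hd
    have h3 := (hA.Aop hδ).2 x
    have h4 : Aop δ φ x - Pop δ (lap φ) x = (Pop δ (Aop η φ) x - Pop δ (lap φ) x) - η * Aop δ (Aop η φ) x := by
      have h5 : δ * Aop δ (Aop η φ) x = Pop δ (Aop η φ) x - Aop η φ x := by
        conv_lhs => rw [_root_.Aop]
        field_simp
      linear_combination (-1) * hr + h5
    rw [h4]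
    refine (abs_sub _ _).trans (add_le_add hd ?_)
    rw [abs_mul, abs_of_pos hη]
    gcongr
  have hlim : Tendsto (fun η : ℝ => N ^ 3 * B * M3 N * √η + η * (2 * (N ^ 2 * B2 * M2 N) / δ)) (nhdsWithin 0 (Ioi 0)) (nhds 0) := by
    have : Continuous (fun η : ℝ => N ^ 3 * B * M3 N * √η + η * (2 * (N ^ 2 * B2 * M2 N) / δ)) := by fun_prop
    have h0 := this.tendsto 0
    simp only [Real.sqrt_zero, mul_zero, zero_mul, add_zero] at h0
    exact h0.mono_left nhdsWithin_le_nhds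
  have h1 : |Aop δ φ x - Pop δ (lap φ) x| ≤ 0 := by
    refine ge_of_tendsto hlim ?_
    filter_upwards [Ioo_mem_nhdsGT hδ] with η hη using key η hη.1 hη.2
  exact sub_eq_zero.1 (abs_nonpos_iff.1 h1)

lemma Aop_test_l1 {φ : Euc N → ℝ} (h : Test φ) {δ : ℝ} (hδ : 0 < δ) : ∫ x, |Aop δ φ x| ≤ ∫ x, |lap φ x| := by
  simp_rw [Aop_eq_Pop_lap h hδ]
  exact Pop_l1 h.lap.integrable

/-! ### second moments -/

lemma nu_shift_sq {δ : ℝ} (hδ : 0 < δ) (z : Euc N) : Integrable (fun y : Euc N => ‖z - y‖ ^ 2) (nu N δ) ∧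
    ∫ y, ‖z - y‖ ^ 2 ∂(nu N δ) = ‖z‖ ^ 2 + δ * M2 N := by
  obtain ⟨l1, l2⟩ := nu_lin (N := N) hδ (fun i => -2 * z i)
  have e : ∀ y : Euc N, ‖z - y‖ ^ 2 = ‖z‖ ^ 2 + (∑ i, y i * (-2 * z i)) + ‖y‖ ^ 2 := fun y => by
    rw [@norm_sub_sq_real, PiLp.inner_apply, Finset.mul_sum, sub_eq_add_neg, ← Finset.sum_neg_distrib]
    congr 2
    refine Finset.sum_congr rfl fun i _ => ?_
    simp
    ring
  have i1 : Integrable (fun y : Euc N => ‖z‖ ^ 2 + (∑ i, y i * (-2 * z i))) (nu N δ) := (integrable_const _).add l1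
  have i2 := nu_moment (N := N) (δ := δ) 2
  simp_rw [e]
  refine ⟨i1.add i2, ?_⟩
  rw [integral_add i1 i2, integral_add (integrable_const _) l1, l2, nu_M2 hδ]
  simp

lemma Pop_moment {δ : ℝ} (hδ : 0 < δ) {f : Euc N → ℝ} (hm : Measurable f)
    (hf : Integrable (fun z => (1 + ‖z‖ ^ 2) * f z)) :
    Integrable (fun x => (1 + ‖x‖ ^ 2) * Pop δ f x) ∧
      ∫ x, (1 + ‖x‖ ^ 2) * Pop δ f x = (∫ x, (1 + ‖x‖ ^ 2) * f x) + δ * M2 N * ∫ x, f x := by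
  have hf0 : Integrable f := by
    refine hf.mono hm.aestronglyMeasurable (ae_of_all _ fun z => ?_)
    rw [norm_mul]
    refine le_mul_of_one_le_left (norm_nonneg _) ?_
    rw [Real.norm_of_nonneg (by positivity)]
    nlinarith [sq_nonneg ‖z‖]
  have inner : ∀ z, ∫ y, (1 + ‖z - y‖ ^ 2) * f z ∂(nu N δ) = (1 + ‖z‖ ^ 2) * f z + δ * M2 N * f z := fun z => by
    obtain ⟨a, b⟩ := nu_shift_sq hδ z
    rw [integral_mul_const, integral_add (integrable_const _) a, b]
    simp; ring
  have hG : Integrable (fun p : Euc N × Euc N => (1 + ‖p.2 - p.1‖ ^ 2) * f p.2) ((nu N δ).prod volume) := by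
    rw [integrable_prod_iff' (by
      refine Measurable.aestronglyMeasurable ?_
      exact (by fun_prop : Measurable fun p : Euc N × Euc N => 1 + ‖p.2 - p.1‖ ^ 2).mul (hm.comp measurable_snd))]
    have i0 : ∀ z, Integrable (fun y : Euc N => 1 + ‖z - y‖ ^ 2) (nu N δ) := fun z => (integrable_const _).add (nu_shift_sq hδ z).1
    refine ⟨ae_of_all _ fun z => (i0 z).mul_const (f z), ?_⟩
    have : ∀ z, ∫ y, ‖(1 + ‖z - y‖ ^ 2) * f z‖ ∂(nu N δ) = ‖(1 + ‖z‖ ^ 2) * f z‖ + δ * M2 N * ‖f z‖ := fun z => by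
      obtain ⟨a, b⟩ := nu_shift_sq hδ z
      have e : ∀ y : Euc N, ‖(1 + ‖z - y‖ ^ 2) * f z‖ = (1 + ‖z - y‖ ^ 2) * ‖f z‖ := fun y => by
        rw [norm_mul, Real.norm_of_nonneg (by positivity)]
      simp_rw [e]
      rw [integral_mul_const, integral_add (integrable_const _) a, b, norm_mul, Real.norm_of_nonneg (by positivity : (0:ℝ) ≤ 1 + ‖z‖ ^ 2)]
      simp; ring
    simp_rw [this]
    exact hf.norm.add (hf0.norm.const_mul _)
  have mp := measurePreserving_prod_add (nu N δ) (volume : Measure (Euc N))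
  have hG' : Integrable (fun p : Euc N × Euc N => (1 + ‖p.2‖ ^ 2) * f (p.2 + p.1)) ((nu N δ).prod volume) := by
    have := mp.integrable_comp_of_integrable hG
    convert this using 2 with p
    simp [Function.comp, add_comm]
  have e1 : ∀ x, (1 + ‖x‖ ^ 2) * Pop δ f x = ∫ y, (1 + ‖x‖ ^ 2) * f (x + y) ∂(nu N δ) := fun x => by
    rw [integral_const_mul]; rfl
  simp_rw [e1]
  refine ⟨hG'.integral_prod_right, ?_⟩
  have e2 := integral_prod_symm _ hG'
  have e3 := integral_prod_symm _ hG
  simp only [inner] at e3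
  rw [integral_add hf (hf0.const_mul _), integral_const_mul] at e3
  rw [← e2, ← e3]
  have e4 : ∫ p, (1 + ‖p.2 - p.1‖ ^ 2) * f p.2 ∂((nu N δ).prod volume) =
     ∫ p, (1 + ‖p.2 - p.1‖ ^ 2) * f p.2 ∂(((nu N δ).prod volume).map (fun z : Euc N × Euc N => (z.1, z.1 + z.2))) := by
    rw [mp.map_eq]
  rw [e4, integral_map mp.measurable.aemeasurable (by rw [mp.map_eq]; exact hG.aestronglyMeasurable)]
  refine integral_congr_ae (ae_of_all _ fun p => ?_)
  simp [add_comm]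

end

noncomputable section

variable {N : ℕ}

/-! ### signed powers -/

lemma spow_nn {m s : ℝ} (hm : 0 < m) (hs : 0 ≤ s) : spow m s = s ^ m := by
  unfold spow
  rcases hs.eq_or_lt with rfl | h
  · simp [Real.zero_rpow hm.ne']
  · rw [abs_of_pos h, Real.rpow_sub_one h.ne']; field_simp

lemma spow_neg (m s : ℝ) : spow m (-s) = - spow m s := by unfold spow; simp

lemma spow_abs {m : ℝ} (hm : 0 < m) (s : ℝ) : |spow m s| = |s| ^ m := by
  rcases le_total 0 s with h | h
  · rw [spow_nn hm h, abs_of_nonneg (Real.rpow_nonneg h _), abs_of_nonneg h]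
  · have h' : 0 ≤ -s := by linarith
    rw [← neg_neg s, spow_neg, spow_nn hm h', abs_neg, abs_neg, abs_of_nonneg (Real.rpow_nonneg h' _), abs_of_nonneg h']

lemma spow_zero {m : ℝ} : spow m 0 = 0 := by unfold spow; simp

lemma spow_mono {m : ℝ} (hm : 0 < m) : StrictMono (spow m) := by
  intro a b hab
  rcases le_or_gt 0 a with h | h
  · rw [spow_nn hm h, spow_nn hm (h.trans hab.le)]
    exact Real.rpow_lt_rpow h hab hm
  · have ha : spow m a = - (-a) ^ m := by rw [← neg_neg a, spow_neg, spow_nn hm (by linarith), neg_neg]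
    rcases le_or_gt 0 b with h2 | h2
    · rw [ha, spow_nn hm h2]
      have := Real.rpow_pos_of_pos (neg_pos.2 h) m
      have := Real.rpow_nonneg h2 m
      linarith
    · have hb : spow m b = - (-b) ^ m := by rw [← neg_neg b, spow_neg, spow_nn hm (by linarith), neg_neg]
      rw [ha, hb]
      have := Real.rpow_lt_rpow (by linarith : 0 ≤ -b) (by linarith : -b < -a) hm
      linarith

lemma spow_meas (m : ℝ) : Measurable (spow m) := by
  unfold spow
  exact (measurable_id.abs.pow_const _).mul measurable_id

lemma spow_cont {m : ℝ} (hm : 1 ≤ m) : Continuous (spow m) := by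
  unfold spow
  exact (continuous_abs.rpow_const fun x => Or.inr (by linarith)).mul continuous_id

lemma spow_inv {m : ℝ} (hm : 0 < m) (s : ℝ) : spow m (spow (1 / m) s) = s := by
  have hm' : 0 < 1 / m := by positivity
  rcases le_total 0 s with h | h
  · rw [spow_nn hm' h, spow_nn hm (Real.rpow_nonneg h _), ← Real.rpow_mul h]
    rw [one_div_mul_cancel hm.ne', Real.rpow_one]
  · have h' : 0 ≤ -s := by linarith
    rw [← neg_neg s, spow_neg, spow_neg, spow_nn hm' h', spow_nn hm (Real.rpow_nonneg h' _), ← Real.rpow_mul h',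
      one_div_mul_cancel hm.ne', Real.rpow_one]

lemma rpow_conv {m : ℝ} (hm : 1 ≤ m) {r t : ℝ} (hr : 0 ≤ r) (hrt : r ≤ t) : t ^ m - r ^ m ≤ m * t ^ (m - 1) * (t - r) := by
  have h := Convex.norm_image_sub_le_of_norm_hasDerivWithin_le (f := fun x : ℝ => x ^ m) (f' := fun x => m * x ^ (m - 1))
    (C := m * t ^ (m - 1)) (s := Icc 0 t) (x := r) (y := t)
    (fun x hx => (Real.hasDerivAt_rpow_const (Or.inr hm)).hasDerivWithinAt)
    (fun x hx => by
      rw [Real.norm_of_nonneg (mul_nonneg (by linarith) (Real.rpow_nonneg hx.1 _))]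
      exact mul_le_mul_of_nonneg_left (Real.rpow_le_rpow hx.1 hx.2 (by linarith)) (by linarith))
    (convex_Icc _ _) ⟨hr, hrt⟩ ⟨hr.trans hrt, le_rfl⟩
  rw [Real.norm_eq_abs, Real.norm_eq_abs, abs_of_nonneg (by linarith : 0 ≤ t - r)] at h
  exact (le_abs_self _).trans h

lemma spow_lip_le {m M : ℝ} (hm : 1 ≤ m) {a b : ℝ} (ha : |a| ≤ M) (hb : |b| ≤ M) (hab : b ≤ a) :
    spow m a - spow m b ≤ m * M ^ (m - 1) * (a - b) := by
  have hm0 : 0 < m := by linarith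
  have hp : ∀ r t, 0 ≤ r → r ≤ t → |t| ≤ M → spow m t - spow m r ≤ m * M ^ (m - 1) * (t - r) := by
    intro r t hr hrt ht
    rw [spow_nn hm0 hr, spow_nn hm0 (hr.trans hrt)]
    refine (rpow_conv hm hr hrt).trans ?_
    have : t ^ (m - 1) ≤ M ^ (m - 1) := Real.rpow_le_rpow (hr.trans hrt) ((le_abs_self t).trans ht) (by linarith)
    gcongr
  rcases le_total 0 b with h | h
  · exact hp b a h hab ha
  · rcases le_total 0 a with h2 | h2
    · have h3 := hp 0 a le_rfl h2 ha
      have h4 := hp 0 (-b) le_rfl (by linarith) (by rwa [abs_neg])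
      rw [spow_neg] at h4
      rw [spow_zero] at h3 h4
      linarith
    · have := hp (-a) (-b) (by linarith) (by linarith) (by rwa [abs_neg])
      rw [spow_neg, spow_neg] at this
      linarith

lemma spow_lip {m M : ℝ} (hm : 1 ≤ m) {a b : ℝ} (ha : |a| ≤ M) (hb : |b| ≤ M) :
    |spow m a - spow m b| ≤ m * M ^ (m - 1) * |a - b| := by
  have hm0 : 0 < m := by linarith
  rcases le_total b a with h | h
  · rw [abs_of_nonneg (sub_nonneg.2 h), abs_of_nonneg (sub_nonneg.2 ((spow_mono hm0).monotone h))]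
    exact spow_lip_le hm ha hb h
  · rw [abs_sub_comm, abs_sub_comm a]
    rw [abs_of_nonneg (sub_nonneg.2 h), abs_of_nonneg (sub_nonneg.2 ((spow_mono hm0).monotone h))]
    exact spow_lip_le hm hb ha h

lemma spow_bd {m M : ℝ} (hm : 1 ≤ m) {a : ℝ} (ha : |a| ≤ M) : |spow m a| ≤ M ^ (m - 1) * |a| := by
  unfold spow
  rw [abs_mul, abs_of_nonneg (Real.rpow_nonneg (abs_nonneg a) _)]
  exact mul_le_mul_of_nonneg_right (Real.rpow_le_rpow (abs_nonneg a) ha (by linarith)) (abs_nonneg _)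

lemma spow_bd' {m M : ℝ} (hm : 1 ≤ m) {a : ℝ} (ha : |a| ≤ M) : |spow m a| ≤ M ^ m := by
  rw [spow_abs (by linarith)]
  exact Real.rpow_le_rpow (abs_nonneg a) ha (by linarith)

/-- strict monotonicity, quantitatively -/
lemma spow_coer {m M ε : ℝ} (hm : 1 ≤ m) (hε : 0 < ε) : ∃ C, 0 ≤ C ∧ ∀ a b, |a| ≤ M → |b| ≤ M →
    |a - b| ≤ ε + C * ((a - b) * (spow m a - spow m b)) := by
  have hm0 : 0 < m := by linarith
  have hnn : ∀ a b, 0 ≤ (a - b) * (spow m a - spow m b) := fun a b => by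
    rcases le_total a b with h | h
    · exact mul_nonneg_of_nonpos_of_nonpos (by linarith) (by linarith [(spow_mono hm0).monotone h])
    · exact mul_nonneg (by linarith) (by linarith [(spow_mono hm0).monotone h])
  set S : Set (ℝ × ℝ) := (Icc (-M) M ×ˢ Icc (-M) M) ∩ {p | ε ≤ |p.1 - p.2|} with hS
  have hSc : IsCompact S := (isCompact_Icc.prod isCompact_Icc).inter_right
    (isClosed_le continuous_const (by fun_prop))
  have hc : Continuous (fun p : ℝ × ℝ => (p.1 - p.2) * (spow m p.1 - spow m p.2)) :=
    (continuous_fst.sub continuous_snd).mul (((spow_cont hm).comp continuous_fst).sub ((spow_cont hm).comp continuous_snd))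
  rcases S.eq_empty_or_nonempty with h0 | hne
  · refine ⟨0, le_rfl, fun a b ha hb => ?_⟩
    by_contra hcon
    have : (a, b) ∈ S := ⟨⟨abs_le.1 ha, abs_le.1 hb⟩, by simp only [mem_ofPred_eq]; linarith⟩
    rw [h0] at this; exact this
  · obtain ⟨p, hp, hmin⟩ := hSc.exists_isMinOn hne hc.continuousOn
    set μ := (p.1 - p.2) * (spow m p.1 - spow m p.2) with hμ
    have hμ0 : 0 < μ := by
      have hne : p.1 ≠ p.2 := fun h => by
        have := hp.2
        simp only [mem_ofPred_eq, h, sub_self, abs_zero] at this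
        linarith
      rcases lt_or_gt_of_ne hne with h | h
      · exact mul_pos_of_neg_of_neg (by linarith) (by linarith [(spow_mono hm0) h])
      · exact mul_pos (by linarith) (by linarith [(spow_mono hm0) h])
    have hM : 0 ≤ M := by have := hp.1.1; linarith [this.1, this.2]
    refine ⟨2 * M / μ, by positivity, fun a b ha hb => ?_⟩
    rcases le_total ε |a - b| with h | h
    · have h1 : μ ≤ (a - b) * (spow m a - spow m b) := hmin (⟨⟨abs_le.1 ha, abs_le.1 hb⟩, h⟩ : (a, b) ∈ S)
      have h2 : |a - b| ≤ 2 * M := by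
        have := abs_sub a b; linarith
      have h3 : 2 * M ≤ 2 * M / μ * ((a - b) * (spow m a - spow m b)) := by
        rw [div_mul_eq_mul_div, le_div_iff₀ hμ0]
        exact mul_le_mul_of_nonneg_left h1 (by linarith)
      linarith
    · have := mul_nonneg (by positivity : 0 ≤ 2 * M / μ) (hnn a b)
      linarith

end

noncomputable section

variable {N : ℕ}

/-- the weight condition, everywhere -/
structure Wt (γ k K : ℝ) (ρ : Euc N → ℝ) : Prop where
  hN : 3 ≤ N
  meas : Measurable ρ
  g0 : 0 ≤ γ
  g2 : γ < 2
  k0 : 0 < k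
  K0 : 0 < K
  lo : ∀ x, k * (1 + ‖x‖) ^ (-γ) ≤ ρ x
  up : ∀ x, x ≠ 0 → ρ x ≤ K * ‖x‖ ^ (-γ)

/-- parameters of the explicit scheme -/
structure Par (m δ h M : ℝ) : Prop where
  m1 : 1 < m
  d0 : 0 < δ
  d1 : δ ≤ 1
  h0 : 0 < h
  M0 : 0 ≤ M
  cfl : h * (m * M ^ (m - 1)) ≤ (1 / 2 : ℝ) ^ m * δ ^ 2

lemma Wt.pos {γ k K : ℝ} {ρ : Euc N → ℝ} (w : Wt γ k K ρ) (x : Euc N) : 0 < ρ x :=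
  lt_of_lt_of_le (mul_pos w.k0 (Real.rpow_pos_of_pos (by positivity) _)) (w.lo x)

def vv (m : ℝ) (u : Euc N → ℝ) (x : Euc N) : ℝ := spow m (u x)

def step (ρ : Euc N → ℝ) (m δ h : ℝ) (u : Euc N → ℝ) (x : Euc N) : ℝ :=
  u x + h / (ρ x + δ) * Aop δ (vv m u) x

lemma BM.vv {m M : ℝ} (hm : 1 ≤ m) {u : Euc N → ℝ} (h : BM M u) : BM (M ^ m) (vv m u) :=
  ⟨(spow_meas m).comp h.1, fun x => spow_bd' hm (h.2 x)⟩

section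
variable {γ k K m δ h M : ℝ} {ρ : Euc N → ℝ}

def cc (ρ : Euc N → ℝ) (δ h : ℝ) (x : Euc N) : ℝ := h / ((ρ x + δ) * δ)

lemma cc_nn (w : Wt γ k K ρ) (p : Par m δ h M) (x : Euc N) : 0 ≤ cc ρ δ h x := by
  have := w.pos x; have := p.d0; have := p.h0; unfold cc; positivity

lemma cc_le (w : Wt γ k K ρ) (p : Par m δ h M) (x : Euc N) : cc ρ δ h x * (m * M ^ (m - 1)) ≤ (1 / 2 : ℝ) ^ m := by
  have h1 := w.pos x; have h2 := p.d0
  unfold cc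
  rw [div_mul_eq_mul_div, div_le_iff₀ (by positivity)]
  refine p.cfl.trans ?_
  have : (0:ℝ) < (1 / 2 : ℝ) ^ m := Real.rpow_pos_of_pos (by norm_num) _
  refine mul_le_mul_of_nonneg_left ?_ this.le
  nlinarith

lemma half_pow_le (p : Par m δ h M) : (1 / 2 : ℝ) ^ m ≤ 1 / 2 := by
  have := Real.rpow_le_rpow_of_exponent_ge (by norm_num : (0:ℝ) < 1 / 2) (by norm_num) p.m1.le
  simpa using this

lemma step_eq (x : Euc N) (u : Euc N → ℝ) : step ρ m δ h u x = u x - cc ρ δ h x * spow m (u x) + cc ρ δ h x * Pop δ (vv m u) x := by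
  unfold step cc Aop vv
  rw [div_mul_div_comm]
  ring

lemma step_sg (w : Wt γ k K ρ) (p : Par m δ h M) (x : Euc N) (u : Euc N → ℝ) :
    (ρ x + δ) * step ρ m δ h u x = (ρ x + δ) * u x + h * Aop δ (vv m u) x := by
  have h1 := w.pos x; have h2 := p.d0
  unfold step
  field_simp

lemma g_mono (w : Wt γ k K ρ) (p : Par m δ h M) (x : Euc N) {a b : ℝ} (ha : |a| ≤ M) (hb : |b| ≤ M) (hab : b ≤ a) :
    cc ρ δ h x * (spow m a - spow m b) ≤ a - b := by
  have h1 := spow_lip_le p.m1.le ha hb hab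
  have h2 := cc_le w p x
  have h3 := half_pow_le p
  calc _ ≤ cc ρ δ h x * (m * M ^ (m - 1) * (a - b)) := mul_le_mul_of_nonneg_left h1 (cc_nn w p x)
    _ = cc ρ δ h x * (m * M ^ (m - 1)) * (a - b) := by ring
    _ ≤ 1 * (a - b) := mul_le_mul_of_nonneg_right (by linarith) (by linarith)
    _ = _ := one_mul _

lemma step_mono (w : Wt γ k K ρ) (p : Par m δ h M) {u û : Euc N → ℝ} (hu : BM M u) (hu' : BM M û) (hle : ∀ x, u x ≤ û x) (x : Euc N) :
    step ρ m δ h u x ≤ step ρ m δ h û x := by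
  rw [step_eq, step_eq]
  have h1 := g_mono w p x (hu'.2 x) (hu.2 x) (hle x)
  have h2 : Pop δ (vv m u) x ≤ Pop δ (vv m û) x :=
    Pop_mono (hu.vv p.m1.le) (hu'.vv p.m1.le) (fun z => (spow_mono (by linarith [p.m1])).monotone (hle z)) x
  have := mul_le_mul_of_nonneg_left h2 (cc_nn w p x)
  linarith

lemma step_const (c : ℝ) (x : Euc N) : step ρ m δ h (fun _ => c) x = c := by
  unfold step Aop vv
  rw [Pop_const]; simp

lemma step_neg (u : Euc N → ℝ) (x : Euc N) : step ρ m δ h (fun z => - u z) x = - step ρ m δ h u x := by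
  have : vv m (fun z => - u z) = fun z => (-1) * vv m u z := by ext z; simp [vv, spow_neg]
  unfold step
  rw [this, Aop_const_mul]; ring

lemma step_meas (w : Wt γ k K ρ) {u : Euc N → ℝ} (hu : Measurable u) : Measurable (step ρ m δ h u) := by
  unfold step
  have h1 : Measurable (vv m u) := (spow_meas m).comp hu
  have h2 : Measurable (Aop δ (vv m u)) := ((meas_Pop h1).sub h1).div_const δ
  exact hu.add ((measurable_const.div (w.meas.add_const δ)).mul h2)

lemma BM.step (w : Wt γ k K ρ) (p : Par m δ h M) {u : Euc N → ℝ} (hu : BM M u) : BM M (step ρ m δ h u) := by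
  refine ⟨step_meas w hu.1, fun x => abs_le.2 ⟨?_, ?_⟩⟩
  · have hc : BM M (fun _ : Euc N => -M) := ⟨measurable_const, fun x => by rw [abs_neg, abs_of_nonneg p.M0]⟩
    have := step_mono w p hc hu (fun x => (abs_le.1 (hu.2 x)).1) x
    rwa [step_const] at this
  · have hc : BM M (fun _ : Euc N => M) := ⟨measurable_const, fun x => by rw [abs_of_nonneg p.M0]⟩
    have := step_mono w p hu hc (fun x => (abs_le.1 (hu.2 x)).2) x
    rwa [step_const] at this

/-- pointwise Kato inequality -/
lemma step_kato (w : Wt γ k K ρ) (p : Par m δ h M) {u û : Euc N → ℝ} (hu : BM M u) (hu' : BM M û) (x : Euc N) :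
    (ρ x + δ) * |step ρ m δ h u x - step ρ m δ h û x| ≤ (ρ x + δ) * |u x - û x| + h * Aop δ (fun z => |vv m u z - vv m û z|) x := by
  have hm0 : 0 < m := by linarith [p.m1]
  have hσ : 0 < ρ x + δ := by linarith [w.pos x, p.d0]
  have hc0 := cc_nn w p x
  have h1 : |(u x - cc ρ δ h x * spow m (u x)) - (û x - cc ρ δ h x * spow m (û x))| = |u x - û x| - cc ρ δ h x * |vv m u x - vv m û x| := by
    unfold vv
    rcases le_total (û x) (u x) with hle | hle
    · have := g_mono w p x (hu.2 x) (hu'.2 x) hle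
      have h3 := (spow_mono hm0).monotone hle
      rw [abs_of_nonneg (by linarith), abs_of_nonneg (sub_nonneg.2 hle), abs_of_nonneg (sub_nonneg.2 h3)]
      ring
    · have := g_mono w p x (hu'.2 x) (hu.2 x) hle
      have h3 := (spow_mono hm0).monotone hle
      rw [abs_of_nonpos (by linarith), abs_of_nonpos (sub_nonpos.2 hle), abs_of_nonpos (sub_nonpos.2 h3)]
      ring
  have h2 : |Pop δ (vv m u) x - Pop δ (vv m û) x| ≤ Pop δ (fun z => |vv m u z - vv m û z|) x := by
    rw [← Pop_sub (hu.vv p.m1.le) (hu'.vv p.m1.le)]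
    exact Pop_abs_le x
  have h3 : |step ρ m δ h u x - step ρ m δ h û x| ≤ |u x - û x| + cc ρ δ h x * (Pop δ (fun z => |vv m u z - vv m û z|) x - |vv m u x - vv m û x|) := by
    rw [step_eq, step_eq]
    calc _ = |((u x - cc ρ δ h x * spow m (u x)) - (û x - cc ρ δ h x * spow m (û x))) + cc ρ δ h x * (Pop δ (vv m u) x - Pop δ (vv m û) x)| := by
            congr 1; ring
      _ ≤ _ := abs_add_le _ _
      _ ≤ (|u x - û x| - cc ρ δ h x * |vv m u x - vv m û x|) + cc ρ δ h x * Pop δ (fun z => |vv m u z - vv m û z|) x := by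
            rw [h1, abs_mul, abs_of_nonneg hc0]
            gcongr
      _ = _ := by ring
  have h4 := mul_le_mul_of_nonneg_left h3 hσ.le
  refine h4.trans (le_of_eq ?_)
  have hd := p.d0
  unfold Aop cc
  field_simp

/-! ### integrability class -/

def Good (M : ℝ) (u : Euc N → ℝ) : Prop := BM M u ∧ Integrable (fun x => (1 + ‖x‖ ^ 2) * u x)

lemma one_le_wt (x : Euc N) : 1 ≤ 1 + ‖x‖ ^ 2 := by nlinarith [sq_nonneg ‖x‖]

lemma int_of_wt {f : Euc N → ℝ} (hm : Measurable f) (hf : Integrable (fun z => (1 + ‖z‖ ^ 2) * f z)) : Integrable f := by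
  refine hf.mono hm.aestronglyMeasurable (ae_of_all _ fun z => ?_)
  rw [norm_mul]
  refine le_mul_of_one_le_left (norm_nonneg _) ?_
  rw [Real.norm_of_nonneg (by positivity)]
  exact one_le_wt z

lemma Good.int {u : Euc N → ℝ} (hu : Good M u) : Integrable u := int_of_wt hu.1.1 hu.2

lemma Good.vv_wt (hm : 1 ≤ m) {u : Euc N → ℝ} (hu : Good M u) : Integrable (fun x => (1 + ‖x‖ ^ 2) * vv m u x) := by
  refine (hu.2.norm.const_mul (M ^ (m - 1))).mono' ?_ (ae_of_all _ fun x => ?_)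
  · exact ((by fun_prop : Measurable fun x : Euc N => 1 + ‖x‖ ^ 2).mul (hu.1.vv hm).1).aestronglyMeasurable
  · rw [norm_mul, norm_mul]
    have := spow_bd hm (hu.1.2 x)
    calc _ ≤ ‖1 + ‖x‖ ^ 2‖ * (M ^ (m - 1) * |u x|) := mul_le_mul_of_nonneg_left this (norm_nonneg _)
      _ = _ := by rw [Real.norm_eq_abs (u x)]; ring

lemma Good.vv_int (hm : 1 ≤ m) {u : Euc N → ℝ} (hu : Good M u) : Integrable (vv m u) := int_of_wt (hu.1.vv hm).1 (hu.vv_wt hm)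

lemma Good.step (w : Wt γ k K ρ) (p : Par m δ h M) {u : Euc N → ℝ} (hu : Good M u) : Good M (step ρ m δ h u) := by
  refine ⟨hu.1.step w p, ?_⟩
  have hP := (Pop_moment p.d0 (hu.1.vv p.m1.le).1 (hu.vv_wt p.m1.le)).1
  have hA : Integrable (fun x => (h / (ρ x + δ) / δ) * ((1 + ‖x‖ ^ 2) * Pop δ (vv m u) x - (1 + ‖x‖ ^ 2) * vv m u x)) := by
    refine (hP.sub (hu.vv_wt p.m1.le)).bdd_mul (c := h / δ / δ) ?_ (ae_of_all _ fun x => ?_)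
    · exact ((measurable_const.div (w.meas.add_const δ)).div_const δ).aestronglyMeasurable
    · have h1 := w.pos x; have h2 := p.d0; have h3 := p.h0
      rw [Real.norm_of_nonneg (by positivity)]
      gcongr
      linarith
  refine (hu.2.add hA).congr (ae_of_all _ fun x => ?_)
  have h1 := w.pos x; have h2 := p.d0
  simp only [Pi.add_apply, _root_.step, Aop]
  field_simp

end

end

noncomputable section

variable {N : ℕ}

/-! ### power weights -/

def sph (N : ℕ) (q : ℝ) : ℝ := N * ((volume : Measure (Euc N)).real (ball 0 1)) / (N - q)

lemma sph_nn {q : ℝ} (hq : q < N) : 0 ≤ sph N q := by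
  unfold sph
  have : (0:ℝ) < N - q := by linarith
  positivity

lemma ball_rpow (hN : 3 ≤ N) {q R : ℝ} (hq : q < N) (hR : 0 < R) :
    IntegrableOn (fun x : Euc N => ‖x‖ ^ (-q)) (ball 0 R) ∧ ∫ x in ball (0 : Euc N) R, ‖x‖ ^ (-q) = sph N q * R ^ (N - q) := by
  have hne : Nontrivial (Euc N) := by
    have : Nonempty (Fin N) := ⟨⟨0, by omega⟩⟩
    infer_instance
  set f : ℝ → ℝ := (Iio R).indicator (fun r => r ^ (-q)) with hf
  have e1 : (fun x : Euc N => f ‖x‖) = (ball (0 : Euc N) R).indicator (fun x => ‖x‖ ^ (-q)) := by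
    ext x
    by_cases hx : ‖x‖ < R
    · rw [hf, indicator_of_mem (by simpa using hx), indicator_of_mem (by simpa using hx)]
    · rw [hf, indicator_of_notMem (by simpa using hx), indicator_of_notMem (by simpa using hx)]
  have e2 : EqOn (fun y : ℝ => y ^ (Module.finrank ℝ (Euc N) - 1) • f y) ((Ioc 0 R).indicator fun y => y ^ ((N:ℝ) - 1 - q)) (Ioi 0 \ {R}) := by
    intro y hy
    have hy0 : 0 < y := hy.1
    have hyR : y ≠ R := hy.2
    simp only [finrank_euclideanSpace, Fintype.card_fin, smul_eq_mul]
    by_cases h : y < R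
    · rw [hf, indicator_of_mem (by simpa using h), indicator_of_mem (show y ∈ Ioc 0 R from ⟨hy0, h.le⟩), ← Real.rpow_natCast,
        ← Real.rpow_add hy0, Nat.cast_sub (by omega)]
      congr 1; push_cast; ring
    · have h' : R < y := lt_of_le_of_ne (not_lt.1 h) (Ne.symm hyR)
      rw [hf, indicator_of_notMem (by simpa using h), indicator_of_notMem (by simp [h']), mul_zero]
  have e3 : (fun y : ℝ => y ^ (Module.finrank ℝ (Euc N) - 1) • f y) =ᵐ[volume.restrict (Ioi 0)] ((Ioc 0 R).indicator fun y => y ^ ((N:ℝ) - 1 - q)) := by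
    rw [Filter.EventuallyEq, ae_restrict_iff' measurableSet_Ioi]
    have : ∀ᵐ y : ℝ, y ≠ R := by simp [ae_iff]
    filter_upwards [this] with y hy hy0 using e2 ⟨hy0, hy⟩
  have i1 : IntegrableOn (fun y : ℝ => y ^ ((N:ℝ) - 1 - q)) (Ioc 0 R) :=
    (intervalIntegrable_iff_integrableOn_Ioc_of_le hR.le).1 (intervalIntegral.intervalIntegrable_rpow' (by linarith))
  have hsub : Ioc 0 R ∩ Ioi 0 = Ioc 0 R := inter_eq_left.2 fun y hy => hy.1
  constructor
  · rw [← integrable_indicator_iff measurableSet_ball, ← e1, integrable_fun_norm_addHaar]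
    refine IntegrableOn.congr_fun_ae ?_ e3.symm
    rw [IntegrableOn, integrable_indicator_iff measurableSet_Ioc, IntegrableOn, Measure.restrict_restrict measurableSet_Ioc, hsub]
    exact i1
  · rw [← integral_indicator measurableSet_ball, ← e1, integral_fun_norm_addHaar, integral_congr_ae e3,
      integral_indicator measurableSet_Ioc, Measure.restrict_restrict measurableSet_Ioc, hsub,
      ← intervalIntegral.integral_of_le hR.le, integral_rpow (Or.inl (by linarith))]
    rw [Real.zero_rpow (by linarith)]
    simp only [finrank_euclideanSpace, Fintype.card_fin, nsmul_eq_mul, smul_eq_mul, sph]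
    have e4 : (N:ℝ) - 1 - q + 1 = N - q := by ring
    rw [e4]
    ring

variable {γ k K : ℝ} {ρ : Euc N → ℝ}

lemma Wt.gN (w : Wt γ k K ρ) : γ < N := by
  have h1 := w.g2
  have h2 : (3:ℝ) ≤ N := by exact_mod_cast w.hN
  linarith

lemma ae_ne_zero (hN : 3 ≤ N) : ∀ᵐ x : Euc N, x ≠ 0 := by
  have hne : Nontrivial (Euc N) := by
    have : Nonempty (Fin N) := ⟨⟨0, by omega⟩⟩
    infer_instance
  have : (volume : Measure (Euc N)) {0} = 0 := measure_singleton 0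
  rw [ae_iff]; simpa using this

lemma Wt.ball (w : Wt γ k K ρ) {R : ℝ} (hR : 0 < R) :
    IntegrableOn ρ (ball 0 R) ∧ ∫ x in ball (0 : Euc N) R, ρ x ≤ K * sph N γ * R ^ (N - γ) := by
  obtain ⟨h1, h2⟩ := ball_rpow w.hN w.gN hR
  have hae : ∀ᵐ x ∂(volume.restrict (Metric.ball (0 : Euc N) R)), ρ x ≤ K * ‖x‖ ^ (-γ) :=
    ae_restrict_of_ae ((ae_ne_zero w.hN).mono fun x hx => w.up x hx)
  have h3 : IntegrableOn ρ (Metric.ball 0 R) := (h1.const_mul K).mono' w.meas.aestronglyMeasurable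
    (hae.mono fun x hx => by rwa [Real.norm_of_nonneg (w.pos x).le])
  refine ⟨h3, (integral_mono_ae h3 (h1.const_mul K) hae).trans (le_of_eq ?_)⟩
  rw [integral_const_mul, h2]; ring

/-- outside a ball the weight is bounded -/
lemma Wt.off (w : Wt γ k K ρ) {r : ℝ} (hr : 0 < r) {x : Euc N} (hx : x ∉ Metric.ball 0 r) : ρ x ≤ K * r ^ (-γ) := by
  have hx' : r ≤ ‖x‖ := by simpa using hx
  refine (w.up x (fun h => by rw [h, norm_zero] at hx'; linarith)).trans ?_
  exact mul_le_mul_of_nonneg_left (Real.rpow_le_rpow_of_nonpos hr hx' (by linarith [w.g0])) w.K0.le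

lemma Wt.mul_int (w : Wt γ k K ρ) {f : Euc N → ℝ} {R C : ℝ} (hR : 0 < R) (hf : Integrable f) (hb : ∀ x ∈ Metric.ball 0 R, |f x| ≤ C) :
    Integrable (fun x => ρ x * f x) := by
  have hC : 0 ≤ C := (abs_nonneg _).trans (hb 0 (by simpa using hR))
  have i1 : Integrable ((Metric.ball (0 : Euc N) R).indicator fun x => ρ x * C) := by
    rw [integrable_indicator_iff measurableSet_ball]
    exact (w.ball hR).1.mul_const C
  refine (i1.add (hf.norm.const_mul (K * R ^ (-γ)))).mono' (w.meas.aestronglyMeasurable.mul hf.aestronglyMeasurable) (ae_of_all _ fun x => ?_)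
  have h0 := (w.pos x).le
  have hc : 0 ≤ K * R ^ (-γ) := mul_nonneg w.K0.le (Real.rpow_nonneg hR.le _)
  rw [norm_mul, Real.norm_of_nonneg h0]
  simp only [Pi.add_apply]
  by_cases hx : x ∈ Metric.ball 0 R
  · rw [indicator_of_mem hx]
    have := mul_le_mul_of_nonneg_left (hb x hx) h0
    have h2 := mul_nonneg hc (norm_nonneg (f x))
    rw [Real.norm_eq_abs] at *
    linarith
  · rw [indicator_of_notMem hx, zero_add]
    exact mul_le_mul_of_nonneg_right (w.off hR hx) (norm_nonneg _)

lemma Wt.bm_int (w : Wt γ k K ρ) {f : Euc N → ℝ} {C : ℝ} (hf : Integrable f) (hb : BM C f) :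
    Integrable (fun x => ρ x * f x) := w.mul_int one_pos hf fun x _ => hb.2 x

lemma Wt.good_int (w : Wt γ k K ρ) {f : Euc N → ℝ} {C : ℝ} (hf : Good C f) :
    Integrable (fun x => ρ x * ((1 + ‖x‖ ^ 2) * f x)) := by
  refine w.mul_int (R := 1) (C := 2 * C) one_pos hf.2 fun x hx => ?_
  have hx' : ‖x‖ < 1 := by simpa using hx
  rw [abs_mul, abs_of_nonneg (by positivity)]
  refine mul_le_mul (by nlinarith [norm_nonneg x]) (hf.1.2 x) (abs_nonneg _) (by norm_num)

/-- `1 ≤ C (1+|x|²) ρ` -/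
lemma Wt.one_le (w : Wt γ k K ρ) (x : Euc N) : 1 ≤ 2 / k * ((1 + ‖x‖ ^ 2) * ρ x) := by
  have h1 := w.lo x
  have h2 : (1 + ‖x‖) ^ γ ≤ 2 * (1 + ‖x‖ ^ 2) := by
    calc (1 + ‖x‖) ^ γ ≤ (1 + ‖x‖) ^ (2:ℝ) := Real.rpow_le_rpow_of_exponent_le (by linarith [norm_nonneg x]) w.g2.le
      _ = (1 + ‖x‖) ^ 2 := by norm_cast
      _ ≤ _ := by nlinarith [sq_nonneg (‖x‖ - 1)]
  have hp : 0 < (1 + ‖x‖) ^ γ := Real.rpow_pos_of_pos (by positivity) _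
  rw [Real.rpow_neg (by positivity)] at h1
  have hk := w.k0
  have h3 : k ≤ ρ x * (1 + ‖x‖) ^ γ := by
    rw [← div_eq_mul_inv, div_le_iff₀ hp] at h1; exact h1
  have h4 : k ≤ ρ x * (2 * (1 + ‖x‖ ^ 2)) := h3.trans (mul_le_mul_of_nonneg_left h2 (w.pos x).le)
  rw [div_mul_eq_mul_div, le_div_iff₀ hk]
  linarith

end

noncomputable section

variable {N : ℕ} {γ k K m δ h M : ℝ} {ρ : Euc N → ℝ}

def sch (ρ : Euc N → ℝ) (m δ h : ℝ) (u₀ : Euc N → ℝ) : ℕ → Euc N → ℝ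
  | 0 => u₀
  | n + 1 => step ρ m δ h (sch ρ m δ h u₀ n)

lemma sch_good (w : Wt γ k K ρ) (p : Par m δ h M) {u₀ : Euc N → ℝ} (hu : Good M u₀) (n : ℕ) : Good M (sch ρ m δ h u₀ n) := by
  induction n with
  | zero => exact hu
  | succ n ih => exact ih.step w p

lemma sch_le (w : Wt γ k K ρ) (p : Par m δ h M) {u₀ û₀ : Euc N → ℝ} (hu : Good M u₀) (hu' : Good M û₀)
    (hle : ∀ x, u₀ x ≤ û₀ x) (n : ℕ) (x : Euc N) : sch ρ m δ h u₀ n x ≤ sch ρ m δ h û₀ n x := by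
  induction n generalizing x with
  | zero => exact hle x
  | succ n ih => exact step_mono w p (sch_good w p hu n).1 (sch_good w p hu' n).1 ih x

lemma Good.neg {u : Euc N → ℝ} (hu : Good M u) : Good M (fun x => - u x) :=
  ⟨hu.1.neg, by simp only [mul_neg]; exact hu.2.neg⟩

lemma sch_neg (u₀ : Euc N → ℝ) (n : ℕ) : sch ρ m δ h (fun x => - u₀ x) n = fun x => - sch ρ m δ h u₀ n x := by
  induction n with
  | zero => rfl
  | succ n ih =>
    ext x
    show step ρ m δ h (sch ρ m δ h (fun x => - u₀ x) n) x = _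
    rw [ih, step_neg]; rfl

lemma sch_zero (n : ℕ) : sch ρ m δ h (fun _ => 0) n = fun _ => 0 := by
  induction n with
  | zero => rfl
  | succ n ih =>
    ext x
    show step ρ m δ h (sch ρ m δ h (fun _ => 0) n) x = _
    rw [ih, step_const]

lemma sch_abs_le (w : Wt γ k K ρ) (p : Par m δ h M) {u₀ û₀ : Euc N → ℝ} (hu : Good M u₀) (hu' : Good M û₀)
    (hle : ∀ x, |u₀ x| ≤ û₀ x) (n : ℕ) (x : Euc N) : |sch ρ m δ h u₀ n x| ≤ sch ρ m δ h û₀ n x := by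
  refine abs_le.2 ⟨?_, sch_le w p hu hu' (fun x => (le_abs_self _).trans (hle x)) n x⟩
  have := sch_le w p hu'.neg hu (fun x => by linarith [neg_abs_le (u₀ x), hle x]) n x
  rwa [sch_neg] at this

lemma good_zero (hM : 0 ≤ M) : Good M (fun _ : Euc N => (0:ℝ)) := ⟨⟨measurable_const, fun x => by simpa using hM⟩, by simp⟩

lemma sch_nn (w : Wt γ k K ρ) (p : Par m δ h M) {u₀ : Euc N → ℝ} (hu : Good M u₀)
    (hle : ∀ x, 0 ≤ u₀ x) (n : ℕ) (x : Euc N) : 0 ≤ sch ρ m δ h u₀ n x := by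
  have := sch_le w p (good_zero p.M0) hu hle n x
  rwa [sch_zero] at this

lemma Good.sub {M' : ℝ} {u v : Euc N → ℝ} (hu : Good M u) (hv : Good M' v) : Good (M + M') (fun x => u x - v x) :=
  ⟨hu.1.sub hv.1, by simp only [mul_sub]; exact hu.2.sub hv.2⟩

lemma Good.abs {u : Euc N → ℝ} (hu : Good M u) : Good M (fun x => |u x|) := by
  refine ⟨hu.1.abs, hu.2.norm.congr (ae_of_all _ fun x => ?_)⟩
  simp only [norm_mul, Real.norm_eq_abs]
  rw [abs_of_nonneg (by positivity : (0:ℝ) ≤ 1 + ‖x‖ ^ 2)]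

lemma Good.vv (hm : 1 ≤ m) {u : Euc N → ℝ} (hu : Good M u) : Good (M ^ m) (vv m u) := ⟨hu.1.vv hm, hu.vv_wt hm⟩

/-- weighted integrability of bounded multiples -/
lemma Wt.phi_int (w : Wt γ k K ρ) {B C : ℝ} {φ f : Euc N → ℝ} (hφ : BM B φ) (hf : Integrable f) (hb : BM C f) (d : ℝ) :
    Integrable (fun x => φ x * ((ρ x + d) * f x)) := by
  refine Integrable.bdd_mul (c := B) ?_ hφ.1.aestronglyMeasurable (ae_of_all _ hφ.2)
  simp only [add_mul]
  exact (w.bm_int hf hb).add (hf.const_mul d)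

lemma kato_step (w : Wt γ k K ρ) (p : Par m δ h M) {u û φ : Euc N → ℝ} (hu : Good M u) (hu' : Good M û) {B : ℝ} (hφ : BM B φ)
    (h0 : ∀ x, 0 ≤ φ x) :
    ∫ x, φ x * ((ρ x + δ) * |step ρ m δ h u x - step ρ m δ h û x|) ≤
      (∫ x, φ x * ((ρ x + δ) * |u x - û x|)) + h * ∫ x, |vv m u x - vv m û x| * Aop δ φ x := by
  have hz := ((hu.vv p.m1.le).sub (hu'.vv p.m1.le)).abs
  have hA : Integrable (fun x => φ x * (h * Aop δ (fun z => |vv m u z - vv m û z|) x)) :=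
    ((Aop_integrable hz.int).const_mul h).bdd_mul (c := B) hφ.1.aestronglyMeasurable (ae_of_all _ hφ.2)
  have i1 := w.phi_int hφ (hu.sub hu').abs.int (hu.sub hu').abs.1 δ
  have i2 := w.phi_int hφ ((hu.step w p).sub (hu'.step w p)).abs.int ((hu.step w p).sub (hu'.step w p)).abs.1 δ
  have e : h * ∫ x, |vv m u x - vv m û x| * Aop δ φ x = ∫ x, φ x * (h * Aop δ (fun z => |vv m u z - vv m û z|) x) := by
    rw [← Aop_symm p.d0.le hz.int hφ, ← integral_const_mul]
    congr 1; ext x; ring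
  rw [e, ← integral_add i1 hA]
  refine integral_mono i2 (i1.add hA) fun x => ?_
  have := mul_le_mul_of_nonneg_left (step_kato w p hu.1 hu'.1 x) (h0 x)
  simp only [mul_add] at this ⊢
  linarith

lemma Aop_one (x : Euc N) (c : ℝ) : Aop δ (fun _ => c) x = 0 := by unfold Aop; rw [Pop_const]; simp

lemma contr_step (w : Wt γ k K ρ) (p : Par m δ h M) {u û : Euc N → ℝ} (hu : Good M u) (hu' : Good M û) :
    ∫ x, (ρ x + δ) * |step ρ m δ h u x - step ρ m δ h û x| ≤ ∫ x, (ρ x + δ) * |u x - û x| := by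
  have := kato_step w p hu hu' (φ := fun _ => 1) (B := 1) ⟨measurable_const, fun x => by simp⟩ (fun x => by simp)
  simpa [Aop_one] using this

/-- integrated weak formulation, one step -/
lemma weak_step (w : Wt γ k K ρ) (p : Par m δ h M) {u φ : Euc N → ℝ} (hu : Good M u) {B : ℝ} (hφ : BM B φ) :
    ∫ x, φ x * ((ρ x + δ) * step ρ m δ h u x) = (∫ x, φ x * ((ρ x + δ) * u x)) + h * ∫ x, vv m u x * Aop δ φ x := by
  have hv := (hu.vv p.m1.le)
  have hA : Integrable (fun x => φ x * (h * Aop δ (vv m u) x)) :=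
    ((Aop_integrable hv.int).const_mul h).bdd_mul (c := B) hφ.1.aestronglyMeasurable (ae_of_all _ hφ.2)
  have i1 := w.phi_int hφ hu.int hu.1 δ
  have e : h * ∫ x, vv m u x * Aop δ φ x = ∫ x, φ x * (h * Aop δ (vv m u) x) := by
    rw [← Aop_symm p.d0.le hv.int hφ, ← integral_const_mul]
    congr 1; ext x; ring
  rw [e, ← integral_add i1 hA]
  congr 1; ext x
  rw [step_sg w p, mul_add]

/-- moment estimate, one step -/
lemma moment_step (w : Wt γ k K ρ) (p : Par m δ h M) {u : Euc N → ℝ} (hu : Good M u) :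
    ∫ x, (1 + ‖x‖ ^ 2) * ((ρ x + δ) * |step ρ m δ h u x|) ≤
      (1 + h * (M2 N * M ^ (m - 1) * (2 / k))) * ∫ x, (1 + ‖x‖ ^ 2) * ((ρ x + δ) * |u x|) := by
  have gi : ∀ {f : Euc N → ℝ}, Good M f → Integrable (fun x => (1 + ‖x‖ ^ 2) * ((ρ x + δ) * |f x|)) := fun {f} hf => by
    refine ((w.good_int hf.abs).add (hf.abs.2.const_mul δ)).congr (ae_of_all _ fun x => ?_)
    simp only [Pi.add_apply]; ring
  have hz := (hu.vv p.m1.le).abs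
  obtain ⟨p1, p2⟩ := Pop_moment p.d0 hz.1.1 hz.2
  have hd := p.d0
  have hk : ∀ x, (ρ x + δ) * |step ρ m δ h u x| ≤ (ρ x + δ) * |u x| + h * Aop δ (fun z => |vv m u z|) x := fun x => by
    have := step_kato w p hu.1 (good_zero (N := N) p.M0).1 x
    rw [step_const] at this
    simpa [vv, spow_zero] using this
  have hAi : Integrable (fun x => (1 + ‖x‖ ^ 2) * (h * Aop δ (fun z => |vv m u z|) x)) := by
    refine ((p1.sub hz.2).const_mul (h / δ)).congr (ae_of_all _ fun x => ?_)
    simp only [Pi.sub_apply, Aop]; field_simp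
  have hAe : ∫ x, (1 + ‖x‖ ^ 2) * (h * Aop δ (fun z => |vv m u z|) x) = h * (M2 N * ∫ x, |vv m u x|) := by
    have e : ∀ x : Euc N, (1 + ‖x‖ ^ 2) * (h * Aop δ (fun z => |vv m u z|) x)
        = (h / δ) * ((1 + ‖x‖ ^ 2) * Pop δ (fun z => |vv m u z|) x - (1 + ‖x‖ ^ 2) * |vv m u x|) := fun x => by
      simp only [Aop]; field_simp
    simp_rw [e]
    rw [integral_const_mul, integral_sub p1 hz.2, p2]
    field_simp; ring
  have h1 : ∫ x, (1 + ‖x‖ ^ 2) * ((ρ x + δ) * |step ρ m δ h u x|) ≤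
      (∫ x, (1 + ‖x‖ ^ 2) * ((ρ x + δ) * |u x|)) + h * (M2 N * ∫ x, |vv m u x|) := by
    rw [← hAe, ← integral_add (gi hu) hAi]
    refine integral_mono (gi (hu.step w p)) ((gi hu).add hAi) fun x => ?_
    have := mul_le_mul_of_nonneg_left (hk x) (by positivity : 0 ≤ 1 + ‖x‖ ^ 2)
    simp only [mul_add] at this ⊢
    linarith
  have h2 : ∫ x, |vv m u x| ≤ M ^ (m - 1) * (2 / k) * ∫ x, (1 + ‖x‖ ^ 2) * ((ρ x + δ) * |u x|) := by
    rw [← integral_const_mul]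
    refine integral_mono hz.int ((gi hu).const_mul _) fun x => ?_
    have a1 := spow_bd p.m1.le (hu.1.2 x)
    have a2 := w.one_le x
    have a3 : 0 < 2 / k := by have := w.k0; positivity
    have a4 := Real.rpow_nonneg p.M0 (m - 1)
    have a5 : 1 ≤ 2 / k * ((1 + ‖x‖ ^ 2) * (ρ x + δ)) := a2.trans (by gcongr; linarith)
    calc |vv m u x| ≤ M ^ (m - 1) * |u x| * 1 := by rw [mul_one]; exact a1
      _ ≤ M ^ (m - 1) * |u x| * (2 / k * ((1 + ‖x‖ ^ 2) * (ρ x + δ))) := mul_le_mul_of_nonneg_left a5 (by positivity)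
      _ = _ := by ring
  have h3 : 0 ≤ M2 N := M2_nonneg
  have h4 := p.h0
  have h5 := mul_le_mul_of_nonneg_left (mul_le_mul_of_nonneg_left h2 h3) h4.le
  refine h1.trans ?_
  linarith

def mom (ρ : Euc N → ℝ) (u : Euc N → ℝ) : ℝ := ∫ x, (1 + ‖x‖ ^ 2) * ((ρ x + 1) * |u x|)

lemma Good.mom_int (w : Wt γ k K ρ) (d : ℝ) {f : Euc N → ℝ} (hf : Good M f) : Integrable (fun x => (1 + ‖x‖ ^ 2) * ((ρ x + d) * |f x|)) := by
  refine ((w.good_int hf.abs).add (hf.abs.2.const_mul d)).congr (ae_of_all _ fun x => ?_)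
  simp only [Pi.add_apply]; ring

lemma sch_moment (w : Wt γ k K ρ) (p : Par m δ h M) {u₀ : Euc N → ℝ} (hu : Good M u₀) (n : ℕ) :
    ∫ x, (1 + ‖x‖ ^ 2) * ((ρ x + δ) * |sch ρ m δ h u₀ n x|) ≤ Real.exp (M2 N * M ^ (m - 1) * (2 / k) * (n * h)) * mom ρ u₀ := by
  set C := M2 N * M ^ (m - 1) * (2 / k) with hC
  have hC0 : 0 ≤ C := by
    have h1 := w.k0; have h2 := Real.rpow_nonneg p.M0 (m - 1); have h3 : 0 ≤ M2 N := M2_nonneg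
    positivity
  induction n with
  | zero =>
    simp only [Nat.cast_zero, zero_mul, mul_zero, Real.exp_zero, one_mul]
    refine integral_mono (hu.mom_int w _) (hu.mom_int w _) fun x => ?_
    have := p.d1
    simp only [sch]
    gcongr
  | succ n ih =>
    refine (moment_step w p (sch_good w p hu n)).trans ?_
    have h1 : 1 + h * C ≤ Real.exp (C * h) := by have := Real.add_one_le_exp (C * h); linarith
    have e : Real.exp (C * ((n + 1 : ℕ) * h)) = Real.exp (C * h) * Real.exp (C * (n * h)) := by
      rw [← Real.exp_add]; congr 1; push_cast; ring
    rw [e, mul_assoc (Real.exp (C * h))]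
    refine mul_le_mul h1 ih ?_ (Real.exp_pos _).le
    exact integral_nonneg fun x => mul_nonneg (by positivity) (mul_nonneg (by linarith [w.pos x, p.d0]) (abs_nonneg _))

/-- uniform `L¹` bound -/
lemma sch_l1 (w : Wt γ k K ρ) (p : Par m δ h M) {u₀ : Euc N → ℝ} (hu : Good M u₀) (n : ℕ) :
    ∫ x, |sch ρ m δ h u₀ n x| ≤ 2 / k * (Real.exp (M2 N * M ^ (m - 1) * (2 / k) * (n * h)) * mom ρ u₀) := by
  have hk := w.k0
  refine le_trans ?_ (mul_le_mul_of_nonneg_left (sch_moment w p hu n) (by positivity))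
  rw [← integral_const_mul]
  have hg := sch_good w p hu n
  refine integral_mono hg.abs.int ((hg.mom_int w _).const_mul _) fun x => ?_
  have a2 := w.one_le x
  have a5 : 1 ≤ 2 / k * ((1 + ‖x‖ ^ 2) * (ρ x + δ)) := a2.trans (by gcongr; linarith [p.d0])
  calc |sch ρ m δ h u₀ n x| ≤ (2 / k * ((1 + ‖x‖ ^ 2) * (ρ x + δ))) * |sch ρ m δ h u₀ n x| :=
        le_mul_of_one_le_left (abs_nonneg _) a5
    _ = _ := by ring

end

noncomputable section

variable {N : ℕ} {γ k K m δ h M : ℝ} {ρ : Euc N → ℝ}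

def b0 (m : ℝ) (U : Euc N → ℝ) (x : Euc N) : ℝ := spow (1 / m) (U x)

lemma vv_b0 (hm : 0 < m) (U : Euc N → ℝ) : vv m (b0 m U) = U := by
  ext x; exact spow_inv hm _

lemma b0_bd (hm : 1 < m) (hM : 0 ≤ M) {U : Euc N → ℝ} (hU : ∀ x, |U x| ≤ M ^ m) (x : Euc N) : |b0 m U x| ≤ M := by
  have hm0 : 0 < m := by linarith
  unfold b0
  rw [spow_abs (by positivity)]
  refine (Real.rpow_le_rpow (abs_nonneg _) (hU x) (by positivity)).trans (le_of_eq ?_)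
  rw [← Real.rpow_mul hM, mul_one_div_cancel hm0.ne', Real.rpow_one]

lemma b0_good (hm : 1 < m) (hM : 0 ≤ M) {U : Euc N → ℝ} (hT : Test U) (hU : ∀ x, |U x| ≤ M ^ m) : Good M (b0 m U) := by
  have hm0 : 0 < m := by linarith
  have hmeas : Measurable (b0 m U) := (spow_meas _).comp hT.1.continuous.measurable
  refine ⟨⟨hmeas, b0_bd hm hM hU⟩, ?_⟩
  obtain ⟨R, hR⟩ := hT.2.isCompact.isBounded.subset_ball 0
  have hz : ∀ x, x ∉ ball (0 : Euc N) R → b0 m U x = 0 := fun x hx => by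
    have : U x = 0 := image_eq_zero_of_notMem_tsupport fun h => hx (hR h)
    simp [b0, this, spow_zero]
  have e : (fun x => (1 + ‖x‖ ^ 2) * b0 m U x) = (ball (0 : Euc N) R).indicator (fun x => (1 + ‖x‖ ^ 2) * b0 m U x) := by
    ext x
    by_cases hx : x ∈ ball (0 : Euc N) R
    · rw [indicator_of_mem hx]
    · rw [indicator_of_notMem hx, hz x hx, mul_zero]
  rw [e, integrable_indicator_iff measurableSet_ball]
  refine Measure.integrableOn_of_bounded (M := (1 + R ^ 2) * M) measure_ball_lt_top.ne
    ((by fun_prop : Measurable fun x : Euc N => 1 + ‖x‖ ^ 2).mul hmeas).aestronglyMeasurable ?_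
  refine (ae_restrict_iff' measurableSet_ball).2 (ae_of_all _ fun x hx => ?_)
  have hx' : ‖x‖ < R := by simpa using hx
  rw [norm_mul, Real.norm_of_nonneg (by positivity : (0:ℝ) ≤ 1 + ‖x‖ ^ 2)]
  gcongr
  exact b0_bd hm hM hU x

def Lc (U : Euc N → ℝ) : ℝ := ∫ x, |lap U x|

lemma Lc_nn (U : Euc N → ℝ) : 0 ≤ Lc U := integral_nonneg fun x => abs_nonneg _

lemma sch_lip1 (w : Wt γ k K ρ) (p : Par m δ h M) {U : Euc N → ℝ} (hT : Test U) (hU : ∀ x, |U x| ≤ M ^ m) (n : ℕ) :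
    ∫ x, (ρ x + δ) * |sch ρ m δ h (b0 m U) (n + 1) x - sch ρ m δ h (b0 m U) n x| ≤ h * Lc U := by
  have hm0 : 0 < m := by linarith [p.m1]
  have hg := b0_good p.m1 p.M0 hT hU
  induction n with
  | zero =>
    have e : ∀ x, (ρ x + δ) * |sch ρ m δ h (b0 m U) (0 + 1) x - sch ρ m δ h (b0 m U) 0 x| = h * |Aop δ U x| := fun x => by
      have h1 : 0 < ρ x + δ := by linarith [w.pos x, p.d0]
      have h2 := step_sg w p x (b0 m U)
      rw [vv_b0 hm0] at h2
      simp only [sch]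
      rw [show ∀ y : ℝ, (ρ x + δ) * |y| = |(ρ x + δ) * y| from fun y => by rw [abs_mul, abs_of_pos h1], mul_sub, h2, add_sub_cancel_left, abs_mul, abs_of_pos p.h0]
    simp_rw [e]
    rw [integral_const_mul]
    exact mul_le_mul_of_nonneg_left (Aop_test_l1 hT p.d0) p.h0.le
  | succ n ih => exact (contr_step w p (sch_good w p hg (n + 1)) (sch_good w p hg n)).trans ih

lemma sch_A (w : Wt γ k K ρ) (p : Par m δ h M) {U : Euc N → ℝ} (hT : Test U) (hU : ∀ x, |U x| ≤ M ^ m) (n : ℕ) :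
    ∫ x, |Aop δ (vv m (sch ρ m δ h (b0 m U) n)) x| ≤ Lc U := by
  have h1 := sch_lip1 w p hT hU n
  have e : ∀ x, (ρ x + δ) * |sch ρ m δ h (b0 m U) (n + 1) x - sch ρ m δ h (b0 m U) n x| = h * |Aop δ (vv m (sch ρ m δ h (b0 m U) n)) x| := fun x => by
    have h1 : 0 < ρ x + δ := by linarith [w.pos x, p.d0]
    have h2 := step_sg w p x (sch ρ m δ h (b0 m U) n)
    simp only [sch]
    rw [show ∀ y : ℝ, (ρ x + δ) * |y| = |(ρ x + δ) * y| from fun y => by rw [abs_mul, abs_of_pos h1], mul_sub, h2, add_sub_cancel_left, abs_mul, abs_of_pos p.h0]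
  simp_rw [e] at h1
  rw [integral_const_mul] at h1
  exact le_of_mul_le_mul_left h1 p.h0

/-- distance with weight `ρ + d` -/
def dd (ρ : Euc N → ℝ) (d : ℝ) (u v : Euc N → ℝ) : ℝ := ∫ x, (ρ x + d) * |u x - v x|

lemma Wt.dd_int (w : Wt γ k K ρ) (d : ℝ) {M' : ℝ} {u v : Euc N → ℝ} (hu : Good M u) (hv : Good M' v) :
    Integrable (fun x => (ρ x + d) * |u x - v x|) := by
  have := w.phi_int (φ := fun _ => 1) (B := 1) ⟨measurable_const, fun x => by simp⟩ (hu.sub hv).abs.int (hu.sub hv).abs.1 d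
  simpa using this

lemma Wt.dd_tri (w : Wt γ k K ρ) {d : ℝ} (hd : 0 ≤ d) {M1 M2 M3 : ℝ} {u v z : Euc N → ℝ} (hu : Good M1 u) (hv : Good M2 v) (hz : Good M3 z) :
    dd ρ d u z ≤ dd ρ d u v + dd ρ d v z := by
  unfold dd
  rw [← integral_add (w.dd_int d hu hv) (w.dd_int d hv hz)]
  refine integral_mono (w.dd_int d hu hz) ((w.dd_int d hu hv).add (w.dd_int d hv hz)) fun x => ?_
  have h1 : 0 ≤ ρ x + d := by linarith [w.pos x]
  have := mul_le_mul_of_nonneg_left (abs_sub_le (u x) (v x) (z x)) h1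
  simp only [mul_add] at this ⊢
  linarith

lemma Wt.dd_nn (w : Wt γ k K ρ) {d : ℝ} (hd : 0 ≤ d) (u v : Euc N → ℝ) : 0 ≤ dd ρ d u v :=
  integral_nonneg fun x => mul_nonneg (by linarith [w.pos x]) (abs_nonneg _)

lemma dd_comm (d : ℝ) (u v : Euc N → ℝ) : dd ρ d u v = dd ρ d v u := by
  unfold dd; simp_rw [abs_sub_comm]

lemma dd_self (d : ℝ) (u : Euc N → ℝ) : dd ρ d u u = 0 := by unfold dd; simp

lemma sch_lip (w : Wt γ k K ρ) (p : Par m δ h M) {U : Euc N → ℝ} (hT : Test U) (hU : ∀ x, |U x| ≤ M ^ m) (n j : ℕ) :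
    dd ρ δ (sch ρ m δ h (b0 m U) (n + j)) (sch ρ m δ h (b0 m U) n) ≤ j * h * Lc U := by
  have hg := b0_good p.m1 p.M0 hT hU
  induction j with
  | zero => simp [dd_self]
  | succ j ih =>
    refine (w.dd_tri p.d0.le (sch_good w p hg _) (sch_good w p hg (n + j)) (sch_good w p hg n)).trans ?_
    have := sch_lip1 w p hT hU (n + j)
    push_cast
    have h2 : dd ρ δ (sch ρ m δ h (b0 m U) (n + (j + 1))) (sch ρ m δ h (b0 m U) (n + j)) ≤ h * Lc U := this
    linarith

/-! ### discrete Aronson–Bénilan -/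

lemma ab_scalar {q b : ℝ} (hq : 0 < q) (hb0 : 0 ≤ b) (hb1 : b ≤ 1) : (1 - b) ^ q ≤ 1 - min q 1 * b := by
  rcases le_total q 1 with h | h
  · rw [min_eq_left h]
    have := rpow_one_add_le_one_add_mul_self (s := -b) (by linarith) hq.le h
    rw [← sub_eq_add_neg] at this
    linarith
  · rw [min_eq_right h, one_mul]
    have := Real.rpow_le_rpow_of_exponent_ge' (by linarith : 0 ≤ 1 - b) (by linarith) zero_le_one h
    rwa [Real.rpow_one] at this

def abC (m : ℝ) : ℝ := 1 / min (m - 1) 1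
def abb (m : ℝ) (n : ℕ) : ℝ := abC m / (n + abC m / (1 / 2 : ℝ) ^ m)

lemma abC_pos (hm : 1 < m) : 0 < abC m := by
  unfold abC
  have : 0 < min (m - 1) 1 := lt_min (by linarith) one_pos
  positivity

lemma sch_ab (w : Wt γ k K ρ) (p : Par m δ h M) {u₀ : Euc N → ℝ} (hu : Good M u₀) (h0 : ∀ x, 0 ≤ u₀ x) (n : ℕ) (x : Euc N) :
    (1 - abb m n) * sch ρ m δ h u₀ n x ≤ sch ρ m δ h u₀ (n + 1) x := by
  have hm1 := p.m1
  have hm0 : 0 < m := by linarith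
  have hC := abC_pos hm1
  have hε0 : (0:ℝ) < (1 / 2 : ℝ) ^ m := Real.rpow_pos_of_pos (by norm_num) _
  set ε : ℝ := (1 / 2 : ℝ) ^ m with hε
  have hε1 : ε ≤ 1 / 2 := half_pow_le p
  have hnn := sch_nn w p hu h0
  have hbd : ∀ n x, sch ρ m δ h u₀ n x ≤ M := fun n x => (le_abs_self _).trans ((sch_good w p hu n).1.2 x)
  have hcu : ∀ n x, cc ρ δ h x * (m * sch ρ m δ h u₀ n x ^ (m - 1)) ≤ ε := fun n x => by
    refine le_trans ?_ (cc_le w p x)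
    have := Real.rpow_le_rpow (hnn n x) (hbd n x) (by linarith : 0 ≤ m - 1)
    have := cc_nn w p x
    gcongr
  induction n generalizing x with
  | zero =>
    have hb : abb m 0 = ε := by unfold abb; field_simp; simp [hε]
    rw [hb]
    show _ ≤ step ρ m δ h (sch ρ m δ h u₀ 0) x
    rw [step_eq]
    have hP : 0 ≤ Pop δ (vv m (sch ρ m δ h u₀ 0)) x := integral_nonneg fun y => by
      show 0 ≤ spow m _
      rw [spow_nn hm0 (hnn 0 _)]; exact Real.rpow_nonneg (hnn 0 _) _
    have h1 := mul_nonneg (cc_nn w p x) hP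
    have h2 : cc ρ δ h x * spow m (sch ρ m δ h u₀ 0 x) ≤ ε * sch ρ m δ h u₀ 0 x := by
      have e : spow m (sch ρ m δ h u₀ 0 x) = sch ρ m δ h u₀ 0 x ^ (m - 1) * sch ρ m δ h u₀ 0 x := by
        unfold spow; rw [abs_of_nonneg (hnn 0 x)]
      have h3 := mul_le_mul_of_nonneg_right (hcu 0 x) (hnn 0 x)
      have h4 : 0 ≤ cc ρ δ h x * (sch ρ m δ h u₀ 0 x ^ (m - 1) * sch ρ m δ h u₀ 0 x) :=
        mul_nonneg (cc_nn w p x) (mul_nonneg (Real.rpow_nonneg (hnn 0 x) _) (hnn 0 x))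
      rw [e]
      refine le_trans ?_ h3
      nlinarith
    linarith
  | succ n ih =>
    set b := abb m n with hb
    set b' := abb m (n + 1) with hb'
    set X : ℝ := n + abC m / ε with hX
    have hXε : abC m / ε ≤ X := by rw [hX]; linarith [(Nat.cast_nonneg n : (0:ℝ) ≤ n)]
    have hX0 : 0 < X := lt_of_lt_of_le (by positivity) hXε
    have hbX : b = abC m / X := rfl
    have hb'X : b' = abC m / (X + 1) := by rw [hb', abb, hX]; push_cast; congr 1; ring
    have hb0 : 0 < b := by rw [hbX]; positivity
    have hb'0 : 0 < b' := by rw [hb'X]; positivity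
    have hbε : b ≤ ε := by
      rw [hbX, div_le_iff₀ hX0]
      rw [div_le_iff₀ hε0] at hXε; linarith
    have hl0 : 0 < 1 - b := by linarith
    have hlε : ε ≤ (1 - b) ^ m := by
      rw [hε]; exact Real.rpow_le_rpow (by norm_num) (by linarith) hm0.le
    have hbb : (1 - b) ^ (m - 1) * b ≤ b' := by
      have h1 := ab_scalar (by linarith : 0 < m - 1) hb0.le (by linarith)
      have h2 : (1 - min (m - 1) 1 * b) * b ≤ b' := by
        have hμ : 0 < min (m - 1) 1 := lt_min (by linarith) one_pos
        have e : min (m - 1) 1 * b = 1 / X := by rw [hbX, abC]; field_simp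
        rw [e, hbX, hb'X]
        rw [show (1 - 1 / X) * (abC m / X) = abC m * ((X - 1) / X ^ 2) by field_simp, div_eq_mul_inv (abC m)]
        refine mul_le_mul_of_nonneg_left ?_ hC.le
        rw [inv_eq_one_div, div_le_div_iff₀ (by positivity) (by positivity)]
        nlinarith
      exact (mul_le_mul_of_nonneg_right h1 hb0.le).trans h2
    set s := sch ρ m δ h u₀ n x with hs
    set t := sch ρ m δ h u₀ (n + 1) x with ht
    have hts : (1 - b) * s ≤ t := ih x
    have hs0 : 0 ≤ s := hnn n x
    have ht0 : 0 ≤ t := hnn (n + 1) x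
    have hP : (1 - b) ^ m * Pop δ (vv m (sch ρ m δ h u₀ n)) x ≤ Pop δ (vv m (sch ρ m δ h u₀ (n + 1))) x := by
      rw [← Pop_const_mul]
      refine Pop_mono (((sch_good w p hu n).1.vv hm1.le).const_mul _) ((sch_good w p hu (n + 1)).1.vv hm1.le) (fun z => ?_) x
      show _ * spow m _ ≤ spow m _
      rw [spow_nn hm0 (hnn n z), spow_nn hm0 (hnn (n + 1) z), ← Real.mul_rpow hl0.le (hnn n z)]
      exact Real.rpow_le_rpow (mul_nonneg hl0.le (hnn n z)) (ih z) hm0.le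
    have e1 : t = s - cc ρ δ h x * spow m s + cc ρ δ h x * Pop δ (vv m (sch ρ m δ h u₀ n)) x := step_eq x _
    have e2 : sch ρ m δ h u₀ (n + 1 + 1) x = t - cc ρ δ h x * spow m t + cc ρ δ h x * Pop δ (vv m (sch ρ m δ h u₀ (n + 1))) x := step_eq x _
    have h1 := mul_le_mul_of_nonneg_left hP (cc_nn w p x)
    have h2 : t ^ m - ((1 - b) * s) ^ m ≤ m * t ^ (m - 1) * (t - (1 - b) * s) := rpow_conv hm1.le (mul_nonneg hl0.le hs0) hts
    have h3 : cc ρ δ h x * (t ^ m - ((1 - b) * s) ^ m) ≤ ε * (t - (1 - b) * s) := by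
      calc _ ≤ cc ρ δ h x * (m * t ^ (m - 1) * (t - (1 - b) * s)) := mul_le_mul_of_nonneg_left h2 (cc_nn w p x)
        _ = cc ρ δ h x * (m * t ^ (m - 1)) * (t - (1 - b) * s) := by ring
        _ ≤ _ := mul_le_mul_of_nonneg_right (hcu (n + 1) x) (by linarith)
    rw [Real.mul_rpow hl0.le hs0] at h3
    rw [spow_nn hm0 hs0] at e1
    rw [spow_nn hm0 ht0] at e2
    have e4 : (1 - b) ^ m = (1 - b) ^ (m - 1) * (1 - b) := by
      rw [← Real.rpow_add_one hl0.ne']; congr 1; ring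
    -- main inequality
    have h5 : 0 ≤ (b' + ((1 - b) ^ m - ε)) * (t - (1 - b) * s) := mul_nonneg (by linarith) (by linarith)
    have h6 : 0 ≤ (b' - (1 - b) ^ (m - 1) * b) * ((1 - b) * s) := mul_nonneg (by linarith) (mul_nonneg hl0.le hs0)
    rw [e2]
    have h7 : cc ρ δ h x * ((1 - b) ^ m * Pop δ (vv m (sch ρ m δ h u₀ n)) x) = (1 - b) ^ m * (t - s + cc ρ δ h x * s ^ m) := by
      rw [e1]; ring
    rw [h7] at h1
    have h8 : (1 - b) ^ (m - 1) * b * ((1 - b) * s) = (1 - b) ^ m * b * s := by rw [e4]; ring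
    nlinarith [h1, h3, h5, h6, h8]

lemma sch_ab' (w : Wt γ k K ρ) (p : Par m δ h M) {u₀ : Euc N → ℝ} (hu : Good M u₀) (h0 : ∀ x, 0 ≤ u₀ x) {n : ℕ} (hn : 0 < n) (x : Euc N) :
    - Aop δ (vv m (sch ρ m δ h u₀ n)) x ≤ abC m / (n * h) * ((ρ x + δ) * sch ρ m δ h u₀ n x) := by
  have h1 := sch_ab w p hu h0 n x
  have h2 := step_sg w p x (sch ρ m δ h u₀ n)
  have hσ : 0 < ρ x + δ := by linarith [w.pos x, p.d0]
  have hh := p.h0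
  have hn' : (0:ℝ) < n := by exact_mod_cast hn
  have hC := abC_pos p.m1
  have hb : abb m n ≤ abC m / n := by
    unfold abb
    have : (0:ℝ) < (1 / 2 : ℝ) ^ m := Real.rpow_pos_of_pos (by norm_num) _
    gcongr
    have : 0 ≤ abC m / (1 / 2 : ℝ) ^ m := by positivity
    linarith
  have hs := sch_nn w p hu h0 n x
  have h3 : sch ρ m δ h u₀ (n + 1) x = step ρ m δ h (sch ρ m δ h u₀ n) x := rfl
  rw [h3] at h1
  have h4 : - (h * Aop δ (vv m (sch ρ m δ h u₀ n)) x) ≤ abC m / n * ((ρ x + δ) * sch ρ m δ h u₀ n x) := by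
    have h5 := mul_le_mul_of_nonneg_left h1 hσ.le
    have h6 := mul_le_mul_of_nonneg_right hb (mul_nonneg hσ.le hs)
    nlinarith
  have h5 : - Aop δ (vv m (sch ρ m δ h u₀ n)) x = (- (h * Aop δ (vv m (sch ρ m δ h u₀ n)) x)) / h := by field_simp
  rw [h5, div_le_iff₀ hh]
  refine h4.trans (le_of_eq ?_)
  field_simp

end

noncomputable section

variable {N : ℕ} {γ k K m δ h M η θ : ℝ} {ρ : Euc N → ℝ}

lemma sch_sum (w : Wt γ k K ρ) (p : Par m δ h M) (u₀ : Euc N → ℝ) (n : ℕ) (x : Euc N) :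
    (ρ x + δ) * sch ρ m δ h u₀ n x = (ρ x + δ) * u₀ x + h * ∑ i ∈ Finset.range n, Aop δ (vv m (sch ρ m δ h u₀ i)) x := by
  induction n with
  | zero => simp [sch]
  | succ n ih =>
    rw [Finset.sum_range_succ, mul_add, ← add_assoc, ← ih]
    exact step_sg w p x _

lemma sum_div {L : ℕ} (hL : 0 < L) (g : ℕ → ℝ) (n : ℕ) :
    ∑ i ∈ Finset.range n, g (i / L) = L * ∑ i ∈ Finset.range (n / L), g i + (n % L : ℕ) * g (n / L) := by
  induction n with
  | zero => simp
  | succ n ih =>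
    rw [Finset.sum_range_succ, ih]
    have hd := Nat.div_add_mod n L
    have hlt := Nat.mod_lt n hL
    rcases Nat.lt_or_ge (n % L + 1) L with h | h
    · have e : n + 1 = L * (n / L) + (n % L + 1) := by omega
      have e1 : (n + 1) / L = n / L := by
        rw [e, Nat.mul_add_div hL, Nat.div_eq_of_lt h, add_zero]
      have e2 : (n + 1) % L = n % L + 1 := by
        rw [e, Nat.mul_add_mod, Nat.mod_eq_of_lt h]
      rw [e1, e2]; push_cast; ring
    · have h' : n % L + 1 = L := by omega
      have e : n + 1 = L * (n / L + 1) + 0 := by rw [mul_add]; omega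
      have e1 : (n + 1) / L = n / L + 1 := by
        rw [e, Nat.mul_add_div hL, Nat.zero_div, add_zero]
      have e2 : (n + 1) % L = 0 := by
        rw [e, Nat.mul_add_mod, Nat.zero_mod]
      rw [e1, e2, Finset.sum_range_succ]
      have : (L : ℝ) = (n % L : ℕ) + 1 := by exact_mod_cast h'.symm
      rw [this]; push_cast; ring

lemma quad_bound (hδ : 0 < δ) {z : ℕ → Euc N → ℝ} {Z C : ℝ} (hb : ∀ n, BM Z (z n)) (hi : ∀ n, Integrable (z n))
    (hA : ∀ n, ∫ x, |Aop δ (z n) x| ≤ 2 * C) (Q : ℕ) :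
    ∑ n ∈ Finset.range Q, ∫ x, Aop δ (fun y => ∑ i ∈ Finset.range n, z i y) x * z n x ≤ Q * (C * Z) := by
  have hSb : ∀ n : ℕ, BM (n * Z) (fun y => ∑ i ∈ Finset.range n, z i y) := fun n => by
    have := BM.finset_sum (Finset.range n) (C := Z) (f := z) (fun i _ => hb i)
    rwa [Finset.card_range] at this
  have hSi : ∀ n, Integrable (fun y => ∑ i ∈ Finset.range n, z i y) := fun n => integrable_finsetSum _ fun i _ => hi i
  have hprod : ∀ {f g : Euc N → ℝ} {B : ℝ}, Integrable f → BM B g → Integrable (fun x => Aop δ f x * g x) := fun {f g B} hf hg =>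
    (Aop_integrable hf).mul_bdd (c := B) hg.1.aestronglyMeasurable (ae_of_all _ hg.2)
  have hq : ∀ n, - (2 * C * Z) ≤ ∫ x, Aop δ (z n) x * z n x := fun n => by
    have h1 : |∫ x, Aop δ (z n) x * z n x| ≤ 2 * C * Z := by
      refine (abs_integral_le_integral_abs).trans ?_
      have hZ := (hb n).nonneg
      refine le_trans ?_ (mul_le_mul_of_nonneg_right (hA n) hZ)
      rw [← integral_mul_const]
      refine integral_mono (hprod (hi n) (hb n)).abs ((Aop_integrable (hi n)).abs.mul_const _) fun x => ?_
      simp only [abs_mul]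
      exact mul_le_mul_of_nonneg_left ((hb n).2 x) (abs_nonneg _)
    exact (abs_le.1 h1).1
  have key : 2 * ∑ n ∈ Finset.range Q, ∫ x, Aop δ (fun y => ∑ i ∈ Finset.range n, z i y) x * z n x
      = (∫ x, Aop δ (fun y => ∑ i ∈ Finset.range Q, z i y) x * ∑ i ∈ Finset.range Q, z i x) - ∑ n ∈ Finset.range Q, ∫ x, Aop δ (z n) x * z n x := by
    induction Q with
    | zero => simp
    | succ n ih =>
      rw [Finset.sum_range_succ, Finset.sum_range_succ (fun n => ∫ x, Aop δ (z n) x * z n x), mul_add, ih]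
      have e : ∀ x, Aop δ (fun y => ∑ i ∈ Finset.range (n + 1), z i y) x * ∑ i ∈ Finset.range (n + 1), z i x
          = (Aop δ (fun y => ∑ i ∈ Finset.range n, z i y) x * ∑ i ∈ Finset.range n, z i x
            + Aop δ (fun y => ∑ i ∈ Finset.range n, z i y) x * z n x)
            + (Aop δ (z n) x * (∑ i ∈ Finset.range n, z i x) + Aop δ (z n) x * z n x) := fun x => by
        rw [Aop_sum _ (fun i _ => hb i), Aop_sum _ (fun i _ => hb i), Finset.sum_range_succ, Finset.sum_range_succ]; ring
      simp_rw [e]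
      have i1 := hprod (hSi n) (hSb n)
      have i2 := hprod (hSi n) (hb n)
      have i3 := hprod (hi n) (hSb n)
      have i4 := hprod (hi n) (hb n)
      have i12 : Integrable (fun x => Aop δ (fun y => ∑ i ∈ Finset.range n, z i y) x * ∑ i ∈ Finset.range n, z i x
            + Aop δ (fun y => ∑ i ∈ Finset.range n, z i y) x * z n x) := i1.add i2
      have i34 : Integrable (fun x => Aop δ (z n) x * (∑ i ∈ Finset.range n, z i x) + Aop δ (z n) x * z n x) := i3.add i4
      rw [integral_add i12 i34, integral_add i1 i2, integral_add i3 i4]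
      have hs := Aop_symm hδ.le (hi n) (hSb n)
      have hs' : ∫ x, z n x * Aop δ (fun y => ∑ i ∈ Finset.range n, z i y) x = ∫ x, Aop δ (fun y => ∑ i ∈ Finset.range n, z i y) x * z n x := by
        simp_rw [mul_comm]
      rw [hs, hs']; ring
  have h1 := Aop_nonpos hδ (hSi Q) (hSb Q)
  have h2 : - (Q * (2 * C * Z)) ≤ ∑ n ∈ Finset.range Q, ∫ x, Aop δ (z n) x * z n x := by
    have := Finset.sum_le_sum (s := Finset.range Q) fun n _ => hq n
    simp only [Finset.sum_const, Finset.card_range, nsmul_eq_mul] at this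
    linarith
  linarith

/-- the pointwise identity comparing two levels -/
lemma pair_id (w : Wt γ k K ρ) (p : Par m δ h M) (p' : Par m η θ M) (hηδ : η < δ) {L : ℕ} (hL : 0 < L) (hh : h = L * θ)
    {u₀ : Euc N → ℝ} (hu : Good M u₀) (n : ℕ) (x : Euc N) :
    ρ x * (sch ρ m δ h u₀ (n / L) x - sch ρ m η θ u₀ n x) =
      θ * Aop δ (fun y => ∑ i ∈ Finset.range n, (vv m (sch ρ m δ h u₀ (i / L)) y - vv m (sch ρ m η θ u₀ i) y)) x
      + ((η * sch ρ m η θ u₀ n x - δ * sch ρ m δ h u₀ (n / L) x + (δ - η) * u₀ x)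
      - (n % L : ℕ) * θ * Aop δ (vv m (sch ρ m δ h u₀ (n / L))) x)
      + (δ - η) * Aop δ (fun y => (ρ y + η) * (sch ρ m η θ u₀ n y - u₀ y)) x := by
  have h1 := sch_sum w p u₀ (n / L) x
  have h2 := sch_sum w p' u₀ n x
  have e0 : (fun y => (ρ y + η) * (sch ρ m η θ u₀ n y - u₀ y)) = fun y => θ * ∑ i ∈ Finset.range n, Aop η (vv m (sch ρ m η θ u₀ i)) y := by
    ext y; have := sch_sum w p' u₀ n y; linarith
  have bδ : ∀ i, BM (M ^ m) (vv m (sch ρ m δ h u₀ i)) := fun i => (sch_good w p hu i).1.vv p.m1.le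
  have bη : ∀ i, BM (M ^ m) (vv m (sch ρ m η θ u₀ i)) := fun i => (sch_good w p' hu i).1.vv p.m1.le
  have e1 : Aop δ (fun y => (ρ y + η) * (sch ρ m η θ u₀ n y - u₀ y)) x = θ * ∑ i ∈ Finset.range n, Aop δ (Aop η (vv m (sch ρ m η θ u₀ i))) x := by
    rw [e0, Aop_const_mul, Aop_sum _ (fun i _ => (bη i).Aop p'.d0)]
  have e2 : ∑ i ∈ Finset.range n, Aop η (vv m (sch ρ m η θ u₀ i)) x =
      ∑ i ∈ Finset.range n, Aop δ (vv m (sch ρ m η θ u₀ i)) x - (δ - η) * ∑ i ∈ Finset.range n, Aop δ (Aop η (vv m (sch ρ m η θ u₀ i))) x := by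
    rw [Finset.mul_sum, ← Finset.sum_sub_distrib]
    exact Finset.sum_congr rfl fun i _ => Aop_resolvent p'.d0 hηδ (bη i) x
  have e3 : Aop δ (fun y => ∑ i ∈ Finset.range n, (vv m (sch ρ m δ h u₀ (i / L)) y - vv m (sch ρ m η θ u₀ i) y)) x =
      ∑ i ∈ Finset.range n, Aop δ (vv m (sch ρ m δ h u₀ (i / L))) x - ∑ i ∈ Finset.range n, Aop δ (vv m (sch ρ m η θ u₀ i)) x := by
    rw [Aop_sum _ (fun i _ => (bδ (i / L)).sub (bη i)), ← Finset.sum_sub_distrib]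
    exact Finset.sum_congr rfl fun i _ => Aop_sub (bδ _) (bη i) x
  have e4 := sum_div hL (fun i => Aop δ (vv m (sch ρ m δ h u₀ i)) x) n
  rw [e1, e3, e4]
  rw [e2] at h2
  rw [hh] at h1
  subst hh
  linear_combination h1 - h2

lemma pair_A (w : Wt γ k K ρ) (p : Par m δ h M) (p' : Par m η θ M) (hηδ : η < δ) {U : Euc N → ℝ} (hT : Test U)
    (hU : ∀ x, |U x| ≤ M ^ m) (i n : ℕ) :
    ∫ x, |Aop δ (fun y => vv m (sch ρ m δ h (b0 m U) i) y - vv m (sch ρ m η θ (b0 m U) n) y) x| ≤ 2 * Lc U := by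
  have hg := b0_good p.m1 p.M0 hT hU
  have g1 := (sch_good w p hg i).vv p.m1.le
  have g2 := (sch_good w p' hg n).vv p.m1.le
  have h1 := sch_A w p hT hU i
  have h2 := (Aop_l1_mono p'.d0 hηδ g2.1 g2.int).trans (sch_A w p' hT hU n)
  have : ∫ x, |Aop δ (fun y => vv m (sch ρ m δ h (b0 m U) i) y - vv m (sch ρ m η θ (b0 m U) n) y) x| ≤
      ∫ x, (|Aop δ (vv m (sch ρ m δ h (b0 m U) i)) x| + |Aop δ (vv m (sch ρ m η θ (b0 m U) n)) x|) := by
    refine integral_mono (Aop_integrable (g1.sub g2).int).abs ((Aop_integrable g1.int).abs.add (Aop_integrable g2.int).abs) fun x => ?_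
    simp only
    rw [Aop_sub g1.1 g2.1]
    exact abs_sub _ _
  rw [integral_add (Aop_integrable g1.int).abs (Aop_integrable g2.int).abs] at this
  linarith

lemma pair_bd (w : Wt γ k K ρ) (p : Par m δ h M) (p' : Par m η θ M) (hηδ : η < δ) {L : ℕ} (hL : 0 < L) (hh : h = L * θ)
    {U : Euc N → ℝ} (hT : Test U) (hU : ∀ x, |U x| ≤ M ^ m) {r : ℝ} (hr : 0 < r) (n : ℕ) {Cl : ℝ}
    (c1 : ∫ x, |sch ρ m δ h (b0 m U) (n / L) x| ≤ Cl) (c2 : ∫ x, |sch ρ m η θ (b0 m U) n x| ≤ Cl) (c3 : ∫ x, |b0 m U x| ≤ Cl) :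
    ∫ x, ρ x * ((sch ρ m δ h (b0 m U) (n / L) x - sch ρ m η θ (b0 m U) n x) *
      (vv m (sch ρ m δ h (b0 m U) (n / L)) x - vv m (sch ρ m η θ (b0 m U) n) x)) ≤
    θ * (∫ x, Aop δ (fun y => ∑ i ∈ Finset.range n, (vv m (sch ρ m δ h (b0 m U) (i / L)) y - vv m (sch ρ m η θ (b0 m U) i) y)) x *
      (vv m (sch ρ m δ h (b0 m U) (n / L)) x - vv m (sch ρ m η θ (b0 m U) n) x))
    + ((δ * (Cl + Cl + Cl) * (M ^ m + M ^ m) + h * Lc U * (M ^ m + M ^ m))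
      + (4 * M * (M ^ m + M ^ m) * (∫ x in ball (0 : Euc N) r, (ρ x + 1)) + 2 * M * (K * r ^ (-γ) + 1) * δ * (2 * Lc U))) := by
  have hg := b0_good p.m1 p.M0 hT hU
  have gu := sch_good w p hg (n / L)
  have gv := sch_good w p' hg n
  set u := sch ρ m δ h (b0 m U) (n / L) with hu
  set v := sch ρ m η θ (b0 m U) n with hv
  set Z := M ^ m + M ^ m with hZ
  set z : Euc N → ℝ := fun x => vv m u x - vv m v x with hz
  have gz : Good Z z := (gu.vv p.m1.le).sub (gv.vv p.m1.le)
  set S : Euc N → ℝ := fun y => ∑ i ∈ Finset.range n, (vv m (sch ρ m δ h (b0 m U) (i / L)) y - vv m (sch ρ m η θ (b0 m U) i) y) with hS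
  have iS : Integrable S := integrable_finsetSum _ fun i _ =>
    (((sch_good w p hg (i / L)).vv p.m1.le).sub ((sch_good w p' hg i).vv p.m1.le)).int
  set D : Euc N → ℝ := fun y => (ρ y + η) * (v y - b0 m U y) with hD
  have gvb := gv.sub hg
  have iD : Integrable D := by
    have := w.phi_int (φ := fun _ => 1) (B := 1) ⟨measurable_const, fun x => by simp⟩ gvb.int gvb.1 η
    simpa using this
  have Z0 : 0 ≤ Z := gz.1.nonneg
  have hM := p.M0
  have mulz : ∀ {f : Euc N → ℝ}, Integrable f → Integrable (fun x => f x * z x) := fun {f} hf =>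
    hf.mul_bdd (c := Z) gz.1.1.aestronglyMeasurable (ae_of_all _ gz.1.2)
  have iA := mulz (Aop_integrable (δ := δ) iS)
  have iAD := mulz (Aop_integrable (δ := δ) iD)
  have iF : Integrable (fun x => (η * v x - δ * u x + (δ - η) * b0 m U x) - (n % L : ℕ) * θ * Aop δ (vv m u) x) :=
    (((gv.int.const_mul η).sub (gu.int.const_mul δ)).add (hg.int.const_mul (δ - η))).sub
      ((Aop_integrable (gu.vv p.m1.le).int).const_mul _)
  have iFz := mulz iF
  have e : ∀ x, ρ x * ((u x - v x) * z x) = θ * (Aop δ S x * z x) + (((η * v x - δ * u x + (δ - η) * b0 m U x) - (n % L : ℕ) * θ * Aop δ (vv m u) x) * z x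
      + (δ - η) * (Aop δ D x * z x)) := fun x => by
    have := pair_id w p p' hηδ hL hh hg n x
    rw [← hu, ← hv, ← hS, ← hD] at this
    linear_combination z x * this
  show ∫ x, ρ x * ((u x - v x) * z x) ≤ θ * (∫ x, Aop δ S x * z x) + _
  simp_rw [e]
  have i23 : Integrable (fun x => ((η * v x - δ * u x + (δ - η) * b0 m U x) - (n % L : ℕ) * θ * Aop δ (vv m u) x) * z x
      + (δ - η) * (Aop δ D x * z x)) := iFz.add (iAD.const_mul _)
  rw [integral_add (iA.const_mul _) i23, integral_add iFz (iAD.const_mul _), integral_const_mul, integral_const_mul]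
  have hd0 := p.d0
  have hη0 := p'.d0
  have hθ0 := p'.h0
  refine add_le_add le_rfl (add_le_add ?_ ?_)
  · -- first error
    have hh' : (n % L : ℕ) * θ ≤ h := by
      rw [hh]; gcongr; exact (Nat.mod_lt n hL).le
    have h0 : 0 ≤ (n % L : ℕ) * θ := by positivity
    calc _ ≤ ∫ x, ((δ * ((|u x| + |v x|) + |b0 m U x|)) * Z + h * |Aop δ (vv m u) x| * Z) := by
          refine integral_mono iFz (((((gu.int.abs.add gv.int.abs).add hg.int.abs).const_mul δ).mul_const Z).add
            (((Aop_integrable (gu.vv p.m1.le).int).abs.const_mul h).mul_const Z)) fun x => ?_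
          simp only
          refine (le_abs_self _).trans ?_
          rw [abs_mul, ← add_mul]
          refine mul_le_mul ?_ (gz.1.2 x) (abs_nonneg _) ?_
          · refine (abs_sub _ _).trans ?_
            refine add_le_add ?_ ?_
            · have t1 : |η * v x| ≤ δ * |v x| := by rw [abs_mul, abs_of_pos hη0]; gcongr
              have t2 : |δ * u x| = δ * |u x| := by rw [abs_mul, abs_of_pos hd0]
              have t3 : |(δ - η) * b0 m U x| ≤ δ * |b0 m U x| := by
                rw [abs_mul, abs_of_pos (by linarith)]; gcongr; linarith
              have t4 := abs_sub (η * v x) (δ * u x)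
              have t5 := abs_add_le (η * v x - δ * u x) ((δ - η) * b0 m U x)
              linarith
            · rw [abs_mul, abs_of_nonneg h0]; gcongr
          · have := p.h0; positivity
      _ ≤ _ := by
          have i1 : Integrable (fun x => |u x| + |v x|) := gu.int.abs.add gv.int.abs
          have i2 : Integrable (fun x => (|u x| + |v x|) + |b0 m U x|) := i1.add hg.int.abs
          rw [integral_add ((i2.const_mul δ).mul_const Z) (((Aop_integrable (gu.vv p.m1.le).int).abs.const_mul h).mul_const Z),
            integral_mul_const, integral_mul_const, integral_const_mul, integral_const_mul,
            integral_add i1 hg.int.abs, integral_add gu.int.abs gv.int.abs]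
          have := sch_A w p hT hU (n / L)
          have := p.h0
          gcongr
  · rw [Aop_symm hd0.le iD gz.1, ← integral_const_mul]
    have hJ : IntegrableOn (fun x => ρ x + 1) (ball (0 : Euc N) r) :=
      (w.ball hr).1.add (integrableOn_const measure_ball_lt_top.ne)
    have hzi := Aop_integrable (δ := δ) gz.int
    calc _ ≤ ∫ x, (4 * M * Z * ((ball (0 : Euc N) r).indicator (fun x => ρ x + 1) x) + 2 * M * (K * r ^ (-γ) + 1) * δ * |Aop δ z x|) := by
          refine integral_mono ((iD.mul_bdd (c := 2 * Z / δ) (gz.1.Aop hd0).1.aestronglyMeasurable (ae_of_all _ (gz.1.Aop hd0).2)).const_mul _)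
            ((((integrable_indicator_iff measurableSet_ball).2 hJ).const_mul _).add (hzi.abs.const_mul _)) fun x => ?_
          simp only
          have hρ := w.pos x
          have hDx : |D x| ≤ 2 * M * (ρ x + 1) := by
            rw [hD]; simp only
            rw [abs_mul, abs_of_pos (by linarith), mul_comm]
            have := gvb.1.2 x
            have : η ≤ 1 := p'.d1
            refine mul_le_mul (by linarith) (by linarith) (by linarith) (by linarith)
          have hAx : |Aop δ z x| ≤ 2 * Z / δ := (gz.1.Aop hd0).2 x
          have hAx' : δ * |Aop δ z x| ≤ 2 * Z := by rw [le_div_iff₀ hd0] at hAx; linarith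
          have t0 : (δ - η) * (D x * Aop δ z x) ≤ |D x| * (δ * |Aop δ z x|) := by
            refine (le_abs_self _).trans ?_
            rw [abs_mul, abs_mul, abs_of_pos (by linarith : 0 < δ - η)]
            have : (δ - η) * (|D x| * |Aop δ z x|) ≤ δ * (|D x| * |Aop δ z x|) := by gcongr; linarith
            linarith
          refine t0.trans ?_
          have hK := w.K0
          have hrg : 0 ≤ r ^ (-γ) := Real.rpow_nonneg hr.le _
          by_cases hx : x ∈ ball (0 : Euc N) r
          · rw [indicator_of_mem hx]
            have t1 : |D x| * (δ * |Aop δ z x|) ≤ 2 * M * (ρ x + 1) * (2 * Z) := by gcongr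
            have t2 : 0 ≤ 2 * M * (K * r ^ (-γ) + 1) * δ * |Aop δ z x| := by positivity
            linarith
          · rw [indicator_of_notMem hx]
            have := w.off hr hx
            have t1 : |D x| * (δ * |Aop δ z x|) ≤ 2 * M * (K * r ^ (-γ) + 1) * (δ * |Aop δ z x|) := by
              gcongr; exact hDx.trans (by gcongr)
            linarith
      _ ≤ _ := by
          rw [integral_add (((integrable_indicator_iff measurableSet_ball).2 hJ).const_mul _) (hzi.abs.const_mul _),
            integral_const_mul, integral_const_mul, integral_indicator measurableSet_ball]
          have := pair_A w p p' hηδ hT hU (n / L) n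
          have hK := w.K0
          have hrg : 0 ≤ r ^ (-γ) := Real.rpow_nonneg hr.le _
          gcongr

end

noncomputable section

variable {N : ℕ} {γ k K m δ h M η θ : ℝ} {ρ : Euc N → ℝ}

lemma Wt.J_bd (w : Wt γ k K ρ) {r : ℝ} (hr : 0 < r) (hr1 : r ≤ 1) :
    ∫ x in Metric.ball (0 : Euc N) r, (ρ x + 1) ≤ (K * sph N γ + sph N 0) * r := by
  have hN3 : (3:ℝ) ≤ N := by exact_mod_cast w.hN
  obtain ⟨i0, h0⟩ := ball_rpow (q := 0) w.hN (by linarith) hr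
  simp only [neg_zero, Real.rpow_zero] at i0 h0
  rw [integral_add (w.ball hr).1 i0, h0]
  have h1 := (w.ball hr).2
  have hs1 : 0 ≤ sph N γ := sph_nn w.gN
  have hs2 : 0 ≤ sph N 0 := sph_nn (by linarith)
  have hK := w.K0
  have e1 : r ^ ((N:ℝ) - γ) ≤ r := by
    have := Real.rpow_le_rpow_of_exponent_ge hr hr1 (by linarith [w.g2] : 1 ≤ (N:ℝ) - γ)
    rwa [Real.rpow_one] at this
  have e2 : r ^ ((N:ℝ) - 0) ≤ r := by
    have := Real.rpow_le_rpow_of_exponent_ge hr hr1 (by linarith [w.g2] : 1 ≤ (N:ℝ) - 0)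
    rwa [Real.rpow_one] at this
  have := mul_le_mul_of_nonneg_left e1 (mul_nonneg hK.le hs1)
  have := mul_le_mul_of_nonneg_left e2 hs2
  linarith

/-- `∫ ρ w z` -/
def GG (ρ : Euc N → ℝ) (m : ℝ) (u v : Euc N → ℝ) : ℝ := ∫ x, ρ x * ((u x - v x) * (vv m u x - vv m v x))

lemma GG_int (w : Wt γ k K ρ) (hm : 1 < m) {u v : Euc N → ℝ} (hu : Good M u) (hv : Good M v) :
    Integrable (fun x => ρ x * ((u x - v x) * (vv m u x - vv m v x))) := by
  have g := (hu.vv hm.le).sub (hv.vv hm.le)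
  have b := (hu.sub hv).1
  refine w.bm_int (C := (M + M) * (M ^ m + M ^ m)) (g.int.bdd_mul (c := M + M) b.1.aestronglyMeasurable (ae_of_all _ b.2)) (b.mul g.1)

lemma wz_nn (hm : 1 < m) (a b : ℝ) : 0 ≤ (a - b) * (spow m a - spow m b) := by
  have hmono := (spow_mono (by linarith : 0 < m)).monotone
  rcases le_total a b with h | h
  · exact mul_nonneg_of_nonpos_of_nonpos (by linarith) (by linarith [hmono h])
  · exact mul_nonneg (by linarith) (by linarith [hmono h])

lemma GG_nn (w : Wt γ k K ρ) (hm : 1 < m) (u v : Euc N → ℝ) : 0 ≤ GG ρ m u v :=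
  integral_nonneg fun x => mul_nonneg (w.pos x).le (wz_nn hm _ _)

lemma dd_coer (w : Wt γ k K ρ) (hm : 1 < m) {ε C R A : ℝ} (hR : 0 < R) (hε : 0 ≤ ε) (hC : 0 ≤ C)
    (hc : ∀ a b, |a| ≤ M → |b| ≤ M → |a - b| ≤ ε + C * ((a - b) * (spow m a - spow m b)))
    {u v : Euc N → ℝ} (hu : Good M u) (hv : Good M v)
    (mu : ∫ x, (1 + ‖x‖ ^ 2) * ((ρ x + 0) * |u x|) ≤ A) (mv : ∫ x, (1 + ‖x‖ ^ 2) * ((ρ x + 0) * |v x|) ≤ A) :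
    dd ρ 0 u v ≤ ε * (∫ x in ball (0 : Euc N) R, ρ x) + C * GG ρ m u v + (A + A) / R ^ 2 := by
  have iB : Integrable ((ball (0 : Euc N) R).indicator ρ) := (integrable_indicator_iff measurableSet_ball).2 (w.ball hR).1
  have iG := GG_int w hm hu hv
  have iu := hu.mom_int w 0
  have iv := hv.mom_int w 0
  calc dd ρ 0 u v ≤ ∫ x, ((ε * (ball (0 : Euc N) R).indicator ρ x + C * (ρ x * ((u x - v x) * (vv m u x - vv m v x))))
        + ((1 + ‖x‖ ^ 2) * ((ρ x + 0) * |u x|) + (1 + ‖x‖ ^ 2) * ((ρ x + 0) * |v x|)) / R ^ 2) := by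
        refine integral_mono (w.dd_int 0 hu hv) (((iB.const_mul ε).add (iG.const_mul C)).add ((iu.add iv).div_const _)) fun x => ?_
        simp only
        have hρ := w.pos x
        have hz := wz_nn hm (u x) (v x)
        have t2 : 0 ≤ (1 + ‖x‖ ^ 2) * ((ρ x + 0) * |u x|) + (1 + ‖x‖ ^ 2) * ((ρ x + 0) * |v x|) := by
          have : 0 ≤ ρ x + 0 := by linarith
          positivity
        by_cases hx : x ∈ ball (0 : Euc N) R
        · rw [indicator_of_mem hx]
          have h1 := mul_le_mul_of_nonneg_left (hc _ _ (hu.1.2 x) (hv.1.2 x)) hρ.le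
          have : 0 ≤ ((1 + ‖x‖ ^ 2) * ((ρ x + 0) * |u x|) + (1 + ‖x‖ ^ 2) * ((ρ x + 0) * |v x|)) / R ^ 2 := by positivity
          simp only [vv]
          linarith
        · rw [indicator_of_notMem hx]
          have hx' : R ≤ ‖x‖ := by simpa using hx
          have h3 : (ρ x + 0) * |u x - v x| ≤ ((1 + ‖x‖ ^ 2) * ((ρ x + 0) * |u x|) + (1 + ‖x‖ ^ 2) * ((ρ x + 0) * |v x|)) / R ^ 2 := by
            rw [le_div_iff₀ (by positivity)]
            have e1 : R ^ 2 ≤ 1 + ‖x‖ ^ 2 := by nlinarith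
            have e2 := abs_sub (u x) (v x)
            calc (ρ x + 0) * |u x - v x| * R ^ 2 ≤ (ρ x + 0) * (|u x| + |v x|) * (1 + ‖x‖ ^ 2) := by
                  have : 0 ≤ ρ x + 0 := by linarith
                  gcongr
              _ = _ := by ring
          have : 0 ≤ C * (ρ x * ((u x - v x) * (vv m u x - vv m v x))) := mul_nonneg hC (mul_nonneg hρ.le hz)
          linarith
    _ ≤ _ := by
        have i1 : Integrable (fun x => ε * (ball (0 : Euc N) R).indicator ρ x + C * (ρ x * ((u x - v x) * (vv m u x - vv m v x)))) := (iB.const_mul ε).add (iG.const_mul C)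
        have i2 : Integrable (fun x => ((1 + ‖x‖ ^ 2) * ((ρ x + 0) * |u x|) + (1 + ‖x‖ ^ 2) * ((ρ x + 0) * |v x|)) / R ^ 2) := (iu.add iv).div_const _
        rw [integral_add i1 i2, integral_add (iB.const_mul ε) (iG.const_mul C), integral_const_mul, integral_const_mul,
          integral_div, integral_add iu iv, integral_indicator measurableSet_ball]
        unfold GG
        gcongr

lemma dd_zero_le (w : Wt γ k K ρ) {d : ℝ} (hd : 0 ≤ d) {u v : Euc N → ℝ} (hu : Good M u) (hv : Good M v) : dd ρ 0 u v ≤ dd ρ d u v := by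
  refine integral_mono (w.dd_int 0 hu hv) (w.dd_int d hu hv) fun x => ?_
  simp only
  gcongr

lemma pair_shift (w : Wt γ k K ρ) (p : Par m δ h M) (p' : Par m η θ M) {L : ℕ} (hL : 0 < L) (hh : h = L * θ)
    {U : Euc N → ℝ} (hT : Test U) (hU : ∀ x, |U x| ≤ M ^ m) (n j : ℕ) :
    dd ρ 0 (sch ρ m δ h (b0 m U) (n / L)) (sch ρ m η θ (b0 m U) n) ≤
      dd ρ 0 (sch ρ m δ h (b0 m U) ((n + j) / L)) (sch ρ m η θ (b0 m U) (n + j)) + (2 * (j * θ) + h) * Lc U := by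
  have hg := b0_good p.m1 p.M0 hT hU
  have g := sch_good w p hg
  have g' := sch_good w p' hg
  have h1 := w.dd_tri le_rfl (g (n / L)) (g ((n + j) / L)) (g' n)
  have h2 := w.dd_tri le_rfl (g ((n + j) / L)) (g' (n + j)) (g' n)
  have h3 := (dd_zero_le w p'.d0.le (g' (n + j)) (g' n)).trans (sch_lip w p' hT hU n j)
  have hle : n / L ≤ (n + j) / L := Nat.div_le_div_right (by omega)
  obtain ⟨i, hi⟩ := Nat.exists_eq_add_of_le hle
  have h4 := (dd_zero_le w p.d0.le (g (n / L + i)) (g (n / L))).trans (sch_lip w p hT hU (n / L) i)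
  rw [← hi, dd_comm] at h4
  have hij : (i : ℝ) * h ≤ j * θ + h := by
    have : i * L ≤ j + L := by
      have a1 := Nat.div_add_mod n L
      have a2 := Nat.div_add_mod (n + j) L
      have a3 := Nat.mod_lt n hL
      rw [hi] at a2
      have : L * (n / L + i) = L * (n / L) + i * L := by ring
      omega
    have : (i : ℝ) * L ≤ j + L := by exact_mod_cast this
    rw [hh]; nlinarith [p'.h0]
  have := mul_le_mul_of_nonneg_right hij (Lc_nn U)
  linarith

/-- moment bound constant up to time `T` -/
def Mo (ρ : Euc N → ℝ) (k m M : ℝ) (u₀ : Euc N → ℝ) (T : ℝ) : ℝ := Real.exp (M2 N * M ^ (m - 1) * (2 / k) * T) * mom ρ u₀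

lemma mom_nn (w : Wt γ k K ρ) (u : Euc N → ℝ) : 0 ≤ mom ρ u := integral_nonneg fun x => by
  have := w.pos x
  simp only [Pi.zero_apply]
  positivity

lemma Mo_nn (w : Wt γ k K ρ) (u : Euc N → ℝ) (T : ℝ) : 0 ≤ Mo ρ k m M u T := mul_nonneg (Real.exp_pos _).le (mom_nn w u)

lemma Mo_mono (w : Wt γ k K ρ) (hM : 0 ≤ M) (u : Euc N → ℝ) {t T : ℝ} (h : t ≤ T) : Mo ρ k m M u t ≤ Mo ρ k m M u T := by
  unfold Mo
  have h1 := w.k0; have h2 := Real.rpow_nonneg hM (m - 1); have h3 : 0 ≤ M2 N := M2_nonneg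
  have := mom_nn w u
  gcongr

lemma sch_mom0 (w : Wt γ k K ρ) (p : Par m δ h M) {u₀ : Euc N → ℝ} (hu : Good M u₀) {n : ℕ} {T : ℝ} (hT : n * h ≤ T) :
    ∫ x, (1 + ‖x‖ ^ 2) * ((ρ x + 0) * |sch ρ m δ h u₀ n x|) ≤ Mo ρ k m M u₀ T := by
  refine le_trans ?_ ((sch_moment w p hu n).trans (Mo_mono w p.M0 u₀ hT))
  have g := sch_good w p hu n
  refine integral_mono (g.mom_int w 0) (g.mom_int w δ) fun x => ?_
  simp only
  have := p.d0
  gcongr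

lemma sch_l1' (w : Wt γ k K ρ) (p : Par m δ h M) {u₀ : Euc N → ℝ} (hu : Good M u₀) {n : ℕ} {T : ℝ} (hT : n * h ≤ T) :
    ∫ x, |sch ρ m δ h u₀ n x| ≤ 2 / k * Mo ρ k m M u₀ T := by
  have hk := w.k0
  exact (sch_l1 w p hu n).trans (mul_le_mul_of_nonneg_left (Mo_mono w p.M0 u₀ hT) (by positivity))

set_option maxHeartbeats 1000000 in
theorem sch_cauchy (w : Wt γ k K ρ) (hm : 1 < m) (hM : 0 ≤ M) {U : Euc N → ℝ} (hT : Test U) (hU : ∀ x, |U x| ≤ M ^ m)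
    {T : ℝ} (hT0 : 0 ≤ T) {ε : ℝ} (hε : 0 < ε) :
    ∃ d : ℝ, 0 < d ∧ ∀ δ h η θ : ℝ, ∀ L : ℕ, Par m δ h M → Par m η θ M → η < δ → 0 < L → h = L * θ → δ ≤ d → h ≤ d →
      ∀ n : ℕ, n * θ ≤ T → dd ρ 0 (sch ρ m δ h (b0 m U) (n / L)) (sch ρ m η θ (b0 m U) n) ≤ ε := by
  have hg := b0_good hm hM hT hU
  have C0 := Lc_nn U
  set Z := M ^ m + M ^ m with hZ
  have Z0 : 0 ≤ Z := by have := Real.rpow_nonneg hM m; positivity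
  -- window
  obtain ⟨s, hs0, hs1, hsC⟩ : ∃ s : ℝ, 0 < s ∧ s ≤ 1 ∧ 4 * s * Lc U ≤ ε / 5 := by
    refine ⟨min 1 (ε / (20 * (Lc U + 1))), lt_min one_pos (by positivity), min_le_left _ _, ?_⟩
    calc 4 * min 1 (ε / (20 * (Lc U + 1))) * Lc U ≤ 4 * (ε / (20 * (Lc U + 1))) * (Lc U + 1) := by
          gcongr
          · exact min_le_right _ _
          · linarith
      _ = ε / 5 := by field_simp; norm_num
  set A := Mo ρ k m M (b0 m U) (T + 2) with hA
  have A0 : 0 ≤ A := Mo_nn w _ _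
  set Cl := 2 / k * A with hCl
  have hk := w.k0
  have hK := w.K0
  have Cl0 : 0 ≤ Cl := by positivity
  -- tail radius
  obtain ⟨R, hR0, hR⟩ : ∃ R : ℝ, 0 < R ∧ (A + A) / R ^ 2 ≤ ε / 10 := by
    refine ⟨max 1 (20 * (A + 1) / ε), by positivity, ?_⟩
    set R := max 1 (20 * (A + 1) / ε)
    have h1 : 1 ≤ R := le_max_left _ _
    have h2 : 20 * (A + 1) / ε ≤ R := le_max_right _ _
    rw [div_le_iff₀ hε] at h2
    rw [div_le_iff₀ (by positivity)]
    have : R ≤ R ^ 2 := by nlinarith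
    nlinarith
  set I := ∫ x in ball (0 : Euc N) R, ρ x with hI
  have I0 : 0 ≤ I := integral_nonneg fun x => (w.pos x).le
  obtain ⟨C, hC0, hC⟩ := spow_coer (M := M) hm.le (show 0 < ε / (10 * (I + 1)) by positivity)
  have hI' : ε / (10 * (I + 1)) * I ≤ ε / 10 := by
    rw [div_mul_eq_mul_div, div_le_iff₀ (by positivity)]; nlinarith
  set D := C * ((T + 2) / s) with hD
  have D0 : 0 ≤ D := by positivity
  have hN3 : (3:ℝ) ≤ N := by exact_mod_cast w.hN
  have Sg : 0 ≤ K * sph N γ + sph N 0 := by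
    have h1 := sph_nn w.gN
    have h2 : 0 ≤ sph N 0 := sph_nn (by linarith)
    positivity
  obtain ⟨r, hr0, hr1, hr⟩ : ∃ r : ℝ, 0 < r ∧ r ≤ 1 ∧ D * (4 * M * Z * ((K * sph N γ + sph N 0) * r)) ≤ ε / 5 := by
    set E := D * (4 * M * Z * (K * sph N γ + sph N 0)) with hE
    have E0 : 0 ≤ E := by positivity
    refine ⟨min 1 (ε / (5 * (E + 1))), lt_min one_pos (by positivity), min_le_left _ _, ?_⟩
    calc _ = E * min 1 (ε / (5 * (E + 1))) := by rw [hE]; ring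
      _ ≤ (E + 1) * (ε / (5 * (E + 1))) := by
          gcongr
          · linarith
          · exact min_le_right _ _
      _ = ε / 5 := by field_simp
  have hrg : 0 ≤ r ^ (-γ) := Real.rpow_nonneg hr0.le _
  set F := D * (Lc U * Z + ((Cl + Cl + Cl) * Z + Lc U * Z + 2 * M * (K * r ^ (-γ) + 1) * (2 * Lc U))) + Lc U with hF
  have F0 : 0 ≤ F := by positivity
  refine ⟨min s (ε / (5 * (F + 1))), lt_min hs0 (by positivity), ?_⟩
  intro δ h η θ L p p' hηδ hL hh hδd hhd n hn
  set d := min s (ε / (5 * (F + 1))) with hd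
  have hdF : F * d ≤ ε / 5 := by
    calc F * d ≤ (F + 1) * (ε / (5 * (F + 1))) := by
          gcongr
          · linarith
          · exact min_le_right _ _
      _ = ε / 5 := by field_simp
  have hθ0 := p'.h0
  have hL1 : (1:ℝ) ≤ L := by exact_mod_cast hL
  have hθh : θ ≤ h := by rw [hh]; exact le_mul_of_one_le_left hθ0.le hL1
  have hθs : θ ≤ s := hθh.trans (hhd.trans (min_le_left _ _))
  set W := ⌈s / θ⌉₊ with hW
  have hW1 : s ≤ W * θ := by
    have := Nat.le_ceil (s / θ); rwa [div_le_iff₀ hθ0] at this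
  have hW2 : W * θ ≤ 2 * s := by
    have := Nat.ceil_lt_add_one (show 0 ≤ s / θ by positivity)
    have h2 : (W:ℝ) * θ ≤ (s / θ + 1) * θ := by gcongr
    have h3 : (s / θ + 1) * θ = s + θ := by field_simp
    linarith
  have hWpos : (0:ℝ) < W := by
    by_contra hc
    have := mul_nonpos_of_nonpos_of_nonneg (not_lt.1 hc) hθ0.le
    linarith
  set G : ℕ → ℝ := fun i => GG ρ m (sch ρ m δ h (b0 m U) (i / L)) (sch ρ m η θ (b0 m U) i) with hG
  set g : ℕ → ℝ := fun i => dd ρ 0 (sch ρ m δ h (b0 m U) (i / L)) (sch ρ m η θ (b0 m U) i) with hgd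
  have hdiv : ∀ i : ℕ, ((i / L : ℕ) : ℝ) * h ≤ i * θ := fun i => by
    have : (i / L) * L ≤ i := Nat.div_mul_le_self i L
    have : ((i / L : ℕ) : ℝ) * L ≤ i := by exact_mod_cast this
    rw [hh, ← mul_assoc]; exact mul_le_mul_of_nonneg_right this hθ0.le
  have htime : ∀ i, i < n + W → (i:ℝ) * θ ≤ T + 2 := fun i hi => by
    have : (i:ℝ) ≤ n + W := by exact_mod_cast hi.le
    have := mul_le_mul_of_nonneg_right this hθ0.le
    rw [add_mul] at this
    linarith
  have c3 : ∫ x, |b0 m U x| ≤ Cl := sch_l1' w p hg (n := 0) (by simp; linarith)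
  set E := ((δ * (Cl + Cl + Cl) * Z + h * Lc U * Z)
      + (4 * M * Z * (∫ x in ball (0 : Euc N) r, (ρ x + 1)) + 2 * M * (K * r ^ (-γ) + 1) * δ * (2 * Lc U))) with hE
  have sumG : ∑ i ∈ Finset.range (n + W), G i ≤ (n + W : ℕ) * (θ * (Lc U * Z) + E) := by
    have h1 : ∀ i ∈ Finset.range (n + W), G i ≤ θ * (∫ x, Aop δ (fun y => ∑ j ∈ Finset.range i, (vv m (sch ρ m δ h (b0 m U) (j / L)) y - vv m (sch ρ m η θ (b0 m U) j) y)) x *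
      (vv m (sch ρ m δ h (b0 m U) (i / L)) x - vv m (sch ρ m η θ (b0 m U) i) x)) + E := fun i hi => by
      have hi' := htime i (Finset.mem_range.1 hi)
      exact pair_bd w p p' hηδ hL hh hT hU hr0 i (sch_l1' w p hg ((hdiv i).trans hi')) (sch_l1' w p' hg hi') c3
    refine (Finset.sum_le_sum h1).trans ?_
    rw [Finset.sum_add_distrib, ← Finset.mul_sum, Finset.sum_const, Finset.card_range, nsmul_eq_mul]
    have hgo : ∀ i, Good Z (fun x => vv m (sch ρ m δ h (b0 m U) (i / L)) x - vv m (sch ρ m η θ (b0 m U) i) x) := fun i =>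
      ((sch_good w p hg (i / L)).vv hm.le).sub ((sch_good w p' hg i).vv hm.le)
    have := quad_bound p.d0 (fun i => (hgo i).1) (fun i => (hgo i).int) (fun i => pair_A w p p' hηδ hT hU (i / L) i) (n + W)
    have := mul_le_mul_of_nonneg_left this hθ0.le
    linarith
  have hcoer : ∀ j ∈ Finset.range W, g n ≤ (ε / 5 + C * G (n + j)) + (4 * s + h) * Lc U := fun j hj => by
    have hj' := Finset.mem_range.1 hj
    have t1 := pair_shift w p p' hL hh hT hU n j
    have hi' := htime (n + j) (by omega)
    have t2 := dd_coer w hm hR0 (by positivity) hC0 hC (sch_good w p hg ((n + j) / L)) (sch_good w p' hg (n + j))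
      (sch_mom0 w p hg ((hdiv (n + j)).trans hi')) (sch_mom0 w p' hg hi')
    have t3 : (2 * (j * θ) + h) * Lc U ≤ (4 * s + h) * Lc U := by
      have : (j:ℝ) ≤ W := by exact_mod_cast hj'.le
      have : (j:ℝ) * θ ≤ W * θ := by gcongr
      exact mul_le_mul_of_nonneg_right (by linarith) C0
    have t4 : ε / (10 * (I + 1)) * I + C * G (n + j) + (A + A) / R ^ 2 ≤ ε / 5 + C * G (n + j) := by linarith
    show g n ≤ _
    linarith [t1, t2, t3, t4]
  have hE0 : E ≤ d * ((Cl + Cl + Cl) * Z + Lc U * Z + 2 * M * (K * r ^ (-γ) + 1) * (2 * Lc U)) + 4 * M * Z * ((K * sph N γ + sph N 0) * r) := by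
    have j1 := w.J_bd hr0 hr1
    generalize hJ : ∫ x in ball (0 : Euc N) r, (ρ x + 1) = J at j1 hE
    clear_value E g G Z Cl A I D F d W
    have a1 : δ * (Cl + Cl + Cl) * Z ≤ d * (Cl + Cl + Cl) * Z := by gcongr
    have a2 : h * Lc U * Z ≤ d * Lc U * Z := by gcongr
    have a3 : 4 * M * Z * J ≤ 4 * M * Z * ((K * sph N γ + sph N 0) * r) := by gcongr
    have a4 : 2 * M * (K * r ^ (-γ) + 1) * δ * (2 * Lc U) ≤ 2 * M * (K * r ^ (-γ) + 1) * d * (2 * Lc U) := by gcongr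
    rw [hE]
    linarith
  have hE1 : 0 ≤ E := by
    have : 0 ≤ ∫ x in ball (0 : Euc N) r, (ρ x + 1) := integral_nonneg fun x => by have := w.pos x; simp only [Pi.zero_apply]; linarith
    generalize hJ : ∫ x in ball (0 : Euc N) r, (ρ x + 1) = J at this hE
    clear_value E g G Z Cl A I D F d W
    have := p.d0; have := p.h0
    rw [hE]
    positivity
  have hsum := Finset.sum_le_sum hcoer
  rw [Finset.sum_add_distrib, Finset.sum_add_distrib, ← Finset.mul_sum] at hsum
  simp only [Finset.sum_const, Finset.card_range, nsmul_eq_mul] at hsum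
  have hsub : ∑ j ∈ Finset.range W, G (n + j) ≤ ∑ i ∈ Finset.range (n + W), G i := by
    rw [Finset.sum_range_add]
    have : 0 ≤ ∑ i ∈ Finset.range n, G i := Finset.sum_nonneg fun i _ => GG_nn w hm _ _
    linarith
  clear_value E g G Z Cl A I D F d W
  have hnW : ((n + W : ℕ) : ℝ) ≤ W * ((T + 2) / s) := by
    push_cast
    have h1 : ((n:ℝ) + W) * s ≤ W * (T + 2) := by
      have h3 : ((n:ℝ) + W) * θ ≤ T + 2 := by rw [add_mul]; linarith
      have h2 : ((n:ℝ) + W) * s ≤ ((n:ℝ) + W) * (W * θ) := by gcongr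
      have h4 := mul_le_mul_of_nonneg_left h3 hWpos.le
      linarith
    rw [← mul_div_assoc, le_div_iff₀ hs0]; exact h1
  set X := θ * (Lc U * Z) + E with hX
  clear_value X
  have hX1 : X ≤ d * (Lc U * Z + ((Cl + Cl + Cl) * Z + Lc U * Z + 2 * M * (K * r ^ (-γ) + 1) * (2 * Lc U))) + 4 * M * Z * ((K * sph N γ + sph N 0) * r) := by
    rw [hX]
    have : θ * (Lc U * Z) ≤ d * (Lc U * Z) := by have := hθh.trans hhd; gcongr
    linarith
  have hX0 : 0 ≤ X := by rw [hX]; positivity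
  have hfin : W * g n ≤ W * (ε / 5 + D * X + (4 * s + h) * Lc U) := by
    have a1 : C * ∑ j ∈ Finset.range W, G (n + j) ≤ C * ((W * ((T + 2) / s)) * X) := by
      refine mul_le_mul_of_nonneg_left (hsub.trans (sumG.trans ?_)) hC0
      exact mul_le_mul_of_nonneg_right hnW hX0
    have a2 : C * ((W * ((T + 2) / s)) * X) = W * (D * X) := by rw [hD]; ring
    linarith
  have hfin' := le_of_mul_le_mul_left hfin hWpos
  have a5 : D * X ≤ D * (d * (Lc U * Z + ((Cl + Cl + Cl) * Z + Lc U * Z + 2 * M * (K * r ^ (-γ) + 1) * (2 * Lc U))) + 4 * M * Z * ((K * sph N γ + sph N 0) * r)) :=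
    mul_le_mul_of_nonneg_left hX1 D0
  have a6 : h * Lc U ≤ d * Lc U := by gcongr
  rw [← show g n = _ from congrFun hgd n]
  rw [hF] at hdF
  linarith

end

noncomputable section

variable {N : ℕ} {γ k K m δ h M : ℝ} {ρ : Euc N → ℝ}

lemma fast_conv {α : Type*} [MeasurableSpace α] {μ : Measure α} {q : α → ℝ} (hq : Measurable q) (hq0 : ∀ x, 0 < q x)
    {g : ℕ → α → ℝ} (hg : ∀ n, Measurable (g n)) {c : ℝ} (hc : 0 ≤ c)
    (h : ∀ n : ℕ, ∫⁻ x, ENNReal.ofReal (q x * |g (n + 1) x - g n x|) ∂μ ≤ ENNReal.ofReal (c * (1 / 2) ^ n)) :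
    (∀ᵐ x ∂μ, Tendsto (fun n => g n x) atTop (nhds (limsup (fun n => g n x) atTop))) ∧
    ∀ n : ℕ, ∫⁻ x, ENNReal.ofReal (q x * |limsup (fun n => g n x) atTop - g n x|) ∂μ ≤ ENNReal.ofReal (2 * c * (1 / 2) ^ n) := by
  set e : ℕ → α → ℝ≥0∞ := fun n x => ENNReal.ofReal (q x * |g (n + 1) x - g n x|) with he
  have hem : ∀ n, Measurable (e n) := fun n => (hq.mul ((hg (n + 1)).sub (hg n)).abs).ennreal_ofReal
  have htail : ∀ n : ℕ, ∫⁻ x, ∑' j, e (n + j) x ∂μ ≤ ENNReal.ofReal (2 * c * (1 / 2) ^ n) := fun n => by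
    rw [lintegral_tsum fun j => (hem _).aemeasurable]
    refine (ENNReal.tsum_le_tsum fun j => h (n + j)).trans ?_
    have hs : HasSum (fun j : ℕ => c * (1 / 2 : ℝ) ^ (n + j)) (2 * c * (1 / 2) ^ n) := by
      have := (hasSum_geometric_two).mul_left (c * (1 / 2 : ℝ) ^ n)
      rw [show 2 * c * (1 / 2 : ℝ) ^ n = c * (1 / 2 : ℝ) ^ n * 2 by ring]
      simpa only [pow_add, mul_assoc] using this
    rw [← hs.tsum_eq, ENNReal.ofReal_tsum_of_nonneg (fun j => by positivity) hs.summable]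
  have hfin : ∀ᵐ x ∂μ, ∑' j, e j x < ⊤ := by
    refine ae_lt_top (Measurable.tsum hem) ?_
    have := htail 0
    simp only [zero_add] at this
    exact ne_top_of_le_ne_top ENNReal.ofReal_ne_top this
  have hed : ∀ x n, edist (q x * g n x) (q x * g (n + 1) x) ≤ e n x := fun x n => by
    rw [edist_dist, Real.dist_eq, ← mul_sub, abs_mul, abs_of_pos (hq0 x), abs_sub_comm]
  have hlim : ∀ᵐ x ∂μ, Tendsto (fun n => g n x) atTop (nhds (limsup (fun n => g n x) atTop)) ∧
      ∀ n, ENNReal.ofReal (q x * |limsup (fun n => g n x) atTop - g n x|) ≤ ∑' j, e (n + j) x := by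
    filter_upwards [hfin] with x hx
    have hcs := cauchySeq_of_edist_le_of_tsum_ne_top (fun n => e n x) (hed x) hx.ne
    obtain ⟨a, ha⟩ := cauchySeq_tendsto_of_complete hcs
    have hg' : Tendsto (fun n => g n x) atTop (nhds (a / q x)) := by
      refine (ha.div_const (q x)).congr fun n => ?_
      field_simp [(hq0 x).ne']
    have hl : limsup (fun n => g n x) atTop = a / q x := hg'.limsup_eq
    rw [hl]
    refine ⟨hg', fun n => ?_⟩
    have := edist_le_tsum_of_edist_le_of_tendsto (fun n => e n x) (hed x) ha n
    refine le_trans (le_of_eq ?_) this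
    rw [edist_dist, Real.dist_eq, abs_sub_comm]
    congr 1
    have h0 := hq0 x
    rw [← abs_of_pos h0, ← abs_mul, abs_of_pos h0]; congr 1; field_simp
  refine ⟨hlim.mono fun x hx => hx.1, fun n => ?_⟩
  exact (lintegral_mono_ae (hlim.mono fun x hx => hx.2 n)).trans (htail n)

/-- measurable with finite weighted integral -/
def Ok (ρ u : Euc N → ℝ) : Prop := Measurable u ∧ Integrable (fun x => ρ x * u x)

lemma Good.ok (w : Wt γ k K ρ) {u : Euc N → ℝ} (hu : Good M u) : Ok ρ u := ⟨hu.1.1, w.bm_int hu.int hu.1⟩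

lemma dd0_int (w : Wt γ k K ρ) {u v : Euc N → ℝ} (hu : Ok ρ u) (hv : Ok ρ v) : Integrable (fun x => ρ x * |u x - v x|) := by
  refine (hu.2.sub hv.2).mono (w.meas.mul (hu.1.sub hv.1).abs).aestronglyMeasurable (ae_of_all _ fun x => ?_)
  simp only [Pi.sub_apply]
  rw [← mul_sub]; simp [abs_mul]

lemma dd0_def (u v : Euc N → ℝ) : dd ρ 0 u v = ∫ x, ρ x * |u x - v x| := by simp [dd]

lemma dd0_tri (w : Wt γ k K ρ) {u v z : Euc N → ℝ} (hu : Ok ρ u) (hv : Ok ρ v) (hz : Ok ρ z) :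
    dd ρ 0 u z ≤ dd ρ 0 u v + dd ρ 0 v z := by
  simp only [dd0_def]
  rw [← integral_add (dd0_int w hu hv) (dd0_int w hv hz)]
  refine integral_mono (dd0_int w hu hz) ((dd0_int w hu hv).add (dd0_int w hv hz)) fun x => ?_
  simp only [Pi.add_apply]
  rw [← mul_add]
  exact mul_le_mul_of_nonneg_left (abs_sub_le _ _ _) (w.pos x).le

/-- parameters of the scheme -/
def ds (i : ℕ) : ℝ := (1 / 2) ^ i
def cs (m : ℝ) (j : ℕ) : ℝ := (1 / 2 : ℝ) ^ m * ds j ^ 2 / (m * ((j : ℝ) + 1) ^ (m - 1) + 1)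
def kk (m : ℝ) (i : ℕ) : ℕ := ∑ j ∈ Finset.range (i + 1), (⌈1 / cs m j⌉₊ + 1)
def hs (m : ℝ) (i : ℕ) : ℝ := (1 / 2) ^ (kk m i)

lemma ds_pos (i : ℕ) : 0 < ds i := by unfold ds; positivity
lemma hs_pos (m : ℝ) (i : ℕ) : 0 < hs m i := by unfold hs; positivity
lemma ds_tend : Tendsto ds atTop (nhds 0) := tendsto_pow_atTop_nhds_zero_of_lt_one (by norm_num) (by norm_num)

lemma cs_pos (hm : 1 < m) (j : ℕ) : 0 < cs m j := by
  unfold cs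
  have := ds_pos j
  have : (0:ℝ) < (1 / 2 : ℝ) ^ m := Real.rpow_pos_of_pos (by norm_num) _
  positivity

lemma kk_mono {i j : ℕ} (hij : i ≤ j) : kk m i ≤ kk m j :=
  Finset.sum_le_sum_of_subset (Finset.range_subset_range.2 (by omega))

lemma kk_ge (i : ℕ) : i ≤ kk m i := by
  unfold kk
  calc i ≤ ∑ j ∈ Finset.range (i + 1), 1 := by simp
    _ ≤ _ := Finset.sum_le_sum fun j _ => by omega

lemma hs_le (hm : 1 < m) (i : ℕ) : hs m i ≤ cs m i := by
  have h1 : ⌈1 / cs m i⌉₊ ≤ kk m i := by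
    unfold kk
    rw [Finset.sum_range_succ]; omega
  have h2 : 1 / cs m i ≤ (2:ℝ) ^ (kk m i) := by
    refine (Nat.le_ceil _).trans ?_
    have : ⌈1 / cs m i⌉₊ ≤ 2 ^ kk m i := h1.trans Nat.lt_two_pow_self.le
    exact_mod_cast this
  have h3 := cs_pos hm i
  unfold hs
  rw [one_div_pow]
  rw [div_le_iff₀ h3] at h2
  rw [div_le_iff₀ (by positivity)]
  linarith

lemma hs_ds (i : ℕ) : hs m i ≤ ds i := by
  unfold hs ds
  exact pow_le_pow_of_le_one (by norm_num) (by norm_num) (kk_ge i)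

lemma hs_tend : Tendsto (hs m) atTop (nhds 0) :=
  squeeze_zero (fun i => (hs_pos m i).le) hs_ds ds_tend

lemma par_i (hm : 1 < m) (hM : 0 ≤ M) {i : ℕ} (hi : M ≤ i + 1) : Par m (ds i) (hs m i) M := by
  refine ⟨hm, ds_pos i, pow_le_one₀ (by norm_num) (by norm_num), hs_pos m i, hM, ?_⟩
  have h1 := hs_le hm i
  have h2 : m * M ^ (m - 1) ≤ m * ((i:ℝ) + 1) ^ (m - 1) + 1 := by
    have := Real.rpow_le_rpow hM hi (by linarith : 0 ≤ m - 1)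
    have := mul_le_mul_of_nonneg_left this (by linarith : 0 ≤ m)
    linarith
  have hp : 0 < m * ((i:ℝ) + 1) ^ (m - 1) + 1 := by positivity
  calc hs m i * (m * M ^ (m - 1)) ≤ cs m i * (m * ((i:ℝ) + 1) ^ (m - 1) + 1) :=
        mul_le_mul h1 h2 (mul_nonneg (by linarith) (Real.rpow_nonneg hM _)) (cs_pos hm i).le
    _ = _ := by unfold cs; field_simp

def us (ρ : Euc N → ℝ) (m : ℝ) (U : Euc N → ℝ) (i : ℕ) (t : ℝ) : Euc N → ℝ := sch ρ m (ds i) (hs m i) (b0 m U) ⌊t / hs m i⌋₊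

lemma us_cauchy (w : Wt γ k K ρ) (hm : 1 < m) (hM : 0 ≤ M) {U : Euc N → ℝ} (hT : Test U) (hU : ∀ x, |U x| ≤ M ^ m)
    {T : ℝ} (hT0 : 0 ≤ T) {ε : ℝ} (hε : 0 < ε) :
    ∃ I : ℕ, ∀ i j : ℕ, I ≤ i → i ≤ j → ∀ t : ℝ, 0 ≤ t → t ≤ T → dd ρ 0 (us ρ m U i t) (us ρ m U j t) ≤ ε := by
  obtain ⟨d, hd, H⟩ := sch_cauchy w hm hM hT hU hT0 hε
  obtain ⟨I, hI⟩ := (ds_tend.eventually (gt_mem_nhds hd)).exists_forall_of_atTop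
  refine ⟨max I ⌈M⌉₊, fun i j hi hij t ht0 htT => ?_⟩
  have hMi : M ≤ i + 1 := by
    have := (Nat.le_ceil M)
    have h2 : (⌈M⌉₊ : ℝ) ≤ i := by exact_mod_cast (le_max_right _ _).trans hi
    linarith
  have hMj : M ≤ j + 1 := by
    have : (i:ℝ) ≤ j := by exact_mod_cast hij
    linarith
  rcases hij.eq_or_lt with rfl | hlt
  · rw [dd_self]; exact hε.le
  have hd' := hI i ((le_max_left _ _).trans hi)
  have hL : hs m i = (2 ^ (kk m j - kk m i) : ℕ) * hs m j := by
    unfold hs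
    push_cast
    have := kk_mono (m := m) hij
    conv_rhs => rw [show kk m j = (kk m j - kk m i) + kk m i by omega, pow_add]
    simp only [Nat.add_sub_cancel]
    rw [← mul_assoc, ← mul_pow]; norm_num
  have hfl : ⌊t / hs m i⌋₊ = ⌊t / hs m j⌋₊ / 2 ^ (kk m j - kk m i) := by
    rw [← Nat.floor_div_natCast, hL, div_div, mul_comm]
  unfold us
  rw [hfl]
  refine H _ _ _ _ _ (par_i hm hM hMi) (par_i hm hM hMj) ?_ (by positivity) hL hd'.le ((hs_ds i).trans hd'.le) _ ?_
  · exact pow_lt_pow_right_of_lt_one₀ (by norm_num) (by norm_num) hlt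
  · have := hs_pos m j
    have h1 := Nat.floor_le (a := t / hs m j) (by positivity)
    rw [le_div_iff₀ this] at h1
    linarith

/-- `u` is the limit of the scheme with data `b0 m U` -/
structure Lim (ρ : Euc N → ℝ) (m M : ℝ) (U : Euc N → ℝ) (u : ℝ → Euc N → ℝ) : Prop where
  meas : Measurable (fun p : Euc N × ℝ => u p.2 p.1)
  bd : ∀ t, BM M (u t)
  int : ∀ t, 0 ≤ t → Integrable (fun x => ρ x * u t x)
  zero : u 0 = b0 m U
  conv : ∀ T ε : ℝ, 0 ≤ T → 0 < ε → ∃ I : ℕ, ∀ i, I ≤ i → ∀ t, 0 ≤ t → t ≤ T → dd ρ 0 (us ρ m U i t) (u t) ≤ ε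

lemma us_good (w : Wt γ k K ρ) (hm : 1 < m) (hM : 0 ≤ M) {U : Euc N → ℝ} (hT : Test U) (hU : ∀ x, |U x| ≤ M ^ m)
    {i : ℕ} (hi : M ≤ i + 1) (t : ℝ) : Good M (us ρ m U i t) := sch_good w (par_i hm hM hi) (b0_good hm hM hT hU) _

lemma limsup_bd {f : ℕ → ℝ} (h : ∀ n, |f n| ≤ M) : |limsup f atTop| ≤ M := by
  have hb : IsBoundedUnder (· ≤ ·) atTop f := isBoundedUnder_of ⟨M, fun n => (abs_le.1 (h n)).2⟩
  have hb' : IsBoundedUnder (· ≥ ·) atTop f := isBoundedUnder_of ⟨-M, fun n => (abs_le.1 (h n)).1⟩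
  refine abs_le.2 ⟨?_, ?_⟩
  · exact le_limsup_of_frequently_le (Frequently.of_forall fun n => (abs_le.1 (h n)).1) hb
  · exact limsup_le_of_le hb'.isCoboundedUnder_le (Eventually.of_forall fun n => (abs_le.1 (h n)).2)

theorem base_limit (w : Wt γ k K ρ) (hm : 1 < m) (hM : 0 ≤ M) {U : Euc N → ℝ} (hT : Test U) (hU : ∀ x, |U x| ≤ M ^ m) :
    ∃ u, Lim ρ m M U u := by
  have hc := fun n : ℕ => us_cauchy w hm hM hT hU (T := n) (by positivity) (ε := (1 / 2) ^ n) (by positivity)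
  choose I hI using hc
  set φ : ℕ → ℕ := fun n => ∑ j ∈ Finset.range (n + 1), (I j) + ⌈M⌉₊ + n with hφ
  have hφm : ∀ n, φ n ≤ φ (n + 1) := fun n => by
    simp only [hφ]; rw [Finset.sum_range_succ _ (n + 1)]; omega
  have hφI : ∀ n, I n ≤ φ n := fun n => by
    simp only [hφ]; rw [Finset.sum_range_succ]; omega
  have hφM : ∀ n, M ≤ φ n + 1 := fun n => by
    have := (Nat.le_ceil M)
    have h2 : (⌈M⌉₊ : ℝ) ≤ φ n := by exact_mod_cast (show ⌈M⌉₊ ≤ φ n by simp only [hφ]; omega)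
    linarith
  have hφn : ∀ n, n ≤ φ n := fun n => by simp only [hφ]; omega
  clear_value φ
  have hgood := fun n t => us_good w hm hM hT hU (hφM n) t
  set u : ℝ → Euc N → ℝ := fun t x => limsup (fun n => us ρ m U (φ n) t x) atTop with hu
  have hbd : ∀ t, BM M (u t) := fun t =>
    ⟨Measurable.limsup fun n => (hgood n t).1.1, fun x => limsup_bd fun n => (hgood n t).1.2 x⟩
  have e0 : ∀ t f g, dd ρ 0 (us ρ m U f t) (us ρ m U g t) = ∫ x, ρ x * |us ρ m U f t x - us ρ m U g t x| := fun t f g => by simp [dd]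
  have key : ∀ t : ℝ, 0 ≤ t → ∀ n : ℕ, t ≤ n → ∫⁻ x, ENNReal.ofReal (ρ x * |u t x - us ρ m U (φ n) t x|) ≤ ENNReal.ofReal (2 * (1 / 2) ^ n) := by
    intro t ht n hn
    have hf := fast_conv (μ := (volume : Measure (Euc N))) w.meas w.pos (g := fun j => us ρ m U (φ (n + j)) t) (fun j => (hgood (n + j) t).1.1) (c := (1 / 2) ^ n) (by positivity) (fun j => by
      have hi := w.dd_int 0 (hgood (n + (j + 1)) t) (hgood (n + j) t)
      simp only [add_zero] at hi
      rw [← ofReal_integral_eq_lintegral_ofReal hi (ae_of_all _ fun x => mul_nonneg (w.pos x).le (abs_nonneg _))]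
      rw [← pow_add]
      refine ENNReal.ofReal_le_ofReal ?_
      rw [← e0, dd_comm]
      exact hI (n + j) _ _ (hφI _) (hφm _) t ht (by push_cast; linarith [Nat.cast_nonneg (α := ℝ) j]))
    have h2 := hf.2 0
    have e : ∀ x, limsup (fun j => us ρ m U (φ (n + j)) t x) atTop = u t x := fun x => by
      simp only [hu]
      rw [← Filter.limsup_nat_add (fun j => us ρ m U (φ j) t x) n]
      simp_rw [add_comm]
    simp only [e] at h2
    simpa using h2
  have hint : ∀ t : ℝ, 0 ≤ t → ∀ n : ℕ, t ≤ n → Integrable (fun x => ρ x * |u t x - us ρ m U (φ n) t x|) ∧ ∫ x, ρ x * |u t x - us ρ m U (φ n) t x| ≤ 2 * (1 / 2) ^ n := by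
    intro t ht n hn
    have hk := key t ht n hn
    have hms : Measurable (fun x => ρ x * |u t x - us ρ m U (φ n) t x|) := w.meas.mul ((hbd t).1.sub (hgood n t).1.1).abs
    have hnn : ∀ x, 0 ≤ ρ x * |u t x - us ρ m U (φ n) t x| := fun x => mul_nonneg (w.pos x).le (abs_nonneg _)
    have hi : Integrable (fun x => ρ x * |u t x - us ρ m U (φ n) t x|) := by
      refine ⟨hms.aestronglyMeasurable, ?_⟩
      rw [hasFiniteIntegral_iff_ofReal (ae_of_all _ hnn)]
      exact lt_of_le_of_lt hk ENNReal.ofReal_lt_top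
    refine ⟨hi, ?_⟩
    rw [← ofReal_integral_eq_lintegral_ofReal hi (ae_of_all _ hnn)] at hk
    exact (ENNReal.ofReal_le_ofReal_iff (by positivity)).1 hk
  have huint : ∀ t, 0 ≤ t → Integrable (fun x => ρ x * u t x) := fun t ht => by
    obtain ⟨n, hn⟩ := exists_nat_ge t
    have h1 := (hint t ht n hn).1
    have h2 := w.bm_int (hgood n t).int (hgood n t).1
    have h3 : Integrable (fun x => ρ x * (u t x - us ρ m U (φ n) t x)) := by
      refine h1.mono (w.meas.mul ((hbd t).1.sub (hgood n t).1.1)).aestronglyMeasurable (ae_of_all _ fun x => ?_)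
      simp
    refine (h3.add h2).congr (ae_of_all _ fun x => ?_)
    simp only [Pi.add_apply]; ring
  refine ⟨u, ?_, hbd, huint, ?_, fun T ε hT0 hε => ?_⟩
  · refine Measurable.limsup fun n => ?_
    have h1 : Measurable (fun p : Euc N × ℕ => sch ρ m (ds (φ n)) (hs m (φ n)) (b0 m U) p.2 p.1) :=
      measurable_from_prod_countable_left fun j => (sch_good w (par_i hm hM (hφM n)) (b0_good hm hM hT hU) j).1.1
    exact h1.comp (measurable_fst.prodMk (Nat.measurable_floor.comp (measurable_snd.div_const _)))
  · ext x
    simp [hu, us, sch]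
  · obtain ⟨I0, hI0⟩ := us_cauchy w hm hM hT hU hT0 (half_pos hε)
    refine ⟨max I0 ⌈M⌉₊, fun i hi t ht0 htT => ?_⟩
    have hMi : M ≤ i + 1 := by
      have := (Nat.le_ceil M)
      have h2 : (⌈M⌉₊ : ℝ) ≤ i := by exact_mod_cast (le_max_right _ _).trans hi
      linarith
    have hgi := us_good w hm hM hT hU hMi t
    have hTn : ∀ᶠ n : ℕ in atTop, t ≤ n ∧ 2 * (1 / 2 : ℝ) ^ n ≤ ε / 2 := by
      have h1 : ∀ᶠ n : ℕ in atTop, t ≤ n := tendsto_natCast_atTop_atTop.eventually_ge_atTop t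
      have h2 : Tendsto (fun n : ℕ => 2 * (1 / 2 : ℝ) ^ n) atTop (nhds (2 * 0)) := (_root_.tendsto_pow_atTop_nhds_zero_of_lt_one (r := (1 / 2 : ℝ)) (by norm_num) (by norm_num)).const_mul 2
      rw [mul_zero] at h2
      exact h1.and ((h2.eventually (gt_mem_nhds (half_pos hε))).mono fun n hn => hn.le)
    obtain ⟨n, hn, hni⟩ := (hTn.and (eventually_ge_atTop i)).exists
    obtain ⟨hn1, hn2⟩ := hn
    obtain ⟨j1, j2⟩ := hint t ht0 n hn1
    have hmain : dd ρ 0 (us ρ m U i t) (us ρ m U (φ n) t) ≤ ε / 2 :=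
      hI0 i _ ((le_max_left _ _).trans hi) (hni.trans (hφn n)) t ht0 htT
    have h3 := dd0_tri w (hgi.ok w) ((hgood n t).ok w) ⟨(hbd t).1, huint t ht0⟩
    have h4 : dd ρ 0 (us ρ m U (φ n) t) (u t) ≤ ε / 2 := by
      rw [dd_comm]; unfold dd; simp only [add_zero]; exact j2.trans hn2
    linarith

end

noncomputable section

variable {N : ℕ} {γ k K m δ h M : ℝ} {ρ : Euc N → ℝ}

lemma test_wt (w : Wt γ k K ρ) {ψ : Euc N → ℝ} (hψ : Test ψ) : ∃ C, 0 ≤ C ∧ ∀ x, |ψ x| ≤ C * ρ x := by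
  obtain ⟨B, hB0, hB⟩ := hψ.bdd
  obtain ⟨R, hR⟩ := hψ.2.isCompact.isBounded.subset_ball 0
  have hk := w.k0
  set R' := max R 0
  have hR0 : 0 ≤ R' := le_max_right _ _
  refine ⟨B / (k * (1 + R') ^ (-γ)), by positivity, fun x => ?_⟩
  by_cases hx : ψ x = 0
  · rw [hx, abs_zero]; have := w.pos x; positivity
  have hx' : ‖x‖ < R := by simpa using hR (subset_tsupport _ hx)
  have h1 : k * (1 + R') ^ (-γ) ≤ ρ x := by
    refine le_trans (mul_le_mul_of_nonneg_left ?_ hk.le) (w.lo x)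
    refine Real.rpow_le_rpow_of_nonpos (by positivity) (by linarith [le_max_left R 0]) (by linarith [w.g0])
  rw [div_mul_eq_mul_div, le_div_iff₀ (by positivity)]
  exact mul_le_mul (hB x) h1 (by positivity) hB0

/-- admissible nonlinearities -/
structure Adm (M Λ : ℝ) (G : ℝ → ℝ → ℝ) : Prop where
  meas : Measurable (fun p : ℝ × ℝ => G p.1 p.2)
  nn : 0 ≤ Λ
  lip : ∀ a b a' b', |a| ≤ M → |b| ≤ M → |a'| ≤ M → |b'| ≤ M → |G a b - G a' b'| ≤ Λ * (|a - a'| + |b - b'|)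
  bd : ∀ a b, |a| ≤ M → |b| ≤ M → |G a b| ≤ Λ * (|a| + |b|)

lemma adm_id : Adm M 1 (fun a _ => a) :=
  ⟨measurable_fst, zero_le_one, fun a b a' b' _ _ _ _ => by linarith [abs_nonneg (b - b')], fun a b _ _ => by linarith [abs_nonneg b]⟩

lemma adm_sub : Adm M 1 (fun a b => |a - b|) := by
  refine ⟨(measurable_fst.sub measurable_snd).abs, zero_le_one, fun a b a' b' _ _ _ _ => ?_, fun a b _ _ => ?_⟩
  · have h1 := abs_abs_sub_abs_le_abs_sub (a - b) (a' - b')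
    have h2 := abs_sub (a - a') (b - b')
    rw [show a - b - (a' - b') = a - a' - (b - b') by ring] at h1
    linarith
  · rw [abs_abs]; linarith [abs_sub a b]

lemma adm_pow (hm : 1 < m) (hM : 0 ≤ M) : Adm M (m * M ^ (m - 1)) (fun a _ => spow m a) := by
  have h0 : 0 ≤ m * M ^ (m - 1) := mul_nonneg (by linarith) (Real.rpow_nonneg hM _)
  refine ⟨(spow_meas m).comp measurable_fst, h0, fun a b a' b' ha _ ha' _ => ?_, fun a b ha _ => ?_⟩
  · refine (spow_lip hm.le ha ha').trans (mul_le_mul_of_nonneg_left ?_ h0)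
    linarith [abs_nonneg (b - b')]
  · have := spow_lip hm.le ha (b := 0) (by simpa using hM)
    rw [spow_zero, sub_zero, sub_zero] at this
    refine this.trans (mul_le_mul_of_nonneg_left ?_ h0)
    linarith [abs_nonneg b]

lemma adm_powsub (hm : 1 < m) (hM : 0 ≤ M) : Adm M (m * M ^ (m - 1)) (fun a b => |spow m a - spow m b|) := by
  have h0 : 0 ≤ m * M ^ (m - 1) := mul_nonneg (by linarith) (Real.rpow_nonneg hM _)
  refine ⟨(((spow_meas m).comp measurable_fst).sub ((spow_meas m).comp measurable_snd)).abs, h0, fun a b a' b' ha hb ha' hb' => ?_, fun a b ha hb => ?_⟩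
  · have h1 := abs_abs_sub_abs_le_abs_sub (spow m a - spow m b) (spow m a' - spow m b')
    have h2 := abs_sub (spow m a - spow m a') (spow m b - spow m b')
    rw [show spow m a - spow m b - (spow m a' - spow m b') = spow m a - spow m a' - (spow m b - spow m b') by ring] at h1
    have h3 := spow_lip hm.le ha ha'
    have h4 := spow_lip hm.le hb hb'
    linarith
  · have := spow_lip hm.le ha hb
    rw [abs_abs]
    refine this.trans (mul_le_mul_of_nonneg_left (abs_sub a b) h0)

section
variable {Λ : ℝ} {G : ℝ → ℝ → ℝ}

lemma Adm.meas' (hG : Adm M Λ G) {u v : Euc N → ℝ} (hu : Measurable u) (hv : Measurable v) : Measurable (fun x => G (u x) (v x)) :=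
  hG.meas.comp (hu.prodMk hv)

lemma Adm.int (hG : Adm M Λ G) {u v : Euc N → ℝ} (hu : Good M u) (hv : Good M v) :
    Integrable (fun x => G (u x) (v x)) ∧ ∫ x, |G (u x) (v x)| ≤ Λ * ((∫ x, |u x|) + ∫ x, |v x|) := by
  have i0 : Integrable (fun x => Λ * (|u x| + |v x|)) := (hu.int.abs.add hv.int.abs).const_mul Λ
  have hb := fun x => hG.bd _ _ (hu.1.2 x) (hv.1.2 x)
  have i1 : Integrable (fun x => G (u x) (v x)) := i0.mono' (hG.meas' hu.1.1 hv.1.1).aestronglyMeasurable (ae_of_all _ hb)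
  refine ⟨i1, ?_⟩
  rw [← integral_add hu.int.abs hv.int.abs, ← integral_const_mul]
  exact integral_mono i1.abs i0 hb

lemma Adm.bm (hG : Adm M Λ G) {u v : Euc N → ℝ} (hu : BM M u) (hv : BM M v) : BM (Λ * (M + M)) (fun x => G (u x) (v x)) :=
  ⟨hG.meas' hu.1 hv.1, fun x => (hG.bd _ _ (hu.2 x) (hv.2 x)).trans (mul_le_mul_of_nonneg_left (add_le_add (hu.2 x) (hv.2 x)) hG.nn)⟩

/-- weighted difference bound -/
lemma Adm.diff (w : Wt γ k K ρ) (hG : Adm M Λ G) {u v u' v' : Euc N → ℝ} (hu : BM M u) (hv : BM M v) (hu' : BM M u') (hv' : BM M v')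
    (ou : Ok ρ u) (ov : Ok ρ v) (ou' : Ok ρ u') (ov' : Ok ρ v') {C : ℝ} (hC : 0 ≤ C) {ψ : Euc N → ℝ} (hψm : Measurable ψ) (hψ : ∀ x, |ψ x| ≤ C * ρ x) :
    Integrable (fun x => (G (u x) (v x) - G (u' x) (v' x)) * ψ x) ∧
    |∫ x, (G (u x) (v x) - G (u' x) (v' x)) * ψ x| ≤ Λ * C * (dd ρ 0 u u' + dd ρ 0 v v') := by
  have i1 : Integrable (fun x => Λ * C * (ρ x * |u x - u' x| + ρ x * |v x - v' x|)) :=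
    ((dd0_int w ou ou').add (dd0_int w ov ov')).const_mul _
  have hb : ∀ x, ‖(G (u x) (v x) - G (u' x) (v' x)) * ψ x‖ ≤ Λ * C * (ρ x * |u x - u' x| + ρ x * |v x - v' x|) := fun x => by
    rw [Real.norm_eq_abs, abs_mul]
    have h1 := hG.lip _ _ _ _ (hu.2 x) (hv.2 x) (hu'.2 x) (hv'.2 x)
    calc _ ≤ (Λ * (|u x - u' x| + |v x - v' x|)) * (C * ρ x) := mul_le_mul h1 (hψ x) (abs_nonneg _) (mul_nonneg hG.nn (by positivity))
      _ = _ := by ring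
  refine ⟨i1.mono' (((hG.meas' hu.1 hv.1).sub (hG.meas' hu'.1 hv'.1)).mul hψm).aestronglyMeasurable (ae_of_all _ hb), ?_⟩
  refine (norm_integral_le_of_norm_le i1 (ae_of_all _ hb)).trans (le_of_eq ?_)
  rw [integral_const_mul, integral_add (dd0_int w ou ou') (dd0_int w ov ov'), dd0_def, dd0_def]

lemma Lim.ok {U : Euc N → ℝ} {u : ℝ → Euc N → ℝ} (l : Lim ρ m M U u) {t : ℝ} (ht : 0 ≤ t) : Ok ρ (u t) := ⟨(l.bd t).1, l.int t ht⟩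

lemma Lim.mono {U : Euc N → ℝ} {u : ℝ → Euc N → ℝ} (l : Lim ρ m M U u) {M' : ℝ} (h : M ≤ M') : Lim ρ m M' U u :=
  ⟨l.meas, fun t => (l.bd t).mono h, l.int, l.zero, l.conv⟩

lemma floor_mul_le (i : ℕ) {t : ℝ} (ht : 0 ≤ t) : ⌊t / hs m i⌋₊ * hs m i ≤ t := by
  have := hs_pos m i
  have h1 := Nat.floor_le (a := t / hs m i) (by positivity)
  rwa [le_div_iff₀ this] at h1

lemma floor_mul_ge (i : ℕ) (t : ℝ) : t - hs m i ≤ ⌊t / hs m i⌋₊ * hs m i := by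
  have := hs_pos m i
  have h1 := (Nat.lt_floor_add_one (t / hs m i)).le
  rw [div_le_iff₀ this] at h1
  linarith

lemma floor_tend {t : ℝ} (ht : 0 ≤ t) : Tendsto (fun i => (⌊t / hs m i⌋₊ : ℝ) * hs m i) atTop (nhds t) := by
  have : Tendsto (fun i => t - hs m i) atTop (nhds (t - 0)) := hs_tend.const_sub t
  rw [sub_zero] at this
  exact tendsto_of_tendsto_of_tendsto_of_le_of_le this tendsto_const_nhds (fun i => floor_mul_ge i t) (fun i => floor_mul_le i ht)

lemma ev_M (M : ℝ) : ∀ᶠ i : ℕ in atTop, M ≤ i + 1 := by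
  filter_upwards [tendsto_natCast_atTop_atTop.eventually_ge_atTop M] with i hi
  linarith

lemma Lim.tend (w : Wt γ k K ρ) {U : Euc N → ℝ} {u : ℝ → Euc N → ℝ} (l : Lim ρ m M U u) {t : ℝ} (ht : 0 ≤ t) :
    Tendsto (fun i => dd ρ 0 (us ρ m U i t) (u t)) atTop (nhds 0) := by
  rw [Metric.tendsto_atTop]
  intro ε hε
  obtain ⟨I, hI⟩ := l.conv t (ε / 2) ht (by linarith)
  refine ⟨I, fun i hi => ?_⟩
  rw [Real.dist_eq, sub_zero, abs_of_nonneg (w.dd_nn le_rfl _ _)]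
  linarith [hI i hi t ht le_rfl]

variable {U V : Euc N → ℝ} {u v : ℝ → Euc N → ℝ}

/-- data for a pair of limits -/
structure Two (γ k K : ℝ) (ρ : Euc N → ℝ) (m M : ℝ) (U V : Euc N → ℝ) (u v : ℝ → Euc N → ℝ) : Prop where
  w : Wt γ k K ρ
  hm : 1 < m
  hM : 0 ≤ M
  hU : Test U
  bU : ∀ x, |U x| ≤ M ^ m
  hV : Test V
  bV : ∀ x, |V x| ≤ M ^ m
  lu : Lim ρ m M U u
  lv : Lim ρ m M V v

lemma Two.us_l1 (H : Two γ k K ρ m M U V u v) {i : ℕ} (hi : M ≤ i + 1) {t T : ℝ} (ht : 0 ≤ t) (htT : t ≤ T) :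
    ∫ x, |us ρ m U i t x| ≤ 2 / k * Mo ρ k m M (b0 m U) T :=
  sch_l1' H.w (par_i H.hm H.hM hi) (b0_good H.hm H.hM H.hU H.bU) ((floor_mul_le i ht).trans htT)

lemma Two.symm (H : Two γ k K ρ m M U V u v) : Two γ k K ρ m M V U v u := ⟨H.w, H.hm, H.hM, H.hV, H.bV, H.hU, H.bU, H.lv, H.lu⟩
lemma Two.diag (H : Two γ k K ρ m M U V u v) : Two γ k K ρ m M U U u u := ⟨H.w, H.hm, H.hM, H.hU, H.bU, H.hU, H.bU, H.lu, H.lu⟩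

theorem test_close (H : Two γ k K ρ m M U V u v) (hG : Adm M Λ G) {φ : Euc N → ℝ} (hφ : Test φ) {T ε : ℝ} (hT : 0 ≤ T) (hε : 0 < ε) :
    ∃ I : ℕ, ∀ i, I ≤ i → ∀ t, 0 ≤ t → t ≤ T →
      |(∫ x, G (us ρ m U i t x) (us ρ m V i t x) * Aop (ds i) φ x) - ∫ x, G (u t x) (v t x) * lap φ x| ≤ ε := by
  obtain ⟨w, hm, hM, hU, bU, hV, bV, lu, lv⟩ := id H
  obtain ⟨B, hB0, hB⟩ := hφ.third_bdd
  obtain ⟨C, hC0, hC⟩ := test_wt w hφ.lap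
  set Z := 2 / k * Mo ρ k m M (b0 m U) T + 2 / k * Mo ρ k m M (b0 m V) T with hZ
  set Q := (N:ℝ) ^ 3 * B * M3 N with hQ
  have hη : 0 < ε / (4 * (Λ * C + 1)) := by have := hG.nn; positivity
  obtain ⟨I1, hI1⟩ := lu.conv T _ hT hη
  obtain ⟨I2, hI2⟩ := lv.conv T _ hT hη
  obtain ⟨I3, hI3⟩ := (ev_M M).exists_forall_of_atTop
  have htend : Tendsto (fun i => Q * √(ds i) * (Λ * Z)) atTop (nhds (Q * √0 * (Λ * Z))) :=
    (((Real.continuous_sqrt.tendsto 0).comp ds_tend).const_mul Q).mul_const _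
  simp only [Real.sqrt_zero, mul_zero, zero_mul] at htend
  obtain ⟨I4, hI4⟩ := (htend.eventually (gt_mem_nhds (half_pos hε))).exists_forall_of_atTop
  refine ⟨max (max I1 I2) (max I3 I4), fun i hi t ht htT => ?_⟩
  simp only [max_le_iff] at hi
  obtain ⟨⟨i1, i2⟩, i3, i4⟩ := hi
  have hMi := hI3 i i3
  have gu := us_good w hm hM hU bU hMi t
  have gv := us_good w hm hM hV bV hMi t
  obtain ⟨j1, j2⟩ := hG.int gu gv
  obtain ⟨d1, d2⟩ := hG.diff w gu.1 gv.1 (lu.bd t) (lv.bd t) (gu.ok w) (gv.ok w) (lu.ok ht) (lv.ok ht) hC0 hφ.lap.1.continuous.measurable hC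
  obtain ⟨CL, hCL0, hCL⟩ := hφ.lap.BM
  obtain ⟨Cφ, hCφ0, hCφ⟩ := hφ.BM
  have hA := hCφ.Aop (ds_pos i)
  have k1 : Integrable (fun x => G (us ρ m U i t x) (us ρ m V i t x) * Aop (ds i) φ x) := j1.mul_bdd hA.1.aestronglyMeasurable (ae_of_all _ hA.2)
  have k2 : Integrable (fun x => G (us ρ m U i t x) (us ρ m V i t x) * lap φ x) := j1.mul_bdd hCL.1.aestronglyMeasurable (ae_of_all _ hCL.2)
  have k3 : Integrable (fun x => G (u t x) (v t x) * lap φ x) := by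
    refine (k2.sub d1).congr (ae_of_all _ fun x => ?_)
    simp only [Pi.sub_apply]; ring
  have e1 : ∫ x, (G (us ρ m U i t x) (us ρ m V i t x) - G (u t x) (v t x)) * lap φ x
      = (∫ x, G (us ρ m U i t x) (us ρ m V i t x) * lap φ x) - ∫ x, G (u t x) (v t x) * lap φ x := by
    rw [← integral_sub k2 k3]; congr 1; ext x; ring
  have e2 : |(∫ x, G (us ρ m U i t x) (us ρ m V i t x) * Aop (ds i) φ x) - ∫ x, G (us ρ m U i t x) (us ρ m V i t x) * lap φ x| ≤ Q * √(ds i) * (Λ * Z) := by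
    rw [← integral_sub k1 k2]
    have hb : ∀ x, ‖G (us ρ m U i t x) (us ρ m V i t x) * Aop (ds i) φ x - G (us ρ m U i t x) (us ρ m V i t x) * lap φ x‖ ≤ Q * √(ds i) * |G (us ρ m U i t x) (us ρ m V i t x)| := fun x => by
      rw [← mul_sub, Real.norm_eq_abs, abs_mul, mul_comm]
      exact mul_le_mul_of_nonneg_right (Aop_lap hφ hB0 hB (ds_pos i) x) (abs_nonneg _)
    refine (norm_integral_le_of_norm_le (j1.abs.const_mul _) (ae_of_all _ hb)).trans ?_
    rw [integral_const_mul]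
    have hQ0 : 0 ≤ Q := by have : 0 ≤ M3 N := M3_nonneg; positivity
    refine mul_le_mul_of_nonneg_left (j2.trans (mul_le_mul_of_nonneg_left ?_ hG.nn)) (by positivity)
    exact add_le_add (H.us_l1 hMi ht htT) (H.symm.us_l1 hMi ht htT)
  have e3 := hI4 i i4
  have e4 := hI1 i i1 t ht htT
  have e5 := hI2 i i2 t ht htT
  have e6 : Λ * C * (dd ρ 0 (us ρ m U i t) (u t) + dd ρ 0 (us ρ m V i t) (v t)) ≤ ε / 2 := by
    have h0 : 0 ≤ Λ * C := mul_nonneg hG.nn hC0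
    refine (mul_le_mul_of_nonneg_left (add_le_add e4 e5) h0).trans ?_
    rw [← two_mul, ← mul_assoc, mul_div_assoc', div_le_iff₀ (by positivity)]
    have : 0 ≤ ε * (Λ * C) := by positivity
    linarith
  rw [e1] at d2
  have := abs_sub_le (∫ x, G (us ρ m U i t x) (us ρ m V i t x) * Aop (ds i) φ x) (∫ x, G (us ρ m U i t x) (us ρ m V i t x) * lap φ x) (∫ x, G (u t x) (v t x) * lap φ x)
  linarith

theorem test_close2 (H : Two γ k K ρ m M U V u v) (hG : Adm M Λ G) {B : ℝ} {φ : Euc N → ℝ} (hφ : BM B φ) {t : ℝ} (ht : 0 ≤ t) :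
    Tendsto (fun i => ∫ x, φ x * ((ρ x + ds i) * G (us ρ m U i t x) (us ρ m V i t x))) atTop (nhds (∫ x, φ x * (ρ x * G (u t x) (v t x)))) := by
  obtain ⟨w, hm, hM, hU, bU, hV, bV, lu, lv⟩ := id H
  have hB0 : 0 ≤ B := (abs_nonneg _).trans (hφ.2 0)
  set Z := 2 / k * Mo ρ k m M (b0 m U) t + 2 / k * Mo ρ k m M (b0 m V) t with hZ
  rw [tendsto_iff_norm_sub_tendsto_zero]
  have htend : Tendsto (fun i => Λ * B * (dd ρ 0 (us ρ m U i t) (u t) + dd ρ 0 (us ρ m V i t) (v t)) + ds i * (B * (Λ * Z))) atTop (nhds (Λ * B * (0 + 0) + 0 * (B * (Λ * Z)))) :=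
    (((lu.tend w ht).add (lv.tend w ht)).const_mul _).add (ds_tend.mul_const _)
  simp only [add_zero, mul_zero, zero_mul] at htend
  refine squeeze_zero' (Eventually.of_forall fun i => norm_nonneg _) ?_ htend
  filter_upwards [ev_M M] with i hMi
  have gu := us_good w hm hM hU bU hMi t
  have gv := us_good w hm hM hV bV hMi t
  obtain ⟨j1, j2⟩ := hG.int gu gv
  have hb := hG.bm gu.1 gv.1
  have hψ : ∀ x, |φ x * ρ x| ≤ B * ρ x := fun x => by
    rw [abs_mul, abs_of_pos (w.pos x)]; exact mul_le_mul_of_nonneg_right (hφ.2 x) (w.pos x).le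
  obtain ⟨d1, d2⟩ := hG.diff w gu.1 gv.1 (lu.bd t) (lv.bd t) (gu.ok w) (gv.ok w) (lu.ok ht) (lv.ok ht) hB0 (ψ := fun x => φ x * ρ x) (hφ.1.mul w.meas) hψ
  have k1 := w.phi_int hφ j1 hb (ds i)
  have k0 := w.phi_int hφ j1 hb 0
  simp only [add_zero] at k0
  have k3 : Integrable (fun x => φ x * (ρ x * G (u t x) (v t x))) := by
    refine (k0.sub d1).congr (ae_of_all _ fun x => ?_)
    simp only [Pi.sub_apply]; ring
  have k4 : Integrable (fun x => φ x * G (us ρ m U i t x) (us ρ m V i t x)) := j1.bdd_mul hφ.1.aestronglyMeasurable (ae_of_all _ hφ.2)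
  have e1 : (∫ x, φ x * ((ρ x + ds i) * G (us ρ m U i t x) (us ρ m V i t x))) - (∫ x, φ x * (ρ x * G (u t x) (v t x)))
      = (∫ x, (G (us ρ m U i t x) (us ρ m V i t x) - G (u t x) (v t x)) * (φ x * ρ x)) + ds i * ∫ x, φ x * G (us ρ m U i t x) (us ρ m V i t x) := by
    rw [← integral_sub k1 k3, ← integral_const_mul, ← integral_add d1 (k4.const_mul _)]; congr 1; ext x; ring
  rw [e1]
  have e2 : |∫ x, φ x * G (us ρ m U i t x) (us ρ m V i t x)| ≤ B * (Λ * Z) := by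
    rw [← Real.norm_eq_abs]
    refine (norm_integral_le_of_norm_le (f := fun x => φ x * G (us ρ m U i t x) (us ρ m V i t x)) (j1.abs.const_mul B) (ae_of_all _ fun x => ?_)).trans ?_
    · rw [norm_mul]; exact mul_le_mul_of_nonneg_right (hφ.2 x) (norm_nonneg _)
    rw [integral_const_mul]
    refine mul_le_mul_of_nonneg_left (j2.trans (mul_le_mul_of_nonneg_left ?_ hG.nn)) hB0
    exact add_le_add (H.us_l1 hMi ht le_rfl) (H.symm.us_l1 hMi ht le_rfl)
  refine (norm_add_le _ _).trans (add_le_add d2 ?_)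
  rw [norm_mul, Real.norm_of_nonneg (ds_pos i).le]
  exact mul_le_mul_of_nonneg_left e2 (ds_pos i).le
end

lemma disc_lim {Fs Ft B s t : ℝ} (hs0 : 0 ≤ s) (hst : s ≤ t) {a : ℕ → ℕ → ℝ}
    (h1 : Tendsto (fun i => a i ⌊s / hs m i⌋₊) atTop (nhds Fs)) (h2 : Tendsto (fun i => a i ⌊t / hs m i⌋₊) atTop (nhds Ft))
    (h3 : ∀ ε > 0, ∀ᶠ i in atTop, ∀ n, ⌊s / hs m i⌋₊ ≤ n → n < ⌊t / hs m i⌋₊ → a i (n + 1) ≤ a i n + hs m i * (B + ε)) :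
    Ft ≤ Fs + (t - s) * B := by
  have key : ∀ ε > 0, Ft ≤ Fs + (t - s) * (B + ε) := by
    intro ε hε
    have hR : Tendsto (fun i => a i ⌊s / hs m i⌋₊ + ((⌊t / hs m i⌋₊ : ℝ) * hs m i - (⌊s / hs m i⌋₊ : ℝ) * hs m i) * (B + ε)) atTop (nhds (Fs + (t - s) * (B + ε))) :=
      h1.add (((floor_tend (hs0.trans hst)).sub (floor_tend hs0)).mul_const _)
    refine le_of_tendsto_of_tendsto h2 hR ?_
    filter_upwards [h3 ε hε] with i hi
    have hind : ∀ j : ℕ, ⌊s / hs m i⌋₊ + j ≤ ⌊t / hs m i⌋₊ → a i (⌊s / hs m i⌋₊ + j) ≤ a i ⌊s / hs m i⌋₊ + j * hs m i * (B + ε) := by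
      intro j
      induction j with
      | zero => intro _; simp
      | succ j ih =>
        intro hj
        have := hi (⌊s / hs m i⌋₊ + j) (by omega) (by omega)
        have := ih (by omega)
        push_cast
        rw [← add_assoc]
        linarith
    have hle : ⌊s / hs m i⌋₊ ≤ ⌊t / hs m i⌋₊ := Nat.floor_mono (div_le_div_of_nonneg_right hst (hs_pos m i).le)
    have := hind (⌊t / hs m i⌋₊ - ⌊s / hs m i⌋₊) (by omega)
    rw [Nat.add_sub_cancel' hle, Nat.cast_sub hle] at this
    linarith
  have hc : Tendsto (fun ε : ℝ => Fs + (t - s) * (B + ε)) (nhdsWithin 0 (Ioi 0)) (nhds (Fs + (t - s) * (B + 0))) := by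
    refine Tendsto.mono_left ?_ nhdsWithin_le_nhds
    exact (Continuous.tendsto (by fun_prop) 0)
  rw [add_zero] at hc
  refine ge_of_tendsto hc ?_
  filter_upwards [self_mem_nhdsWithin] with ε hε
  exact key ε hε

/-- a time in `[s,t]` whose step index is `n` -/
lemma time_of {s t : ℝ} (hs0 : 0 ≤ s) (hst : s ≤ t) {i n : ℕ} (h1 : ⌊s / hs m i⌋₊ ≤ n) (h2 : n < ⌊t / hs m i⌋₊) :
    ∃ τ, s ≤ τ ∧ τ ≤ t ∧ ⌊τ / hs m i⌋₊ = n := by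
  have hp := hs_pos m i
  rcases h1.eq_or_lt with h | h
  · exact ⟨s, le_rfl, hst, h⟩
  · refine ⟨n * hs m i, ?_, ?_, ?_⟩
    · rw [Nat.floor_lt (by positivity), div_lt_iff₀ hp] at h; exact h.le
    · refine le_trans ?_ (floor_mul_le (m := m) i (hs0.trans hst))
      exact mul_le_mul_of_nonneg_right (by exact_mod_cast h2.le) hp.le
    · rw [mul_div_cancel_right₀ _ hp.ne', Nat.floor_natCast]

section
variable {U V : Euc N → ℝ} {u v : ℝ → Euc N → ℝ}

theorem kato_lim (H : Two γ k K ρ m M U V u v) {φ : Euc N → ℝ} (hφ : Test φ) (h0 : ∀ x, 0 ≤ φ x) {s t B : ℝ} (hs0 : 0 ≤ s) (hst : s ≤ t)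
    (hB : ∀ τ, s ≤ τ → τ ≤ t → ∫ x, |spow m (u τ x) - spow m (v τ x)| * lap φ x ≤ B) :
    ∫ x, φ x * (ρ x * |u t x - v t x|) ≤ (∫ x, φ x * (ρ x * |u s x - v s x|)) + (t - s) * B := by
  obtain ⟨w, hm, hM, hU, bU, hV, bV, lu, lv⟩ := id H
  obtain ⟨Cφ, hCφ0, hCφ⟩ := hφ.BM
  refine disc_lim (m := m) hs0 hst (a := fun i n => ∫ x, φ x * ((ρ x + ds i) * |sch ρ m (ds i) (hs m i) (b0 m U) n x - sch ρ m (ds i) (hs m i) (b0 m V) n x|))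
    (test_close2 H adm_sub hCφ hs0) (test_close2 H adm_sub hCφ (hs0.trans hst)) fun ε hε => ?_
  obtain ⟨I, hI⟩ := test_close H (adm_powsub hm hM) hφ (hs0.trans hst) hε
  filter_upwards [ev_M M, eventually_ge_atTop I] with i hMi hi n hn1 hn2
  obtain ⟨τ, hτ1, hτ2, rfl⟩ := time_of (m := m) hs0 hst hn1 hn2
  have p := par_i hm hM hMi
  have gu := us_good w hm hM hU bU hMi τ
  have gv := us_good w hm hM hV bV hMi τ
  have h1 := kato_step w p gu gv hCφ h0
  have h2 := (abs_le.1 (hI i hi τ (hs0.trans hτ1) hτ2)).2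
  have h3 := hB τ hτ1 hτ2
  refine h1.trans (add_le_add le_rfl (mul_le_mul_of_nonneg_left ?_ (hs_pos m i).le))
  have h4 : ∫ x, |vv m (us ρ m U i τ) x - vv m (us ρ m V i τ) x| * Aop (ds i) φ x = ∫ x, |spow m (us ρ m U i τ x) - spow m (us ρ m V i τ x)| * Aop (ds i) φ x := rfl
  linarith

theorem weak_lim (H : Two γ k K ρ m M U V u v) {φ : Euc N → ℝ} (hφ : Test φ) {s t B : ℝ} (hs0 : 0 ≤ s) (hst : s ≤ t)
    (hB : ∀ τ, s ≤ τ → τ ≤ t → ∫ x, spow m (u τ x) * lap φ x ≤ B) :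
    ∫ x, φ x * (ρ x * u t x) ≤ (∫ x, φ x * (ρ x * u s x)) + (t - s) * B := by
  obtain ⟨w, hm, hM, hU, bU, hV, bV, lu, lv⟩ := id H
  obtain ⟨Cφ, hCφ0, hCφ⟩ := hφ.BM
  refine disc_lim (m := m) hs0 hst (a := fun i n => ∫ x, φ x * ((ρ x + ds i) * sch ρ m (ds i) (hs m i) (b0 m U) n x))
    (test_close2 H adm_id hCφ hs0) (test_close2 H adm_id hCφ (hs0.trans hst)) fun ε hε => ?_
  obtain ⟨I, hI⟩ := test_close H (adm_pow hm hM) hφ (hs0.trans hst) hε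
  filter_upwards [ev_M M, eventually_ge_atTop I] with i hMi hi n hn1 hn2
  obtain ⟨τ, hτ1, hτ2, rfl⟩ := time_of (m := m) hs0 hst hn1 hn2
  have p := par_i hm hM hMi
  have gu := us_good w hm hM hU bU hMi τ
  have h1 := (weak_step w p gu hCφ).le
  have h2 := (abs_le.1 (hI i hi τ (hs0.trans hτ1) hτ2)).2
  have h3 := hB τ hτ1 hτ2
  refine h1.trans (add_le_add le_rfl (mul_le_mul_of_nonneg_left ?_ (hs_pos m i).le))
  have h4 : ∫ x, vv m (us ρ m U i τ) x * Aop (ds i) φ x = ∫ x, spow m (us ρ m U i τ x) * Aop (ds i) φ x := rfl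
  linarith

theorem ab_lim (H : Two γ k K ρ m M U V u v) (hU0 : ∀ x, 0 ≤ U x) {φ : Euc N → ℝ} (hφ : Test φ) (h0 : ∀ x, 0 ≤ φ x) {t : ℝ} (ht : 0 < t) :
    - (∫ x, spow m (u t x) * lap φ x) ≤ abC m / t * ∫ x, φ x * (ρ x * u t x) := by
  obtain ⟨w, hm, hM, hU, bU, hV, bV, lu, lv⟩ := id H
  obtain ⟨Cφ, hCφ0, hCφ⟩ := hφ.BM
  have hc0 : Tendsto (fun i => ∫ x, spow m (us ρ m U i t x) * Aop (ds i) φ x) atTop (nhds (∫ x, spow m (u t x) * lap φ x)) := by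
    rw [Metric.tendsto_atTop]
    intro ε hε
    obtain ⟨I, hI⟩ := test_close H (adm_pow hm hM) hφ ht.le (half_pos hε)
    refine ⟨I, fun i hi => ?_⟩
    rw [Real.dist_eq]; linarith [hI i hi t ht.le le_rfl]
  have hc1 := test_close2 H adm_id hCφ ht.le
  have hc2 : Tendsto (fun i => abC m / ((⌊t / hs m i⌋₊ : ℝ) * hs m i)) atTop (nhds (abC m / t)) := tendsto_const_nhds.div (floor_tend ht.le) ht.ne'
  refine le_of_tendsto_of_tendsto hc0.neg (hc2.mul hc1) ?_
  have hev : ∀ᶠ i in atTop, hs m i < t := hs_tend.eventually (gt_mem_nhds ht)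
  filter_upwards [ev_M M, hev] with i hMi hi
  have p := par_i hm hM hMi
  have hgb := b0_good hm hM hU bU
  have gu := us_good w hm hM hU bU hMi t
  have hn : 0 < ⌊t / hs m i⌋₊ := by
    rw [Nat.floor_pos, le_div_iff₀ (hs_pos m i)]; linarith
  have hb0 : ∀ x, 0 ≤ b0 m U x := fun x => by
    unfold b0; rw [spow_nn (by positivity) (hU0 x)]; exact Real.rpow_nonneg (hU0 x) _
  have hab := sch_ab' w p hgb hb0 hn
  have hvi := gu.vv_int hm.le
  have e1 := Aop_symm (ds_pos i).le hvi hCφ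
  have i1 : Integrable (fun x => Aop (ds i) (vv m (us ρ m U i t)) x * φ x) := (Aop_integrable hvi).mul_bdd hCφ.1.aestronglyMeasurable (ae_of_all _ hCφ.2)
  have i2 := w.phi_int hCφ gu.int gu.1 (ds i)
  have e2 : ∫ x, vv m (us ρ m U i t) x * Aop (ds i) φ x = ∫ x, spow m (us ρ m U i t x) * Aop (ds i) φ x := rfl
  rw [← e2, ← e1, ← integral_neg, ← integral_const_mul]
  refine integral_mono i1.neg (i2.const_mul _) fun x => ?_
  have := mul_le_mul_of_nonneg_left (hab x) (h0 x)
  simp only [us] at *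
  linarith

theorem lip_lim (H : Two γ k K ρ m M U V u v) {s t : ℝ} (hs0 : 0 ≤ s) (hst : s ≤ t) : dd ρ 0 (u t) (u s) ≤ (t - s) * Lc U := by
  obtain ⟨w, hm, hM, hU, bU, hV, bV, lu, lv⟩ := id H
  have ht0 := hs0.trans hst
  have hR : Tendsto (fun i => dd ρ 0 (us ρ m U i t) (u t) + ((⌊t / hs m i⌋₊ : ℝ) * hs m i - (⌊s / hs m i⌋₊ : ℝ) * hs m i) * Lc U + dd ρ 0 (us ρ m U i s) (u s)) atTop (nhds (0 + (t - s) * Lc U + 0)) :=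
      ((lu.tend w ht0).add (((floor_tend (hs0.trans hst)).sub (floor_tend hs0)).mul_const _)).add (lu.tend w hs0)
  rw [zero_add, add_zero] at hR
  refine ge_of_tendsto hR ?_
  filter_upwards [ev_M M] with i hMi
  have p := par_i hm hM hMi
  have gt := us_good w hm hM hU bU hMi t
  have gs := us_good w hm hM hU bU hMi s
  have hle : ⌊s / hs m i⌋₊ ≤ ⌊t / hs m i⌋₊ := Nat.floor_mono (div_le_div_of_nonneg_right hst (hs_pos m i).le)
  have h1 := sch_lip w p hU bU ⌊s / hs m i⌋₊ (⌊t / hs m i⌋₊ - ⌊s / hs m i⌋₊)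
  rw [Nat.add_sub_cancel' hle, Nat.cast_sub hle] at h1
  have h2 := dd_zero_le w (ds_pos i).le gt gs
  have h3 := dd0_tri w (lu.ok ht0) (gt.ok w) (lu.ok hs0)
  have h4 := dd0_tri w (gt.ok w) (gs.ok w) (lu.ok hs0)
  rw [dd_comm _ (u t) (us ρ m U i t)] at h3
  unfold us at *
  linarith

theorem ord_lim (H : Two γ k K ρ m M U V u v) (hle : ∀ x, |U x| ≤ V x) {t : ℝ} (ht : 0 ≤ t) : ∀ᵐ x, |u t x| ≤ v t x := by
  obtain ⟨w, hm, hM, hU, bU, hV, bV, lu, lv⟩ := id H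
  have hm0 : 0 < m := by linarith
  have ou := lu.ok ht
  have ov := lv.ok ht
  have i0 : Integrable (fun x => max (ρ x * |u t x| - ρ x * v t x) 0) := by
    have : Integrable (fun x => ρ x * |u t x|) := ou.2.abs.congr (ae_of_all _ fun x => by simp [abs_mul, abs_of_pos (w.pos x)])
    exact (this.sub ov.2).pos_part
  have hz : ∫ x, max (ρ x * |u t x| - ρ x * v t x) 0 ≤ 0 := by
    have hR := (lu.tend w ht).add (lv.tend w ht)
    rw [add_zero] at hR
    refine ge_of_tendsto hR ?_
    filter_upwards [ev_M M] with i hMi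
    have gu := us_good w hm hM hU bU hMi t
    have gv := us_good w hm hM hV bV hMi t
    simp only [dd0_def]
    rw [← integral_add (dd0_int w (gu.ok w) ou) (dd0_int w (gv.ok w) ov)]
    refine integral_mono i0 ((dd0_int w (gu.ok w) ou).add (dd0_int w (gv.ok w) ov)) fun x => ?_
    have h1 : |us ρ m U i t x| ≤ us ρ m V i t x := sch_abs_le w (par_i hm hM hMi) (b0_good hm hM hU bU) (b0_good hm hM hV bV) (fun x => by
      unfold b0
      rw [spow_abs (by positivity), spow_nn (by positivity) ((abs_nonneg _).trans (hle x))]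
      exact Real.rpow_le_rpow (abs_nonneg _) (hle x) (by positivity)) _ x
    have hp := w.pos x
    simp only
    refine max_le ?_ (by positivity)
    rw [← mul_sub, ← mul_add]
    refine mul_le_mul_of_nonneg_left ?_ hp.le
    have h2 := abs_sub_abs_le_abs_sub (u t x) (us ρ m U i t x)
    rw [abs_sub_comm] at h2
    have h3 := le_abs_self (us ρ m V i t x - v t x)
    linarith
  have hz' : ∫ x, max (ρ x * |u t x| - ρ x * v t x) 0 = 0 := le_antisymm hz (integral_nonneg fun x => le_max_right _ _)
  rw [integral_eq_zero_iff_of_nonneg (f := fun x => max (ρ x * |u t x| - ρ x * v t x) 0) (fun x => le_max_right _ _) i0] at hz'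
  filter_upwards [hz'] with x hx
  have hx' : max (ρ x * |u t x| - ρ x * v t x) 0 = 0 := hx
  have := le_max_left (ρ x * |u t x| - ρ x * v t x) 0
  rw [hx', ← mul_sub] at this
  have hp := w.pos x
  by_contra hcon
  push Not at hcon
  have := mul_pos hp (sub_pos.2 hcon)
  linarith
end

end

noncomputable section

variable {N : ℕ} {γ k K m δ h M : ℝ} {ρ : Euc N → ℝ}

/-- a smooth cutoff profile -/
def chi (s : ℝ) : ℝ := Real.smoothTransition (2 - 2 * s)
def chi1 : ℝ → ℝ := deriv chi
def chi2 : ℝ → ℝ := deriv chi1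

lemma chi_cd : ContDiff ℝ (⊤ : ℕ∞) chi := Real.smoothTransition.contDiff.comp (contDiff_const.sub (contDiff_const.mul contDiff_id))
lemma chi1_cd : ContDiff ℝ (⊤ : ℕ∞) chi1 := by
  have h : ContDiff ℝ ((⊤ : ℕ∞) + 1) chi := by exact_mod_cast chi_cd
  exact ((contDiff_succ_iff_deriv.1 h).2.2)
lemma chi2_cd : ContDiff ℝ (⊤ : ℕ∞) chi2 := by
  have h : ContDiff ℝ ((⊤ : ℕ∞) + 1) chi1 := by exact_mod_cast chi1_cd
  exact ((contDiff_succ_iff_deriv.1 h).2.2)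
lemma chi_d (s : ℝ) : HasDerivAt chi (chi1 s) s := (chi_cd.differentiable (by simp) s).hasDerivAt
lemma chi1_d (s : ℝ) : HasDerivAt chi1 (chi2 s) s := (chi1_cd.differentiable (by simp) s).hasDerivAt
lemma chi_nn (s : ℝ) : 0 ≤ chi s := Real.smoothTransition.nonneg _
lemma chi_le (s : ℝ) : chi s ≤ 1 := Real.smoothTransition.le_one _
lemma chi_one {s : ℝ} (h : s ≤ 1 / 2) : chi s = 1 := Real.smoothTransition.one_of_one_le (by linarith)
lemma chi_zero {s : ℝ} (h : 1 ≤ s) : chi s = 0 := Real.smoothTransition.zero_of_nonpos (by linarith)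
lemma chi1_zero {s : ℝ} (h : s < 1 / 2 ∨ 1 < s) : chi1 s = 0 := by
  rcases h with h | h
  · have : chi =ᶠ[nhds s] fun _ => (1:ℝ) := by
      filter_upwards [gt_mem_nhds h] with y hy using chi_one hy.le
    rw [chi1, this.deriv_eq]; simp
  · have : chi =ᶠ[nhds s] fun _ => (0:ℝ) := by
      filter_upwards [lt_mem_nhds h] with y hy using chi_zero hy.le
    rw [chi1, this.deriv_eq]; simp
lemma chi2_zero {s : ℝ} (h : s < 1 / 2 ∨ 1 < s) : chi2 s = 0 := by
  rcases h with h | h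
  · have : chi1 =ᶠ[nhds s] fun _ => (0:ℝ) := by
      filter_upwards [gt_mem_nhds h] with y hy using chi1_zero (Or.inl hy)
    rw [chi2, this.deriv_eq]; simp
  · have : chi1 =ᶠ[nhds s] fun _ => (0:ℝ) := by
      filter_upwards [lt_mem_nhds h] with y hy using chi1_zero (Or.inr hy)
    rw [chi2, this.deriv_eq]; simp

lemma chi_bd : ∃ C, 0 ≤ C ∧ ∀ s, |chi1 s| ≤ C ∧ |chi2 s| ≤ C := by
  obtain ⟨C1, h1⟩ := isCompact_Icc.exists_bound_of_continuousOn (s := Icc (1/2:ℝ) 1) chi1_cd.continuous.continuousOn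
  obtain ⟨C2, h2⟩ := isCompact_Icc.exists_bound_of_continuousOn (s := Icc (1/2:ℝ) 1) chi2_cd.continuous.continuousOn
  refine ⟨max (max C1 C2) 0, le_max_right _ _, fun s => ?_⟩
  by_cases hs : s ∈ Icc (1/2:ℝ) 1
  · exact ⟨(h1 s hs).trans ((le_max_left _ _).trans (le_max_left _ _)), (h2 s hs).trans ((le_max_right _ _).trans (le_max_left _ _))⟩
  · have : s < 1 / 2 ∨ 1 < s := by
      by_contra hc; push Not at hc; exact hs ⟨hc.1, hc.2⟩
    rw [chi1_zero this, chi2_zero this]; simp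

lemma nsq_deriv (x y : Euc N) : HasFDerivAt (fun y : Euc N => ‖y - x‖ ^ 2) (2 • (innerSL ℝ (y - x))) y := by
  have := ((hasFDerivAt_id y).sub_const x).norm_sq
  simpa using this

lemma radial {g g1 g2 : ℝ → ℝ} (hg : ∀ s, 0 ≤ s → ContDiffAt ℝ (⊤ : ℕ∞) g s) (h1 : ∀ s, 0 ≤ s → HasDerivAt g (g1 s) s)
    (h2 : ∀ s, 0 ≤ s → HasDerivAt g1 (g2 s) s) (x : Euc N) :
    ContDiff ℝ (⊤ : ℕ∞) (fun y : Euc N => g (‖y - x‖ ^ 2)) ∧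
    ∀ y, lap (fun y : Euc N => g (‖y - x‖ ^ 2)) y = 4 * ‖y - x‖ ^ 2 * g2 (‖y - x‖ ^ 2) + 2 * N * g1 (‖y - x‖ ^ 2) := by
  constructor
  · rw [contDiff_iff_contDiffAt]
    intro y
    exact (hg _ (sq_nonneg _)).comp y ((contDiff_id.sub contDiff_const).norm_sq ℝ).contDiffAt
  intro y
  have e1 : ∀ (i : Fin N), pd i (fun y : Euc N => g (‖y - x‖ ^ 2)) = fun y => g1 (‖y - x‖ ^ 2) * (2 * (y i - x i)) := by
    intro i; ext y
    have : HasFDerivAt (fun y : Euc N => g (‖y - x‖ ^ 2)) _ y := ((h1 _ (sq_nonneg _)).comp_hasFDerivAt y (nsq_deriv x y))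
    unfold pd
    rw [this.fderiv]
    simp [EuclideanSpace.inner_single_right]
  have e2 : ∀ (i : Fin N), pd i (fun y : Euc N => g1 (‖y - x‖ ^ 2) * (2 * (y i - x i))) y = 4 * (y i - x i) ^ 2 * g2 (‖y - x‖ ^ 2) + 2 * g1 (‖y - x‖ ^ 2) := by
    intro i
    have a1 := ((h2 _ (sq_nonneg _)).comp_hasFDerivAt y (nsq_deriv x y))
    have a2 : HasFDerivAt (fun y : Euc N => 2 * (y i - x i)) ((2:ℝ) • (EuclideanSpace.proj i : Euc N →L[ℝ] ℝ)) y :=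
      (((EuclideanSpace.proj i : Euc N →L[ℝ] ℝ).hasFDerivAt (x := y)).sub_const (x i)).const_mul 2
    have := a1.mul a2
    unfold pd
    have e := this.fderiv
    simp only [Function.comp_def] at e
    erw [e]
    simp [EuclideanSpace.inner_single_right]
    ring
  rw [lap_eq]
  simp_rw [e1, e2]
  rw [Finset.sum_add_distrib]
  have e3 : ‖y - x‖ ^ 2 = ∑ i, (y i - x i) ^ 2 := by
    rw [EuclideanSpace.norm_sq_eq]; simp
  rw [← Finset.sum_mul, ← Finset.mul_sum, ← e3]
  simp
  ring

/-- cutoff functions -/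
def cut (R : ℝ) (y : Euc N) : ℝ := chi (‖y‖ ^ 2 / (2 * R) ^ 2)

lemma cut_nn (R : ℝ) (y : Euc N) : 0 ≤ cut R y := chi_nn _
lemma cut_le (R : ℝ) (y : Euc N) : cut R y ≤ 1 := chi_le _
lemma cut_one {R : ℝ} (hR : 0 < R) {y : Euc N} (h : ‖y‖ ≤ R) : cut R y = 1 := by
  apply chi_one
  rw [div_le_iff₀ (by positivity)]
  have := pow_le_pow_left₀ (norm_nonneg y) h 2
  linarith [sq_nonneg R]
lemma cut_zero {R : ℝ} (hR : 0 < R) {y : Euc N} (h : 2 * R ≤ ‖y‖) : cut R y = 0 := by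
  apply chi_zero
  rw [le_div_iff₀ (by positivity), one_mul]
  exact pow_le_pow_left₀ (by positivity) h 2

lemma cut_props {R : ℝ} (hR : 0 < R) : Test (cut (N := N) R) ∧ ∀ y : Euc N,
    lap (cut R) y = 4 * ‖y‖ ^ 2 * (chi2 (‖y‖ ^ 2 / (2 * R) ^ 2) / (2 * R) ^ 2 / (2 * R) ^ 2) + 2 * N * (chi1 (‖y‖ ^ 2 / (2 * R) ^ 2) / (2 * R) ^ 2) := by
  have hd : ∀ s : ℝ, HasDerivAt (fun s : ℝ => s / (2 * R) ^ 2) (1 / (2 * R) ^ 2) s := fun s => (hasDerivAt_id s).div_const _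
  have := radial (N := N) (g := fun s => chi (s / (2 * R) ^ 2)) (g1 := fun s => chi1 (s / (2 * R) ^ 2) / (2 * R) ^ 2)
    (g2 := fun s => chi2 (s / (2 * R) ^ 2) / (2 * R) ^ 2 / (2 * R) ^ 2)
    (fun s _ => (chi_cd.comp (contDiff_id.div_const _)).contDiffAt)
    (fun s _ => by simpa [div_eq_mul_inv, Function.comp_def] using (chi_d _).comp s (hd s))
    (fun s _ => by simpa [div_eq_mul_inv, Function.comp_def] using ((chi1_d _).comp s (hd s)).div_const ((2 * R) ^ 2)) 0
  simp only [sub_zero] at this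
  refine ⟨⟨this.1, ?_⟩, this.2⟩
  refine HasCompactSupport.intro (isCompact_closedBall (0 : Euc N) (2 * R)) fun y hy => cut_zero hR ?_
  simp at hy; exact hy.le

lemma cut_lap : ∃ C, 0 ≤ C ∧ ∀ R : ℝ, 0 < R → ∀ y : Euc N, |lap (cut R) y| ≤ C / R ^ 2 ∧ (2 * R < ‖y‖ → lap (cut R) y = 0) := by
  obtain ⟨C, hC0, hC⟩ := chi_bd
  refine ⟨C + N * C, by positivity, fun R hR y => ?_⟩
  have hz : 2 * R < ‖y‖ → lap (cut R) y = 0 := fun h => by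
    have h1 : 1 < ‖y‖ ^ 2 / (2 * R) ^ 2 := by
      rw [lt_div_iff₀ (by positivity), one_mul]; exact pow_lt_pow_left₀ h (by positivity) (by norm_num)
    rw [(cut_props hR).2, chi1_zero (Or.inr h1), chi2_zero (Or.inr h1)]; simp
  refine ⟨?_, hz⟩
  by_cases hy : 2 * R < ‖y‖
  · rw [hz hy, abs_zero]; positivity
  rw [(cut_props hR).2]
  obtain ⟨c1, c2⟩ := hC (‖y‖ ^ 2 / (2 * R) ^ 2)
  push Not at hy
  have hy2 := pow_le_pow_left₀ (norm_nonneg y) hy 2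
  refine (abs_add_le _ _).trans ?_
  have e1 : |4 * ‖y‖ ^ 2 * (chi2 (‖y‖ ^ 2 / (2 * R) ^ 2) / (2 * R) ^ 2 / (2 * R) ^ 2)| ≤ C / R ^ 2 := by
    rw [abs_mul, abs_div, abs_div, abs_of_nonneg (by positivity : 0 ≤ (2 * R) ^ 2), abs_of_nonneg (by positivity : 0 ≤ 4 * ‖y‖ ^ 2)]
    calc _ ≤ 4 * (2 * R) ^ 2 * (C / (2 * R) ^ 2 / (2 * R) ^ 2) := by gcongr
      _ = _ := by field_simp; norm_num
  have e2 : |2 * N * (chi1 (‖y‖ ^ 2 / (2 * R) ^ 2) / (2 * R) ^ 2)| ≤ N * C / R ^ 2 := by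
    rw [abs_mul, abs_div, abs_of_nonneg (by positivity : 0 ≤ (2 * R) ^ 2), abs_of_nonneg (by positivity : 0 ≤ 2 * (N:ℝ))]
    calc _ ≤ 2 * N * (C / (2 * R) ^ 2) := by gcongr
      _ = N * C / R ^ 2 / 2 := by field_simp
      _ ≤ _ := half_le_self (by positivity)
  rw [add_div]
  linarith

end

noncomputable section

variable {N : ℕ} {γ k K m δ h M : ℝ} {ρ : Euc N → ℝ}

lemma newton_test (hN : 3 ≤ N) : ∃ c A : ℝ, 0 < c ∧ 0 ≤ A ∧ ∀ (x : Euc N) (δ r : ℝ), 0 < δ → 2 * δ ≤ r →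
    ∃ φ : Euc N → ℝ, Test φ ∧ (∀ y, 0 ≤ φ y) ∧ (∀ y, y ≠ x → φ y ≤ ‖y - x‖ ^ (2 - (N:ℝ))) ∧ (∀ y, r < ‖y - x‖ → φ y = 0) ∧
      (∀ y, r < ‖y - x‖ → lap φ y = 0) ∧ (∀ y, - (A * r ^ (-(N:ℝ))) ≤ - lap φ y) ∧
      (∀ y, ‖y - x‖ ≤ δ → c * δ ^ (-(N:ℝ)) ≤ - lap φ y) := by
  obtain ⟨B, hB0, hB⟩ := chi_bd
  set q : ℝ := ((N:ℝ) - 2) / 2 with hq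
  have hN' : (3:ℝ) ≤ N := by exact_mod_cast hN
  have hq0 : 0 < q := by rw [hq]; linarith
  have hNq : (N:ℝ) = 2 * q + 2 := by rw [hq]; ring
  clear_value q
  refine ⟨2 * N * q * 2 ^ (-q - 2), 4 * (2 * q * 2 ^ (q + 1) * B + 2 ^ (q + 1) * B) + 2 * N * 2 ^ (q + 1) * B, by positivity, by positivity, fun x δ r hδ hr => ?_⟩
  have hr0 : 0 < r := by linarith
  have hp : ∀ s : ℝ, 0 ≤ s → 0 < s + δ ^ 2 := fun s hs => by positivity
  have hd : ∀ s : ℝ, HasDerivAt (fun s : ℝ => s / r ^ 2) (1 / r ^ 2) s := fun s => (hasDerivAt_id s).div_const _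
  have hd1 : ∀ (e s : ℝ), 0 ≤ s → HasDerivAt (fun s : ℝ => (s + δ ^ 2) ^ e) (e * (s + δ ^ 2) ^ (e - 1)) s := fun e s hs => by
    have := ((hasDerivAt_id s).add_const (δ ^ 2)).rpow_const (p := e) (Or.inl (hp s hs).ne')
    simpa using this
  have hc0 : ∀ s : ℝ, HasDerivAt (fun s : ℝ => chi (s / r ^ 2)) (chi1 (s / r ^ 2) / r ^ 2) s := fun s => by
    simpa [div_eq_mul_inv, Function.comp_def] using (chi_d _).comp s (hd s)
  have hc1 : ∀ s : ℝ, HasDerivAt (fun s : ℝ => chi1 (s / r ^ 2)) (chi2 (s / r ^ 2) / r ^ 2) s := fun s => by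
    simpa [div_eq_mul_inv, Function.comp_def] using (chi1_d _).comp s (hd s)
  set P : ℝ → ℝ := fun s => (s + δ ^ 2) ^ (-q) with hP
  set P1 : ℝ → ℝ := fun s => (s + δ ^ 2) ^ (-q - 1) with hP1
  set P2 : ℝ → ℝ := fun s => (s + δ ^ 2) ^ (-q - 2) with hP2
  have dP : ∀ s, 0 ≤ s → HasDerivAt P (-q * P1 s) s := fun s hs => hd1 _ s hs
  have dP1 : ∀ s, 0 ≤ s → HasDerivAt P1 ((-q - 1) * P2 s) s := fun s hs => by
    have := hd1 (-q - 1) s hs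
    rwa [show -q - 1 - 1 = -q - 2 by ring] at this
  have hP12 : ∀ s, 0 ≤ s → P1 s = (s + δ ^ 2) * P2 s := fun s hs => by
    rw [hP1, hP2]; simp only
    rw [show -q - 1 = 1 + (-q - 2) by ring, Real.rpow_add (hp s hs), Real.rpow_one]
  have hPnn : ∀ s, 0 ≤ s → 0 ≤ P s ∧ 0 ≤ P1 s ∧ 0 ≤ P2 s := fun s hs => ⟨Real.rpow_nonneg (hp s hs).le _, Real.rpow_nonneg (hp s hs).le _, Real.rpow_nonneg (hp s hs).le _⟩
  obtain ⟨hcd, hlap⟩ := radial (N := N) (g := fun s => P s * chi (s / r ^ 2))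
    (g1 := fun s => -q * P1 s * chi (s / r ^ 2) + P s * (chi1 (s / r ^ 2) / r ^ 2))
    (g2 := fun s => (-q * ((-q - 1) * P2 s) * chi (s / r ^ 2) + -q * P1 s * (chi1 (s / r ^ 2) / r ^ 2)) + (-q * P1 s * (chi1 (s / r ^ 2) / r ^ 2) + P s * (chi2 (s / r ^ 2) / r ^ 2 / r ^ 2)))
    (fun s hs => by
      refine ContDiffAt.mul ?_ (chi_cd.comp (contDiff_id.div_const _)).contDiffAt
      exact (contDiffAt_id.add contDiffAt_const).rpow_const_of_ne (hp s hs).ne')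
    (fun s hs => (dP s hs).mul (hc0 s))
    (fun s hs => (((dP1 s hs).const_mul (-q)).mul (hc0 s)).add ((dP s hs).mul ((hc1 s).div_const _))) x
  -- the error term
  have hE : ∀ s, 0 ≤ s → |4 * s * (2 * (-q * P1 s * (chi1 (s / r ^ 2) / r ^ 2)) + P s * (chi2 (s / r ^ 2) / r ^ 2 / r ^ 2)) + 2 * N * (P s * (chi1 (s / r ^ 2) / r ^ 2))|
      ≤ (4 * (2 * q * 2 ^ (q + 1) * B + 2 ^ (q + 1) * B) + 2 * N * 2 ^ (q + 1) * B) * r ^ (-(N:ℝ)) := by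
    intro s hs
    by_cases hs1 : s / r ^ 2 < 1 / 2 ∨ 1 < s / r ^ 2
    · rw [chi1_zero hs1, chi2_zero hs1]; simp; positivity
    push Not at hs1
    obtain ⟨l1, l2⟩ := hs1
    rw [le_div_iff₀ (by positivity)] at l1
    rw [div_le_iff₀ (by positivity), one_mul] at l2
    have hr2 : 0 < 1 / 2 * r ^ 2 := by positivity
    have hb1 : P1 s ≤ 2 ^ (q + 1) * r ^ (-(N:ℝ)) := by
      have : P1 s ≤ (1 / 2 * r ^ 2) ^ (-q - 1) := Real.rpow_le_rpow_of_nonpos hr2 (by linarith [sq_nonneg δ]) (by linarith)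
      refine this.trans (le_of_eq ?_)
      rw [Real.mul_rpow (by norm_num) (by positivity), one_div, Real.inv_rpow (by norm_num), ← Real.rpow_neg (by norm_num), ← Real.rpow_natCast, ← Real.rpow_mul hr0.le]
      congr 2 <;> [ring; (push_cast; rw [hNq]; ring)]
    have hb0 : P s ≤ 2 ^ (q + 1) * (r ^ (-(N:ℝ)) * r ^ 2) := by
      have : P s ≤ (1 / 2 * r ^ 2) ^ (-q) := Real.rpow_le_rpow_of_nonpos hr2 (by linarith [sq_nonneg δ]) (by linarith)
      refine this.trans ?_
      rw [Real.mul_rpow (by norm_num) (by positivity), one_div, Real.inv_rpow (by norm_num), ← Real.rpow_neg (by norm_num), ← Real.rpow_natCast, ← Real.rpow_mul hr0.le, ← Real.rpow_add hr0]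
      refine mul_le_mul (Real.rpow_le_rpow_of_exponent_le (by norm_num) (by linarith)) (le_of_eq ?_) (by positivity) (by positivity)
      congr 1; push_cast; rw [hNq]; ring
    obtain ⟨p0, p1, _⟩ := hPnn s hs
    obtain ⟨c1, c2⟩ := hB (s / r ^ 2)
    set Z := r ^ (-(N:ℝ)) with hZ
    have hZ0 : 0 ≤ Z := by positivity
    clear_value Z
    set A := (2:ℝ) ^ (q + 1) with hA
    have hA0 : 0 ≤ A := by positivity
    clear_value A P P1 P2
    have t1 : |-q * P1 s * (chi1 (s / r ^ 2) / r ^ 2)| ≤ q * (A * Z) * (B / r ^ 2) := by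
      rw [abs_mul, abs_mul, abs_neg, abs_of_pos hq0, abs_of_nonneg p1, abs_div, abs_of_nonneg (sq_nonneg r)]
      gcongr
    have t2 : |P s * (chi2 (s / r ^ 2) / r ^ 2 / r ^ 2)| ≤ A * (Z * r ^ 2) * (B / r ^ 2 / r ^ 2) := by
      rw [abs_mul, abs_of_nonneg p0, abs_div, abs_div, abs_of_nonneg (sq_nonneg r)]
      gcongr
    have t3 : |P s * (chi1 (s / r ^ 2) / r ^ 2)| ≤ A * (Z * r ^ 2) * (B / r ^ 2) := by
      rw [abs_mul, abs_of_nonneg p0, abs_div, abs_of_nonneg (sq_nonneg r)]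
      gcongr
    refine (abs_add_le _ _).trans ?_
    rw [abs_mul, abs_mul (2 * (N:ℝ)), abs_of_nonneg (by positivity : 0 ≤ 4 * s), abs_of_nonneg (by positivity : 0 ≤ 2 * (N:ℝ))]
    have t4 : |2 * (-q * P1 s * (chi1 (s / r ^ 2) / r ^ 2)) + P s * (chi2 (s / r ^ 2) / r ^ 2 / r ^ 2)| ≤ 2 * (q * (A * Z) * (B / r ^ 2)) + A * (Z * r ^ 2) * (B / r ^ 2 / r ^ 2) := by
      refine (abs_add_le _ _).trans (add_le_add ?_ t2)
      rw [abs_mul, abs_two]; linarith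
    calc _ ≤ 4 * r ^ 2 * (2 * (q * (A * Z) * (B / r ^ 2)) + A * (Z * r ^ 2) * (B / r ^ 2 / r ^ 2)) + 2 * N * (A * (Z * r ^ 2) * (B / r ^ 2)) := by gcongr
      _ = _ := by field_simp
  have hmain : ∀ y, - lap (fun y => P (‖y - x‖ ^ 2) * chi (‖y - x‖ ^ 2 / r ^ 2)) y = chi (‖y - x‖ ^ 2 / r ^ 2) * (2 * N * q * δ ^ 2 * P2 (‖y - x‖ ^ 2))
     - (4 * ‖y - x‖ ^ 2 * (2 * (-q * P1 (‖y - x‖ ^ 2) * (chi1 (‖y - x‖ ^ 2 / r ^ 2) / r ^ 2)) + P (‖y - x‖ ^ 2) * (chi2 (‖y - x‖ ^ 2 / r ^ 2) / r ^ 2 / r ^ 2)) + 2 * N * (P (‖y - x‖ ^ 2) * (chi1 (‖y - x‖ ^ 2 / r ^ 2) / r ^ 2))) := by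
    intro y
    rw [hlap, hP12 _ (sq_nonneg _), hNq]
    ring
  have hz : ∀ y, r < ‖y - x‖ → 1 < ‖y - x‖ ^ 2 / r ^ 2 := fun y hy => by
    rw [lt_div_iff₀ (by positivity), one_mul]; exact pow_lt_pow_left₀ hy hr0.le (by norm_num)
  refine ⟨fun y => P (‖y - x‖ ^ 2) * chi (‖y - x‖ ^ 2 / r ^ 2), ⟨hcd, ?_⟩, fun y => mul_nonneg (hPnn _ (sq_nonneg _)).1 (chi_nn _), fun y hy => ?_, fun y hy => ?_, fun y hy => ?_, fun y => ?_, fun y hy => ?_⟩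
  · refine HasCompactSupport.intro (isCompact_closedBall x r) fun y hy => ?_
    simp only [mem_closedBall, dist_eq_norm, not_le] at hy
    simp only [chi_zero (hz y hy).le, mul_zero]
  · have hpos : 0 < ‖y - x‖ := norm_pos_iff.2 (sub_ne_zero.2 hy)
    calc P (‖y - x‖ ^ 2) * chi (‖y - x‖ ^ 2 / r ^ 2) ≤ P (‖y - x‖ ^ 2) * 1 := mul_le_mul_of_nonneg_left (chi_le _) (hPnn _ (sq_nonneg _)).1
      _ ≤ (‖y - x‖ ^ 2) ^ (-q) := by rw [mul_one]; exact Real.rpow_le_rpow_of_nonpos (by positivity) (by linarith [sq_nonneg δ]) (by linarith)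
      _ = _ := by rw [← Real.rpow_natCast, ← Real.rpow_mul hpos.le]; congr 1; push_cast; rw [hNq]; ring
  · simp only [chi_zero (hz y hy).le, mul_zero]
  · have := hmain y
    rw [chi_zero (hz y hy).le, chi1_zero (Or.inr (hz y hy)), chi2_zero (Or.inr (hz y hy))] at this
    simpa using this
  · rw [hmain]
    have h1 := (abs_le.1 (hE _ (sq_nonneg ‖y - x‖))).2
    have h2 : 0 ≤ chi (‖y - x‖ ^ 2 / r ^ 2) * (2 * N * q * δ ^ 2 * P2 (‖y - x‖ ^ 2)) := by
      have := (hPnn _ (sq_nonneg ‖y - x‖)).2.2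
      have := chi_nn (‖y - x‖ ^ 2 / r ^ 2)
      positivity
    linarith
  · have hs2 : ‖y - x‖ ^ 2 ≤ δ ^ 2 := pow_le_pow_left₀ (norm_nonneg _) hy 2
    have hdr : (2 * δ) ^ 2 ≤ r ^ 2 := pow_le_pow_left₀ (by positivity) hr 2
    have hd2 : 0 < δ ^ 2 := by positivity
    have hs3 : ‖y - x‖ ^ 2 / r ^ 2 < 1 / 2 := by
      rw [div_lt_iff₀ (by positivity)]; linarith
    rw [hmain, chi_one hs3.le, chi1_zero (Or.inl hs3), chi2_zero (Or.inl hs3)]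
    have h3 : (2 * δ ^ 2) ^ (-q - 2) ≤ P2 (‖y - x‖ ^ 2) := Real.rpow_le_rpow_of_nonpos (hp _ (sq_nonneg _)) (by linarith) (by linarith)
    have h4 : δ ^ 2 * (2 * δ ^ 2) ^ (-q - 2) = 2 ^ (-q - 2) * δ ^ (-(N:ℝ)) := by
      rw [Real.mul_rpow (by norm_num) (by positivity), ← Real.rpow_natCast, ← Real.rpow_mul hδ.le, mul_left_comm, ← Real.rpow_add hδ]
      congr 2; push_cast; rw [hNq]; ring
    have h5 : 2 * N * q * (δ ^ 2 * (2 * δ ^ 2) ^ (-q - 2)) ≤ 2 * N * q * (δ ^ 2 * P2 (‖y - x‖ ^ 2)) := by gcongr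
    rw [h4] at h5
    simp only [zero_div, mul_zero, add_zero, sub_zero, one_mul]
    linarith

lemma newton (hN : 3 ≤ N) : ∃ C : ℝ, 0 < C ∧ ∀ (f G : Euc N → ℝ) (b M : ℝ), BM M f → (∀ x, 0 ≤ f x) → (∀ x, 0 ≤ G x) → 0 ≤ b →
    (∀ φ, Test φ → (∀ x, 0 ≤ φ x) → - (∫ x, f x * lap φ x) ≤ b * ∫ x, φ x * G x) →
    ∀ᵐ x, ∀ r, 0 < r → IntegrableOn (fun y => ‖y - x‖ ^ (2 - (N:ℝ)) * G y) (closedBall x r) →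
      f x ≤ C * (b * (∫ y in closedBall x r, ‖y - x‖ ^ (2 - (N:ℝ)) * G y) + r ^ (-(N:ℝ)) * ∫ y in closedBall x r, f y) := by
  obtain ⟨c, A, hc, hA, H⟩ := newton_test hN
  set V := (volume : Measure (Euc N)).real (ball 0 1) with hV
  have hV0 : 0 < V := ENNReal.toReal_pos (measure_ball_pos _ _ one_pos).ne' measure_ball_lt_top.ne
  refine ⟨(1 + A) / (c * V), by positivity, fun f G b M hf f0 G0 hb hyp => ?_⟩
  have hfi : ∀ (x : Euc N) (r : ℝ), IntegrableOn f (closedBall x r) := fun x r => by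
    refine Measure.integrableOn_of_bounded (M := M) (isCompact_closedBall x r).measure_lt_top.ne hf.1.aestronglyMeasurable (ae_of_all _ fun y => hf.2 y)
  have hli : LocallyIntegrable f := fun x => ⟨closedBall x 1, closedBall_mem_nhds x one_pos, hfi x 1⟩
  filter_upwards [IsUnifLocDoublingMeasure.ae_tendsto_average (μ := (volume : Measure (Euc N))) hli 1] with x hx r hr hint
  set J := ∫ y in closedBall x r, ‖y - x‖ ^ (2 - (N:ℝ)) * G y with hJ
  set Q := ∫ y in closedBall x r, f y with hQ
  have hJ0 : 0 ≤ J := integral_nonneg fun y => mul_nonneg (Real.rpow_nonneg (norm_nonneg _) _) (G0 y)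
  have hQ0 : 0 ≤ Q := integral_nonneg fun y => f0 y
  have key : ∀ δ, 0 < δ → 2 * δ ≤ r → ⨍ y in closedBall x δ, f y ≤ (1 + A) / (c * V) * (b * J + r ^ (-(N:ℝ)) * Q) := by
    intro δ hδ hδr
    obtain ⟨φ, hφ, φ0, φ1, φ2, φ3, φ4, φ5⟩ := H x δ r hδ hδr
    have h1 := hyp φ hφ φ0
    have hG : ∫ y, φ y * G y ≤ J := by
      rw [hJ, ← integral_indicator measurableSet_closedBall]
      refine integral_mono_of_nonneg (ae_of_all _ fun y => mul_nonneg (φ0 y) (G0 y)) (hint.integrable_indicator measurableSet_closedBall) ?_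
      have : ∀ᵐ y : Euc N, y ≠ x := by
        have : Nonempty (Fin N) := ⟨⟨0, by omega⟩⟩
        simp [ae_iff]
      filter_upwards [this] with y hy
      by_cases hyr : y ∈ closedBall x r
      · rw [indicator_of_mem hyr]; exact mul_le_mul_of_nonneg_right (φ1 y hy) (G0 y)
      · rw [indicator_of_notMem hyr]
        simp only [mem_closedBall, dist_eq_norm, not_le] at hyr
        rw [φ2 y hyr, zero_mul]
    have i1 : Integrable (fun y => f y * lap φ y) := by
      refine hφ.lap.integrable.bdd_mul hf.1.aestronglyMeasurable (ae_of_all _ hf.2)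
    have hF : c * δ ^ (-(N:ℝ)) * (∫ y in closedBall x δ, f y) - A * r ^ (-(N:ℝ)) * Q ≤ - ∫ y, f y * lap φ y := by
      rw [hQ, ← integral_indicator measurableSet_closedBall, ← integral_indicator measurableSet_closedBall, ← integral_const_mul, ← integral_const_mul, ← integral_neg,
        ← integral_sub (((hfi x δ).integrable_indicator measurableSet_closedBall).const_mul _) (((hfi x r).integrable_indicator measurableSet_closedBall).const_mul _)]
      refine integral_mono ((((hfi x δ).integrable_indicator measurableSet_closedBall).const_mul _).sub (((hfi x r).integrable_indicator measurableSet_closedBall).const_mul _)) i1.neg fun y => ?_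
      simp only
      have hr0 : 0 ≤ A * r ^ (-(N:ℝ)) := by positivity
      by_cases y1 : y ∈ closedBall x δ
      · have y2 : y ∈ closedBall x r := closedBall_subset_closedBall (by linarith) y1
        rw [indicator_of_mem y1, indicator_of_mem y2]
        have := φ5 y (by simpa [dist_eq_norm] using y1)
        have := mul_le_mul_of_nonneg_left this (f0 y)
        have := mul_nonneg hr0 (f0 y)
        linarith
      · rw [indicator_of_notMem y1]
        by_cases y2 : y ∈ closedBall x r
        · rw [indicator_of_mem y2]
          have := mul_le_mul_of_nonneg_left (φ4 y) (f0 y)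
          linarith
        · rw [indicator_of_notMem y2]
          simp only [mem_closedBall, dist_eq_norm, not_le] at y2
          rw [φ3 y y2]; simp
    have hvol : (volume : Measure (Euc N)).real (closedBall x δ) = δ ^ (N:ℝ) * V := by
      rw [Measure.addHaar_real_closedBall _ _ hδ.le, finrank_euclideanSpace_fin, Real.rpow_natCast]
    rw [setAverage_eq, hvol, smul_eq_mul, mul_inv, ← Real.rpow_neg hδ.le, div_mul_eq_mul_div, le_div_iff₀ (by positivity)]
    have e1 : b * ∫ y, φ y * G y ≤ b * J := mul_le_mul_of_nonneg_left hG hb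
    have e2 : δ ^ (-(N:ℝ)) * V⁻¹ * (∫ y in closedBall x δ, f y) * (c * V) = c * δ ^ (-(N:ℝ)) * (∫ y in closedBall x δ, f y) := by
      field_simp
    rw [e2]
    have e3 : 0 ≤ b * J := by positivity
    have e4 : 0 ≤ r ^ (-(N:ℝ)) * Q := by positivity
    have e5 := mul_nonneg hA e3
    linarith
  have hd : Tendsto (fun n : ℕ => r / 2 / ((n:ℝ) + 1)) atTop (nhdsWithin 0 (Ioi 0)) := by
    refine tendsto_nhdsWithin_iff.2 ⟨?_, Eventually.of_forall fun n => ?_⟩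
    · have := (tendsto_one_div_add_atTop_nhds_zero_nat (𝕜 := ℝ)).const_mul (r / 2)
      simpa [div_eq_mul_inv] using this
    · exact mem_Ioi.2 (by positivity)
  have ht := hx (fun _ => x) _ hd (Eventually.of_forall fun n => mem_closedBall_self (by positivity))
  refine le_of_tendsto ht (Eventually.of_forall fun n => key _ (by positivity) ?_)
  rw [mul_div_assoc', mul_div_cancel₀ _ two_ne_zero]
  exact div_le_self hr.le (by linarith [n.cast_nonneg (α := ℝ)])

end

noncomputable section

variable {N : ℕ} {γ k K m δ h M : ℝ} {ρ : Euc N → ℝ}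

lemma kern_pt {q g a b : ℝ} (hq : 0 ≤ q) (hg : 0 ≤ g) (ha : 0 < a) (hb : 0 < b) : a ^ (-q) * b ^ (-g) ≤ a ^ (-(q + g)) + (if b < a then b ^ (-(q + g)) else 0) := by
  have e : ∀ c : ℝ, 0 < c → c ^ (-(q + g)) = c ^ (-q) * c ^ (-g) := fun c hc => by rw [← Real.rpow_add hc]; congr 1; ring
  split_ifs with h
  · have h1 : a ^ (-q) ≤ b ^ (-q) := Real.rpow_le_rpow_of_nonpos hb h.le (by linarith)
    have h2 := mul_le_mul_of_nonneg_right h1 (Real.rpow_nonneg hb.le (-g))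
    rw [← e b hb] at h2
    have := Real.rpow_nonneg ha.le (-(q + g))
    linarith
  · push Not at h
    have h1 : b ^ (-g) ≤ a ^ (-g) := Real.rpow_le_rpow_of_nonpos ha h (by linarith)
    have h2 := mul_le_mul_of_nonneg_left h1 (Real.rpow_nonneg ha.le (-q))
    rw [← e a ha] at h2
    linarith

lemma kern (w : Wt γ k K ρ) : ∃ C, 0 < C ∧ ∀ (x : Euc N) (r : ℝ), 0 < r →
    IntegrableOn (fun y => ‖y - x‖ ^ (2 - (N:ℝ)) * ρ y) (closedBall x r) ∧ ∫ y in closedBall x r, ‖y - x‖ ^ (2 - (N:ℝ)) * ρ y ≤ C * r ^ (2 - γ) := by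
  have hN' : (3:ℝ) ≤ N := by exact_mod_cast w.hN
  have h0 := w.g0
  have h2 := w.g2
  have hK : 0 < K := w.K0
  set q : ℝ := N - 2 + γ with hq
  have hqN : q < N := by linarith
  have hs := sph_nn (N := N) hqN
  refine ⟨K * sph N q * (2 ^ (2 - γ) + 1) + 1, by positivity, fun x r hr => ?_⟩
  have b1 := ball_rpow w.hN hqN (R := 2 * r) (by positivity)
  have b2 := ball_rpow w.hN hqN hr
  have hNq : (N:ℝ) - q = 2 - γ := by rw [hq]; ring
  rw [hNq] at b1 b2
  rw [← integrable_indicator_iff measurableSet_ball, ← integral_indicator measurableSet_ball] at b1 b2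
  set f1 : Euc N → ℝ := (ball 0 (2 * r)).indicator (fun y => ‖y‖ ^ (-q)) with hf1
  set f2 : Euc N → ℝ := (ball 0 r).indicator (fun y => ‖y‖ ^ (-q)) with hf2
  have j1 : Integrable (fun y => f1 (y - x)) := b1.1.comp_sub_right x
  have e1 : ∫ y, f1 (y - x) = sph N q * (2 * r) ^ (2 - γ) := by rw [integral_sub_right_eq_self f1 x, b1.2]
  have iT : Integrable (fun y => K * (f1 (y - x) + f2 y)) := (j1.add b2.1).const_mul K
  have f0 : ∀ y, 0 ≤ f1 y := fun y => indicator_nonneg (fun y _ => Real.rpow_nonneg (norm_nonneg _) _) _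
  have f0' : ∀ y, 0 ≤ f2 y := fun y => indicator_nonneg (fun y _ => Real.rpow_nonneg (norm_nonneg _) _) _
  have hx : ∀ᵐ y : Euc N, y ≠ x := by
    have : Nonempty (Fin N) := ⟨⟨0, by have := w.hN; omega⟩⟩
    simp [ae_iff]
  have hae : ∀ᵐ y, (closedBall x r).indicator (fun y => ‖y - x‖ ^ (2 - (N:ℝ)) * ρ y) y ≤ K * (f1 (y - x) + f2 y) := by
    filter_upwards [ae_ne_zero w.hN, hx] with y hy hyx
    by_cases hm : y ∈ closedBall x r
    · rw [indicator_of_mem hm]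
      have hyr : ‖y - x‖ ≤ r := by simpa [dist_eq_norm] using hm
      have hp1 : 0 < ‖y - x‖ := norm_pos_iff.2 (sub_ne_zero.2 hyx)
      have hp2 : 0 < ‖y‖ := norm_pos_iff.2 hy
      have m1 : y - x ∈ ball (0 : Euc N) (2 * r) := by simp; linarith
      have h3 : f1 (y - x) = ‖y - x‖ ^ (-q) := indicator_of_mem m1 _
      have h4 := kern_pt (q := N - 2) (g := γ) (by linarith) h0 hp1 hp2
      have h5 : (if ‖y‖ < ‖y - x‖ then ‖y‖ ^ (-((N:ℝ) - 2 + γ)) else 0) ≤ f2 y := by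
        split_ifs with hlt
        · rw [hf2, indicator_of_mem (by simp; linarith)]
        · exact f0' y
      have h6 : ‖y - x‖ ^ (2 - (N:ℝ)) * ρ y ≤ K * (‖y - x‖ ^ (-((N:ℝ) - 2)) * ‖y‖ ^ (-γ)) := by
        rw [show -((N:ℝ) - 2) = 2 - N by ring]
        calc _ ≤ ‖y - x‖ ^ (2 - (N:ℝ)) * (K * ‖y‖ ^ (-γ)) := mul_le_mul_of_nonneg_left (w.up y hy) (by positivity)
          _ = _ := by ring
      refine h6.trans (mul_le_mul_of_nonneg_left ?_ hK.le)
      rw [h3]; linarith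
    · rw [indicator_of_notMem hm]
      have := f0 (y - x); have := f0' y
      positivity
  have hnn : ∀ y, 0 ≤ (closedBall x r).indicator (fun y => ‖y - x‖ ^ (2 - (N:ℝ)) * ρ y) y := fun y =>
    indicator_nonneg (fun y _ => mul_nonneg (Real.rpow_nonneg (norm_nonneg _) _) (w.pos y).le) _
  have hmeas : Measurable (fun y => ‖y - x‖ ^ (2 - (N:ℝ)) * ρ y) := ((measurable_id.sub_const x).norm.pow_const _).mul w.meas
  rw [← integrable_indicator_iff measurableSet_closedBall, ← integral_indicator measurableSet_closedBall]
  have i1 : Integrable ((closedBall x r).indicator (fun y => ‖y - x‖ ^ (2 - (N:ℝ)) * ρ y)) :=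
    iT.mono' (hmeas.indicator measurableSet_closedBall).aestronglyMeasurable (hae.mono fun y hy => by rwa [Real.norm_of_nonneg (hnn y)])
  refine ⟨i1, (integral_mono_ae i1 iT hae).trans ?_⟩
  rw [integral_const_mul, integral_add j1 b2.1, e1, b2.2, Real.mul_rpow (by norm_num) hr.le]
  have : 0 ≤ r ^ (2 - γ) := by positivity
  linarith

def alp (m γ : ℝ) : ℝ := (2 - γ) / (m - 1)
def aa (N : ℕ) (m γ : ℝ) : ℝ := alp m γ + N - γ
def DD (N : ℕ) (m γ : ℝ) : ℝ := 1 + (m - 1) * N / (2 - γ)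
def lam (N : ℕ) (m γ : ℝ) : ℝ := N / (2 - γ) / DD N m γ

/-- algebraic part of the smoothing -/
lemma smooth_alg (w : Wt γ k K ρ) (hm : 1 < m) {C1 : ℝ} (hC : 0 < C1) : ∃ C, 0 < C ∧ ∀ b I S : ℝ, 0 < b → 0 < I → 0 < S →
    (∀ κ, 0 < κ → κ ≤ 1 → S ^ m ≤ C1 * (b * κ ^ (2 - γ) * (2 * S) + κ ^ (-(N:ℝ)) * (2 * S) ^ (m - 1) * I)) →
    S ≤ C * (b ^ lam N m γ * I ^ (1 / DD N m γ) + I) := by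
  have hp : 0 < 2 - γ := by linarith [w.g2]
  have hN' : (3:ℝ) ≤ N := by exact_mod_cast w.hN
  have hm1 : 0 < m - 1 := by linarith
  have hD : 0 < DD N m γ := by unfold DD; positivity
  set C2 := C1 * 2 ^ m with hC2
  have hC20 : 0 < C2 := by positivity
  refine ⟨C2 + (C2 * (4 * C1) ^ ((N:ℝ) / (2 - γ))) ^ (1 / DD N m γ), by positivity, fun b I S hb hI hS hyp => ?_⟩
  have hSm : S ^ m = S ^ (m - 1) * S := by
    rw [← Real.rpow_add_one hS.ne']; congr 1; ring
  have main : ∀ κ, 0 < κ → κ ≤ 1 → κ ^ (2 - γ) ≤ S ^ (m - 1) / (4 * C1 * b) → S ≤ C2 * κ ^ (-(N:ℝ)) * I := by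
    intro κ h0 h1 h2
    have h3 := hyp κ h0 h1
    rw [le_div_iff₀ (by positivity)] at h2
    have h4 : C1 * (b * κ ^ (2 - γ) * (2 * S)) ≤ S ^ m / 2 := by
      have := mul_le_mul_of_nonneg_right h2 hS.le
      rw [hSm]; linarith
    rw [Real.mul_rpow (by norm_num) hS.le] at h3
    have h22 : (2:ℝ) ^ m = 2 ^ (m - 1) * 2 := by rw [← Real.rpow_add_one (by norm_num)]; congr 1; ring
    have h5 : S ^ (m - 1) * S ≤ S ^ (m - 1) * (C2 * κ ^ (-(N:ℝ)) * I) := by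
      rw [← hSm, hC2, h22]
      linarith
    exact le_of_mul_le_mul_left h5 (by positivity)
  have t1 : 0 ≤ b ^ lam N m γ * I ^ (1 / DD N m γ) := by positivity
  set C3 := (C2 * (4 * C1) ^ ((N:ℝ) / (2 - γ))) ^ (1 / DD N m γ) with hC3
  have hC30 : 0 ≤ C3 := by positivity
  by_cases hA : 1 ≤ S ^ (m - 1) / (4 * C1 * b)
  · have := main 1 one_pos le_rfl (by rwa [Real.one_rpow])
    rw [Real.one_rpow, mul_one] at this
    have := mul_nonneg hC20.le t1
    have := mul_nonneg hC30 (add_nonneg t1 hI.le)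
    linarith
  · push Not at hA
    set A := S ^ (m - 1) / (4 * C1 * b) with hAdef
    have hA0 : 0 < A := by positivity
    have h1 := main (A ^ (1 / (2 - γ))) (by positivity) (Real.rpow_le_one hA0.le hA.le (by positivity)) (by
      rw [← Real.rpow_mul hA0.le, one_div_mul_cancel hp.ne', Real.rpow_one])
    have h2 : S ^ DD N m γ ≤ C2 * (4 * C1) ^ ((N:ℝ) / (2 - γ)) * (b ^ ((N:ℝ) / (2 - γ)) * I) := by
      have e1 : (A ^ (1 / (2 - γ))) ^ (-(N:ℝ)) = (4 * C1) ^ ((N:ℝ) / (2 - γ)) * b ^ ((N:ℝ) / (2 - γ)) * (S ^ ((m - 1) * N / (2 - γ)))⁻¹ := by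
        rw [← Real.rpow_mul hA0.le, hAdef, Real.div_rpow (by positivity) (by positivity), ← Real.rpow_mul hS.le, ← Real.mul_rpow (by positivity) hb.le, ← Real.rpow_neg hS.le, div_eq_mul_inv, ← Real.rpow_neg (by positivity), mul_comm]
        congr 2 <;> field_simp
      have e2 : S ^ DD N m γ = S * S ^ ((m - 1) * N / (2 - γ)) := by
        unfold DD; rw [Real.rpow_add hS, Real.rpow_one]
      have hZ : 0 < S ^ ((m - 1) * N / (2 - γ)) := by positivity
      rw [e1] at h1
      rw [e2]
      calc _ ≤ _ := mul_le_mul_of_nonneg_right h1 hZ.le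
        _ = _ := by field_simp
    have h3 : S ≤ C3 * (b ^ lam N m γ * I ^ (1 / DD N m γ)) := by
      have := Real.rpow_le_rpow (by positivity) h2 (z := 1 / DD N m γ) (by positivity)
      rw [← Real.rpow_mul hS.le, mul_one_div_cancel hD.ne', Real.rpow_one, Real.mul_rpow (by positivity) (by positivity), Real.mul_rpow (by positivity) hI.le, ← Real.rpow_mul hb.le] at this
      unfold lam
      rw [div_eq_mul_one_div ((N:ℝ) / (2 - γ))]
      exact this
    have := mul_nonneg hC20.le t1
    have := mul_nonneg hC30 hI.le
    have := mul_nonneg hC20.le hI.le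
    linarith

end

noncomputable section

variable {N : ℕ} {γ k K m δ h M : ℝ} {ρ : Euc N → ℝ}

lemma alp_nn (w : Wt γ k K ρ) (hm : 1 < m) : 0 < alp m γ := div_pos (by linarith [w.g2]) (by linarith)
lemma alp_m (hm : 1 < m) : alp m γ * (m - 1) = 2 - γ := by unfold alp; exact div_mul_cancel₀ _ (by linarith)
lemma aa_pos (w : Wt γ k K ρ) (hm : 1 < m) : 0 < aa N m γ := by unfold aa; linarith [alp_nn w hm, w.gN]

lemma BM.ion {C : ℝ} {f : Euc N → ℝ} (hf : BM C f) (x : Euc N) (r : ℝ) : IntegrableOn f (closedBall x r) :=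
  Measure.integrableOn_of_bounded (M := C) (isCompact_closedBall x r).measure_lt_top.ne hf.1.aestronglyMeasurable (ae_of_all _ fun y => hf.2 y)

/-- lower bound of the weight on balls -/
lemma Wt.lo_ball (w : Wt γ k K ρ) {R : ℝ} (hR : 1 ≤ R) {y : Euc N} (hy : ‖y‖ < R) : 1 ≤ (2 * R) ^ γ / k * ρ y := by
  have h1 := w.lo y
  have hk := w.k0
  have h2 : (2 * R) ^ (-γ) ≤ (1 + ‖y‖) ^ (-γ) := Real.rpow_le_rpow_of_nonpos (by positivity) (by linarith) (by linarith [w.g0])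
  have h3 : k * (2 * R) ^ (-γ) ≤ ρ y := (mul_le_mul_of_nonneg_left h2 hk.le).trans h1
  rw [Real.rpow_neg (by linarith)] at h3
  have hp : 0 < (2 * R) ^ γ := by positivity
  rw [div_mul_eq_mul_div, le_div_iff₀ hk, one_mul]
  calc k = (2 * R) ^ γ * (k * ((2 * R) ^ γ)⁻¹) := by field_simp
    _ ≤ _ := mul_le_mul_of_nonneg_left h3 hp.le

theorem smooth_imp (w : Wt γ k K ρ) (hm : 1 < m) : ∃ C1, 0 < C1 ∧ ∀ (u : Euc N → ℝ) (M b I r S κ : ℝ), BM M u → (∀ x, 0 ≤ u x) → 0 ≤ b → 0 ≤ I → 1 ≤ r →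
    (∀ φ, Test φ → (∀ x, 0 ≤ φ x) → - (∫ x, spow m (u x) * lap φ x) ≤ b * ∫ x, φ x * (ρ x * u x)) →
    (∀ R, r ≤ R → ∫ x in ball (0 : Euc N) R, ρ x * u x ≤ I * R ^ aa N m γ) →
    0 ≤ S → (∀ R, r ≤ R → ∀ᵐ x : Euc N, ‖x‖ < R → u x ≤ S * R ^ alp m γ) → 0 < κ → κ ≤ 1 →
    ∀ R, r ≤ R → ∀ᵐ x : Euc N, ‖x‖ < R → u x ^ m ≤ C1 * (b * κ ^ (2 - γ) * S + κ ^ (-(N:ℝ)) * S ^ (m - 1) * I) * (R ^ alp m γ) ^ m := by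
  obtain ⟨C0, hC0, hnew⟩ := newton w.hN
  obtain ⟨Ck, hCk, hker⟩ := kern w
  have hk := w.k0
  set α := alp m γ with hα
  have hα0 : 0 < α := alp_nn w hm
  have hαm : α * (m - 1) = 2 - γ := alp_m hm
  set a := aa N m γ with ha
  have haα : a = α + N - γ := rfl
  set A1 := (2:ℝ) ^ α * Ck with hA1
  set A2 := ((2:ℝ) ^ α) ^ (m - 1) * (4 ^ γ / k) * 2 ^ a with hA2
  have hA10 : 0 < A1 := by positivity
  have hA20 : 0 < A2 := by positivity
  refine ⟨C0 * (A1 + A2), by positivity, ?_⟩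
  intro u M b I r S κ hu u0 hb hI hr hyp hgr hS hval hκ0 hκ1 R hR
  have hR1 : 1 ≤ R := hr.trans hR
  have hR0 : 0 < R := by linarith
  have hm0 : 0 < m := by linarith
  have hsp : ∀ x, spow m (u x) = u x ^ m := fun x => spow_nn hm0 (u0 x)
  have hbm : BM (M ^ m) (fun x => spow m (u x)) := by
    refine ⟨(spow_meas m).comp hu.1, fun x => ?_⟩
    show |spow m (u x)| ≤ M ^ m
    rw [hsp, abs_of_nonneg (Real.rpow_nonneg (u0 x) _)]
    exact Real.rpow_le_rpow (u0 x) ((le_abs_self _).trans (hu.2 x)) hm0.le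
  have hN1 := hnew (fun x => spow m (u x)) (fun x => ρ x * u x) b (M ^ m) hbm (fun x => by rw [hsp]; exact Real.rpow_nonneg (u0 x) _) (fun x => mul_nonneg (w.pos x).le (u0 x)) hb hyp
  have hv2 := hval (2 * R) (by linarith)
  filter_upwards [hN1] with x hx hxR
  have hκR : 0 < κ * R := by positivity
  have hsub : closedBall x (κ * R) ⊆ ball 0 (2 * R) := by
    intro y hy
    have h1 : ‖y - x‖ ≤ κ * R := by simpa [dist_eq_norm] using hy
    have h2 : κ * R ≤ R := mul_le_of_le_one_left hR0.le hκ1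
    have h3 := norm_le_norm_add_norm_sub x y
    rw [norm_sub_rev] at h3
    simp; linarith
  obtain ⟨k1, k2⟩ := hker x (κ * R) hκR
  set Y := S * (2 * R) ^ α with hY
  have hY0 : 0 ≤ Y := by positivity
  have i1 : IntegrableOn (fun y => Y * (‖y - x‖ ^ (2 - (N:ℝ)) * ρ y)) (closedBall x (κ * R)) := k1.const_mul Y
  have hb1 : ∀ᵐ y ∂volume.restrict (closedBall x (κ * R)), ‖y - x‖ ^ (2 - (N:ℝ)) * (ρ y * u y) ≤ Y * (‖y - x‖ ^ (2 - (N:ℝ)) * ρ y) := by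
    rw [ae_restrict_iff' measurableSet_closedBall]
    filter_upwards [hv2] with y hy hyb
    have h1 := hy (by simpa using hsub hyb)
    have : 0 ≤ ‖y - x‖ ^ (2 - (N:ℝ)) * ρ y := mul_nonneg (Real.rpow_nonneg (norm_nonneg _) _) (w.pos y).le
    calc _ = u y * (‖y - x‖ ^ (2 - (N:ℝ)) * ρ y) := by ring
      _ ≤ _ := mul_le_mul_of_nonneg_right h1 this
  have hnn1 : ∀ y, 0 ≤ ‖y - x‖ ^ (2 - (N:ℝ)) * (ρ y * u y) := fun y => mul_nonneg (Real.rpow_nonneg (norm_nonneg _) _) (mul_nonneg (w.pos y).le (u0 y))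
  have i2 : IntegrableOn (fun y => ‖y - x‖ ^ (2 - (N:ℝ)) * (ρ y * u y)) (closedBall x (κ * R)) :=
    Integrable.mono' i1 (((measurable_id.sub_const x).norm.pow_const _).mul (w.meas.mul hu.1)).aestronglyMeasurable (hb1.mono fun y hy => by rwa [Real.norm_of_nonneg (hnn1 y)])
  have hx1 := hx (κ * R) hκR i2
  have J1 : ∫ y in closedBall x (κ * R), ‖y - x‖ ^ (2 - (N:ℝ)) * (ρ y * u y) ≤ Y * (Ck * (κ * R) ^ (2 - γ)) := by
    refine (integral_mono_ae i2 i1 hb1).trans ?_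
    rw [integral_const_mul]
    exact mul_le_mul_of_nonneg_left k2 hY0
  -- second integral
  have iρ : IntegrableOn (fun y => ρ y * u y) (ball 0 (2 * R)) := by
    refine ((w.ball (R := 2 * R) (by positivity)).1.mul_const M).mono' (w.meas.mul hu.1).aestronglyMeasurable (ae_of_all _ fun y => ?_)
    rw [norm_mul, Real.norm_of_nonneg (w.pos y).le]
    exact mul_le_mul_of_nonneg_left (hu.2 y) (w.pos y).le
  have i3 : IntegrableOn (fun y => Y ^ (m - 1) * ((2 * (2 * R)) ^ γ / k) * (ρ y * u y)) (ball 0 (2 * R)) := iρ.const_mul _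
  have J2 : ∫ y in closedBall x (κ * R), spow m (u y) ≤ Y ^ (m - 1) * ((2 * (2 * R)) ^ γ / k) * (I * (2 * R) ^ a) := by
    calc _ ≤ ∫ y in ball 0 (2 * R), spow m (u y) := by
          refine setIntegral_mono_set ((hbm.ion 0 (2 * R)).mono_set ball_subset_closedBall) (ae_of_all _ fun y => ?_) (ae_of_all _ hsub)
          simp only [Pi.zero_apply]; rw [hsp]; exact Real.rpow_nonneg (u0 y) _
      _ ≤ ∫ y in ball 0 (2 * R), Y ^ (m - 1) * ((2 * (2 * R)) ^ γ / k) * (ρ y * u y) := by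
          refine integral_mono_ae ((hbm.ion 0 (2 * R)).mono_set ball_subset_closedBall) i3 ?_
          refine (ae_restrict_iff' measurableSet_ball).2 ?_
          filter_upwards [hv2] with y hy hyb
          have hyb' : ‖y‖ < 2 * R := by simpa using hyb
          have h1 := hy hyb'
          rw [hsp]
          have h2 : u y ^ m = u y ^ (m - 1) * u y := by
            rcases (u0 y).eq_or_lt with h | h
            · rw [← h, Real.zero_rpow hm0.ne', mul_zero]
            · rw [← Real.rpow_add_one h.ne']; congr 1; ring
          have h3 := w.lo_ball (R := 2 * R) (by linarith) hyb'
          have h4 : u y ^ (m - 1) ≤ Y ^ (m - 1) := Real.rpow_le_rpow (u0 y) h1 (by linarith)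
          rw [h2]
          calc _ ≤ Y ^ (m - 1) * (1 * u y) := by rw [one_mul]; exact mul_le_mul_of_nonneg_right h4 (u0 y)
            _ ≤ Y ^ (m - 1) * (((2 * (2 * R)) ^ γ / k * ρ y) * u y) := mul_le_mul_of_nonneg_left (mul_le_mul_of_nonneg_right h3 (u0 y)) (by positivity)
            _ = _ := by ring
      _ ≤ _ := by
          rw [integral_const_mul]
          exact mul_le_mul_of_nonneg_left (hgr _ (by linarith)) (by positivity)
  rw [hsp] at hx1
  refine hx1.trans ?_
  have e1 : b * (Y * (Ck * (κ * R) ^ (2 - γ))) = A1 * (b * κ ^ (2 - γ) * S) * (R ^ α) ^ m := by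
    have : (R ^ α) ^ m = R ^ α * R ^ (2 - γ) := by
      rw [← Real.rpow_mul hR0.le, ← Real.rpow_add hR0, ← hαm]; congr 1; ring
    rw [this, hY, hA1, Real.mul_rpow (by norm_num) hR0.le, Real.mul_rpow hκ0.le hR0.le]; ring
  have e2 : (κ * R) ^ (-(N:ℝ)) * (Y ^ (m - 1) * ((2 * (2 * R)) ^ γ / k) * (I * (2 * R) ^ a)) = A2 * (κ ^ (-(N:ℝ)) * S ^ (m - 1) * I) * (R ^ α) ^ m := by
    have e3 : R ^ (-(N:ℝ)) * (R ^ α) ^ (m - 1) * R ^ γ * R ^ a = (R ^ α) ^ m := by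
      rw [← Real.rpow_mul hR0.le, ← Real.rpow_mul hR0.le, ← Real.rpow_add hR0, ← Real.rpow_add hR0, ← Real.rpow_add hR0]
      congr 1; rw [haα]; ring
    rw [← e3, hY, hA2, Real.mul_rpow hκ0.le hR0.le, Real.mul_rpow hS (by positivity), Real.mul_rpow (by norm_num) hR0.le, Real.mul_rpow (by positivity) (by positivity),
      show 2 * (2 * R) = 4 * R by ring, Real.mul_rpow (by norm_num) hR0.le, Real.mul_rpow (by norm_num : (0:ℝ) ≤ 2) hR0.le]
    ring
  have g1 := mul_le_mul_of_nonneg_left J1 hb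
  have g2 := mul_le_mul_of_nonneg_left J2 (Real.rpow_nonneg hκR.le (-(N:ℝ)))
  rw [e1] at g1
  rw [e2] at g2
  rw [mul_assoc C0, mul_assoc C0]
  refine mul_le_mul_of_nonneg_left ((add_le_add g1 g2).trans ?_) hC0.le
  have z1 : 0 ≤ b * κ ^ (2 - γ) * S := by positivity
  have z2 : 0 ≤ κ ^ (-(N:ℝ)) * S ^ (m - 1) * I := by positivity
  have z3 : 0 ≤ (R ^ α) ^ m := by positivity
  rw [← add_mul]
  refine mul_le_mul_of_nonneg_right ?_ z3
  have := mul_nonneg hA10.le z2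
  have := mul_nonneg hA20.le z1
  linarith

theorem smooth (w : Wt γ k K ρ) (hm : 1 < m) : ∃ C, 0 < C ∧ ∀ (u : Euc N → ℝ) (M b I r : ℝ), BM M u → (∀ x, 0 ≤ u x) → 0 < b → 0 < I → 1 ≤ r →
    (∀ φ, Test φ → (∀ x, 0 ≤ φ x) → - (∫ x, spow m (u x) * lap φ x) ≤ b * ∫ x, φ x * (ρ x * u x)) →
    (∀ R, r ≤ R → ∫ x in ball (0 : Euc N) R, ρ x * u x ≤ I * R ^ aa N m γ) →
    ∀ R, r ≤ R → ∀ᵐ x : Euc N, ‖x‖ < R → u x ≤ C * (b ^ lam N m γ * I ^ (1 / DD N m γ) + I) * R ^ alp m γ := by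
  obtain ⟨C1, hC1, himp⟩ := smooth_imp w hm
  obtain ⟨C, hC, halg⟩ := smooth_alg w hm hC1
  refine ⟨2 * C, by positivity, ?_⟩
  intro u M b I r hu u0 hb hI hr hyp hgr
  have hm0 : 0 < m := by linarith
  have hα0 := alp_nn w hm
  set V : Set ℝ := {S | 0 ≤ S ∧ ∀ R, r ≤ R → ∀ᵐ x : Euc N, ‖x‖ < R → u x ≤ S * R ^ alp m γ} with hV
  have hM0 : 0 ≤ M := (abs_nonneg _).trans (hu.2 0)
  have hne : V.Nonempty := by
    refine ⟨M, hM0, fun R hR => ae_of_all _ fun x _ => ?_⟩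
    have : 1 ≤ R ^ alp m γ := Real.one_le_rpow (hr.trans hR) hα0.le
    have h2 := (le_abs_self _).trans (hu.2 x)
    exact h2.trans (le_mul_of_one_le_right hM0 this)
  have hbb : BddBelow V := ⟨0, fun S hS => hS.1⟩
  have hup : ∀ S, sInf V < S → S ∈ V := by
    intro S hS
    obtain ⟨S', hS', hlt⟩ := exists_lt_of_csInf_lt hne hS
    refine ⟨hS'.1.trans hlt.le, fun R hR => (hS'.2 R hR).mono fun x hx hxR => (hx hxR).trans ?_⟩
    exact mul_le_mul_of_nonneg_right hlt.le (Real.rpow_nonneg (by linarith) _)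
  have h0 : 0 ≤ sInf V := Real.sInf_nonneg fun S hS => hS.1
  have hpos : 0 < C * (b ^ lam N m γ * I ^ (1 / DD N m γ) + I) := by positivity
  suffices hS : sInf V ≤ C * (b ^ lam N m γ * I ^ (1 / DD N m γ) + I) by
    rw [mul_assoc 2]
    exact (hup _ (by linarith)).2
  rcases h0.eq_or_lt with h | h
  · rw [← h]; exact hpos.le
  refine halg b I _ hb hI h fun κ hκ0 hκ1 => ?_
  obtain ⟨S0, S1⟩ := hup (2 * sInf V) (by linarith)
  have hi := himp u M b I r (2 * sInf V) κ hu u0 hb.le hI.le hr hyp hgr S0 S1 hκ0 hκ1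
  set Q := C1 * (b * κ ^ (2 - γ) * (2 * sInf V) + κ ^ (-(N:ℝ)) * (2 * sInf V) ^ (m - 1) * I) with hQ
  have hQ0 : 0 ≤ Q := by positivity
  have hmem : Q ^ (1 / m) ∈ V := by
    refine ⟨by positivity, fun R hR => (hi R hR).mono fun x hx hxR => ?_⟩
    have hR0 : 0 < R := by linarith
    have h1 := Real.rpow_le_rpow (Real.rpow_nonneg (u0 x) _) (hx hxR) (z := 1 / m) (by positivity)
    rw [Real.mul_rpow hQ0 (by positivity), ← Real.rpow_mul (u0 x), ← Real.rpow_mul (by positivity : 0 ≤ R ^ alp m γ), mul_one_div_cancel hm0.ne', Real.rpow_one, Real.rpow_one] at h1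
    exact h1
  have h3 := Real.rpow_le_rpow h.le (csInf_le hbb hmem) hm0.le
  rwa [← Real.rpow_mul hQ0, one_div_mul_cancel hm0.ne', Real.rpow_one] at h3

end

noncomputable section
variable {N : ℕ} {γ k K m δ h M : ℝ} {ρ : Euc N → ℝ}

/-! ### growth estimates -/

def J (ρ g : Euc N → ℝ) (R : ℝ) : ℝ := ∫ x in ball (0 : Euc N) R, ρ x * g x
def th (N : ℕ) (m γ : ℝ) : ℝ := 1 / DD N m γ

lemma DD_one (w : Wt γ k K ρ) (hm : 1 < m) : 1 < DD N m γ := by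
  have hp : 0 < 2 - γ := by linarith [w.g2]
  have hN' : (3:ℝ) ≤ N := by exact_mod_cast w.hN
  have hm1 : 0 < m - 1 := by linarith
  have : 0 < (m - 1) * N / (2 - γ) := by positivity
  unfold DD; linarith

lemma th_pos (w : Wt γ k K ρ) (hm : 1 < m) : 0 < th N m γ := one_div_pos.2 (by linarith [DD_one w hm])
lemma th_le (w : Wt γ k K ρ) (hm : 1 < m) : th N m γ ≤ 1 := by
  unfold th; rw [div_le_one (by linarith [DD_one w hm])]; exact (DD_one w hm).le

lemma lam_th (w : Wt γ k K ρ) (hm : 1 < m) : lam N m γ = (1 - th N m γ) / (m - 1) := by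
  have hp : 0 < 2 - γ := by linarith [w.g2]
  have hm1 : 0 < m - 1 := by linarith
  have hD := DD_one w hm
  have hD0 : DD N m γ ≠ 0 := by linarith
  have hD' : DD N m γ - 1 = (m - 1) * N / (2 - γ) := by unfold DD; ring
  unfold lam th
  rw [eq_div_iff hm1.ne', one_sub_div hD0, hD']
  field_simp

structure MFlow (ρ : Euc N → ℝ) (L : ℝ) (g G : ℝ → Euc N → ℝ) : Prop where
  nn : ∀ t x, 0 ≤ g t x
  ok : ∀ t, 0 ≤ t → Ok ρ (g t)
  kato : ∀ φ : Euc N → ℝ, Test φ → (∀ x, 0 ≤ φ x) → ∀ s t B : ℝ, 0 ≤ s → s ≤ t →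
    (∀ τ, s ≤ τ → τ ≤ t → ∫ x, G τ x * lap φ x ≤ B) →
    ∫ x, φ x * (ρ x * g t x) ≤ (∫ x, φ x * (ρ x * g s x)) + (t - s) * B
  lip : ∀ s t, 0 ≤ s → s ≤ t → dd ρ 0 (g t) (g s) ≤ (t - s) * L

lemma bd_mul_int {φ f : Euc N → ℝ} (hφ : Measurable φ) (h0 : ∀ x, 0 ≤ φ x) (h1 : ∀ x, φ x ≤ 1) (hf : Integrable f) :
    Integrable (fun x => φ x * f x) :=
  hf.bdd_mul (c := 1) hφ.aestronglyMeasurable (Eventually.of_forall fun x => by rw [Real.norm_eq_abs, abs_of_nonneg (h0 x)]; exact h1 x)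

lemma dd_phi (w : Wt γ k K ρ) {f g φ : Euc N → ℝ} (hf : Ok ρ f) (hg : Ok ρ g) (hφ : Measurable φ) (h0 : ∀ x, 0 ≤ φ x) (h1 : ∀ x, φ x ≤ 1) :
    ∫ x, φ x * (ρ x * f x) ≤ (∫ x, φ x * (ρ x * g x)) + dd ρ 0 f g := by
  rw [dd0_def, ← integral_add (bd_mul_int hφ h0 h1 hg.2) (dd0_int w hf hg)]
  refine integral_mono (bd_mul_int hφ h0 h1 hf.2) ((bd_mul_int hφ h0 h1 hg.2).add (dd0_int w hf hg)) fun x => ?_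
  show φ x * (ρ x * f x) ≤ φ x * (ρ x * g x) + ρ x * |f x - g x|
  have h2 := le_abs_self (f x - g x)
  have h3 : φ x * (ρ x * (f x - g x)) ≤ 1 * (ρ x * |f x - g x|) := by
    have hp := (w.pos x).le
    calc φ x * (ρ x * (f x - g x)) ≤ φ x * (ρ x * |f x - g x|) := by gcongr; exact h0 x
      _ ≤ 1 * (ρ x * |f x - g x|) := by gcongr; exact h1 x
  nlinarith

lemma J_eq (f : Euc N → ℝ) (R : ℝ) : J ρ f R = ∫ x, (ball (0 : Euc N) R).indicator (fun _ => (1:ℝ)) x * (ρ x * f x) := by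
  rw [J, ← integral_indicator measurableSet_ball]
  congr 1; ext x
  by_cases hx : x ∈ ball (0 : Euc N) R
  · rw [indicator_of_mem hx, indicator_of_mem hx, one_mul]
  · rw [indicator_of_notMem hx, indicator_of_notMem hx, zero_mul]

lemma ind_nn (S : Set (Euc N)) (x : Euc N) : 0 ≤ S.indicator (fun _ => (1:ℝ)) x := indicator_nonneg (fun _ _ => zero_le_one) x
lemma ind_le (S : Set (Euc N)) (x : Euc N) : S.indicator (fun _ => (1:ℝ)) x ≤ 1 := indicator_le_self' (fun _ _ => zero_le_one) x
lemma ind_meas (R : ℝ) : Measurable ((ball (0 : Euc N) R).indicator (fun _ => (1:ℝ))) := measurable_const.indicator measurableSet_ball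

lemma J_dd (w : Wt γ k K ρ) {f g : Euc N → ℝ} (hf : Ok ρ f) (hg : Ok ρ g) (R : ℝ) : J ρ f R ≤ J ρ g R + dd ρ 0 f g := by
  rw [J_eq, J_eq]; exact dd_phi w hf hg (ind_meas R) (ind_nn _) (ind_le _)

lemma J_mono (w : Wt γ k K ρ) {f : Euc N → ℝ} (hf : Ok ρ f) (h0 : ∀ x, 0 ≤ f x) {R : ℝ} {φ : Euc N → ℝ} (hφ : Measurable φ) (hφ0 : ∀ x, 0 ≤ φ x) (hφ1 : ∀ x, φ x ≤ 1)
    (h1 : ∀ x, ‖x‖ < R → φ x = 1) : J ρ f R ≤ ∫ x, φ x * (ρ x * f x) := by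
  rw [J_eq]
  refine integral_mono (bd_mul_int (ind_meas R) (ind_nn _) (ind_le _) hf.2) (bd_mul_int hφ hφ0 hφ1 hf.2) fun x => ?_
  have hp := mul_nonneg (w.pos x).le (h0 x)
  by_cases hx : x ∈ ball (0 : Euc N) R
  · show _ * _ ≤ φ x * (ρ x * f x)
    rw [h1 x (by simpa using hx), indicator_of_mem hx]
  · show _ * _ ≤ φ x * (ρ x * f x)
    rw [indicator_of_notMem hx, zero_mul]; exact mul_nonneg (hφ0 x) hp

lemma J_ge (w : Wt γ k K ρ) {f : Euc N → ℝ} (hf : Ok ρ f) (h0 : ∀ x, 0 ≤ f x) {R : ℝ} {φ : Euc N → ℝ} (hφ : Measurable φ) (hφ0 : ∀ x, 0 ≤ φ x) (hφ1 : ∀ x, φ x ≤ 1)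
    (h1 : ∀ x, R ≤ ‖x‖ → φ x = 0) : ∫ x, φ x * (ρ x * f x) ≤ J ρ f R := by
  rw [J_eq]
  refine integral_mono (bd_mul_int hφ hφ0 hφ1 hf.2) (bd_mul_int (ind_meas R) (ind_nn _) (ind_le _) hf.2) fun x => ?_
  have hp := mul_nonneg (w.pos x).le (h0 x)
  by_cases hx : x ∈ ball (0 : Euc N) R
  · show φ x * (ρ x * f x) ≤ _ * _
    rw [indicator_of_mem hx]
    exact mul_le_mul_of_nonneg_right (hφ1 x) hp
  · show φ x * (ρ x * f x) ≤ _ * _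
    rw [indicator_of_notMem hx, zero_mul, h1 x (by simpa using hx), zero_mul]

lemma J_nn (w : Wt γ k K ρ) {f : Euc N → ℝ} (h0 : ∀ x, 0 ≤ f x) (R : ℝ) : 0 ≤ J ρ f R :=
  integral_nonneg fun x => mul_nonneg (w.pos x).le (h0 x)

lemma J_le_tot (w : Wt γ k K ρ) {f : Euc N → ℝ} (hf : Ok ρ f) (h0 : ∀ x, 0 ≤ f x) (R : ℝ) : J ρ f R ≤ ∫ x, ρ x * f x :=
  setIntegral_le_integral hf.2 (Eventually.of_forall fun x => mul_nonneg (w.pos x).le (h0 x))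

lemma ae_ball_closed (hN : 3 ≤ N) (R : ℝ) : ∀ᵐ x : Euc N, ‖x‖ ≠ R := by
  have : Nontrivial (Euc N) := by
    have : Nonempty (Fin N) := ⟨⟨0, by omega⟩⟩
    infer_instance
  have h := Measure.addHaar_sphere (volume : Measure (Euc N)) 0 R
  rw [ae_iff]
  convert h using 2
  ext x; simp

/-- one step of the local mass estimate -/
lemma flow_lap (w : Wt γ k K ρ) (hm : 1 < m) : ∃ E, 0 < E ∧ ∀ (f F : Euc N → ℝ) (σ D r R : ℝ), Ok ρ f → (∀ x, 0 ≤ f x) → 0 ≤ σ → 0 ≤ D → 1 ≤ r → r ≤ R →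
    (∀ R, r ≤ R → ∀ᵐ x : Euc N, ‖x‖ < R → |F x| ≤ σ * R ^ (2 - γ) * f x) →
    (∀ R, r ≤ R → J ρ f R ≤ D * R ^ aa N m γ) → ∫ x, F x * lap (cut R) x ≤ E * σ * D * R ^ aa N m γ := by
  obtain ⟨Cc, hC0, hC⟩ := cut_lap (N := N)
  have hk := w.k0
  refine ⟨(Cc + 1) * (2 ^ (2 - γ) * (4 ^ γ / k) * 2 ^ aa N m γ), by positivity, ?_⟩
  intro f F σ D r R hf f0 hσ hD hr hR hF hJ
  have hR1 : 1 ≤ R := hr.trans hR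
  have hR0 : 0 < R := by linarith
  set Q := Cc / R ^ 2 * (σ * (2 * R) ^ (2 - γ)) * ((4 * R) ^ γ / k) with hQ
  have hQ0 : 0 ≤ Q := by positivity
  have i1 : IntegrableOn (fun x => ρ x * f x) (ball (0 : Euc N) (2 * R)) := hf.2.integrableOn
  have hb : ∀ᵐ x : Euc N, ‖F x * lap (cut R) x‖ ≤ (ball (0 : Euc N) (2 * R)).indicator (fun x => Q * (ρ x * f x)) x := by
    filter_upwards [hF (2 * R) (by linarith), ae_ball_closed w.hN (2 * R)] with x hx hne
    rw [norm_mul, Real.norm_eq_abs, Real.norm_eq_abs]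
    rcases lt_or_gt_of_ne hne with h1 | h1
    · rw [indicator_of_mem (by simpa using h1)]
      have h2 := hx h1
      have h3 := (hC R hR0 x).1
      have h4 := w.lo_ball (R := 2 * R) (by linarith) h1
      rw [show 2 * (2 * R) = 4 * R by ring] at h4
      calc |F x| * |lap (cut R) x| ≤ (σ * (2 * R) ^ (2 - γ) * f x) * (Cc / R ^ 2) :=
            mul_le_mul h2 h3 (abs_nonneg _) (by have := f0 x; positivity)
        _ = Cc / R ^ 2 * (σ * (2 * R) ^ (2 - γ)) * f x * 1 := by ring
        _ ≤ Cc / R ^ 2 * (σ * (2 * R) ^ (2 - γ)) * f x * ((4 * R) ^ γ / k * ρ x) :=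
            mul_le_mul_of_nonneg_left h4 (by have := f0 x; positivity)
        _ = Q * (ρ x * f x) := by rw [hQ]; ring
    · rw [(hC R hR0 x).2 h1, abs_zero, mul_zero]
      exact indicator_nonneg (fun y _ => mul_nonneg hQ0 (mul_nonneg (w.pos y).le (f0 y))) x
  have i2 : Integrable ((ball (0 : Euc N) (2 * R)).indicator (fun x => Q * (ρ x * f x))) :=
    (integrable_indicator_iff measurableSet_ball).2 (i1.const_mul Q)
  have h5 := norm_integral_le_of_norm_le i2 hb
  rw [integral_indicator measurableSet_ball, integral_const_mul] at h5
  have h6 := hJ (2 * R) (by linarith)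
  have hg : Q * (D * (2 * R) ^ aa N m γ) = Cc * (2 ^ (2 - γ) * (4 ^ γ / k) * 2 ^ aa N m γ) * σ * D * R ^ aa N m γ := by
    rw [hQ, Real.mul_rpow (by norm_num) hR0.le, Real.mul_rpow (by norm_num) hR0.le, Real.mul_rpow (by norm_num) hR0.le]
    have e1 : R ^ (2 - γ) * R ^ γ = R ^ 2 := by
      rw [← Real.rpow_add hR0, show 2 - γ + γ = (2:ℕ) by push_cast; ring, Real.rpow_natCast]
    have hR2 : R ^ 2 ≠ 0 := by positivity
    calc _ = Cc / R ^ 2 * (R ^ (2 - γ) * R ^ γ) * (2 ^ (2 - γ) * (4 ^ γ / k) * 2 ^ aa N m γ) * σ * D * R ^ aa N m γ := by ring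
      _ = _ := by rw [e1, div_mul_cancel₀ _ hR2]
  calc _ ≤ _ := le_abs_self _
    _ ≤ _ := h5
    _ ≤ Q * (D * (2 * R) ^ aa N m γ) := mul_le_mul_of_nonneg_left h6 hQ0
    _ = _ := hg
    _ ≤ _ := by
      have : Cc * (2 ^ (2 - γ) * (4 ^ γ / k) * 2 ^ aa N m γ) ≤ (Cc + 1) * (2 ^ (2 - γ) * (4 ^ γ / k) * 2 ^ aa N m γ) :=
        mul_le_mul_of_nonneg_right (by linarith) (by positivity)
      gcongr

theorem flow_step (w : Wt γ k K ρ) (hm : 1 < m) : ∃ E, 0 < E ∧ ∀ (L : ℝ) (g G : ℝ → Euc N → ℝ), MFlow ρ L g G → ∀ T b Cg D I0 r : ℝ,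
    0 < b → 0 ≤ Cg → 0 ≤ D → 1 ≤ r →
    (∀ τ, 0 < τ → τ ≤ T → ∀ R, r ≤ R → ∀ᵐ x : Euc N, ‖x‖ < R → |G τ x| ≤ Cg * ((τ * b) ^ th N m γ / τ) * R ^ (2 - γ) * g τ x) →
    (∀ τ, 0 ≤ τ → τ ≤ T → ∀ R, r ≤ R → J ρ (g τ) R ≤ D * R ^ aa N m γ) →
    (∀ R, r ≤ R → J ρ (g 0) R ≤ I0 * R ^ aa N m γ) →
    ∀ t, 0 ≤ t → t ≤ T → ∀ R, r ≤ R → J ρ (g t) R ≤ (2 ^ aa N m γ * I0 + E * Cg * (t * b) ^ th N m γ * D) * R ^ aa N m γ := by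
  obtain ⟨E0, hE0, hE⟩ := flow_lap w hm
  set θ := th N m γ with hθ
  have hθ0 : 0 < θ := th_pos w hm
  have hq : (1 / 2 : ℝ) ^ θ < 1 := Real.rpow_lt_one (by norm_num) (by norm_num) hθ0
  refine ⟨E0 / (1 - (1 / 2 : ℝ) ^ θ), div_pos hE0 (by linarith), ?_⟩
  intro L g G hF T b Cg D I0 r hb hCg hD hr hG hJD hJ0 t ht0 htT R hR
  have hR0 : 0 < R := by linarith
  have hc := cut_props (N := N) hR0
  have hcm : Measurable (cut (N := N) R) := hc.1.1.continuous.measurable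
  set E := E0 / (1 - (1 / 2 : ℝ) ^ θ) with hEd
  have hEp : 0 < E := div_pos hE0 (by linarith)
  have hE1 : E * (1 - (1 / 2 : ℝ) ^ θ) = E0 := div_mul_cancel₀ _ (by linarith)
  set F : ℝ → ℝ := fun s => ∫ x, cut R x * (ρ x * g s x) with hFd
  set P := Cg * D * R ^ aa N m γ with hP
  have hP0 : 0 ≤ P := by positivity
  have step : ∀ s, 0 < s → s ≤ T → F s - E * P * (s * b) ^ θ ≤ F (s / 2) - E * P * (s / 2 * b) ^ θ := by
    intro s hs hsT
    have h1 := hF.kato (cut R) hc.1 (cut_nn R) (s / 2) s (E0 * (Cg * ((s * b) ^ θ / (s / 2))) * D * R ^ aa N m γ) (by linarith) (by linarith) (by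
      intro τ h1 h2
      have hτ : 0 < τ := by linarith
      have := hE (g τ) (G τ) (Cg * ((τ * b) ^ θ / τ)) D r R (hF.ok τ hτ.le) (hF.nn τ) (by positivity) hD hr hR (hG τ hτ (h2.trans hsT)) (hJD τ hτ.le (h2.trans hsT))
      refine this.trans ?_
      gcongr)
    have h2 : (s / 2 * b) ^ θ = (1 / 2 : ℝ) ^ θ * (s * b) ^ θ := by
      rw [← Real.mul_rpow (by norm_num) (by positivity)]; congr 1; ring
    have h3 : (s - s / 2) * (E0 * (Cg * ((s * b) ^ θ / (s / 2))) * D * R ^ aa N m γ) = E0 * P * (s * b) ^ θ := by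
      rw [hP]; field_simp; ring
    rw [h3, ← hE1] at h1
    rw [h2]
    have h1' : F s ≤ F (s / 2) + E * (1 - (1 / 2) ^ θ) * P * (s * b) ^ θ := h1
    linear_combination h1'
  have key : F t - E * P * (t * b) ^ θ ≤ F 0 := by
    rcases ht0.eq_or_lt with h0 | h0
    · rw [← h0]
      have : 0 ≤ E * P * (0 * b) ^ θ := by positivity
      linarith
    have it : ∀ n : ℕ, F t - E * P * (t * b) ^ θ ≤ F (t / 2 ^ n) - E * P * (t / 2 ^ n * b) ^ θ := by
      intro n
      induction n with
      | zero => simp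
      | succ n ih =>
        have hle : t / 2 ^ n ≤ T := (div_le_self ht0 (one_le_pow₀ (by norm_num))).trans htT
        have := step (t / 2 ^ n) (by positivity) hle
        rw [div_div, ← pow_succ] at this
        exact ih.trans this
    have it2 : ∀ n : ℕ, F t - E * P * (t * b) ^ θ ≤ F 0 + t * L * (1 / 2) ^ n := by
      intro n
      have hp : 0 ≤ t / 2 ^ n := by positivity
      have h1 := dd_phi w (hF.ok _ hp) (hF.ok 0 le_rfl) hcm (cut_nn R) (cut_le R)
      have h2 := hF.lip 0 (t / 2 ^ n) le_rfl hp
      have h3 : 0 ≤ E * P * (t / 2 ^ n * b) ^ θ := by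
        positivity
      have h4 : (t / 2 ^ n - 0) * L = t * L * (1 / 2) ^ n := by rw [one_div, inv_pow]; ring
      have h5 : F (t / 2 ^ n) ≤ F 0 + dd ρ 0 (g (t / 2 ^ n)) (g 0) := h1
      linarith [it n]
    have hlim : Tendsto (fun n : ℕ => F 0 + t * L * (1 / 2 : ℝ) ^ n) atTop (nhds (F 0 + t * L * 0)) :=
      ((_root_.tendsto_pow_atTop_nhds_zero_of_lt_one (r := (1 / 2 : ℝ)) (by norm_num) (by norm_num)).const_mul _).const_add _
    rw [mul_zero, add_zero] at hlim
    exact ge_of_tendsto' hlim it2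
  have h1 : J ρ (g t) R ≤ F t := J_mono w (hF.ok t ht0) (hF.nn t) hcm (cut_nn R) (cut_le R) (fun x hx => cut_one hR0 hx.le)
  have h2 : F 0 ≤ J ρ (g 0) (2 * R) := J_ge w (hF.ok 0 le_rfl) (hF.nn 0) hcm (cut_nn R) (cut_le R) (fun x hx => cut_zero hR0 hx)
  have h3 := hJ0 (2 * R) (by linarith)
  rw [Real.mul_rpow (by norm_num) hR0.le] at h3
  calc _ ≤ I0 * (2 ^ aa N m γ * R ^ aa N m γ) + E * P * (t * b) ^ θ := by linarith
    _ = _ := by rw [hP]; ring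

end

noncomputable section
variable {N : ℕ} {γ k K m δ h M : ℝ} {ρ : Euc N → ℝ}

def Sol (ρ : Euc N → ℝ) (m : ℝ) (U : Euc N → ℝ) (u : ℝ → Euc N → ℝ) : Prop :=
  Test U ∧ ∃ M, 0 ≤ M ∧ (∀ x, |U x| ≤ M ^ m) ∧ Lim ρ m M U u

lemma Sol.two (w : Wt γ k K ρ) (hm : 1 < m) {U V : Euc N → ℝ} {u v : ℝ → Euc N → ℝ} (hu : Sol ρ m U u) (hv : Sol ρ m V v) :
    ∃ M, Two γ k K ρ m M U V u v := by
  obtain ⟨tU, M1, h1, b1, l1⟩ := hu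
  obtain ⟨tV, M2, h2, b2, l2⟩ := hv
  have hm0 : 0 ≤ m := by linarith
  exact ⟨max M1 M2, w, hm, h1.trans (le_max_left _ _), tU, fun x => (b1 x).trans (Real.rpow_le_rpow h1 (le_max_left _ _) hm0), tV,
    fun x => (b2 x).trans (Real.rpow_le_rpow h2 (le_max_right _ _) hm0), l1.mono (le_max_left _ _), l2.mono (le_max_right _ _)⟩

lemma Ok.abs {f : Euc N → ℝ} (w : Wt γ k K ρ) (hf : Ok ρ f) : Ok ρ (fun x => |f x|) := by
  refine ⟨hf.1.abs, ?_⟩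
  refine hf.2.abs.congr (ae_of_all _ fun x => ?_)
  show |ρ x * f x| = ρ x * |f x|
  rw [abs_mul, abs_of_nonneg (w.pos x).le]

lemma Ok.sub {f g : Euc N → ℝ} (hf : Ok ρ f) (hg : Ok ρ g) : Ok ρ (fun x => f x - g x) := by
  refine ⟨hf.1.sub hg.1, ?_⟩
  refine (hf.2.sub hg.2).congr (ae_of_all _ fun x => ?_)
  show ρ x * f x - ρ x * g x = ρ x * (f x - g x)
  ring

lemma Sol.ok {U : Euc N → ℝ} {u : ℝ → Euc N → ℝ} (hu : Sol ρ m U u) {t : ℝ} (ht : 0 ≤ t) : Ok ρ (u t) := by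
  obtain ⟨tU, M1, h1, b1, l1⟩ := hu
  exact l1.ok ht

lemma Sol.pos (w : Wt γ k K ρ) (hm : 1 < m) {U : Euc N → ℝ} {u : ℝ → Euc N → ℝ} (hu : Sol ρ m U u) (h0 : ∀ x, 0 ≤ U x) {t : ℝ} (ht : 0 ≤ t) :
    ∀ᵐ x, 0 ≤ u t x := by
  obtain ⟨M, H⟩ := hu.two w hm hu
  filter_upwards [ord_lim H (fun x => (abs_of_nonneg (h0 x)).le) ht] with x hx
  exact (abs_nonneg _).trans hx

lemma flow_abs (w : Wt γ k K ρ) (hm : 1 < m) {U : Euc N → ℝ} {u : ℝ → Euc N → ℝ} (hu : Sol ρ m U u) (h0 : ∀ x, 0 ≤ U x) :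
    MFlow ρ (Lc U) (fun t x => |u t x|) (fun t x => spow m (u t x)) := by
  obtain ⟨M, H⟩ := hu.two w hm hu
  have e : ∀ t, 0 ≤ t → ∀ φ : Euc N → ℝ, ∫ x, φ x * (ρ x * |u t x|) = ∫ x, φ x * (ρ x * u t x) := fun t ht φ =>
    integral_congr_ae (by filter_upwards [hu.pos w hm h0 ht] with x hx; rw [abs_of_nonneg hx])
  refine ⟨fun t x => abs_nonneg _, fun t ht => (hu.ok ht).abs w, ?_, ?_⟩
  · intro φ hφ hφ0 s t B hs hst hB
    rw [e t (hs.trans hst), e s hs]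
    exact weak_lim H hφ hs hst hB
  · intro s t hs hst
    refine le_trans ?_ (lip_lim H hs hst)
    rw [dd0_def, dd0_def]
    refine integral_mono (dd0_int w ((hu.ok (hs.trans hst)).abs w) ((hu.ok hs).abs w)) (dd0_int w (hu.ok (hs.trans hst)) (hu.ok hs)) fun x => ?_
    exact mul_le_mul_of_nonneg_left (abs_abs_sub_abs_le _ _) (w.pos x).le

lemma flow_diff (w : Wt γ k K ρ) (hm : 1 < m) {U V : Euc N → ℝ} {u v : ℝ → Euc N → ℝ} (hu : Sol ρ m U u) (hv : Sol ρ m V v) :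
    MFlow ρ (Lc U + Lc V) (fun t x => |u t x - v t x|) (fun t x => |spow m (u t x) - spow m (v t x)|) := by
  obtain ⟨M, H⟩ := hu.two w hm hv
  refine ⟨fun t x => abs_nonneg _, fun t ht => ((hu.ok ht).sub (hv.ok ht)).abs w, ?_, ?_⟩
  · intro φ hφ hφ0 s t B hs hst hB
    exact kato_lim H hφ hφ0 hs hst hB
  · intro s t hs hst
    have ht := hs.trans hst
    have h1 := lip_lim H hs hst
    have h2 := lip_lim H.symm hs hst
    rw [dd0_def] at h1 h2 ⊢
    have i1 := dd0_int w (hu.ok ht) (hu.ok hs)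
    have i2 := dd0_int w (hv.ok ht) (hv.ok hs)
    have : ∫ x, ρ x * |(|u t x - v t x| - |u s x - v s x|)| ≤ ∫ x, (ρ x * |u t x - u s x| + ρ x * |v t x - v s x|) := by
      refine integral_mono (dd0_int w (((hu.ok ht).sub (hv.ok ht)).abs w) (((hu.ok hs).sub (hv.ok hs)).abs w)) (i1.add i2) fun x => ?_
      show _ ≤ ρ x * |u t x - u s x| + ρ x * |v t x - v s x|
      rw [← mul_add]
      refine mul_le_mul_of_nonneg_left ?_ (w.pos x).le
      refine (abs_abs_sub_abs_le _ _).trans ?_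
      rw [show u t x - v t x - (u s x - v s x) = (u t x - u s x) - (v t x - v s x) by ring]
      exact abs_sub _ _
    rw [integral_add i1 i2] at this
    linarith

/-- smoothing profile -/
def sg (N : ℕ) (m γ b t : ℝ) : ℝ := ((t * b) ^ th N m γ / t) ^ (1 / (m - 1))

lemma sg_nn {b t : ℝ} (hb : 0 ≤ b) (ht : 0 ≤ t) : 0 ≤ sg N m γ b t := by unfold sg; positivity

lemma sg_pow (hm : 1 < m) {b t : ℝ} (hb : 0 ≤ b) (ht : 0 ≤ t) : sg N m γ b t ^ (m - 1) = (t * b) ^ th N m γ / t := by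
  unfold sg
  rw [← Real.rpow_mul (by positivity), one_div_mul_cancel (by linarith), Real.rpow_one]

lemma sg_alg (w : Wt γ k K ρ) (hm : 1 < m) {B t c : ℝ} (hB : 0 < B) (ht : 0 < t) (hc : 0 < c) (hX : t * B ^ (m - 1) ≤ 1) :
    (c / t) ^ lam N m γ * B ^ (1 / DD N m γ) + B ≤ (c ^ lam N m γ + 1) * sg N m γ (B ^ (m - 1)) t := by
  have hm1 : 0 < m - 1 := by linarith
  have hl := lam_th w hm
  have hθ0 := th_pos w hm
  have hθ1 := th_le w hm
  rw [← th]
  set θ := th N m γ with hθ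
  set e := 1 / (m - 1) with he
  have he0 : 0 < e := by positivity
  have hem : (m - 1) * e = 1 := mul_one_div_cancel hm1.ne'
  have hl' : lam N m γ = e - θ * e := by rw [hl, he]; ring
  set X := t * B ^ (m - 1) with hXd
  have hX0 : 0 < X := by positivity
  have hBX : B = X ^ e * t ^ (-e) := by
    rw [hXd, Real.mul_rpow ht.le (by positivity), ← Real.rpow_mul hB.le, hem, Real.rpow_one, mul_comm (t ^ e), mul_assoc, ← Real.rpow_add ht]
    simp
  have hs : sg N m γ (B ^ (m - 1)) t = X ^ (θ * e) * t ^ (-e) := by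
    unfold sg
    rw [← hXd, ← hθ, ← he, Real.div_rpow (by positivity) ht.le, ← Real.rpow_mul hX0.le, Real.rpow_neg ht.le, div_eq_mul_inv]
  have h1 : (c / t) ^ lam N m γ * B ^ θ = c ^ lam N m γ * (X ^ (θ * e) * t ^ (-e)) := by
    have hBt : B ^ θ = X ^ (θ * e) * t ^ (-(θ * e)) := by
      conv_lhs => rw [hBX]
      rw [Real.mul_rpow (by positivity) (by positivity), ← Real.rpow_mul hX0.le, ← Real.rpow_mul ht.le]
      congr 2 <;> ring
    rw [Real.div_rpow hc.le ht.le, hBt, div_eq_mul_inv, ← Real.rpow_neg ht.le]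
    rw [show (-e) = -lam N m γ + -(θ * e) by rw [hl']; ring, Real.rpow_add ht]
    ring
  have h2 : B ≤ X ^ (θ * e) * t ^ (-e) := by
    conv_lhs => rw [hBX]
    refine mul_le_mul_of_nonneg_right ?_ (by positivity)
    exact Real.rpow_le_rpow_of_exponent_ge hX0 hX (mul_le_of_le_one_left he0.le hθ1)
  rw [h1, hs]
  nlinarith [h2]

theorem smooth2 (w : Wt γ k K ρ) (hm : 1 < m) : ∃ C, 0 < C ∧ ∀ (U : Euc N → ℝ) (u : ℝ → Euc N → ℝ), Sol ρ m U u → (∀ x, 0 ≤ U x) →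
    ∀ t B r : ℝ, 0 < t → 0 < B → 1 ≤ r → t * B ^ (m - 1) ≤ 1 → (∀ R, r ≤ R → J ρ (fun x => |u t x|) R ≤ B * R ^ aa N m γ) →
    ∀ R, r ≤ R → ∀ᵐ x : Euc N, ‖x‖ < R → |u t x| ≤ C * sg N m γ (B ^ (m - 1)) t * R ^ alp m γ := by
  obtain ⟨C, hC, hs⟩ := smooth w hm
  have hab := abC_pos hm
  refine ⟨C * (abC m ^ lam N m γ + 1), by positivity, ?_⟩
  intro U u hu h0 t B r ht hB hr hX hJ R hR
  obtain ⟨M, H⟩ := hu.two w hm hu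
  have hpos := hu.pos w hm h0 ht.le
  have hR0 : 0 < R := by linarith
  have hr := hs (fun x => |u t x|) M (abC m / t) B r (H.lu.bd t).abs (fun x => abs_nonneg _) (by positivity) hB hr (by
    intro φ hφ hφ0
    have := ab_lim H h0 hφ hφ0 ht
    have e1 : ∫ x, spow m |u t x| * lap φ x = ∫ x, spow m (u t x) * lap φ x :=
      integral_congr_ae (by filter_upwards [hpos] with x hx; rw [abs_of_nonneg hx])
    have e2 : ∫ x, φ x * (ρ x * |u t x|) = ∫ x, φ x * (ρ x * u t x) :=
      integral_congr_ae (by filter_upwards [hpos] with x hx; rw [abs_of_nonneg hx])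
    rw [e1, e2]; exact this) hJ R hR
  filter_upwards [hr] with x hx hxR
  refine (hx hxR).trans ?_
  rw [mul_assoc C (_ + 1)]
  gcongr
  exact sg_alg w hm hB ht hab hX

lemma spow_Y (w : Wt γ k K ρ) (hm : 1 < m) {C b t R : ℝ} (hC : 0 < C) (hb : 0 ≤ b) (ht : 0 ≤ t) (hR : 0 < R) :
    (C * sg N m γ b t * R ^ alp m γ) ^ (m - 1) = C ^ (m - 1) * ((t * b) ^ th N m γ / t) * R ^ (2 - γ) := by
  have := sg_nn (N := N) (m := m) (γ := γ) hb ht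
  rw [Real.mul_rpow (by positivity) (by positivity), Real.mul_rpow hC.le this, sg_pow hm hb ht, ← Real.rpow_mul hR.le, alp_m hm]

/-- basic pointwise bound predicate -/
def PB (N : ℕ) (m γ C b r : ℝ) (f : Euc N → ℝ) (t : ℝ) : Prop := ∀ R, r ≤ R → ∀ᵐ x : Euc N, ‖x‖ < R → |f x| ≤ C * sg N m γ b t * R ^ alp m γ

theorem growth (w : Wt γ k K ρ) (hm : 1 < m) : ∃ C q, 0 < C ∧ 0 < q ∧ q ≤ 1 ∧
    (∀ (U : Euc N → ℝ) (u : ℝ → Euc N → ℝ), Sol ρ m U u → (∀ x, 0 ≤ U x) → ∀ T B r : ℝ, 0 < B → 1 ≤ r → T * B ^ (m - 1) ≤ q →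
      (∀ R, r ≤ R → J ρ (fun x => |u 0 x|) R ≤ B / (4 * 2 ^ aa N m γ) * R ^ aa N m γ) →
      (∀ t, 0 ≤ t → t ≤ T → ∀ R, r ≤ R → J ρ (fun x => |u t x|) R ≤ B * R ^ aa N m γ) ∧
      ∀ t, 0 < t → t ≤ T → PB N m γ C (B ^ (m - 1)) r (u t) t) ∧
    (∀ (U V : Euc N → ℝ) (u v : ℝ → Euc N → ℝ), Sol ρ m U u → Sol ρ m V v → ∀ T b I r : ℝ, 0 < b → 0 ≤ I → 1 ≤ r → T * b ≤ q →
      (∀ t, 0 < t → t ≤ T → PB N m γ C b r (u t) t) → (∀ t, 0 < t → t ≤ T → PB N m γ C b r (v t) t) →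
      (∀ R, r ≤ R → J ρ (fun x => |u 0 x - v 0 x|) R ≤ I * R ^ aa N m γ) →
      ∀ t, 0 ≤ t → t ≤ T → ∀ R, r ≤ R → J ρ (fun x => |u t x - v t x|) R ≤ 2 * 2 ^ aa N m γ * I * R ^ aa N m γ) := by
  obtain ⟨C, hC, hs⟩ := smooth2 w hm
  obtain ⟨E, hE, hst⟩ := flow_step w hm
  have hm0 : 0 < m := by linarith
  have hm1 : 0 < m - 1 := by linarith
  have hθ0 := th_pos w hm
  have ha := aa_pos w hm
  set Cg := m * C ^ (m - 1) with hCg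
  have hCg0 : 0 < Cg := by positivity
  set θ := th N m γ with hθ
  set a := aa N m γ with haa
  obtain ⟨q, hq0, hq1, hq⟩ : ∃ q : ℝ, 0 < q ∧ q ≤ 1 ∧ E * Cg * q ^ θ ≤ 1 / 2 := by
    refine ⟨min 1 ((1 / (2 * (E * Cg))) ^ (1 / θ)), lt_min one_pos (by positivity), min_le_left _ _, ?_⟩
    have h1 : (min 1 ((1 / (2 * (E * Cg))) ^ (1 / θ))) ^ θ ≤ ((1 / (2 * (E * Cg))) ^ (1 / θ)) ^ θ :=
      Real.rpow_le_rpow (le_min zero_le_one (by positivity)) (min_le_right _ _) hθ0.le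
    rw [← Real.rpow_mul (by positivity), one_div_mul_cancel hθ0.ne', Real.rpow_one] at h1
    calc _ ≤ E * Cg * (1 / (2 * (E * Cg))) := by gcongr
      _ = 1 / 2 := by field_simp
  have hqt : ∀ t b T, 0 ≤ t → t ≤ T → 0 < b → T * b ≤ q → E * Cg * (t * b) ^ θ ≤ 1 / 2 := by
    intro t b T h1 h2 h3 h4
    refine le_trans ?_ hq
    gcongr
    exact (mul_le_mul_of_nonneg_right h2 h3.le).trans h4
  have pow1 : ∀ R : ℝ, 1 ≤ R → 1 ≤ R ^ a := fun R hR => Real.one_le_rpow hR ha.le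
  refine ⟨C, q, hC, hq0, hq1, ?_, ?_⟩
  · intro U u hu h0 T B r hB hr hT hI
    have hF := flow_abs w hm hu h0
    have hb : 0 < B ^ (m - 1) := by positivity
    have main : ∀ T', T' ≤ T → (∀ t, 0 ≤ t → t ≤ T' → ∀ R, r ≤ R → J ρ (fun x => |u t x|) R ≤ B * R ^ a) →
        ∀ t, 0 ≤ t → t ≤ T' → ∀ R, r ≤ R → J ρ (fun x => |u t x|) R ≤ 3 / 4 * B * R ^ a := by
      intro T' hT' hap t ht htT R hR
      have h1 := hst _ _ _ hF T' (B ^ (m - 1)) Cg B (B / (4 * 2 ^ a)) r hb hCg0.le hB.le hr (by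
        intro τ hτ hτT R hR
        have hR0 : 0 < R := by linarith
        have hX : τ * B ^ (m - 1) ≤ 1 := ((mul_le_mul_of_nonneg_right (hτT.trans hT') hb.le).trans hT).trans hq1
        filter_upwards [hs U u hu h0 τ B r hτ hB hr hX (hap τ hτ.le hτT) R hR] with x hx hxR
        have h2 := spow_bd hm.le (hx hxR)
        rw [spow_Y w hm hC hb.le hτ.le hR0] at h2
        refine h2.trans ?_
        refine mul_le_mul_of_nonneg_right ?_ (abs_nonneg _)
        rw [hCg]
        have : C ^ (m - 1) ≤ m * C ^ (m - 1) := le_mul_of_one_le_left (by positivity) hm.le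
        gcongr) hap hI t ht htT R hR
      refine h1.trans ?_
      have hR0 : 0 < R := by linarith
      have h2 := hqt t (B ^ (m - 1)) T ht (htT.trans hT') hb hT
      have h3 : (2:ℝ) ^ a * (B / (4 * 2 ^ a)) = B / 4 := by field_simp
      rw [h3]
      refine mul_le_mul_of_nonneg_right ?_ (by positivity)
      have h4 : E * Cg * (t * B ^ (m - 1)) ^ θ * B ≤ 1 / 2 * B := mul_le_mul_of_nonneg_right h2 hB.le
      linarith
    have all : ∀ t, 0 ≤ t → t ≤ T → ∀ R, r ≤ R → J ρ (fun x => |u t x|) R ≤ B * R ^ a := by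
      set τ := B / (4 * (Lc U + 1)) with hτ
      have hL := Lc_nn U
      have hτ0 : 0 < τ := by positivity
      have hτL : τ * Lc U ≤ B / 4 := by
        have h1 : τ * (Lc U + 1) = B / 4 := by rw [hτ]; field_simp
        have h2 : τ * Lc U ≤ τ * (Lc U + 1) := mul_le_mul_of_nonneg_left (by linarith) hτ0.le
        linarith
      have ind : ∀ n : ℕ, ∀ t, 0 ≤ t → t ≤ T → t ≤ n * τ → ∀ R, r ≤ R → J ρ (fun x => |u t x|) R ≤ B * R ^ a := by
        intro n
        induction n with
        | zero =>
          intro t ht htT htn R hR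
          have : t = 0 := le_antisymm (by simpa using htn) ht
          subst this
          refine (hI R hR).trans ?_
          have hR0 : 0 < R := by linarith
          refine mul_le_mul_of_nonneg_right ?_ (by positivity)
          refine div_le_self hB.le ?_
          have : (1:ℝ) ≤ 2 ^ a := Real.one_le_rpow (by norm_num) ha.le
          linarith
        | succ n ih =>
          intro t ht htT htn R hR
          have hs0 : (0:ℝ) ≤ max 0 (t - τ) := le_max_left _ _
          have hst' : max 0 (t - τ) ≤ t := max_le ht (by linarith)
          have hsn : max 0 (t - τ) ≤ n * τ := by
            push_cast at htn
            exact max_le (by positivity) (by linarith)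
          have h1 := main (max 0 (t - τ)) (hst'.trans htT) (fun t' h1 h2 R hR => ih t' h1 (h2.trans (hst'.trans htT)) (h2.trans hsn) R hR) _ hs0 le_rfl R hR
          have h2 := J_dd w (hF.ok t ht) (hF.ok _ hs0) R
          have h3 := hF.lip _ t hs0 hst'
          have h4 : (t - max 0 (t - τ)) * Lc U ≤ τ * Lc U := mul_le_mul_of_nonneg_right (by linarith [le_max_right 0 (t - τ)]) hL
          have h5 := pow1 R (hr.trans hR)
          have h6 : B / 4 ≤ B / 4 * R ^ a := le_mul_of_one_le_right (by linarith) h5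
          linarith
      intro t ht htT
      obtain ⟨n, hn⟩ := exists_nat_ge (t / τ)
      exact ind n t ht htT ((div_le_iff₀ hτ0).1 hn)
    refine ⟨all, fun t ht htT => ?_⟩
    have hX : t * B ^ (m - 1) ≤ 1 := ((mul_le_mul_of_nonneg_right htT hb.le).trans hT).trans hq1
    exact hs U u hu h0 t B r ht hB hr hX (all t ht.le htT)
  · intro U V u v hu hv T b I r hb hI hr hT pu pv hJ0
    have hF := flow_diff w hm hu hv
    have hmain := fun D hD hap => hst _ _ _ hF T b Cg D I r hb hCg0.le hD hr (by
        intro τ hτ hτT R hR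
        have hR0 : 0 < R := by linarith
        filter_upwards [pu τ hτ hτT R hR, pv τ hτ hτT R hR] with x hx hy hxR
        have h2 := spow_lip hm.le (hx hxR) (hy hxR)
        rw [spow_Y w hm hC hb.le hτ.le hR0] at h2
        rw [abs_abs]
        refine h2.trans (le_of_eq ?_)
        rw [hCg]; ring) hap hJ0
    obtain ⟨D0, hD0, hap0⟩ : ∃ D0 : ℝ, 0 ≤ D0 ∧ ∀ τ, 0 ≤ τ → τ ≤ T → ∀ R, r ≤ R → J ρ (fun x => |u τ x - v τ x|) R ≤ D0 * R ^ a := by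
      have hL : 0 ≤ Lc U + Lc V := add_nonneg (Lc_nn U) (Lc_nn V)
      have hi : 0 ≤ ∫ x, ρ x * |u 0 x - v 0 x| := integral_nonneg fun x => mul_nonneg (w.pos x).le (abs_nonneg _)
      refine ⟨(∫ x, ρ x * |u 0 x - v 0 x|) + |T| * (Lc U + Lc V), by positivity, ?_⟩
      intro τ h1 h2 R hR
      have h3 := J_dd w (hF.ok τ h1) (hF.ok 0 le_rfl) R
      have h4 := hF.lip 0 τ le_rfl h1
      have h5 := J_le_tot w (hF.ok 0 le_rfl) (hF.nn 0) R
      have h6 : (τ - 0) * (Lc U + Lc V) ≤ |T| * (Lc U + Lc V) := mul_le_mul_of_nonneg_right (by linarith [le_abs_self T]) hL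
      refine le_trans ?_ (le_mul_of_one_le_right (by positivity) (pow1 R (hr.trans hR)))
      linarith
    have it : ∀ n : ℕ, ∀ t, 0 ≤ t → t ≤ T → ∀ R, r ≤ R → J ρ (fun x => |u t x - v t x|) R ≤ (2 * 2 ^ a * I + D0 * (1 / 2) ^ n) * R ^ a := by
      intro n
      induction n with
      | zero =>
        intro t h1 h2 R hR
        refine (hap0 t h1 h2 R hR).trans ?_
        have hR0 : 0 < R := by linarith
        refine mul_le_mul_of_nonneg_right ?_ (by positivity)
        have : 0 ≤ 2 * 2 ^ a * I := by positivity
        rw [pow_zero]; linarith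
      | succ n ih =>
        intro t h1 h2 R hR
        have h3 := hmain _ (by positivity) ih t h1 h2 R hR
        refine h3.trans ?_
        have hR0 : 0 < R := by linarith
        refine mul_le_mul_of_nonneg_right ?_ (by positivity)
        have h4 := mul_le_mul_of_nonneg_right (hqt t b T h1 h2 hb hT) (show 0 ≤ 2 * 2 ^ a * I + D0 * (1 / 2) ^ n by positivity)
        rw [pow_succ]
        linarith
    intro t h1 h2 R hR
    have hlim : Tendsto (fun n : ℕ => (2 * 2 ^ a * I + D0 * (1 / 2 : ℝ) ^ n) * R ^ a) atTop (nhds ((2 * 2 ^ a * I + D0 * 0) * R ^ a)) :=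
      (((_root_.tendsto_pow_atTop_nhds_zero_of_lt_one (r := (1 / 2 : ℝ)) (by norm_num) (by norm_num)).const_mul _).const_add _).mul_const _
    rw [mul_zero, add_zero] at hlim
    exact ge_of_tendsto' hlim fun n => it n t h1 h2 R hR

end

noncomputable section
variable {N : ℕ} {γ k K m δ h M : ℝ} {ρ : Euc N → ℝ}

/-! ### approximation of the data -/

lemma spow_inv' {m : ℝ} (hm : 0 < m) (s : ℝ) : spow (1 / m) (spow m s) = s := by
  have := spow_inv (m := 1 / m) (by positivity) s
  rwa [one_div_one_div] at this

lemma spow_cont' {m : ℝ} (hm : 0 < m) : Continuous (spow (1 / m)) :=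
  (spow_mono (by positivity)).monotone.continuous_of_surjective fun s => ⟨spow m s, spow_inv' hm s⟩

def bmp (N n : ℕ) : ContDiffBump (0 : Euc N) := ⟨1 / (2 * (n + 1)), 1 / (n + 1), by positivity, by
  rw [div_lt_div_iff₀ (by positivity) (by positivity)]
  have : (0:ℝ) ≤ n := Nat.cast_nonneg n
  linarith⟩

open scoped Convolution in
lemma mollify {f : Euc N → ℝ} {C R : ℝ} (hf : Measurable f) (h0 : ∀ x, 0 ≤ f x) (hC : ∀ x, f x ≤ C) (hR : 0 < R) (hs : ∀ x, R ≤ ‖x‖ → f x = 0) :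
    ∃ A : ℕ → Euc N → ℝ, (∀ n, Test (A n)) ∧ (∀ n x, 0 ≤ A n x) ∧ (∀ n x, A n x ≤ C) ∧ (∀ n x, R + 1 ≤ ‖x‖ → A n x = 0) ∧
      ∀ᵐ x, Tendsto (fun n => A n x) atTop (nhds (f x)) := by
  have hint : Integrable f := by
    have h1 : IntegrableOn f (ball (0 : Euc N) R) := (BM.ion (C := C) ⟨hf, fun x => by rw [abs_of_nonneg (h0 x)]; exact hC x⟩ 0 R).mono_set ball_subset_closedBall
    refine (integrableOn_iff_integrable_of_support_subset fun x hx => ?_).1 h1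
    by_contra hn
    exact hx (hs x (by simpa using hn))
  have hval : ∀ (n : ℕ) (x : Euc N), ((bmp N n).normed volume ⋆[ContinuousLinearMap.lsmul ℝ ℝ, volume] f) x = ∫ t, (bmp N n).normed volume t * f (x - t) := fun n x => rfl
  have hi : ∀ (n : ℕ) (x : Euc N), Integrable fun t => (bmp N n).normed volume t * f (x - t) := by
    intro n x
    refine ((bmp N n).integrable_normed (μ := volume)).mul_bdd (c := C) (hf.comp (measurable_const.sub measurable_id)).aestronglyMeasurable (ae_of_all _ fun t => ?_)
    show ‖f (x - t)‖ ≤ C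
    rw [Real.norm_eq_abs, abs_of_nonneg (h0 _)]; exact hC _
  have hz : ∀ (n : ℕ) (x : Euc N), R + 1 ≤ ‖x‖ → ((bmp N n).normed volume ⋆[ContinuousLinearMap.lsmul ℝ ℝ, volume] f) x = 0 := by
    intro n x hx
    rw [hval]
    refine integral_eq_zero_of_ae (ae_of_all _ fun t => ?_)
    show (bmp N n).normed volume t * f (x - t) = 0
    by_cases ht : ‖t‖ < 1
    · have : R ≤ ‖x - t‖ := by linarith [norm_sub_norm_le x t]
      rw [hs _ this, mul_zero]
    · have : t ∉ Function.support ((bmp N n).normed volume) := by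
        rw [ContDiffBump.support_normed_eq]
        have h1 : (bmp N n).rOut ≤ 1 := by
          show (1:ℝ) / (n + 1) ≤ 1
          rw [div_le_one (by positivity)]
          linarith [(Nat.cast_nonneg n : (0:ℝ) ≤ n)]
        simp only [mem_ball, dist_zero_right]
        push Not at ht ⊢
        linarith
      rw [Function.notMem_support.1 this, zero_mul]
  refine ⟨fun n => (bmp N n).normed volume ⋆[ContinuousLinearMap.lsmul ℝ ℝ, volume] f, fun n => ⟨?_, ?_⟩, ?_, ?_, hz, ?_⟩
  · exact (bmp N n).hasCompactSupport_normed.contDiff_convolution_left _ (bmp N n).contDiff_normed hint.locallyIntegrable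
  · refine HasCompactSupport.intro (isCompact_closedBall (0 : Euc N) (R + 1)) fun x hx => hz n x ?_
    simp only [mem_closedBall, dist_zero_right] at hx
    push Not at hx
    exact hx.le
  · intro n x
    beta_reduce; rw [hval]
    exact integral_nonneg fun t => mul_nonneg ((bmp N n).nonneg_normed t) (h0 _)
  · intro n x
    beta_reduce; rw [hval]
    have : ∫ t, (bmp N n).normed volume t * f (x - t) ≤ ∫ t, (bmp N n).normed volume t * C :=
      integral_mono (hi n x) ((bmp N n).integrable_normed.mul_const C) fun t => mul_le_mul_of_nonneg_left (hC _) ((bmp N n).nonneg_normed t)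
    rwa [integral_mul_const, ContDiffBump.integral_normed, one_mul] at this
  · refine ContDiffBump.ae_convolution_tendsto_right_of_locallyIntegrable (K := 2) ?_ (Eventually.of_forall fun n => ?_) hint.locallyIntegrable
    · exact tendsto_one_div_add_atTop_nhds_zero_nat
    · show (1:ℝ) / (n + 1) ≤ 2 * (1 / (2 * (n + 1)))
      apply le_of_eq; field_simp

lemma Test.add {f g : Euc N → ℝ} (hf : Test f) (hg : Test g) : Test (fun x => f x + g x) := ⟨hf.1.add hg.1, hf.2.add hg.2⟩
lemma Test.sub {f g : Euc N → ℝ} (hf : Test f) (hg : Test g) : Test (fun x => f x - g x) := ⟨hf.1.sub hg.1, hf.2.sub hg.2⟩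

/-- dominated convergence in `L¹(ρ)` -/
lemma dd_tend (w : Wt γ k K ρ) {f : Euc N → ℝ} {A : ℕ → Euc N → ℝ} {C R : ℝ} (hR : 0 < R) (hf : Measurable f) (hA : ∀ n, Measurable (A n)) (fC : ∀ x, |f x| ≤ C)
    (AC : ∀ n x, |A n x| ≤ C) (fs : ∀ x, R ≤ ‖x‖ → f x = 0) (As : ∀ n x, R ≤ ‖x‖ → A n x = 0) (ht : ∀ᵐ x, Tendsto (fun n => A n x) atTop (nhds (f x))) :
    Tendsto (fun n => dd ρ 0 (A n) f) atTop (nhds 0) := by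
  have h0 : (0:ℝ) = ∫ x : Euc N, (0:ℝ) := by simp
  simp only [dd0_def]
  rw [h0]
  refine tendsto_integral_of_dominated_convergence ((ball (0 : Euc N) R).indicator fun x => 2 * C * ρ x) (fun n => (w.meas.mul ((hA n).sub hf).abs).aestronglyMeasurable)
    ((integrable_indicator_iff measurableSet_ball).2 ((w.ball hR).1.const_mul (2 * C))) (fun n => ae_of_all _ fun x => ?_) ?_
  · rw [Real.norm_eq_abs, abs_mul, abs_abs, abs_of_nonneg (w.pos x).le]
    by_cases hx : x ∈ ball (0 : Euc N) R
    · rw [indicator_of_mem hx, mul_comm]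
      refine mul_le_mul_of_nonneg_right ?_ (w.pos x).le
      linarith [abs_sub (A n x) (f x), AC n x, fC x]
    · rw [indicator_of_notMem hx, fs x (by simpa using hx), As n x (by simpa using hx)]; simp
  · filter_upwards [ht] with x hx
    have := ((hx.sub_const (f x)).abs).const_mul (ρ x)
    simpa using this

lemma approx1 (w : Wt γ k K ρ) (hm : 1 < m) {f : Euc N → ℝ} {C R : ℝ} (hR : 0 < R) (hf : Measurable f) (fC : ∀ x, |f x| ≤ C) (fs : ∀ x, R ≤ ‖x‖ → f x = 0)
    {ε : ℝ} (hε : 0 < ε) : ∃ U W : Euc N → ℝ, Test U ∧ Test W ∧ (∀ x, |U x| ≤ W x) ∧ dd ρ 0 (b0 m U) f ≤ ε ∧ dd ρ 0 (b0 m W) (fun x => |f x|) ≤ ε := by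
  have hm0 : 0 < m := by linarith
  have hC0 : 0 ≤ C := (abs_nonneg _).trans (fC 0)
  have fp : ∀ x, |spow m (f x)| ≤ C ^ m := fun x => spow_bd' hm.le (fC x)
  have fz : ∀ x, R ≤ ‖x‖ → spow m (f x) = 0 := fun x hx => by rw [fs x hx, spow_zero]
  have hmm : Measurable fun x => spow m (f x) := (spow_meas m).comp hf
  obtain ⟨A, tA, A0, AC, As, At⟩ := mollify (f := fun x => max (spow m (f x)) 0) (C := C ^ m) (hmm.max measurable_const) (fun x => le_max_right _ _)
    (fun x => max_le ((le_abs_self _).trans (fp x)) (by positivity)) hR (fun x hx => by simp [fz x hx])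
  obtain ⟨B, tB, B0, BC, Bs, Bt⟩ := mollify (f := fun x => max (-spow m (f x)) 0) (C := C ^ m) (hmm.neg.max measurable_const) (fun x => le_max_right _ _)
    (fun x => max_le ((neg_le_abs _).trans (fp x)) (by positivity)) hR (fun x hx => by simp [fz x hx])
  have hA : ∀ n, Measurable (A n) := fun n => (tA n).1.continuous.measurable
  have hB : ∀ n, Measurable (B n) := fun n => (tB n).1.continuous.measurable
  have sc := spow_cont' hm0
  have b2 : ∀ y, |y| ≤ 2 * C ^ m → |spow (1 / m) y| ≤ (2 * C ^ m) ^ (1 / m) := by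
    intro y hy
    rw [spow_abs (by positivity)]
    exact Real.rpow_le_rpow (abs_nonneg _) hy (by positivity)
  have hCC : C ≤ (2 * C ^ m) ^ (1 / m) := by
    calc C = (C ^ m) ^ (1 / m) := by rw [← Real.rpow_mul hC0, mul_one_div_cancel hm0.ne', Real.rpow_one]
      _ ≤ _ := by
        have : 0 ≤ C ^ m := by positivity
        exact Real.rpow_le_rpow this (by linarith) (by positivity)
  have t1 := dd_tend w (f := f) (A := fun n => b0 m (fun x => A n x - B n x)) (C := (2 * C ^ m) ^ (1 / m)) (R := R + 1) (by linarith) hf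
    (fun n => (spow_meas _).comp ((hA n).sub (hB n))) (fun x => (fC x).trans hCC) (fun n x => b2 _ (by
      rw [abs_le]; constructor <;> linarith [A0 n x, B0 n x, AC n x, BC n x])) (fun x hx => fs x (by linarith))
    (fun n x hx => by show spow (1 / m) (A n x - B n x) = 0; rw [As n x hx, Bs n x hx, sub_zero, spow_zero]) (by
      filter_upwards [At, Bt] with x h1 h2
      have h3 := (sc.tendsto _).comp (h1.sub h2)
      have e : max (spow m (f x)) 0 - max (-spow m (f x)) 0 = spow m (f x) := by
        rcases le_total 0 (spow m (f x)) with h | h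
        · rw [max_eq_left h, max_eq_right (by linarith)]; ring
        · rw [max_eq_right h, max_eq_left (by linarith)]; ring
      rw [e, spow_inv' hm0] at h3
      exact h3)
  have t2 := dd_tend w (f := fun x => |f x|) (A := fun n => b0 m (fun x => A n x + B n x)) (C := (2 * C ^ m) ^ (1 / m)) (R := R + 1) (by linarith) hf.abs
    (fun n => (spow_meas _).comp ((hA n).add (hB n))) (fun x => by rw [abs_abs]; exact (fC x).trans hCC) (fun n x => b2 _ (by
      rw [abs_le]; constructor <;> linarith [A0 n x, B0 n x, AC n x, BC n x])) (fun x hx => by rw [fs x (by linarith), abs_zero])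
    (fun n x hx => by show spow (1 / m) (A n x + B n x) = 0; rw [As n x hx, Bs n x hx, add_zero, spow_zero]) (by
      filter_upwards [At, Bt] with x h1 h2
      have h3 := (sc.tendsto _).comp (h1.add h2)
      have e : max (spow m (f x)) 0 + max (-spow m (f x)) 0 = spow m |f x| := by
        rw [spow_nn hm0 (abs_nonneg _), ← spow_abs hm0]
        rcases le_total 0 (spow m (f x)) with h | h
        · rw [max_eq_left h, max_eq_right (by linarith), abs_of_nonneg h]; ring
        · rw [max_eq_right h, max_eq_left (by linarith), abs_of_nonpos h]; ring
      rw [e, spow_inv' hm0] at h3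
      exact h3)
  obtain ⟨n, h1, h2⟩ := ((t1.eventually_le_const hε).and (t2.eventually_le_const hε)).exists
  refine ⟨fun x => A n x - B n x, fun x => A n x + B n x, (tA n).sub (tB n), (tA n).add (tB n), fun x => ?_, h1, h2⟩
  rw [abs_le]; constructor <;> linarith [A0 n x, B0 n x]

/-- data in `X₀` -/
structure Data (ρ : Euc N → ℝ) (m γ : ℝ) (f : Euc N → ℝ) : Prop where
  meas : Measurable f
  loc : ∀ R, IntegrableOn (fun x => ρ x * f x) (ball (0 : Euc N) R)
  dec : ∀ ε : ℝ, 0 < ε → ∃ r, 1 ≤ r ∧ ∀ R, r ≤ R → J ρ (fun x => |f x|) R ≤ ε * R ^ aa N m γ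

lemma abs_loc (w : Wt γ k K ρ) {f : Euc N → ℝ} {R : ℝ} (h : IntegrableOn (fun x => ρ x * f x) (ball (0 : Euc N) R)) :
    IntegrableOn (fun x => ρ x * |f x|) (ball (0 : Euc N) R) :=
  (Integrable.abs h).congr (ae_of_all _ fun x => by show |ρ x * f x| = ρ x * |f x|; rw [abs_mul, abs_of_nonneg (w.pos x).le])

lemma sub_loc {f g : Euc N → ℝ} {R : ℝ} (h : IntegrableOn (fun x => ρ x * f x) (ball (0 : Euc N) R))
    (h' : IntegrableOn (fun x => ρ x * g x) (ball (0 : Euc N) R)) : IntegrableOn (fun x => ρ x * (f x - g x)) (ball (0 : Euc N) R) :=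
  (Integrable.sub h h').congr (ae_of_all _ fun x => by show ρ x * f x - ρ x * g x = ρ x * (f x - g x); ring)

lemma J_tri (w : Wt γ k K ρ) {f g p : Euc N → ℝ} {R : ℝ} (hf : IntegrableOn (fun x => ρ x * f x) (ball (0 : Euc N) R))
    (hg : IntegrableOn (fun x => ρ x * g x) (ball (0 : Euc N) R)) (hp : IntegrableOn (fun x => ρ x * p x) (ball (0 : Euc N) R)) :
    J ρ (fun x => |f x - p x|) R ≤ J ρ (fun x => |f x - g x|) R + J ρ (fun x => |g x - p x|) R := by
  have i1 := abs_loc w (sub_loc hf hg)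
  have i2 := abs_loc w (sub_loc hg hp)
  unfold J
  rw [← integral_add i1 i2]
  refine integral_mono (abs_loc w (sub_loc hf hp)) (i1.add i2) fun x => ?_
  show ρ x * |f x - p x| ≤ ρ x * |f x - g x| + ρ x * |g x - p x|
  rw [← mul_add]
  exact mul_le_mul_of_nonneg_left (abs_sub_le _ _ _) (w.pos x).le

lemma J_R (w : Wt γ k K ρ) {f : Euc N → ℝ} {R R' : ℝ} (hf : IntegrableOn (fun x => ρ x * f x) (ball (0 : Euc N) R')) (h0 : ∀ x, 0 ≤ f x) (h : R ≤ R') :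
    J ρ f R ≤ J ρ f R' :=
  setIntegral_mono_set hf (ae_of_all _ fun x => mul_nonneg (w.pos x).le (h0 x)) (ball_subset_ball h).eventuallyLE

lemma J_dd' (w : Wt γ k K ρ) {f g : Euc N → ℝ} (hf : Ok ρ f) (hg : Ok ρ g) (R : ℝ) : J ρ (fun x => |f x - g x|) R ≤ dd ρ 0 f g := by
  rw [dd0_def]
  exact J_le_tot w ((hf.sub hg).abs w) (fun x => abs_nonneg _) R

lemma approx2 (w : Wt γ k K ρ) (hm : 1 < m) {f : Euc N → ℝ} (hf : Data ρ m γ f) {ε : ℝ} (hε : 0 < ε) :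
    ∃ U W : Euc N → ℝ, Test U ∧ Test W ∧ (∀ x, |U x| ≤ W x) ∧ (∀ R, 1 ≤ R → J ρ (fun x => |b0 m U x - f x|) R ≤ ε * R ^ aa N m γ) ∧
      (∀ R, 1 ≤ R → J ρ (fun x => |b0 m W x - abs (f x)|) R ≤ ε * R ^ aa N m γ) := by
  obtain ⟨r, hr1, hr⟩ := hf.dec (ε / 2) (by linarith)
  have hr0 : 0 < r := by linarith
  have ha := aa_pos w hm
  set f' : ℕ → Euc N → ℝ := fun n x => (ball (0 : Euc N) (n + 1)).indicator (fun x => if |f x| ≤ n then f x else 0) x with hf'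
  have hle : ∀ n x, |f' n x| ≤ n := by
    intro n x
    simp only [hf', indicator]
    split_ifs with h1 h2 <;> simp [*]
  have hor : ∀ n x, f' n x = f x ∨ f' n x = 0 := by
    intro n x
    simp only [hf', indicator]
    split_ifs with h1 h2 <;> simp [*]
  have hms : ∀ n, Measurable (f' n) := fun n =>
    (Measurable.ite (measurableSet_le hf.meas.abs measurable_const) hf.meas measurable_const).indicator measurableSet_ball
  have hz : ∀ (n : ℕ) (x : Euc N), (n:ℝ) + 1 ≤ ‖x‖ → f' n x = 0 := by
    intro n x hx
    simp only [hf']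
    exact indicator_of_notMem (by simpa using hx) _
  have hok : ∀ n, Ok ρ (f' n) := by
    intro n
    refine ⟨hms n, ?_⟩
    have h1 : IntegrableOn (fun x => ρ x * f' n x) (ball (0 : Euc N) (n + 1)) := by
      have := (w.ball (R := n + 1) (by positivity)).1.mul_bdd (c := n) (hms n).aestronglyMeasurable (ae_of_all _ fun x => hle n x)
      exact this
    refine (integrableOn_iff_integrable_of_support_subset fun x hx => ?_).1 h1
    by_contra hn
    exact hx (by simp only [hz n x (by simpa using hn), mul_zero])
  have ht : Tendsto (fun n => J ρ (fun x => |f' n x - f x|) r) atTop (nhds 0) := by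
    have h0 : (0:ℝ) = ∫ x in ball (0 : Euc N) r, (0:ℝ) := by simp
    unfold J
    rw [h0]
    refine tendsto_integral_of_dominated_convergence (fun x => ρ x * |f x|) (fun n => (w.meas.mul ((hms n).sub hf.meas).abs).aestronglyMeasurable) (abs_loc w (hf.loc r)) (fun n => ae_of_all _ fun x => ?_) (ae_of_all _ fun x => ?_)
    · rw [Real.norm_eq_abs, abs_mul, abs_abs, abs_of_nonneg (w.pos x).le]
      refine mul_le_mul_of_nonneg_left ?_ (w.pos x).le
      rcases hor n x with h | h <;> rw [h] <;> simp
    · have : ∀ᶠ n : ℕ in atTop, ρ x * |f' n x - f x| = 0 := by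
        filter_upwards [eventually_ge_atTop ⌈max |f x| ‖x‖⌉₊] with n hn
        have h1 : max |f x| ‖x‖ ≤ n := (Nat.le_ceil _).trans (by exact_mod_cast hn)
        have h2 : f' n x = f x := by
          simp only [hf']
          rw [indicator_of_mem (by simp; linarith [le_max_right |f x| ‖x‖]), if_pos ((le_max_left _ _).trans h1)]
        rw [h2]; simp
      exact tendsto_const_nhds.congr' (this.mono fun n hn => hn.symm)
  obtain ⟨n, hn⟩ := (ht.eventually_le_const (show 0 < ε / 2 by linarith)).exists
  obtain ⟨U, W, tU, tW, hUW, d1, d2⟩ := approx1 w hm (R := n + 1) (by positivity) (hms n) (hle n) (fun x hx => hz n x hx) (show 0 < ε / 2 by linarith)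
  have okb : ∀ V : Euc N → ℝ, Test V → Ok ρ (b0 m V) := by
    intro V hV
    obtain ⟨B, hB0, hB⟩ := hV.bdd
    have hm0 : 0 < m := by linarith
    exact (b0_good (M := B ^ (1 / m)) hm (by positivity) hV (fun x => by
      rw [← Real.rpow_mul hB0, one_div_mul_cancel hm0.ne', Real.rpow_one]; exact hB x)).ok w
  have hJ : ∀ R, 1 ≤ R → J ρ (fun x => |f' n x - f x|) R ≤ ε / 2 * R ^ aa N m γ := by
    intro R hR
    have il : ∀ R, IntegrableOn (fun x => ρ x * |f' n x - f x|) (ball (0 : Euc N) R) := fun R => abs_loc w (sub_loc (hok n).2.integrableOn (hf.loc R))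
    rcases le_total r R with h | h
    · refine le_trans ?_ (hr R h)
      refine integral_mono (il R) (abs_loc w (hf.loc R)) fun x => ?_
      refine mul_le_mul_of_nonneg_left ?_ (w.pos x).le
      beta_reduce; rcases hor n x with h | h <;> rw [h] <;> simp
    · exact ((J_R w (il r) (fun x => abs_nonneg _) h).trans hn).trans (le_mul_of_one_le_right (by linarith) (Real.one_le_rpow hR ha.le))
  have hpow : ∀ R : ℝ, 1 ≤ R → ε / 2 ≤ ε / 2 * R ^ aa N m γ := fun R hR => le_mul_of_one_le_right (by linarith) (Real.one_le_rpow hR ha.le)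
  refine ⟨U, W, tU, tW, hUW, fun R hR => ?_, fun R hR => ?_⟩
  · have h1 := J_tri w (okb U tU).2.integrableOn (hok n).2.integrableOn (hf.loc R)
    have h2 := J_dd' w (okb U tU) (hok n) R
    linarith [hJ R hR, hpow R hR]
  · have h1 := J_tri w (R := R) (okb W tW).2.integrableOn ((hok n).abs w).2.integrableOn (abs_loc w (hf.loc R))
    have h2 := J_dd' w (okb W tW) ((hok n).abs w) R
    have h3 : J ρ (fun x => |(|f' n x| - |f x|)|) R ≤ J ρ (fun x => |f' n x - f x|) R := by
      refine integral_mono (abs_loc w (sub_loc ((hok n).abs w).2.integrableOn (abs_loc w (hf.loc R)))) (abs_loc w (sub_loc (hok n).2.integrableOn (hf.loc R))) fun x => ?_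
      exact mul_le_mul_of_nonneg_left (abs_abs_sub_abs_le _ _) (w.pos x).le
    linarith [hJ R hR, hpow R hR]

end

noncomputable section
variable {N : ℕ} {γ k K m δ h M : ℝ} {ρ : Euc N → ℝ}

/-! ## Limits of the approximating solutions -/
lemma sol_exists (w : Wt γ k K ρ) (hm : 1 < m) {U : Euc N → ℝ} (hU : Test U) : ∃ u, Sol ρ m U u := by
  obtain ⟨B, hB0, hB⟩ := hU.bdd
  have hm0 : 0 < m := by linarith
  have hb : ∀ x, |U x| ≤ (B ^ (1 / m)) ^ m := fun x => by
    rw [← Real.rpow_mul hB0, one_div_mul_cancel hm0.ne', Real.rpow_one]; exact hB x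
  obtain ⟨u, hu⟩ := base_limit w hm (M := B ^ (1 / m)) (by positivity) hU hb
  exact ⟨u, hU, _, by positivity, hb, hu⟩

lemma Sol.zero {U : Euc N → ℝ} {u : ℝ → Euc N → ℝ} (hu : Sol ρ m U u) : u 0 = b0 m U := by
  obtain ⟨tU, M1, h1, b1, l1⟩ := hu
  exact l1.zero

lemma Sol.meas {U : Euc N → ℝ} {u : ℝ → Euc N → ℝ} (hu : Sol ρ m U u) : Measurable (fun p : Euc N × ℝ => u p.2 p.1) := by
  obtain ⟨tU, M1, h1, b1, l1⟩ := hu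
  exact l1.meas

lemma seq_exists (w : Wt γ k K ρ) (hm : 1 < m) {f : Euc N → ℝ} (hf : Data ρ m γ f) :
    ∃ (C A : ℝ) (U : ℕ → Euc N → ℝ) (u : ℕ → ℝ → Euc N → ℝ), 0 < C ∧ 0 < A ∧ (∀ n, Sol ρ m (U n) (u n)) ∧
      (∀ n : ℕ, ∀ R, 1 ≤ R → J ρ (fun x => |u n 0 x - f x|) R ≤ (1 / 2) ^ n * R ^ aa N m γ) ∧
      ∀ T η : ℝ, 0 < T → 0 < η → ∃ (b r : ℝ) (n0 : ℕ), 0 < b ∧ b ≤ η ∧ 1 ≤ r ∧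
        (∀ n, n0 ≤ n → ∀ t, 0 < t → t ≤ T → PB N m γ C b r (u n t) t) ∧
        (∀ n, n0 ≤ n → ∀ t, 0 ≤ t → t ≤ T → ∀ R, r ≤ R → J ρ (fun x => |u (n + 1) t x - u n t x|) R ≤ A * (1 / 2) ^ n * R ^ aa N m γ) := by
  obtain ⟨C, q, hC, hq, hq1, g1, g2⟩ := growth w hm
  have ex := fun n : ℕ => approx2 w hm hf (ε := (1 / 2) ^ n) (by positivity)
  choose U W tU tW hUW dU dW using ex
  choose u hu using fun n => sol_exists w hm (tU n)
  choose v hv using fun n => sol_exists w hm (tW n)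
  have ha := aa_pos w hm
  have hle : ∀ n t, 0 ≤ t → ∀ᵐ x, |u n t x| ≤ v n t x := fun n t ht => by
    obtain ⟨M, H⟩ := (hu n).two w hm (hv n)
    exact ord_lim H (hUW n) ht
  have d0 : ∀ n : ℕ, ∀ R, 1 ≤ R → J ρ (fun x => |u n 0 x - f x|) R ≤ (1 / 2) ^ n * R ^ aa N m γ := fun n R hR => by
    rw [(hu n).zero]; exact dU n R hR
  refine ⟨C, 2 * 2 ^ aa N m γ * 2, U, u, hC, by positivity, hu, d0, fun T η hT hη => ?_⟩
  set b := min η (q / T) with hb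
  have b0' : 0 < b := lt_min hη (by positivity)
  have hm1 : 0 < m - 1 := by linarith
  have hTb : T * b ≤ q := by
    have := mul_le_mul_of_nonneg_left (min_le_right η (q / T)) hT.le
    rwa [mul_div_cancel₀ _ hT.ne'] at this
  set B := b ^ (1 / (m - 1)) with hB
  have B0 : 0 < B := by positivity
  have hBb : B ^ (m - 1) = b := by
    rw [hB, ← Real.rpow_mul b0'.le, one_div_mul_cancel hm1.ne', Real.rpow_one]
  set ε := B / (8 * 2 ^ aa N m γ) with hε
  have ε0 : 0 < ε := by positivity
  obtain ⟨r, hr1, hr⟩ := hf.dec ε ε0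
  obtain ⟨n0, hn0⟩ := exists_pow_lt_of_lt_one ε0 (show (1 / 2 : ℝ) < 1 by norm_num)
  have hpw : ∀ n, n0 ≤ n → (1 / 2 : ℝ) ^ n ≤ ε := fun n hn => (pow_le_pow_of_le_one (by norm_num) (by norm_num) hn).trans hn0.le
  have hPB : ∀ n, n0 ≤ n → ∀ t, 0 < t → t ≤ T → PB N m γ C b r (u n t) t := by
    intro n hn t ht htT R hR
    have h := (g1 (W n) (v n) (hv n) (fun x => (abs_nonneg _).trans (hUW n x)) T B r B0 hr1 (by rw [hBb]; exact hTb) (fun R hR => by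
      have hR0 : 0 < R := by linarith
      have i1 : IntegrableOn (fun x => ρ x * v n 0 x) (ball (0 : Euc N) R) := ((hv n).ok le_rfl).2.integrableOn
      have h1 := J_tri w (p := fun _ => 0) i1 (abs_loc w (hf.loc R)) (by simp)
      simp only [sub_zero, abs_abs] at h1
      rw [(hv n).zero] at h1 ⊢
      have h2 := dW n R (hr1.trans hR)
      have h3 := hr R hR
      have h4 := mul_le_mul_of_nonneg_right (hpw n hn) (Real.rpow_nonneg hR0.le (aa N m γ))
      have h5 : B / (4 * 2 ^ aa N m γ) = 2 * ε := by rw [hε]; field_simp; norm_num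
      rw [h5]; linarith)).2 t ht htT R hR
    rw [hBb] at h
    filter_upwards [h, hle n t ht.le] with x hx hx2 hxR
    exact hx2.trans ((le_abs_self _).trans (hx hxR))
  refine ⟨b, r, n0, b0', min_le_left _ _, hr1, hPB, fun n hn t ht htT R hR => ?_⟩
  have h := g2 (U (n + 1)) (U n) (u (n + 1)) (u n) (hu _) (hu _) T b (2 * (1 / 2) ^ n) r b0' (by positivity) hr1 hTb (hPB _ (by omega)) (hPB n hn) (fun R hR => by
    have hR1 := hr1.trans hR
    have hR0 : 0 < R := by linarith
    have i1 : IntegrableOn (fun x => ρ x * u (n + 1) 0 x) (ball (0 : Euc N) R) := ((hu _).ok le_rfl).2.integrableOn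
    have i2 : IntegrableOn (fun x => ρ x * u n 0 x) (ball (0 : Euc N) R) := ((hu _).ok le_rfl).2.integrableOn
    have h1 := J_tri w i1 (hf.loc R) i2
    have h2 := d0 (n + 1) R hR1
    have h3 := d0 n R hR1
    simp only [fun x => abs_sub_comm (f x) (u n 0 x)] at h1
    have h4 : (0:ℝ) ≤ (1 / 2) ^ n * R ^ aa N m γ := by positivity
    rw [pow_succ] at h2
    linarith) t ht htT R hR
  refine h.trans (le_of_eq ?_)
  ring

structure Lm (ρ : Euc N → ℝ) (m γ C : ℝ) (f : Euc N → ℝ) (U : ℕ → Euc N → ℝ) (un : ℕ → ℝ → Euc N → ℝ) (u : ℝ → Euc N → ℝ) : Prop where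
  C0 : 0 < C
  sol : ∀ n, Sol ρ m (U n) (un n)
  meas : Measurable (fun p : Euc N × ℝ => u p.2 p.1)
  loc : ∀ t, 0 ≤ t → ∀ R, IntegrableOn (fun x => ρ x * u t x) (ball (0 : Euc N) R)
  zero : ∀ᵐ x, u 0 x = f x
  conv : ∀ T ε : ℝ, 0 < T → 0 < ε → ∃ n0 : ℕ, ∀ n, n0 ≤ n → ∀ t, 0 ≤ t → t ≤ T → ∀ R, 1 ≤ R → J ρ (fun x => |u t x - un n t x|) R ≤ ε * R ^ aa N m γ
  bd : ∀ T η : ℝ, 0 < T → 0 < η → ∃ (b r : ℝ) (n0 : ℕ), 0 < b ∧ b ≤ η ∧ 1 ≤ r ∧ ∀ t, 0 < t → t ≤ T →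
    PB N m γ C b r (u t) t ∧ ∀ n, n0 ≤ n → PB N m γ C b r (un n t) t


theorem lm_exists (w : Wt γ k K ρ) (hm : 1 < m) {f : Euc N → ℝ} (hf : Data ρ m γ f) : ∃ C U un u, Lm ρ m γ C f U un u := by
  obtain ⟨C, A, U, un, hC, hA, hs, d0, hT⟩ := seq_exists w hm hf
  have ha := aa_pos w hm
  have mn : ∀ n t, Measurable (un n t) := fun n t => (hs n).meas.comp (measurable_id.prodMk measurable_const)
  obtain ⟨u, hu⟩ : ∃ u : ℝ → Euc N → ℝ, u = fun t x => limsup (fun n => un n t x) atTop := ⟨_, rfl⟩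
  have mu : Measurable (fun p : Euc N × ℝ => u p.2 p.1) := by rw [hu]; exact Measurable.limsup fun n => (hs n).meas
  have mutt : ∀ t, Measurable (u t) := fun t => mu.comp (measurable_id.prodMk measurable_const)
  have key : ∀ T r : ℝ, ∀ n0 : ℕ, (∀ n, n0 ≤ n → ∀ t, 0 ≤ t → t ≤ T → ∀ R, r ≤ R → J ρ (fun x => |un (n + 1) t x - un n t x|) R ≤ A * (1 / 2) ^ n * R ^ aa N m γ) →
      1 ≤ r → ∀ n, n0 ≤ n → ∀ t, 0 ≤ t → t ≤ T → ∀ R, r ≤ R →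
      (∀ᵐ x, ‖x‖ < R → Tendsto (fun n => un n t x) atTop (nhds (u t x))) ∧ IntegrableOn (fun x => ρ x * u t x) (ball (0 : Euc N) R) ∧
      J ρ (fun x => |u t x - un n t x|) R ≤ 2 * A * (1 / 2) ^ n * R ^ aa N m γ := by
    intro T r n0 hd hr1 n hn t ht htT R hR
    have hR0 : 0 < R := by linarith
    have il : ∀ n, IntegrableOn (fun x => ρ x * un n t x) (ball (0 : Euc N) R) := fun n => ((hs n).ok ht).2.integrableOn
    have hfc := fast_conv (μ := volume.restrict (ball (0 : Euc N) R)) w.meas w.pos (g := fun j => un (n + j) t) (fun j => mn _ _) (c := A * (1 / 2) ^ n * R ^ aa N m γ) (by positivity) (fun j => by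
      have hi := abs_loc w (sub_loc (il (n + (j + 1))) (il (n + j)))
      rw [← ofReal_integral_eq_lintegral_ofReal hi (ae_of_all _ fun x => mul_nonneg (w.pos x).le (abs_nonneg _))]
      refine ENNReal.ofReal_le_ofReal ?_
      refine (hd (n + j) (by omega) t ht htT R hR).trans (le_of_eq ?_)
      rw [pow_add]; ring)
    have e : ∀ x, limsup (fun j => un (n + j) t x) atTop = u t x := fun x => by
      simp only [hu]
      rw [← Filter.limsup_nat_add (fun j => un j t x) n]
      simp_rw [add_comm]
    simp only [e] at hfc
    have h1 := (ae_restrict_iff' measurableSet_ball).1 hfc.1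
    have hk := hfc.2 0
    simp only [add_zero, pow_zero, mul_one] at hk
    have hms : Measurable (fun x => ρ x * |u t x - un n t x|) := w.meas.mul ((mutt t).sub (mn n t)).abs
    have hnn : ∀ x, 0 ≤ ρ x * |u t x - un n t x| := fun x => mul_nonneg (w.pos x).le (abs_nonneg _)
    have hi : IntegrableOn (fun x => ρ x * |u t x - un n t x|) (ball (0 : Euc N) R) := by
      refine ⟨hms.aestronglyMeasurable, ?_⟩
      rw [hasFiniteIntegral_iff_ofReal (ae_of_all _ hnn)]
      exact hk.trans_lt ENNReal.ofReal_lt_top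
    refine ⟨?_, ?_, ?_⟩
    · filter_upwards [h1] with x hx hxR
      have := hx (by simpa using hxR)
      refine (tendsto_add_atTop_iff_nat n).1 ?_
      simpa only [add_comm] using this
    · have hi2 : IntegrableOn (fun x => ρ x * (u t x - un n t x)) (ball (0 : Euc N) R) := by
        refine Integrable.mono hi (w.meas.mul ((mutt t).sub (mn n t))).aestronglyMeasurable (ae_of_all _ fun x => ?_)
        rw [Real.norm_eq_abs, Real.norm_eq_abs, abs_mul, abs_mul, abs_abs]
      refine (Integrable.add hi2 (il n)).congr (ae_of_all _ fun x => ?_)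
      show ρ x * (u t x - un n t x) + ρ x * un n t x = _
      ring
    · have h3 : ENNReal.ofReal (J ρ (fun x => |u t x - un n t x|) R) ≤ ENNReal.ofReal (2 * (A * (1 / 2) ^ n * R ^ aa N m γ)) := by
        unfold J
        rw [ofReal_integral_eq_lintegral_ofReal hi (ae_of_all _ hnn)]
        exact hk
      have h4 := (ENNReal.ofReal_le_ofReal_iff (by positivity)).1 h3
      linarith
  have conv : ∀ T ε : ℝ, 0 < T → 0 < ε → ∃ n0 : ℕ, ∀ n, n0 ≤ n → ∀ t, 0 ≤ t → t ≤ T → ∀ R, 1 ≤ R → J ρ (fun x => |u t x - un n t x|) R ≤ ε * R ^ aa N m γ := by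
    intro T ε hT0 hε
    obtain ⟨b, r, n0, hb, hbη, hr1, hPB, hd⟩ := hT T 1 hT0 one_pos
    have hr0 : 0 < r := by linarith
    obtain ⟨n1, hn1⟩ := exists_pow_lt_of_lt_one (show 0 < ε / (2 * A * r ^ aa N m γ) by positivity) (show (1 / 2 : ℝ) < 1 by norm_num)
    refine ⟨max n0 n1, fun n hn t ht htT R hR => ?_⟩
    have hR0 : 0 < R := by linarith
    have hn0 : n0 ≤ n := (le_max_left _ _).trans hn
    have hpw : (1 / 2 : ℝ) ^ n ≤ ε / (2 * A * r ^ aa N m γ) := (pow_le_pow_of_le_one (by norm_num) (by norm_num) ((le_max_right _ _).trans hn)).trans hn1.le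
    rw [le_div_iff₀ (by positivity)] at hpw
    have hra : 1 ≤ r ^ aa N m γ := Real.one_le_rpow hr1 ha.le
    have hRa : 1 ≤ R ^ aa N m γ := Real.one_le_rpow hR ha.le
    have hA2 : 2 * A * (1 / 2 : ℝ) ^ n ≤ ε := by
      have : 2 * A * (1 / 2 : ℝ) ^ n ≤ (1 / 2) ^ n * (2 * A * r ^ aa N m γ) := by
        have h0 : 0 ≤ (1 / 2 : ℝ) ^ n * (2 * A) := by positivity
        have := mul_le_mul_of_nonneg_left hra h0
        linarith
      linarith
    rcases le_total r R with h | h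
    · exact ((key T r n0 hd hr1 n hn0 t ht htT R h).2.2).trans (mul_le_mul_of_nonneg_right hA2 (by positivity))
    · obtain ⟨_, il, h2⟩ := key T r n0 hd hr1 n hn0 t ht htT r le_rfl
      have h3 := J_R w (abs_loc w (sub_loc il ((hs n).ok ht).2.integrableOn)) (fun x => abs_nonneg _) h
      have h4 : 2 * A * (1 / 2) ^ n * r ^ aa N m γ ≤ ε := by linarith
      have h5 : ε ≤ ε * R ^ aa N m γ := le_mul_of_one_le_right hε.le hRa
      linarith
  have loc : ∀ t, 0 ≤ t → ∀ R, IntegrableOn (fun x => ρ x * u t x) (ball (0 : Euc N) R) := by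
    intro t ht R
    obtain ⟨b, r, n0, hb, hbη, hr1, hPB, hd⟩ := hT (t + 1) 1 (by linarith) one_pos
    exact (key (t + 1) r n0 hd hr1 n0 le_rfl t ht (by linarith) (max r R) (le_max_left _ _)).2.1.mono_set (ball_subset_ball (le_max_right _ _))
  refine ⟨C, U, un, u, hC, hs, mu, loc, ?_, conv, ?_⟩
  · have hz : ∀ j : ℕ, ∀ᵐ x, ‖x‖ < (j : ℝ) + 1 → u 0 x = f x := by
      intro j
      set R : ℝ := (j : ℝ) + 1 with hR
      have hR1 : 1 ≤ R := by rw [hR]; linarith [(Nat.cast_nonneg j : (0:ℝ) ≤ j)]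
      have hR0 : 0 < R := by linarith
      have hz : J ρ (fun x => |u 0 x - f x|) R ≤ 0 := by
        refine le_of_forall_pos_le_add fun ε hε => ?_
        have hε' : 0 < ε / (2 * R ^ aa N m γ) := by positivity
        obtain ⟨n0, hn0⟩ := conv 1 (ε / (2 * R ^ aa N m γ)) one_pos hε'
        obtain ⟨n1, hn1⟩ := exists_pow_lt_of_lt_one hε' (show (1 / 2 : ℝ) < 1 by norm_num)
        have h1 := hn0 (max n0 n1) (le_max_left _ _) 0 le_rfl zero_le_one R hR1
        have h2 := d0 (max n0 n1) R hR1
        have h3 : (1 / 2 : ℝ) ^ (max n0 n1) ≤ ε / (2 * R ^ aa N m γ) := (pow_le_pow_of_le_one (by norm_num) (by norm_num) (le_max_right _ _)).trans hn1.le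
        have h4 := J_tri w (loc 0 le_rfl R) ((hs (max n0 n1)).ok le_rfl).2.integrableOn (hf.loc R)
        have h5 := mul_le_mul_of_nonneg_right h3 (show 0 ≤ R ^ aa N m γ by positivity)
        have h6 : ε / (2 * R ^ aa N m γ) * R ^ aa N m γ = ε / 2 := by field_simp
        rw [h6] at h1 h5
        linarith
      have hi := abs_loc w (sub_loc (loc 0 le_rfl R) (hf.loc R))
      have hnn : ∀ x, 0 ≤ ρ x * |u 0 x - f x| := fun x => mul_nonneg (w.pos x).le (abs_nonneg _)
      have h0 : J ρ (fun x => |u 0 x - f x|) R = 0 := le_antisymm hz (J_nn w (fun x => abs_nonneg _) R)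
      have h1 := (integral_eq_zero_iff_of_nonneg hnn hi).1 h0
      filter_upwards [(ae_restrict_iff' measurableSet_ball).1 h1] with x hx hxR
      have := hx (by simpa using hxR)
      simp only [Pi.zero_apply, mul_eq_zero, abs_eq_zero, sub_eq_zero] at this
      exact this.resolve_left (w.pos x).ne'
    filter_upwards [ae_all_iff.2 hz] with x hx
    obtain ⟨j, hj⟩ := exists_nat_gt ‖x‖
    exact hx j (by linarith)
  · intro T η hT0 hη
    obtain ⟨b, r, n0, hb, hbη, hr1, hPB, hd⟩ := hT T η hT0 hη
    refine ⟨b, r, n0, hb, hbη, hr1, fun t ht htT => ⟨fun R hR => ?_, fun n hn => hPB n hn t ht htT⟩⟩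
    have h1 := (key T r n0 hd hr1 n0 le_rfl t ht.le htT R hR).1
    have h2 : ∀ᵐ x, ∀ n, n0 ≤ n → ‖x‖ < R → |un n t x| ≤ C * sg N m γ b t * R ^ alp m γ := by
      rw [ae_all_iff]; intro n
      by_cases hn : n0 ≤ n
      · filter_upwards [hPB n hn t ht htT R hR] with x hx _ using hx
      · exact ae_of_all _ fun x h => absurd h hn
    filter_upwards [h1, h2] with x hx hx2 hxR
    exact le_of_tendsto (hx hxR).abs (eventually_atTop.2 ⟨n0, fun n hn => hx2 n hn hxR⟩)

end

noncomputable section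
variable {N : ℕ} {γ k K m δ h M : ℝ} {ρ : Euc N → ℝ}

/-! ## The weak formulation -/
/-- what is needed about a space-time test function -/
structure TF (φ A L : Euc N × ℝ → ℝ) (R a b C : ℝ) : Prop where
  R1 : 1 ≤ R
  a0 : 0 < a
  C0 : 0 ≤ C
  test : ∀ t, Test (fun y => φ (y, t))
  mA : Measurable A
  mL : Measurable L
  mφ : Measurable φ
  bφ : ∀ p, |φ p| ≤ C
  bA : ∀ p, |A p| ≤ C
  bL : ∀ p, |L p| ≤ C
  hL : ∀ p, L p = lap (fun y => φ (y, p.2)) p.1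
  hA : ∀ p, A p = deriv (fun s => φ (p.1, s)) p.2
  tay : ∀ x s t, |φ (x, s) - φ (x, t) - (s - t) * A (x, t)| ≤ C * (s - t) ^ 2
  out : ∀ p : Euc N × ℝ, p ∉ ball (0 : Euc N) R ×ˢ Icc a b → φ p = 0 ∧ A p = 0 ∧ L p = 0

lemma fd_cs {ψ : Euc N × ℝ → ℝ} (h : ContDiff ℝ (⊤ : ℕ∞) ψ) (v : Euc N × ℝ) : ContDiff ℝ (⊤ : ℕ∞) (fun p => fderiv ℝ ψ p v) :=
  (h.fderiv_right (m := (⊤ : ℕ∞)) (by simp)).clm_apply contDiff_const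

lemma fd_pd {ψ : Euc N × ℝ → ℝ} (h : ContDiff ℝ (⊤ : ℕ∞) ψ) (i : Fin N) (x : Euc N) (t : ℝ) :
    pd i (fun y => ψ (y, t)) x = fderiv ℝ ψ (x, t) (EuclideanSpace.single i 1, 0) := by
  have h1 : HasFDerivAt ψ (fderiv ℝ ψ (x, t)) (x, t) := (h.differentiable (by simp) _).hasFDerivAt
  have h2 := HasFDerivAt.comp (f := fun y : Euc N => (y, t)) x h1 (hasFDerivAt_prodMk_left x t)
  unfold pd
  have h3 : HasFDerivAt (fun y => ψ (y, t)) _ x := h2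
  rw [h3.fderiv]; simp

lemma tf_exists {φ : Euc N × ℝ → ℝ} (h : ContDiff ℝ (⊤ : ℕ∞) φ) (hc : HasCompactSupport φ) (hs : tsupport φ ⊆ {p : Euc N × ℝ | p.2 ∈ TimeSet ⊤}) :
    ∃ A L R a b C, TF φ A L R a b C := by
  set A : Euc N × ℝ → ℝ := fun p => fderiv ℝ φ p (0, 1) with hA
  set D : Fin N → Euc N × ℝ → ℝ := fun i p => fderiv ℝ φ p (EuclideanSpace.single i 1, 0) with hD
  set L : Euc N × ℝ → ℝ := fun p => ∑ i : Fin N, fderiv ℝ (D i) p (EuclideanSpace.single i 1, 0) with hL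
  have cA := fd_cs h (0, 1)
  have cD : ∀ i, ContDiff ℝ (⊤ : ℕ∞) (D i) := fun i => fd_cs h _
  have cL : ContDiff ℝ (⊤ : ℕ∞) L := ContDiff.sum fun i _ => fd_cs (cD i) _
  have zA : ∀ p, p ∉ tsupport φ → A p = 0 := fun p hp => image_eq_zero_of_notMem_tsupport fun h => hp (tsupport_fderiv_apply_subset ℝ _ h)
  have zL : ∀ p, p ∉ tsupport φ → L p = 0 := fun p hp => Finset.sum_eq_zero fun i _ => image_eq_zero_of_notMem_tsupport (f := fun p => fderiv ℝ (D i) p (EuclideanSpace.single i 1, 0)) fun h =>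
    hp (tsupport_fderiv_apply_subset ℝ _ (tsupport_fderiv_apply_subset ℝ _ h))
  have kA : HasCompactSupport A := hc.fderiv_apply ℝ _
  have kL : HasCompactSupport L := HasCompactSupport.intro hc zL
  obtain ⟨C1, h1⟩ := hc.exists_bound_of_continuous h.continuous
  obtain ⟨C2, h2⟩ := kA.exists_bound_of_continuous cA.continuous
  obtain ⟨C3, h3⟩ := kL.exists_bound_of_continuous cL.continuous
  obtain ⟨C4, h4⟩ := ContDiff.lipschitzWith_of_hasCompactSupport kA cA (by simp)
  obtain ⟨R0, hR0⟩ := hc.isCompact.isBounded.subset_ball 0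
  obtain ⟨a, ha, ha'⟩ := hc.isCompact.exists_forall_le' (f := fun p : Euc N × ℝ => p.2) continuous_snd.continuousOn (a := 0) fun p hp => (hs hp).1
  have hder : ∀ x s, HasDerivAt (fun s => φ (x, s)) (A (x, s)) s := fun x s => by
    have e1 : HasFDerivAt φ (fderiv ℝ φ (x, s)) (x, s) := (h.differentiable (by simp) _).hasFDerivAt
    have e2 : HasDerivAt (fun s : ℝ => (x, s)) ((0 : Euc N), (1 : ℝ)) s := (hasDerivAt_const s x).prodMk (hasDerivAt_id s)
    exact e1.comp_hasDerivAt s e2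
  set C := max (max C1 C2) (max C3 C4) with hC
  have hC4 : (C4 : ℝ) ≤ C := (le_max_right _ _).trans (le_max_right _ _)
  refine ⟨A, L, max R0 1, a, R0, C, le_max_right _ _, ha, C4.2.trans hC4, fun t => ⟨h.comp (contDiff_id.prodMk contDiff_const), ?_⟩, cA.continuous.measurable, cL.continuous.measurable, h.continuous.measurable,
    fun p => (h1 p).trans ((le_max_left _ _).trans (le_max_left _ _)), fun p => (h2 p).trans ((le_max_right _ _).trans (le_max_left _ _)),
    fun p => (h3 p).trans ((le_max_left _ _).trans (le_max_right _ _)), fun p => ?_, fun p => (hder p.1 p.2).deriv.symm, fun x s t => ?_, fun p hp => ?_⟩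
  · refine HasCompactSupport.intro (hc.isCompact.image continuous_fst) fun x hx => ?_
    by_contra h0
    exact hx ⟨(x, t), subset_tsupport _ h0, rfl⟩
  · rw [lap_eq]
    refine Finset.sum_congr rfl fun i _ => ?_
    have : pd i (fun y => φ (y, p.2)) = fun y => D i (y, p.2) := funext fun y => fd_pd h i y p.2
    rw [this, fd_pd (cD i)]
  · have hb : ∀ τ ∈ uIcc t s, ‖A (x, τ) - A (x, t)‖ ≤ C * |s - t| := fun τ hτ => by
      have e1 := h4.dist_le_mul (x, τ) (x, t)
      rw [Real.dist_eq] at e1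
      have e2 : dist (x, τ) (x, t) = |τ - t| := by
        rw [Prod.dist_eq, dist_self, Real.dist_eq, max_eq_right (abs_nonneg _)]
      rw [e2] at e1
      exact e1.trans (mul_le_mul hC4 (abs_sub_left_of_mem_uIcc hτ) (abs_nonneg _) (C4.2.trans hC4))
    have := Convex.norm_image_sub_le_of_norm_hasDerivWithin_le (f := fun τ => φ (x, τ) - τ * A (x, t)) (f' := fun τ => A (x, τ) - A (x, t)) (s := uIcc t s) (C := C * |s - t|)
      (fun τ _ => ((hder x τ).sub (by simpa using (hasDerivAt_id τ).mul_const (A (x, t)))).hasDerivWithinAt) hb (convex_uIcc t s) left_mem_uIcc right_mem_uIcc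
    rw [Real.norm_eq_abs, Real.norm_eq_abs, mul_assoc, ← sq, sq_abs] at this
    refine le_trans (le_of_eq ?_) this
    congr 1; ring
  · have hp' : p ∉ tsupport φ := fun h => hp (by
      have h5 := hR0 h
      rw [mem_ball, dist_zero_right, Prod.norm_def, max_lt_iff] at h5
      refine ⟨?_, ha' p h, ?_⟩
      · rw [mem_ball, dist_zero_right]; exact h5.1.trans_le (le_max_left _ _)
      · exact ((le_abs_self _).trans_lt h5.2).le)
    exact ⟨image_eq_zero_of_notMem_tsupport hp', zA p hp', zL p hp'⟩

lemma lap_neg' (φ : Euc N → ℝ) (x : Euc N) : lap (fun y => -φ y) x = -lap φ x := by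
  simp only [lap, fderiv_fun_neg, ContinuousLinearMap.neg_apply, Finset.sum_neg_distrib]

lemma sp_int {ψ f : Euc N → ℝ} (hm : 1 < m) (hM : 0 ≤ M) (hf : BM M f) (hψ : Integrable ψ) : Integrable (fun x => spow m (f x) * ψ x) :=
  hψ.bdd_mul (c := M ^ m) ((spow_meas m).comp hf.1).aestronglyMeasurable (ae_of_all _ fun x => spow_bd' hm.le (hf.2 x))

/-- second order expansion in time of `∫ ψ ρ u` -/
lemma time_step (w : Wt γ k K ρ) (hm : 1 < m) {U : Euc N → ℝ} {u : ℝ → Euc N → ℝ} (hu : Sol ρ m U u) {ψ : Euc N → ℝ} (hψ : Test ψ) :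
    ∃ E, 0 ≤ E ∧ ∀ s t σ, 0 ≤ s → s ≤ t → s ≤ σ → σ ≤ t →
      |(∫ x, ψ x * (ρ x * u t x)) - (∫ x, ψ x * (ρ x * u s x)) - (t - s) * ∫ x, spow m (u σ x) * lap ψ x| ≤ E * (t - s) ^ 2 := by
  obtain ⟨M, H⟩ := hu.two w hm hu
  obtain ⟨C, hC0, hC⟩ := test_wt w hψ.lap
  have hM := H.hM
  have hbd := H.lu.bd
  have hL := Lc_nn U
  have hm0 : 0 ≤ m := by linarith
  refine ⟨m * M ^ (m - 1) * C * Lc U, by positivity, fun s t σ hs hst h1 h2 => ?_⟩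
  have hI : ∀ τ, Integrable (fun x => spow m (u τ x) * lap ψ x) := fun τ => sp_int hm hM (hbd τ) hψ.lap.integrable
  have hd : ∀ τ, s ≤ τ → τ ≤ t → |(∫ x, spow m (u τ x) * lap ψ x) - ∫ x, spow m (u σ x) * lap ψ x| ≤ (m * M ^ (m - 1) * C * Lc U) * (t - s) := by
    intro τ h3 h4
    have hdd : dd ρ 0 (u τ) (u σ) ≤ (t - s) * Lc U := by
      rcases le_total σ τ with h | h
      · exact (lip_lim H (hs.trans h1) h).trans (mul_le_mul_of_nonneg_right (by linarith) (Lc_nn U))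
      · rw [dd_comm]
        exact (lip_lim H (hs.trans h3) h).trans (mul_le_mul_of_nonneg_right (by linarith) (Lc_nn U))
    rw [← integral_sub (hI τ) (hI σ), ← Real.norm_eq_abs]
    have hi := dd0_int w (hu.ok (hs.trans h3)) (hu.ok (hs.trans h1))
    refine (norm_integral_le_of_norm_le (hi.const_mul (m * M ^ (m - 1) * C)) (ae_of_all _ fun x => ?_)).trans ?_
    · rw [Real.norm_eq_abs, ← sub_mul, abs_mul]
      have e1 := spow_lip hm.le ((hbd τ).2 x) ((hbd σ).2 x)
      have e2 := mul_le_mul e1 (hC x) (abs_nonneg _) (by positivity)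
      linarith
    · rw [integral_const_mul, ← dd0_def]
      have := mul_le_mul_of_nonneg_left hdd (show 0 ≤ m * M ^ (m - 1) * C by positivity)
      linarith
  have e1 := weak_lim H hψ hs hst (B := (∫ x, spow m (u σ x) * lap ψ x) + (m * M ^ (m - 1) * C * Lc U) * (t - s)) fun τ h3 h4 => by
    linarith [(abs_le.1 (hd τ h3 h4)).2]
  have hn : Test (fun x => -ψ x) := ⟨hψ.1.neg, hψ.2.neg⟩
  have e2 := weak_lim H hn hs hst (B := -(∫ x, spow m (u σ x) * lap ψ x) + (m * M ^ (m - 1) * C * Lc U) * (t - s)) fun τ h3 h4 => by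
    simp only [lap_neg', mul_neg, integral_neg]
    linarith [(abs_le.1 (hd τ h3 h4)).1]
  simp only [neg_mul, integral_neg] at e2
  rw [abs_le]
  constructor <;> linarith

end

noncomputable section
variable {N : ℕ} {γ k K m δ h M : ℝ} {ρ : Euc N → ℝ}

lemma meas_S (R a b : ℝ) : MeasurableSet (ball (0 : Euc N) R ×ˢ Icc a b) := measurableSet_ball.prod measurableSet_Icc

lemma restr_S (R a b : ℝ) : (volume : Measure (Euc N × ℝ)).restrict (ball (0 : Euc N) R ×ˢ Icc a b) =
    (volume.restrict (ball (0 : Euc N) R)).prod (volume.restrict (Icc a b)) := by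
  rw [Measure.volume_eq_prod, Measure.prod_restrict]

lemma supp_int {D g : Euc N × ℝ → ℝ} {R a b C : ℝ} (hD : Measurable D) (h0 : ∀ p, p ∉ ball (0 : Euc N) R ×ˢ Icc a b → D p = 0)
    (hb : ∀ p, |D p| ≤ C * g p) (hg : IntegrableOn g (ball (0 : Euc N) R ×ˢ Icc a b)) :
    Integrable D ∧ |∫ p, D p| ≤ C * ∫ p in ball (0 : Euc N) R ×ˢ Icc a b, g p := by
  have h1 : IntegrableOn D (ball (0 : Euc N) R ×ˢ Icc a b) :=
    Integrable.mono' (Integrable.const_mul hg C) hD.aestronglyMeasurable (ae_of_all _ hb)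
  refine ⟨(integrableOn_iff_integrable_of_support_subset fun p hp => ?_).1 h1, ?_⟩
  · by_contra h
    exact hp (h0 p h)
  · rw [← setIntegral_eq_integral_of_forall_compl_eq_zero h0, ← integral_const_mul, ← Real.norm_eq_abs]
    exact norm_integral_le_of_norm_le (Integrable.const_mul hg C) (ae_of_all _ hb)

lemma prod_small {g : Euc N × ℝ → ℝ} {R a b c : ℝ} (hg : Measurable g) (h0 : ∀ p, 0 ≤ g p) (hab : a ≤ b) (hc : 0 ≤ c)
    (h : ∀ t ∈ Icc a b, ∫⁻ x in ball (0 : Euc N) R, ENNReal.ofReal (g (x, t)) ≤ ENNReal.ofReal c) :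
    IntegrableOn g (ball (0 : Euc N) R ×ˢ Icc a b) ∧ ∫ p in ball (0 : Euc N) R ×ˢ Icc a b, g p ≤ c * (b - a) := by
  have h1 : ∫⁻ p in ball (0 : Euc N) R ×ˢ Icc a b, ENNReal.ofReal (g p) ≤ ENNReal.ofReal (c * (b - a)) := by
    rw [restr_S, lintegral_prod_symm' _ hg.ennreal_ofReal]
    calc _ ≤ ∫⁻ t in Icc a b, ENNReal.ofReal c := setLIntegral_mono measurable_const h
      _ = _ := by rw [setLIntegral_const, Real.volume_Icc, ENNReal.ofReal_mul hc]
  have hi : IntegrableOn g (ball (0 : Euc N) R ×ˢ Icc a b) := by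
    refine ⟨hg.aestronglyMeasurable, ?_⟩
    rw [hasFiniteIntegral_iff_ofReal (ae_of_all _ h0)]
    exact h1.trans_lt ENNReal.ofReal_lt_top
  refine ⟨hi, ?_⟩
  rw [← ofReal_integral_eq_lintegral_ofReal hi (ae_of_all _ h0)] at h1
  exact (ENNReal.ofReal_le_ofReal_iff (mul_nonneg hc (by linarith))).1 h1

lemma rho_S (w : Wt γ k K ρ) {R a b : ℝ} (hR : 0 < R) : IntegrableOn (fun p : Euc N × ℝ => ρ p.1) (ball (0 : Euc N) R ×ˢ Icc a b) := by
  unfold IntegrableOn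
  rw [restr_S]
  have h1 : Integrable (fun _ : ℝ => (1:ℝ)) (volume.restrict (Icc a b)) := integrable_const _
  simpa using Integrable.mul_prod (w.ball hR).1 h1

lemma const_S {R a b : ℝ} (c : ℝ) : IntegrableOn (fun _ : Euc N × ℝ => c) (ball (0 : Euc N) R ×ˢ Icc a b) := by
  unfold IntegrableOn
  rw [restr_S]
  have h1 : IsFiniteMeasure (volume.restrict (ball (0 : Euc N) R)) := ⟨by simpa using measure_ball_lt_top⟩
  exact integrable_const _

lemma weak_base (w : Wt γ k K ρ) (hm : 1 < m) {U : Euc N → ℝ} {u : ℝ → Euc N → ℝ} (hu : Sol ρ m U u) {φ A L : Euc N × ℝ → ℝ} {R a b C : ℝ}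
    (F : TF φ A L R a b C) :
    Integrable (fun p : Euc N × ℝ => u p.2 p.1 * A p * ρ p.1) ∧ Integrable (fun p : Euc N × ℝ => spow m (u p.2 p.1) * L p) ∧
    (∫ p : Euc N × ℝ, u p.2 p.1 * A p * ρ p.1) + (∫ p : Euc N × ℝ, spow m (u p.2 p.1) * L p) = 0 := by
  obtain ⟨M, H⟩ := hu.two w hm hu
  have hM := H.hM
  have hbd := H.lu.bd
  have hC0 := F.C0
  have hR0 : 0 < R := by linarith [F.R1]
  have i1 : Integrable (fun p : Euc N × ℝ => u p.2 p.1 * A p * ρ p.1) := by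
    refine (supp_int (D := fun p => u p.2 p.1 * A p * ρ p.1) (C := M * C) ((hu.meas.mul F.mA).mul (w.meas.comp measurable_fst)) (fun p hp => ?_) (fun p => ?_) (rho_S w (a := a) (b := b) hR0)).1
    · beta_reduce; rw [(F.out p hp).2.1]; simp
    · beta_reduce; rw [abs_mul, abs_mul, abs_of_pos (w.pos _)]
      exact mul_le_mul_of_nonneg_right (mul_le_mul ((hbd _).2 _) (F.bA p) (abs_nonneg _) hM) (w.pos _).le
  have i2 : Integrable (fun p : Euc N × ℝ => spow m (u p.2 p.1) * L p) := by
    refine (supp_int (D := fun p => spow m (u p.2 p.1) * L p) (C := M ^ m * C) (R := R) (a := a) (b := b) (((spow_meas m).comp hu.meas).mul F.mL) (fun p hp => ?_) (fun p => ?_) (const_S 1)).1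
    · beta_reduce; rw [(F.out p hp).2.2]; simp
    · beta_reduce; rw [abs_mul, mul_one]
      exact mul_le_mul (spow_bd' hm.le ((hbd _).2 _)) (F.bL p) (abs_nonneg _) (by positivity)
  refine ⟨i1, i2, ?_⟩
  rw [← integral_add i1 i2]
  set G : ℝ → ℝ := fun t => ∫ x, (u t x * A (x, t) * ρ x + spow m (u t x) * L (x, t)) with hG
  have i3 := i1.add i2
  have e1 : ∫ p : Euc N × ℝ, (u p.2 p.1 * A p * ρ p.1 + spow m (u p.2 p.1) * L p) = ∫ t, G t := by
    rw [Measure.volume_eq_prod] at i3 ⊢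
    exact integral_prod_symm _ i3
  have iG : Integrable G := by
    rw [Measure.volume_eq_prod] at i3
    exact i3.integral_prod_right
  set P : ℝ → ℝ → ℝ := fun s t => ∫ x, φ (x, s) * (ρ x * u t x) with hP
  have sec : ∀ {f : Euc N × ℝ → ℝ} (t : ℝ), Measurable f → Measurable (fun x => f (x, t)) := fun t hf => hf.comp (measurable_id.prodMk measurable_const)
  have bi : ∀ {f g : Euc N → ℝ}, Measurable f → (∀ x, |f x| ≤ C) → Integrable g → Integrable (fun x => f x * g x) := fun hf h hg =>
    hg.bdd_mul (c := C) hf.aestronglyMeasurable (ae_of_all _ h)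
  have out : ∀ t, t ∉ Icc a b → ∀ x, φ (x, t) = 0 ∧ A (x, t) = 0 ∧ L (x, t) = 0 := fun t ht x => F.out _ fun h => ht h.2
  have hz : ∀ t, t ∉ Icc a b → P t t = 0 := fun t ht => by simp [hP, out t ht]
  have hder : ∀ t, HasDerivAt (fun t => P t t) (G t) t := by
    intro t
    by_cases hta : t < a
    · have hG0 : G t = 0 := by simp [hG, out t fun h => by linarith [h.1]]
      rw [hG0]
      refine (hasDerivAt_const t (0:ℝ)).congr_of_eventuallyEq ?_
      filter_upwards [Iio_mem_nhds hta] with s hs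
      exact hz s fun h => absurd h.1 (not_le.2 hs)
    push Not at hta
    have ht0 : 0 < t := F.a0.trans_le hta
    obtain ⟨E, hE0, hE⟩ := time_step w hm hu (F.test t)
    have ot := (hu.ok ht0.le)
    set Z := ∫ x, |ρ x * u t x| with hZ
    have hGt : G t = (∫ x, A (x, t) * (ρ x * u t x)) + ∫ x, spow m (u t x) * lap (fun y => φ (y, t)) x := by
      rw [← integral_add (bi (sec t F.mA) (fun x => F.bA _) ot.2) (sp_int hm hM (hbd t) (F.test t).lap.integrable)]
      refine integral_congr_ae (ae_of_all _ fun x => ?_)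
      show u t x * A (x, t) * ρ x + spow m (u t x) * L (x, t) = A (x, t) * (ρ x * u t x) + spow m (u t x) * lap (fun y => φ (y, t)) x
      rw [F.hL]; ring
    have hmain : ∀ s, 0 < s → |s - t| ≤ 1 → |P s s - P t t - (s - t) * G t| ≤ (C * Z + 2 * C * Lc U + E) * ‖s - t‖ ^ 2 := by
      intro s hs hst
      have os := (hu.ok hs.le)
      have hI : ∀ s' t', 0 ≤ t' → Integrable (fun x => φ (x, s') * (ρ x * u t' x)) := fun s' t' h => bi (sec s' F.mφ) (fun x => F.bφ _) (hu.ok h).2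
      have hJ : ∀ t', 0 ≤ t' → Integrable (fun x => φ (x, s) * (ρ x * u t' x) - φ (x, t) * (ρ x * u t' x)) := fun t' h => (hI s t' h).sub (hI t t' h)
      have T1 : |P s t - P t t - (s - t) * ∫ x, A (x, t) * (ρ x * u t x)| ≤ C * (s - t) ^ 2 * Z := by
        have e : P s t - P t t - (s - t) * (∫ x, A (x, t) * (ρ x * u t x)) = ∫ x, (φ (x, s) - φ (x, t) - (s - t) * A (x, t)) * (ρ x * u t x) := by
          have e1 : P s t - P t t = ∫ x, (φ (x, s) * (ρ x * u t x) - φ (x, t) * (ρ x * u t x)) := (integral_sub (hI s t ht0.le) (hI t t ht0.le)).symm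
          rw [e1, ← integral_const_mul, ← integral_sub (hJ t ht0.le) ((bi (sec t F.mA) (fun x => F.bA _) ot.2).const_mul _)]
          refine integral_congr_ae (ae_of_all _ fun x => ?_)
          beta_reduce; ring
        rw [e, ← Real.norm_eq_abs, hZ, ← integral_const_mul]
        refine norm_integral_le_of_norm_le (ot.2.abs.const_mul _) (ae_of_all _ fun x => ?_)
        rw [Real.norm_eq_abs, abs_mul]
        exact mul_le_mul_of_nonneg_right (F.tay x s t) (abs_nonneg _)
      have hdd : dd ρ 0 (u s) (u t) ≤ |s - t| * Lc U := by
        rcases le_total t s with h | h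
        · rw [abs_of_nonneg (by linarith)]; exact lip_lim H ht0.le h
        · rw [dd_comm, abs_sub_comm, abs_of_nonneg (by linarith)]; exact lip_lim H hs.le h
      have T2 : |(P s s - P t s) - (P s t - P t t)| ≤ 2 * C * |s - t| * dd ρ 0 (u s) (u t) := by
        have e : (P s s - P t s) - (P s t - P t t) = ∫ x, (φ (x, s) - φ (x, t)) * (ρ x * (u s x - u t x)) := by
          have e1 : P s s - P t s = ∫ x, (φ (x, s) * (ρ x * u s x) - φ (x, t) * (ρ x * u s x)) := (integral_sub (hI s s hs.le) (hI t s hs.le)).symm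
          have e2 : P s t - P t t = ∫ x, (φ (x, s) * (ρ x * u t x) - φ (x, t) * (ρ x * u t x)) := (integral_sub (hI s t ht0.le) (hI t t ht0.le)).symm
          rw [e1, e2, ← integral_sub (hJ s hs.le) (hJ t ht0.le)]
          refine integral_congr_ae (ae_of_all _ fun x => ?_)
          beta_reduce; ring
        rw [e, ← Real.norm_eq_abs, dd0_def, ← integral_const_mul]
        refine norm_integral_le_of_norm_le ((dd0_int w os ot).const_mul _) (ae_of_all _ fun x => ?_)
        rw [Real.norm_eq_abs, abs_mul, abs_mul (ρ x), abs_of_pos (w.pos x)]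
        refine mul_le_mul_of_nonneg_right ?_ (mul_nonneg (w.pos x).le (abs_nonneg _))
        have q1 := F.tay x s t
        have q2 : |(s - t) * A (x, t)| ≤ |s - t| * C := by rw [abs_mul]; exact mul_le_mul_of_nonneg_left (F.bA _) (abs_nonneg _)
        have q3 : C * (s - t) ^ 2 ≤ C * |s - t| := by
          refine mul_le_mul_of_nonneg_left ?_ hC0
          rw [← sq_abs, sq]; exact mul_le_of_le_one_left (abs_nonneg _) hst
        have q4 := abs_add_le (φ (x, s) - φ (x, t) - (s - t) * A (x, t)) ((s - t) * A (x, t))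
        rw [sub_add_cancel] at q4
        linarith
      have T3 : |P t s - P t t - (s - t) * ∫ x, spow m (u t x) * lap (fun y => φ (y, t)) x| ≤ E * (s - t) ^ 2 := by
        rcases le_total t s with h | h
        · exact hE t s t ht0.le h le_rfl h
        · have := hE s t t hs.le h h le_rfl
          rw [← abs_neg, show (s - t) ^ 2 = (t - s) ^ 2 by ring]
          refine le_trans (le_of_eq ?_) this
          congr 1; simp only [hP]; ring
      have T2' : 2 * C * |s - t| * dd ρ 0 (u s) (u t) ≤ 2 * C * Lc U * |s - t| ^ 2 := by
        have := mul_le_mul_of_nonneg_left hdd (show 0 ≤ 2 * C * |s - t| by positivity)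
        refine this.trans (le_of_eq ?_); ring
      rw [hGt, Real.norm_eq_abs]
      rw [← sq_abs] at T1 T3
      set I1 := ∫ x, A (x, t) * (ρ x * u t x)
      set I2 := ∫ x, spow m (u t x) * lap (fun y => φ (y, t)) x
      have e : P s s - P t t - (s - t) * (I1 + I2) = (P s t - P t t - (s - t) * I1) + ((P s s - P t s) - (P s t - P t t)) + (P t s - P t t - (s - t) * I2) := by ring
      rw [e]
      refine (abs_add_three _ _ _).trans ?_
      linarith
    rw [hasDerivAt_iff_isLittleO]
    refine Asymptotics.IsBigO.trans_isLittleO ?_ (Asymptotics.isLittleO_pow_sub_sub t (m := 2) (by norm_num))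
    refine Asymptotics.IsBigO.of_bound (C * Z + 2 * C * Lc U + E) ?_
    filter_upwards [Ioi_mem_nhds ht0, Metric.ball_mem_nhds t one_pos] with s hs hs1
    have := hmain s hs (by rw [mem_ball, Real.dist_eq] at hs1; exact hs1.le)
    rw [smul_eq_mul, Real.norm_eq_abs, Real.norm_eq_abs (‖s - t‖ ^ 2), abs_of_nonneg (show 0 ≤ ‖s - t‖ ^ 2 by positivity)]
    exact this
  rw [e1, integral_of_hasDerivAt_of_tendsto hder iG (m := 0) (n := 0), sub_zero]
  · refine tendsto_const_nhds.congr' ?_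
    filter_upwards [eventually_lt_atBot a] with t ht
    exact (hz t fun h => absurd h.1 (not_le.2 ht)).symm
  · refine tendsto_const_nhds.congr' ?_
    filter_upwards [eventually_gt_atTop b] with t ht
    exact (hz t fun h => absurd h.2 (not_le.2 ht)).symm

end

noncomputable section
variable {N : ℕ} {γ k K m δ h M : ℝ} {ρ : Euc N → ℝ}

variable {C : ℝ} {f : Euc N → ℝ} {U : ℕ → Euc N → ℝ} {un : ℕ → ℝ → Euc N → ℝ} {u : ℝ → Euc N → ℝ}

lemma sg_le (w : Wt γ k K ρ) (hm : 1 < m) {a b c t : ℝ} (ha : 0 < a) (hc : 0 < c) (hat : a ≤ t) (htb : t ≤ b) :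
    sg N m γ c t ≤ ((b * c) ^ th N m γ / a) ^ (1 / (m - 1)) := by
  have ht : 0 < t := ha.trans_le hat
  have hθ := th_pos w hm
  have hm1 : 0 < m - 1 := by linarith
  unfold sg
  refine Real.rpow_le_rpow (by positivity) (div_le_div₀ (by have := ht.trans_le htb; positivity) ?_ ha hat) (by positivity)
  exact Real.rpow_le_rpow (by positivity) (mul_le_mul_of_nonneg_right htb hc.le) hθ.le

lemma Lm.un_loc (H : Lm ρ m γ C f U un u) (n : ℕ) {t : ℝ} (ht : 0 ≤ t) (R : ℝ) : IntegrableOn (fun x => ρ x * un n t x) (ball (0 : Euc N) R) :=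
  ((H.sol n).ok ht).2.integrableOn

lemma lm_small (w : Wt γ k K ρ) (hm : 1 < m) (H : Lm ρ m γ C f U un u) {R a b ε : ℝ} (hR : 1 ≤ R) (ha : 0 < a) (hab : a ≤ b) (hε : 0 < ε) :
    ∃ n, (IntegrableOn (fun p : Euc N × ℝ => ρ p.1 * |u p.2 p.1 - un n p.2 p.1|) (ball (0 : Euc N) R ×ˢ Icc a b) ∧
      ∫ p in ball (0 : Euc N) R ×ˢ Icc a b, ρ p.1 * |u p.2 p.1 - un n p.2 p.1| ≤ ε) ∧
      IntegrableOn (fun p : Euc N × ℝ => |spow m (u p.2 p.1) - spow m (un n p.2 p.1)|) (ball (0 : Euc N) R ×ˢ Icc a b) ∧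
      ∫ p in ball (0 : Euc N) R ×ˢ Icc a b, |spow m (u p.2 p.1) - spow m (un n p.2 p.1)| ≤ ε := by
  have hb0 : 0 < b := ha.trans_le hab
  have hC := H.C0
  have hk := w.k0
  obtain ⟨c, r, n1, hc0, -, hr, hP⟩ := H.bd b 1 hb0 one_pos
  set R' := max R r with hR'
  have hR0 : 0 < R := by linarith
  set M := C * ((b * c) ^ th N m γ / a) ^ (1 / (m - 1)) * R' ^ alp m γ with hM
  have hR'0 : 0 < R' := hR0.trans_le (le_max_left _ _)
  have hM0 : 0 ≤ M := by positivity
  have hPB : ∀ (g : Euc N → ℝ) t, a ≤ t → t ≤ b → PB N m γ C c r g t → ∀ᵐ x : Euc N, ‖x‖ < R → |g x| ≤ M := by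
    intro g t h1 h2 h3
    filter_upwards [h3 R' (le_max_right _ _)] with x hx hxR
    refine (hx (hxR.trans_le (le_max_left _ _))).trans ?_
    exact mul_le_mul_of_nonneg_right (mul_le_mul_of_nonneg_left (sg_le w hm ha hc0 h1 h2) hC.le) (by positivity)
  set Q := m * M ^ (m - 1) * ((2 * R) ^ γ / k) with hQ
  have hQ0 : 0 ≤ Q := by positivity
  set c0 := ε / ((Q + 1) * (b - a + 1)) with hc
  have hab0 : 0 ≤ b - a := by linarith
  have hc00 : 0 < c0 := by positivity
  have hce : c0 * ((Q + 1) * (b - a + 1)) = ε := div_mul_cancel₀ _ (by positivity)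
  obtain ⟨n0, hn0⟩ := H.conv b (c0 / R ^ aa N m γ) hb0 (by positivity)
  set n := max n0 n1 with hn
  have mun := (H.sol n).meas
  have hJ : ∀ t ∈ Icc a b, ∫⁻ x in ball (0 : Euc N) R, ENNReal.ofReal (ρ x * |u t x - un n t x|) ≤ ENNReal.ofReal c0 := by
    intro t ht
    have ht0 : 0 ≤ t := ha.le.trans ht.1
    rw [← ofReal_integral_eq_lintegral_ofReal (abs_loc w (sub_loc (H.loc t ht0 R) (H.un_loc n ht0 R))) (ae_of_all _ fun x => mul_nonneg (w.pos x).le (abs_nonneg _))]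
    refine ENNReal.ofReal_le_ofReal ((hn0 n (le_max_left _ _) t ht0 ht.2 R hR).trans (le_of_eq ?_))
    exact div_mul_cancel₀ _ (by positivity)
  have A1 := prod_small (g := fun p : Euc N × ℝ => ρ p.1 * |u p.2 p.1 - un n p.2 p.1|) (R := R) (a := a) (b := b) (c := c0)
    ((w.meas.comp measurable_fst).mul (_root_.measurable_abs.comp (H.meas.sub mun))) (fun p => mul_nonneg (w.pos _).le (abs_nonneg _)) hab hc00.le hJ
  have A2 := prod_small (g := fun p : Euc N × ℝ => |spow m (u p.2 p.1) - spow m (un n p.2 p.1)|) (R := R) (a := a) (b := b) (c := Q * c0)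
    (_root_.measurable_abs.comp (((spow_meas m).comp H.meas).sub ((spow_meas m).comp mun))) (fun p => abs_nonneg _) hab (by positivity) (by
      intro t ht
      have ht0 : 0 < t := ha.trans_le ht.1
      have p1 := hPB _ t ht.1 ht.2 (hP t ht0 ht.2).1
      have p2 := hPB _ t ht.1 ht.2 ((hP t ht0 ht.2).2 n (le_max_right _ _))
      calc ∫⁻ x in ball (0 : Euc N) R, ENNReal.ofReal |spow m (u t x) - spow m (un n t x)|
          ≤ ∫⁻ x in ball (0 : Euc N) R, ENNReal.ofReal Q * ENNReal.ofReal (ρ x * |u t x - un n t x|) := by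
            refine lintegral_mono_ae ?_
            filter_upwards [ae_restrict_mem measurableSet_ball, ae_restrict_of_ae p1, ae_restrict_of_ae p2] with x hx h1 h2
            rw [mem_ball_zero_iff] at hx
            rw [← ENNReal.ofReal_mul hQ0]
            refine ENNReal.ofReal_le_ofReal ((spow_lip hm.le (h1 hx) (h2 hx)).trans ?_)
            have l := w.lo_ball hR hx
            calc m * M ^ (m - 1) * |u t x - un n t x| = m * M ^ (m - 1) * (1 * |u t x - un n t x|) := by rw [one_mul]
              _ ≤ m * M ^ (m - 1) * ((2 * R) ^ γ / k * ρ x * |u t x - un n t x|) :=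
                mul_le_mul_of_nonneg_left (mul_le_mul_of_nonneg_right l (abs_nonneg _)) (by positivity)
              _ = _ := by rw [hQ]; ring
        _ = ENNReal.ofReal Q * ∫⁻ x in ball (0 : Euc N) R, ENNReal.ofReal (ρ x * |u t x - un n t x|) := lintegral_const_mul' _ _ ENNReal.ofReal_ne_top
        _ ≤ ENNReal.ofReal Q * ENNReal.ofReal c0 := mul_le_mul' le_rfl (hJ t ht)
        _ = _ := (ENNReal.ofReal_mul hQ0).symm)
  have z1 : 0 ≤ c0 * Q * (b - a) := by positivity
  have z2 : 0 ≤ c0 * Q := by positivity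
  have z3 : 0 ≤ c0 * (b - a) := by positivity
  have z : ε = c0 * Q * (b - a) + c0 * Q + c0 * (b - a) + c0 := by rw [← hce]; ring
  refine ⟨n, ⟨A1.1, A1.2.trans (by linarith)⟩, A2.1, A2.2.trans ?_⟩
  linarith [show Q * c0 * (b - a) = c0 * Q * (b - a) by ring]

lemma lm_sp (w : Wt γ k K ρ) (hm : 1 < m) (H : Lm ρ m γ C f U un u) (R : ℝ) {a b : ℝ} (ha : 0 < a) (hab : a ≤ b) :
    IntegrableOn (fun p : Euc N × ℝ => spow m (u p.2 p.1)) (ball (0 : Euc N) R ×ˢ Icc a b) := by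
  obtain ⟨n, -, h2, -⟩ := lm_small w hm H (le_max_right R 1) ha hab one_pos
  obtain ⟨M, T⟩ := (H.sol n).two w hm (H.sol n)
  refine IntegrableOn.mono_set ?_ (prod_mono (ball_subset_ball (le_max_left R 1)) subset_rfl)
  refine Integrable.mono' (h2.add (const_S (M ^ m))) ((spow_meas m).comp H.meas).aestronglyMeasurable (ae_of_all _ fun p => ?_)
  have q1 := spow_bd' hm.le ((T.lu.bd p.2).2 p.1)
  have q2 := abs_add_le (spow m (u p.2 p.1) - spow m (un n p.2 p.1)) (spow m (un n p.2 p.1))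
  rw [sub_add_cancel] at q2
  show |spow m (u p.2 p.1)| ≤ |spow m (u p.2 p.1) - spow m (un n p.2 p.1)| + M ^ m
  linarith

lemma lm_weak (w : Wt γ k K ρ) (hm : 1 < m) (H : Lm ρ m γ C f U un u) {φ A L : Euc N × ℝ → ℝ} {R a b B : ℝ} (F : TF φ A L R a b B) :
    (∫ p : Euc N × ℝ, u p.2 p.1 * A p * ρ p.1) + (∫ p : Euc N × ℝ, spow m (u p.2 p.1) * L p) = 0 := by
  have hB := F.C0
  have out : ∀ p : Euc N × ℝ, p ∉ ball (0 : Euc N) R ×ˢ Icc a (max a b) → φ p = 0 ∧ A p = 0 ∧ L p = 0 :=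
    fun p hp => F.out p fun h => hp ⟨h.1, h.2.1, h.2.2.trans (le_max_right _ _)⟩
  refine abs_nonpos_iff.1 (le_of_forall_pos_le_add fun δ hδ => ?_)
  obtain ⟨n, ⟨g1, e1⟩, g2, e2⟩ := lm_small w hm H F.R1 F.a0 (le_max_left a b) (show 0 < δ / (2 * B + 1) by positivity)
  have mun := (H.sol n).meas
  obtain ⟨i1, i2, i0⟩ := weak_base w hm (H.sol n) F
  obtain ⟨j1, l1⟩ := supp_int (D := fun p => (u p.2 p.1 - un n p.2 p.1) * A p * ρ p.1) (C := B)
    (((H.meas.sub mun).mul F.mA).mul (w.meas.comp measurable_fst)) (fun p hp => by beta_reduce; rw [(out p hp).2.1]; simp)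
    (fun p => by
      beta_reduce
      rw [abs_mul, abs_mul, abs_of_pos (w.pos _)]
      calc _ ≤ |u p.2 p.1 - un n p.2 p.1| * B * ρ p.1 := mul_le_mul_of_nonneg_right (mul_le_mul_of_nonneg_left (F.bA p) (abs_nonneg _)) (w.pos _).le
        _ = _ := by ring) g1
  obtain ⟨j2, l2⟩ := supp_int (D := fun p => (spow m (u p.2 p.1) - spow m (un n p.2 p.1)) * L p) (C := B)
    ((((spow_meas m).comp H.meas).sub ((spow_meas m).comp mun)).mul F.mL) (fun p hp => by beta_reduce; rw [(out p hp).2.2]; simp)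
    (fun p => by
      beta_reduce
      rw [abs_mul, mul_comm]
      exact mul_le_mul_of_nonneg_right (F.bL p) (abs_nonneg _)) g2
  have E1 : ∫ p : Euc N × ℝ, u p.2 p.1 * A p * ρ p.1 = (∫ p : Euc N × ℝ, (u p.2 p.1 - un n p.2 p.1) * A p * ρ p.1) + ∫ p : Euc N × ℝ, un n p.2 p.1 * A p * ρ p.1 := by
    rw [← integral_add j1 i1]
    refine integral_congr_ae (ae_of_all _ fun p => ?_)
    beta_reduce; ring
  have E2 : ∫ p : Euc N × ℝ, spow m (u p.2 p.1) * L p = (∫ p : Euc N × ℝ, (spow m (u p.2 p.1) - spow m (un n p.2 p.1)) * L p) + ∫ p : Euc N × ℝ, spow m (un n p.2 p.1) * L p := by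
    rw [← integral_add j2 i2]
    refine integral_congr_ae (ae_of_all _ fun p => ?_)
    beta_reduce; ring
  have q1 := l1.trans (mul_le_mul_of_nonneg_left e1 hB)
  have q2 := l2.trans (mul_le_mul_of_nonneg_left e2 hB)
  have q3 : (2 * B + 1) * (δ / (2 * B + 1)) = δ := mul_div_cancel₀ _ (by positivity)
  have q4 : 0 < δ / (2 * B + 1) := by positivity
  rw [E1, E2, zero_add]
  set I1 := ∫ p : Euc N × ℝ, (u p.2 p.1 - un n p.2 p.1) * A p * ρ p.1
  set I2 := ∫ p : Euc N × ℝ, (spow m (u p.2 p.1) - spow m (un n p.2 p.1)) * L p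
  have q5 := abs_add_le I1 I2
  rw [show ∀ x y : ℝ, I1 + x + (I2 + y) = I1 + I2 + (x + y) from fun x y => by ring, i0, add_zero]
  linarith

end

noncomputable section
variable {N : ℕ} {γ k K m δ h M : ℝ} {ρ : Euc N → ℝ}

variable {C : ℝ} {f : Euc N → ℝ} {U : ℕ → Euc N → ℝ} {un : ℕ → ℝ → Euc N → ℝ} {u : ℝ → Euc N → ℝ}

lemma lm_cont (w : Wt γ k K ρ) (hm : 1 < m) (H : Lm ρ m γ C f U un u) {s ε : ℝ} (hs : 0 ≤ s) (hε : 0 < ε) :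
    ∃ δ, 0 < δ ∧ ∀ t, 0 ≤ t → |t - s| < δ → ∀ R, J ρ (fun x => |u t x - u s x|) R ≤ ε * max R 1 ^ aa N m γ := by
  have ha := aa_pos w hm
  obtain ⟨n, hn⟩ := H.conv (s + 1) (ε / 3) (by linarith) (by linarith)
  obtain ⟨M, T⟩ := (H.sol n).two w hm (H.sol n)
  have hL : 0 ≤ Lc (U n) := Lc_nn _
  refine ⟨min 1 (ε / 3 / (Lc (U n) + 1)), by positivity, fun t ht hts R => ?_⟩
  have d1 : |t - s| ≤ 1 := hts.le.trans (min_le_left _ _)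
  have d2 : |t - s| ≤ ε / 3 / (Lc (U n) + 1) := hts.le.trans (min_le_right _ _)
  have ht1 : t ≤ s + 1 := by linarith [le_abs_self (t - s)]
  have hdd : dd ρ 0 (un n t) (un n s) ≤ |t - s| * Lc (U n) := by
    rcases le_total s t with h | h
    · rw [abs_of_nonneg (by linarith)]; exact lip_lim T hs h
    · rw [dd_comm, abs_sub_comm, abs_of_nonneg (by linarith)]; exact lip_lim T ht h
  have hX : 1 ≤ max R 1 ^ aa N m γ := Real.one_le_rpow (le_max_right _ _) ha.le
  have e1 : dd ρ 0 (un n t) (un n s) ≤ ε / 3 := by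
    have q : ε / 3 / (Lc (U n) + 1) * (Lc (U n) + 1) = ε / 3 := div_mul_cancel₀ _ (by positivity)
    have q1 := mul_le_mul d2 (show Lc (U n) ≤ Lc (U n) + 1 by linarith) hL (by positivity)
    linarith
  have e2 := J_dd' w ((H.sol n).ok ht) ((H.sol n).ok hs) (max R 1)
  have e3 := hn n le_rfl t ht ht1 (max R 1) (le_max_right _ _)
  have e4 := hn n le_rfl s hs (by linarith) (max R 1) (le_max_right _ _)
  have f1 := H.loc t ht (max R 1)
  have f2 := H.loc s hs (max R 1)
  have f3 := H.un_loc n ht (max R 1)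
  have f4 := H.un_loc n hs (max R 1)
  have t1 := J_tri w f1 f3 f2
  have t2 := J_tri w f3 f4 f2
  have t3 : J ρ (fun x => |un n s x - u s x|) (max R 1) = J ρ (fun x => |u s x - un n s x|) (max R 1) := by simp only [abs_sub_comm]
  have t4 := J_R w (abs_loc w (sub_loc f1 f2)) (fun x => abs_nonneg _) (le_max_left R 1)
  have q := mul_le_mul_of_nonneg_left hX (show 0 ≤ ε / 3 by linarith)
  linarith

lemma lm_decay (w : Wt γ k K ρ) (hm : 1 < m) (H : Lm ρ m γ C f U un u) {t ε : ℝ} (ht : 0 < t) (hε : 0 < ε) :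
    ∃ R, 0 < R ∧ ∀ᵐ x : Euc N, R < ‖x‖ → ‖x‖ ^ (-alp m γ) * |u t x| ≤ ε := by
  have hC := H.C0
  have hα := alp_nn w hm
  have hθ := th_pos w hm
  have hm1 : 0 < m - 1 := by linarith
  set e := ε / (C * 2 ^ alp m γ) with he
  have he0 : 0 < e := by positivity
  have hee : C * e * 2 ^ alp m γ = ε := by rw [he]; field_simp
  set η := (t * e ^ (m - 1)) ^ (1 / th N m γ) / t with hη
  obtain ⟨b, r, _n, hb0, hb, hr, hP⟩ := H.bd t η ht (by positivity)
  have hsg : sg N m γ b t ≤ e := by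
    have h1 : t * b ≤ (t * e ^ (m - 1)) ^ (1 / th N m γ) := by
      have := mul_le_mul_of_nonneg_left hb ht.le
      rwa [hη, mul_div_cancel₀ _ ht.ne'] at this
    have h2 := Real.rpow_le_rpow (by positivity) h1 hθ.le
    rw [← Real.rpow_mul (by positivity), one_div_mul_cancel hθ.ne', Real.rpow_one] at h2
    have h3 : (t * b) ^ th N m γ / t ≤ e ^ (m - 1) := by rw [div_le_iff₀ ht]; linarith
    have h4 := Real.rpow_le_rpow (by positivity) h3 (show 0 ≤ 1 / (m - 1) by positivity)
    rwa [← Real.rpow_mul he0.le, mul_one_div_cancel hm1.ne', Real.rpow_one] at h4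
  refine ⟨r + 1, by linarith, ?_⟩
  have hall : ∀ j : ℕ, r ≤ j → ∀ᵐ x : Euc N, ‖x‖ < j → |u t x| ≤ C * sg N m γ b t * (j:ℝ) ^ alp m γ := fun j hj => (hP t ht le_rfl).1 j hj
  have hall' : ∀ᵐ x : Euc N, ∀ j : ℕ, r ≤ j → ‖x‖ < j → |u t x| ≤ C * sg N m γ b t * (j:ℝ) ^ alp m γ := by
    rw [ae_all_iff]; intro j
    by_cases hj : r ≤ j
    · filter_upwards [hall j hj] with x hx _ using hx
    · exact ae_of_all _ fun x h => absurd h hj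
  filter_upwards [hall'] with x hx hxR
  have hx0 : 0 < ‖x‖ := by linarith
  have l1 := Nat.lt_floor_add_one ‖x‖
  have l2 := Nat.floor_le hx0.le
  have q := hx (⌊‖x‖⌋₊ + 1) (by push_cast; linarith) (by push_cast; exact l1)
  have q2 : ((⌊‖x‖⌋₊ + 1 : ℕ) : ℝ) ^ alp m γ ≤ (2 * ‖x‖) ^ alp m γ := Real.rpow_le_rpow (by positivity) (by push_cast; linarith) hα.le
  rw [Real.mul_rpow (by norm_num) hx0.le] at q2
  have q3 : |u t x| ≤ ε * ‖x‖ ^ alp m γ := by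
    refine q.trans ?_
    calc _ ≤ C * e * (2 ^ alp m γ * ‖x‖ ^ alp m γ) := mul_le_mul (mul_le_mul_of_nonneg_left hsg hC.le) q2 (by positivity) (by positivity)
      _ = _ := by rw [← hee]; ring
  rw [Real.rpow_neg hx0.le, inv_mul_le_iff₀ (by positivity)]
  linarith

lemma wt_exists {ρ : Euc N → ℝ} (hN : 3 ≤ N) (hγ0 : 0 ≤ γ) (hγ2 : γ < 2) (hk : 0 < k) (hkK : k ≤ K) (hρ : WeightCond N γ k K ρ) :
    ∃ ρ' : Euc N → ℝ, Wt γ k K ρ' ∧ ∀ᵐ x, ρ x = ρ' x := by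
  classical
  obtain ⟨hm, hae⟩ := hρ
  have m1 : Measurable (fun x : Euc N => k * (1 + ‖x‖) ^ (-γ)) := by fun_prop
  have m2 : Measurable (fun x : Euc N => K * ‖x‖ ^ (-γ)) := by fun_prop
  have mG : MeasurableSet {x : Euc N | k * (1 + ‖x‖) ^ (-γ) ≤ ρ x ∧ ρ x ≤ K * ‖x‖ ^ (-γ)} :=
    (measurableSet_le m1 hm).inter (measurableSet_le hm m2)
  refine ⟨fun x => if k * (1 + ‖x‖) ^ (-γ) ≤ ρ x ∧ ρ x ≤ K * ‖x‖ ^ (-γ) then ρ x else k * (1 + ‖x‖) ^ (-γ),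
    ⟨hN, Measurable.ite mG hm m1, hγ0, hγ2, hk, hk.trans_le hkK, fun x => ?_, fun x hx => ?_⟩, ?_⟩
  · split_ifs with h
    · exact h.1
    · exact le_rfl
  · split_ifs with h
    · exact h.2
    · have hx0 := norm_pos_iff.2 hx
      exact mul_le_mul hkK (Real.rpow_le_rpow_of_nonpos hx0 (by linarith) (by linarith)) (by positivity) (by linarith)
  · filter_upwards [hae] with x hx
    rw [if_pos hx]

lemma aem_of_rho (w : Wt γ k K ρ) {g : Euc N → ℝ} {R : ℝ} (h : IntegrableOn (fun x => ρ x * g x) (ball (0 : Euc N) R)) :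
    AEMeasurable g (volume.restrict (ball (0 : Euc N) R)) := by
  refine (w.meas.inv.aemeasurable.mul h.1.aemeasurable).congr (ae_of_all _ fun x => ?_)
  show (ρ x)⁻¹ * (ρ x * g x) = g x
  rw [inv_mul_cancel_left₀ (w.pos x).ne']

lemma wrap (w : Wt γ k K ρ) (hm : 1 < m) {u₀ : Euc N → ℝ} (hloc : ∀ R : ℝ, IntegrableOn (fun x => ρ x * |u₀ x|) (ball (0 : Euc N) R)) :
    ∃ v₀ : Euc N → ℝ, AEMeasurable v₀ ∧ (∀ x, |v₀ x| = |u₀ x|) ∧ ∀ g : ℝ → Euc N → ℝ, (∀ t, Measurable (g t)) →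
      (∀ t, 0 < t → ∀ R, IntegrableOn (fun x => ρ x * g t x) (ball (0 : Euc N) R)) →
      (∀ ε : ℝ, 0 < ε → ∃ δ, 0 < δ ∧ ∀ t, 0 < t → t < δ → ∀ R, J ρ (fun x => |g t x - v₀ x|) R ≤ ε * max R 1 ^ aa N m γ) →
      ∀ ε : ℝ, 0 < ε → ∃ δ, 0 < δ ∧ ∀ t, 0 < t → t < δ → ∀ R, J ρ (fun x => |g t x - u₀ x|) R ≤ ε * max R 1 ^ aa N m γ := by
  classical
  have ha := aa_pos w hm
  by_cases hP : ∀ R, AEMeasurable u₀ (volume.restrict (ball (0 : Euc N) R))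
  · refine ⟨u₀, ?_, fun x => rfl, fun g _ _ h => h⟩
    have := aemeasurable_iUnion_iff.2 fun n : ℕ => hP n
    rwa [iUnion_ball_nat, Measure.restrict_univ] at this
  push Not at hP
  obtain ⟨R0, hR0⟩ := hP
  have habs : AEMeasurable (fun x => |u₀ x|) := by
    have := aemeasurable_iUnion_iff.2 fun n : ℕ => aem_of_rho w (hloc n)
    rwa [iUnion_ball_nat, Measure.restrict_univ] at this
  have mono : ∀ R R' : ℝ, R ≤ R' → AEMeasurable u₀ (volume.restrict (ball (0 : Euc N) R')) → AEMeasurable u₀ (volume.restrict (ball (0 : Euc N) R)) :=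
    fun R R' h h' => h'.mono_measure (Measure.restrict_mono (ball_subset_ball h) le_rfl)
  set S : Set ℝ := {R | AEMeasurable u₀ (volume.restrict (ball (0 : Euc N) R))} with hS
  have hbdd : BddAbove S := ⟨R0, fun R hR => by
    by_contra h
    push Not at h
    exact hR0 (mono _ _ h.le hR)⟩
  have h0S : (0:ℝ) ∈ S := by show AEMeasurable _ _; rw [ball_zero, Measure.restrict_empty]; exact aemeasurable_zero_measure
  obtain ⟨s, hs⟩ : ∃ s, s = sSup S := ⟨_, rfl⟩
  have hs0 : 0 ≤ s := hs ▸ le_csSup hbdd h0S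
  have hPs : AEMeasurable u₀ (volume.restrict (ball (0 : Euc N) s)) := by
    have h1 : ∀ n : ℕ, AEMeasurable u₀ (volume.restrict (ball (0 : Euc N) (s - 1 / ((n:ℝ) + 1)))) := fun n => by
      obtain ⟨R, hR, hlt⟩ := exists_lt_of_lt_csSup ⟨0, h0S⟩ (show s - 1 / ((n:ℝ) + 1) < sSup S by rw [← hs]; linarith [show 0 < 1 / ((n:ℝ) + 1) by positivity])
      exact mono _ _ hlt.le hR
    refine (aemeasurable_iUnion_iff.2 h1).mono_measure (Measure.restrict_mono (fun x hx => ?_) le_rfl)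
    rw [mem_ball_zero_iff] at hx
    obtain ⟨n, hn⟩ := exists_nat_one_div_lt (sub_pos.2 hx)
    exact mem_iUnion.2 ⟨n, by rw [mem_ball_zero_iff]; linarith⟩
  have hgt : ∀ R, s < R → ¬ AEMeasurable u₀ (volume.restrict (ball (0 : Euc N) R)) := fun R hR h => by
    have : R ≤ sSup S := le_csSup hbdd h
    rw [← hs] at this; linarith
  obtain ⟨v₀, hv⟩ : ∃ v₀ : Euc N → ℝ, v₀ = (ball (0 : Euc N) s).piecewise u₀ (fun x => |u₀ x|) := ⟨_, rfl⟩
  have vin : ∀ x ∈ ball (0 : Euc N) s, v₀ x = u₀ x := fun x hx => by rw [hv, piecewise_eq_of_mem _ _ _ hx]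
  have vout : ∀ x, x ∉ ball (0 : Euc N) s → v₀ x = |u₀ x| := fun x hx => by rw [hv, piecewise_eq_of_notMem _ _ _ hx]
  have mv : AEMeasurable v₀ := by rw [hv]; exact (AEStronglyMeasurable.piecewise measurableSet_ball hPs.aestronglyMeasurable habs.restrict.aestronglyMeasurable).aemeasurable
  have va : ∀ x, |v₀ x| = |u₀ x| := fun x => by
    by_cases hx : x ∈ ball (0 : Euc N) s
    · rw [vin x hx]
    · rw [vout x hx, abs_abs]
  refine ⟨v₀, mv, va, fun g mg lg hg ε hε => ?_⟩
  have lv : ∀ R : ℝ, IntegrableOn (fun x => ρ x * v₀ x) (ball (0 : Euc N) R) := fun R =>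
    (hloc R).mono' (w.meas.aemeasurable.mul mv).aestronglyMeasurable.restrict (ae_of_all _ fun x => by
      rw [Real.norm_eq_abs, abs_mul, abs_of_pos (w.pos x), va])
  -- small shell
  obtain ⟨R1, hR1, hsh⟩ : ∃ R1, s < R1 ∧ ∫ x in ball (0 : Euc N) R1 \ ball 0 s, 2 * (ρ x * |u₀ x|) ≤ ε / 2 := by
    have hI : ∀ R : ℝ, IntegrableOn (fun x => 2 * (ρ x * |u₀ x|)) (ball (0 : Euc N) R) := fun R => Integrable.const_mul (hloc R) 2
    have ht := tendsto_setIntegral_of_antitone (μ := volume) (f := fun x : Euc N => 2 * (ρ x * |u₀ x|)) (s := fun n : ℕ => ball (0 : Euc N) (s + 1 / ((n:ℝ) + 1)) \ ball 0 s)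
      (fun n => measurableSet_ball.diff measurableSet_ball)
      (fun i j hij => sdiff_subset_sdiff_left (ball_subset_ball (by
        have : (1:ℝ) / ((j:ℝ) + 1) ≤ 1 / ((i:ℝ) + 1) := one_div_le_one_div_of_le (by positivity) (by have : (i:ℝ) ≤ j := by exact_mod_cast hij
                                                                                                     linarith)
        linarith))) ⟨0, (hI _).mono_set sdiff_subset⟩
    have hz : volume (⋂ n : ℕ, ball (0 : Euc N) (s + 1 / ((n:ℝ) + 1)) \ ball 0 s) = 0 := by
      refine measure_mono_null (fun x hx => ?_) (ae_iff.1 (ae_ball_closed w.hN s))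
      rw [mem_iInter] at hx
      show ¬ ‖x‖ ≠ s
      have h1 := (hx 0).2
      rw [mem_ball_zero_iff, not_lt] at h1
      have h2 : ‖x‖ ≤ s := by
        by_contra h
        push Not at h
        obtain ⟨n, hn⟩ := exists_nat_one_div_lt (sub_pos.2 h)
        have := (hx n).1
        rw [mem_ball_zero_iff] at this
        linarith
      exact not_not.2 (le_antisymm h2 h1)
    rw [setIntegral_measure_zero _ hz] at ht
    obtain ⟨n, hn⟩ := (ht.eventually (Iio_mem_nhds (show (0:ℝ) < ε / 2 by linarith))).exists
    exact ⟨_, by linarith [show 0 < 1 / ((n:ℝ) + 1) by positivity], le_of_lt hn⟩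
  -- non-measurability for small times
  obtain ⟨δ2, hδ2, hnm⟩ : ∃ δ, 0 < δ ∧ ∀ t, 0 < t → t < δ → ¬ AEMeasurable (fun x => |g t x - u₀ x|) (volume.restrict (ball (0 : Euc N) R1)) := by
    by_contra hcon
    push Not at hcon
    have hsel : ∀ n : ℕ, ∃ t, 0 < t ∧ J ρ (fun x => |g t x - v₀ x|) R1 ≤ 1 / ((n:ℝ) + 1) * max R1 1 ^ aa N m γ ∧
        AEMeasurable (fun x => |g t x - u₀ x|) (volume.restrict (ball (0 : Euc N) R1)) := fun n => by
      obtain ⟨d, hd, hd'⟩ := hg (1 / ((n:ℝ) + 1)) (by positivity)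
      obtain ⟨t, h1, h2, h3⟩ := hcon d hd
      exact ⟨t, h1, hd' t h1 h2 R1, h3⟩
    choose t t0 tJ tm using hsel
    have lgn : ∀ n, IntegrableOn (fun x => ρ x * |g (t n) x - v₀ x|) (ball (0 : Euc N) R1) := fun n => abs_loc w (sub_loc (lg _ (t0 n) R1) (lv R1))
    have hJ0 : Tendsto (fun n => J ρ (fun x => |g (t n) x - v₀ x|) R1) atTop (nhds 0) := by
      refine squeeze_zero (fun n => J_nn w (fun x => abs_nonneg _) _) tJ ?_
      simpa using (tendsto_one_div_add_atTop_nhds_zero_nat (𝕜 := ℝ)).mul_const (max R1 1 ^ aa N m γ)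
    have hTM : TendstoInMeasure (volume.restrict (ball (0 : Euc N) R1)) (fun n x => ρ x * |g (t n) x - v₀ x|) atTop (fun _ => (0:ℝ)) := by
      refine tendstoInMeasure_of_tendsto_eLpNorm (p := 1) one_ne_zero (fun n => (lgn n).1) aestronglyMeasurable_const ?_
      have e : ∀ n, eLpNorm ((fun x => ρ x * |g (t n) x - v₀ x|) - fun _ => (0:ℝ)) 1 (volume.restrict (ball (0 : Euc N) R1)) = ENNReal.ofReal (J ρ (fun x => |g (t n) x - v₀ x|) R1) := fun n => by
        rw [eLpNorm_one_eq_lintegral_enorm]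
        unfold J
        rw [ofReal_integral_eq_lintegral_ofReal (lgn n) (ae_of_all _ fun x => mul_nonneg (w.pos x).le (abs_nonneg _))]
        refine lintegral_congr fun x => ?_
        rw [Pi.sub_apply, sub_zero, Real.enorm_of_nonneg (mul_nonneg (w.pos x).le (abs_nonneg _))]
      simp_rw [e]
      simpa using ENNReal.tendsto_ofReal hJ0
    obtain ⟨ns, -, hns⟩ := hTM.exists_seq_tendsto_ae
    have hlim : AEMeasurable (fun x => |v₀ x - u₀ x|) (volume.restrict (ball (0 : Euc N) R1)) := by
      refine aemeasurable_of_tendsto_metrizable_ae' (fun n => tm (ns n)) ?_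
      filter_upwards [hns] with x hx
      have h1 := hx.const_mul (ρ x)⁻¹
      simp only [inv_mul_cancel_left₀ (w.pos x).ne', mul_zero] at h1
      have h2 : Tendsto (fun n => g (t (ns n)) x - v₀ x) atTop (nhds 0) := (tendsto_zero_iff_abs_tendsto_zero _).2 h1
      have h3 := (h2.add_const (v₀ x - u₀ x)).abs
      simpa using h3
    refine hgt R1 hR1 ?_
    have hw : AEMeasurable (fun x => v₀ x - |v₀ x - u₀ x|) (volume.restrict (ball (0 : Euc N) R1)) := mv.restrict.sub hlim
    refine hw.congr (ae_of_all _ fun x => ?_)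
    beta_reduce
    by_cases hx : x ∈ ball (0 : Euc N) s
    · rw [vin x hx]; simp
    · rw [vout x hx, abs_of_nonneg (sub_nonneg.2 (le_abs_self (u₀ x)))]; ring
  obtain ⟨δ1, hδ1, hd1⟩ := hg (ε / 2) (by linarith)
  refine ⟨min δ1 δ2, lt_min hδ1 hδ2, fun t ht htd R => ?_⟩
  have hX : 1 ≤ max R 1 ^ aa N m γ := Real.one_le_rpow (le_max_right _ _) ha.le
  rcases le_or_gt R1 R with hR | hR
  · have : ¬ IntegrableOn (fun x => ρ x * |g t x - u₀ x|) (ball (0 : Euc N) R) := fun hi =>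
      hnm t ht (htd.trans_le (min_le_right _ _)) ((aem_of_rho w hi).mono_measure (Measure.restrict_mono (ball_subset_ball hR) le_rfl))
    unfold J
    rw [integral_undef this]
    positivity
  · have q1 := hd1 t ht (htd.trans_le (min_le_left _ _)) R
    have i1 := abs_loc w (sub_loc (lg t ht R) (lv R))
    have i2 : IntegrableOn ((ball (0 : Euc N) s)ᶜ.indicator fun x => 2 * (ρ x * |u₀ x|)) (ball (0 : Euc N) R) :=
      Integrable.indicator (Integrable.const_mul (hloc R) 2) measurableSet_ball.compl
    have e2 : ∫ x in ball (0 : Euc N) R, (ball (0 : Euc N) s)ᶜ.indicator (fun x => 2 * (ρ x * |u₀ x|)) x = ∫ x in ball (0 : Euc N) R \ ball 0 s, 2 * (ρ x * |u₀ x|) := by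
      rw [setIntegral_indicator measurableSet_ball.compl, Set.sdiff_eq]
    have e3 : ∫ x in ball (0 : Euc N) R \ ball 0 s, 2 * (ρ x * |u₀ x|) ≤ ∫ x in ball (0 : Euc N) R1 \ ball 0 s, 2 * (ρ x * |u₀ x|) :=
      setIntegral_mono_set (IntegrableOn.mono_set (Integrable.const_mul (hloc R1) 2) sdiff_subset)
        (ae_of_all _ fun x => mul_nonneg zero_le_two (mul_nonneg (w.pos x).le (abs_nonneg _))) (sdiff_subset_sdiff_left (ball_subset_ball hR.le)).eventuallyLE
    have e1 : J ρ (fun x => |g t x - u₀ x|) R ≤ J ρ (fun x => |g t x - v₀ x|) R + ∫ x in ball (0 : Euc N) R, (ball (0 : Euc N) s)ᶜ.indicator (fun x => 2 * (ρ x * |u₀ x|)) x := by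
      unfold J
      rw [← integral_add i1 i2]
      refine integral_mono_of_nonneg (ae_of_all _ fun x => mul_nonneg (w.pos x).le (abs_nonneg _)) (i1.add i2) (ae_of_all _ fun x => ?_)
      show ρ x * |g t x - u₀ x| ≤ ρ x * |g t x - v₀ x| + (ball (0 : Euc N) s)ᶜ.indicator (fun x => 2 * (ρ x * |u₀ x|)) x
      by_cases hx : x ∈ ball (0 : Euc N) s
      · rw [vin x hx, indicator_of_notMem (notMem_compl_iff.2 hx), add_zero]
      · rw [indicator_of_mem (mem_compl hx)]
        have h1 := abs_sub_le (g t x) (v₀ x) (u₀ x)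
        have h2 : |v₀ x - u₀ x| ≤ 2 * |u₀ x| := by rw [vout x hx]; have := abs_sub (|u₀ x|) (u₀ x); rw [abs_abs] at this; linarith
        have h3 := mul_le_mul_of_nonneg_left (h1.trans (add_le_add_right h2 _)) (w.pos x).le
        linarith
    have := mul_le_mul_of_nonneg_left hX (show 0 ≤ ε / 2 by linarith)
    linarith

end

noncomputable section
variable {N : ℕ} {γ k K m δ h M : ℝ} {ρ : Euc N → ℝ}

lemma J_congr {g g' : Euc N → ℝ} (h : ∀ᵐ x, g x = g' x) (R : ℝ) : J ρ g R = J ρ g' R := by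
  unfold J
  refine integral_congr_ae (ae_restrict_of_ae ?_)
  filter_upwards [h] with x hx
  rw [hx]

lemma ae_fst {P : Euc N → Prop} (h : ∀ᵐ x, P x) : ∀ᵐ p : Euc N × ℝ, P p.1 := by
  rw [Measure.volume_eq_prod]
  exact Measure.quasiMeasurePreserving_fst.ae h

lemma ts_eq : TimeSet ⊤ = Ioi (0:ℝ) := by
  ext t; exact ⟨fun h => h.1, fun h => ⟨h, ENNReal.ofReal_lt_top⟩⟩

theorem final (hN : 3 ≤ N) (hm : 1 < m) (hγ0 : 0 ≤ γ) (hγ2 : γ < 2) (hk : 0 < k) (hkK : k ≤ K)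
    (hρ : WeightCond N γ k K ρ) {u₀ : Euc N → ℝ} (hu0 : memX ρ m γ u₀) (hl : ell ρ m γ u₀ = 0) :
    ∃ u : Euc N → ℝ → ℝ,
      IsVeryWeakSol ρ m ⊤ u u₀ ∧
      (∀ s : ℝ, 0 ≤ s →
        Tendsto (fun t => wnorm1 ρ m γ 1 (fun x => u x t - u x s))
          (nhdsWithin s (Ici 0)) (nhds 0)) ∧
      (∀ t : ℝ, 0 < t → ∀ ε : ℝ, 0 < ε → ∃ R : ℝ, 0 < R ∧
        ∀ᵐ x : Euc N ∂volume, R < ‖x‖ → ‖x‖ ^ (-((2 - γ) / (m - 1))) * |u x t| ≤ ε) := by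
  obtain ⟨ρ', w, hρe⟩ := wt_exists hN hγ0 hγ2 hk hkK hρ
  have ha := aa_pos w hm
  have hexp : -((2 - γ) / (m - 1)) - (N : ℝ) + γ = -aa N m γ := by unfold aa alp; ring
  have JJ : ∀ (g : Euc N → ℝ) (R : ℝ), ∫ x in ball (0 : Euc N) R, |g x| * ρ x = J ρ' (fun x => |g x|) R := fun g R => by
    unfold J
    refine integral_congr_ae (ae_restrict_of_ae ?_)
    filter_upwards [hρe] with x hx
    rw [hx, mul_comm]
  have hloc : ∀ R : ℝ, IntegrableOn (fun x => ρ' x * |u₀ x|) (ball (0 : Euc N) R) := fun R => by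
    rcases le_or_gt R 0 with h | h
    · rw [ball_eq_empty.2 h]; exact integrableOn_empty
    · refine (hu0.1 R h).congr (ae_restrict_of_ae ?_)
      filter_upwards [hρe] with x hx
      rw [hx, mul_comm]
  have hdec : ∀ ε : ℝ, 0 < ε → ∃ r, 1 ≤ r ∧ ∀ R, r ≤ R → J ρ' (fun x => |u₀ x|) R ≤ ε * R ^ aa N m γ := by
    intro ε hε
    obtain ⟨_, ⟨r, hr, rfl⟩, hlt⟩ := exists_lt_of_csInf_lt ((nonempty_Ici (a := (1:ℝ))).image _) (hl.trans_lt hε)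
    refine ⟨r, hr, fun R hR => ?_⟩
    have h1 := le_csSup (hu0.2.mono (image_mono (Ici_subset_Ici.2 hr))) (mem_image_of_mem _ (mem_Ici.2 hR))
    have hR0 : 0 < R := by have : (1:ℝ) ≤ r := hr
                           linarith
    have h2 := h1.trans hlt.le
    beta_reduce at h2
    rw [hexp, JJ, Real.rpow_neg hR0.le, inv_mul_le_iff₀ (by positivity)] at h2
    linarith
  obtain ⟨v₀, mv, va, hwrap⟩ := wrap w hm hloc
  have hfe : ∀ᵐ x, v₀ x = mv.mk v₀ x := mv.ae_eq_mk
  have D : Data ρ' m γ (mv.mk v₀) := by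
    refine ⟨mv.measurable_mk, fun R => ?_, fun ε hε => ?_⟩
    · refine (hloc R).mono' (w.meas.mul mv.measurable_mk).aestronglyMeasurable (ae_restrict_of_ae ?_)
      filter_upwards [hfe] with x hx
      rw [Real.norm_eq_abs, abs_mul, abs_of_pos (w.pos x), ← hx, va]
    · obtain ⟨r, hr, h⟩ := hdec ε hε
      refine ⟨r, hr, fun R hR => ?_⟩
      rw [J_congr (g' := fun x => |u₀ x|)]
      · exact h R hR
      · filter_upwards [hfe] with x hx
        rw [← hx, va]
  obtain ⟨C, U, un, v, H⟩ := lm_exists w hm D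
  obtain ⟨u, hu⟩ : ∃ u : Euc N → ℝ → ℝ, u = fun x t => if t = 0 then u₀ x else v t x := ⟨_, rfl⟩
  have ue0 : ∀ x, u x 0 = u₀ x := fun x => by rw [hu]; simp
  have ue : ∀ x t, 0 < t → u x t = v t x := fun x t ht => by rw [hu]; exact if_neg ht.ne'
  have sl : ∀ t, Measurable (v t) := fun t => H.meas.comp (measurable_id.prodMk measurable_const)
  -- continuity
  have hcont : ∀ s ε : ℝ, 0 ≤ s → 0 < ε → ∃ δ, 0 < δ ∧ ∀ t, 0 ≤ t → |t - s| < δ → ∀ R, J ρ' (fun x => |u x t - u x s|) R ≤ ε * max R 1 ^ aa N m γ := by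
    intro s ε hs hε
    rcases hs.eq_or_lt with rfl | hs'
    · obtain ⟨δ, hδ, h⟩ := hwrap v sl (fun t ht R => H.loc t ht.le R) (fun ε' hε' => by
        obtain ⟨δ, hδ, h⟩ := lm_cont w hm H le_rfl hε'
        refine ⟨δ, hδ, fun t ht htd R => ?_⟩
        rw [J_congr (g' := fun x => |v t x - v 0 x|)]
        · exact h t ht.le (by rwa [sub_zero, abs_of_pos ht]) R
        · filter_upwards [hfe, H.zero] with x h1 h2
          rw [h1, h2]) ε hε
      refine ⟨δ, hδ, fun t ht htd R => ?_⟩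
      rcases ht.eq_or_lt with rfl | ht'
      · unfold J; simp only [sub_self, abs_zero, mul_zero, integral_zero]; positivity
      · simp only [ue _ t ht', ue0]
        exact h t ht' (by rwa [sub_zero, abs_of_pos ht'] at htd) R
    · obtain ⟨δ, hδ, h⟩ := lm_cont w hm H hs hε
      refine ⟨min δ s, lt_min hδ hs', fun t ht htd R => ?_⟩
      have h1 := htd.trans_le (min_le_left _ _)
      have h2 := htd.trans_le (min_le_right _ _)
      have ht' : 0 < t := by linarith [neg_abs_le (t - s)]
      simp only [ue _ t ht', ue _ s hs']
      exact h t ht h1 R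
  refine ⟨u, ⟨?_, ?_, ?_, ?_, ?_⟩, ?_, ?_⟩
  · intro t ht
    rcases ht.1.eq_or_lt with rfl | ht'
    · simp only [ue0]; exact hu0.1
    · intro R hR
      simp only [ue _ t ht']
      refine (abs_loc w (H.loc t ht'.le R)).congr (ae_restrict_of_ae ?_)
      filter_upwards [hρe] with x hx
      rw [hx, mul_comm]
  · intro s hs R hR
    rw [Metric.tendsto_nhdsWithin_nhds]
    intro ε hε
    have hX : 0 < max R 1 ^ aa N m γ := by positivity
    obtain ⟨δ, hδ, h⟩ := hcont s (ε / 2 / max R 1 ^ aa N m γ) hs.1 (by positivity)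
    refine ⟨δ, hδ, fun t ht htd => ?_⟩
    rw [JJ (fun x => u x t - u x s), Real.dist_eq, sub_zero, abs_of_nonneg (J_nn w (fun x => abs_nonneg _) _)]
    have q := h t ht.1 htd R
    rw [div_mul_cancel₀ _ hX.ne'] at q
    linarith
  · exact ae_of_all _ ue0
  · intro R hR a b ha0 hab _
    refine (lm_sp w hm H R ha0 hab).congr_fun (fun p hp => ?_) (meas_S R a b)
    beta_reduce
    rw [ue _ _ (ha0.trans_le hp.2.1)]
  · intro φ h1 h2 h3
    obtain ⟨A, L, R, a, b, B, F⟩ := tf_exists h1 h2 h3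
    have hS : MeasurableSet ((univ : Set (Euc N)) ×ˢ TimeSet ⊤) := by rw [ts_eq]; exact MeasurableSet.univ.prod measurableSet_Ioi
    have hout : ∀ p : Euc N × ℝ, p ∉ (univ : Set (Euc N)) ×ˢ TimeSet ⊤ → φ p = 0 ∧ A p = 0 ∧ L p = 0 := fun p hp => F.out p fun h =>
      hp ⟨mem_univ _, F.a0.trans_le h.2.1, ENNReal.ofReal_lt_top⟩
    have E1 : ∫ p : Euc N × ℝ in (univ : Set (Euc N)) ×ˢ TimeSet ⊤, u p.1 p.2 * deriv (fun s => φ (p.1, s)) p.2 * ρ p.1 = ∫ p : Euc N × ℝ, v p.2 p.1 * A p * ρ' p.1 := by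
      refine Eq.trans (setIntegral_congr_ae hS ?_) (setIntegral_eq_integral_of_forall_compl_eq_zero (s := (univ : Set (Euc N)) ×ˢ TimeSet ⊤) (fun p hp => by rw [(hout p hp).2.1]; simp))
      filter_upwards [ae_fst hρe] with p hp hpS
      rw [hp, ue _ _ hpS.2.1, F.hA]
    have E2 : ∫ p : Euc N × ℝ in (univ : Set (Euc N)) ×ˢ TimeSet ⊤, spow m (u p.1 p.2) * lap (fun y => φ (y, p.2)) p.1 = ∫ p : Euc N × ℝ, spow m (v p.2 p.1) * L p := by
      refine Eq.trans (setIntegral_congr_fun hS fun p hpS => ?_) (setIntegral_eq_integral_of_forall_compl_eq_zero (s := (univ : Set (Euc N)) ×ˢ TimeSet ⊤) (fun p hp => by rw [(hout p hp).2.2]; simp))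
      beta_reduce
      rw [ue _ _ hpS.2.1, F.hL]
    rw [E1, E2]
    have := lm_weak w hm H F
    linarith
  · intro s hs
    rw [Metric.tendsto_nhdsWithin_nhds]
    intro ε hε
    obtain ⟨δ, hδ, h⟩ := hcont s (ε / 2) hs (by linarith)
    refine ⟨δ, hδ, fun t ht htd => ?_⟩
    have q1 : wnorm1 ρ m γ 1 (fun x => u x t - u x s) ≤ ε / 2 := by
      unfold wnorm1
      refine csSup_le ((nonempty_Ici (a := (1:ℝ))).image _) ?_
      rintro _ ⟨R, hR, rfl⟩
      have hR1 : (1:ℝ) ≤ R := hR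
      have hR0 : 0 < R := by linarith
      beta_reduce
      rw [hexp, JJ (fun x => u x t - u x s), Real.rpow_neg hR0.le, inv_mul_le_iff₀ (by positivity)]
      have q := h t ht htd R
      rw [max_eq_left hR1] at q
      linarith
    have q2 : 0 ≤ wnorm1 ρ m γ 1 (fun x => u x t - u x s) := by
      unfold wnorm1
      refine Real.sSup_nonneg ?_
      rintro _ ⟨R, hR, rfl⟩
      have hR1 : (1:ℝ) ≤ R := hR
      have hR0 : 0 < R := by linarith
      beta_reduce
      rw [JJ (fun x => u x t - u x s)]
      exact mul_nonneg (by positivity) (J_nn w (fun x => abs_nonneg _) _)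
    rw [Real.dist_eq, sub_zero, abs_of_nonneg q2]
    linarith
  · intro t ht ε hε
    simp only [ue _ t ht]
    exact lm_decay w hm H ht hε

end

open MeasureTheory Metric Filter Set ENNReal in
/-- **Global existence for data in `X₀`**: if `u₀ ∈ X₀` (i.e. `u₀ ∈ X` and `ℓ(u₀) = 0`) then
there is a global very weak solution which is continuous from `[0,∞)` into `X` and satisfies
`ess lim_{|x|→∞} |x|^{-(2-γ)/(m-1)} u(x,t) = 0` for every `t > 0`. -/
theorem global_existence_X0
    (N : ℕ) (hN : 3 ≤ N) (m γ k K : ℝ)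
    (hm : 1 < m) (hγ0 : 0 ≤ γ) (hγ2 : γ < 2) (hk : 0 < k) (hkK : k ≤ K)
    (ρ : Euc N → ℝ) (hρ : WeightCond N γ k K ρ) :
    ∀ u₀ : Euc N → ℝ, memX ρ m γ u₀ → ell ρ m γ u₀ = 0 →
    ∃ u : Euc N → ℝ → ℝ,
      IsVeryWeakSol ρ m ⊤ u u₀ ∧
      (∀ s : ℝ, 0 ≤ s →
        Tendsto (fun t => wnorm1 ρ m γ 1 (fun x => u x t - u x s))
          (nhdsWithin s (Ici 0)) (nhds 0)) ∧
      (∀ t : ℝ, 0 < t → ∀ ε : ℝ, 0 < ε → ∃ R : ℝ, 0 < R ∧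
        ∀ᵐ x : Euc N ∂volume, R < ‖x‖ → ‖x‖ ^ (-((2 - γ) / (m - 1))) * |u x t| ≤ ε) := by
  intro u₀ h1 h2
  exact final hN hm hγ0 hγ2 hk hkK hρ h1 h2
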